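/- The recurrence coefficients bₙ in the three-term recurrence P_{n+1}(z) = (z - bₙ)Pₙ(z) - aₙ² P_{n-1}(z) for the monic orthogonal polynomials with respect to w_c satisfy, as n → ∞, bₙ = −(log c/(πn))·cos(θₙ) + O(1/n²). -/

import Mathlib

open Filter Set MeasureTheory Polynomial

/-- `2 i ∂F/∂z̄`. -/
noncomputable def dbar (F : ℂ → ℂ) (z : ℂ) : ℂ :=
  Complex.I * fderiv ℝ F z 1 - fderiv ℝ F z Complex.I

lemma norm_I_mul_clm_sub (A : ℂ →L[ℝ] ℂ) (w : ℂ) :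
    Complex.I * A w - A (w * Complex.I) = (starRingEnd ℂ w) * (Complex.I * A 1 - A Complex.I) := by
  have h1 : A w = w.re * A 1 + w.im * A Complex.I := by
    conv_lhs => rw [show w = (w.re : ℝ) • (1:ℂ) + (w.im : ℝ) • Complex.I by
      simp [Complex.re_add_im]]
    rw [map_add, map_smul, map_smul]; simp
  have h2 : A (w * Complex.I) = -w.im * A 1 + w.re * A Complex.I := by
    conv_lhs => rw [show w * Complex.I = (-w.im : ℝ) • (1:ℂ) + (w.re : ℝ) • Complex.I by
      apply Complex.ext <;> simp]
    rw [map_add, map_smul, map_smul]; simp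
  have h3 : (starRingEnd ℂ w) = w.re - w.im * Complex.I := by
    apply Complex.ext <;> simp
  rw [h1, h2, h3]
  linear_combination (w.im * A 1) * Complex.I_sq

/-- A `C¹` function on the plane with a limit at infinity is uniformly close to that limit if its
`∂̄`-derivative is small and compactly supported. -/
lemma norm_sub_le_of_dbar_le {F : ℂ → ℂ} {ρ ε : ℝ} (hρ : 0 < ρ) (hε : 0 ≤ ε)
    (hF : ContDiff ℝ 1 F) (hb : ∀ z, ‖dbar F z‖ ≤ ε) (h0 : ∀ z, ρ ≤ ‖z‖ → dbar F z = 0)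
    {L : ℂ} (hL : Tendsto F (cocompact ℂ) (nhds L)) {z : ℂ} (hz : ‖z‖ ≤ ρ) :
    ‖F z - L‖ ≤ 2 * ρ * ε := by
  set m : ℝ → ℂ := fun x => ∫ y in (0:ℝ)..(2 * Real.pi), F (z + Complex.exp (x + y * Complex.I))
    with hm
  have hFd : Differentiable ℝ F := hF.differentiable (by norm_num)
  have hF' : Continuous (fderiv ℝ F) := hF.continuous_fderiv (by norm_num)
  have hpi := Real.pi_pos
  -- key identity
  have key : ∀ a b : ℝ, a ≤ Real.log (2 * ρ) → Real.log (2 * ρ) ≤ b →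
      ‖m b - m a‖ ≤ 4 * Real.pi * ρ * ε := by
    intro a b ha hab
    set g : ℂ → ℂ := fun ζ => F (z + Complex.exp ζ) with hg
    set g' : ℂ → ℂ →L[ℝ] ℂ := fun ζ => (fderiv ℝ F (z + Complex.exp ζ)).comp
      ((ContinuousLinearMap.toSpanSingleton ℂ (Complex.exp ζ)).restrictScalars ℝ) with hg'
    have hgd : ∀ ζ, HasFDerivAt g (g' ζ) ζ := by
      intro ζ
      have h1 : HasFDerivAt (fun ζ => z + Complex.exp ζ) (ContinuousLinearMap.toSpanSingleton ℂ (Complex.exp ζ)) ζ :=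
        (Complex.hasDerivAt_exp ζ).hasFDerivAt.const_add z
      exact (hFd _).hasFDerivAt.comp ζ (h1.restrictScalars ℝ)
    have hD : ∀ ζ, Complex.I • g' ζ 1 - g' ζ Complex.I =
        (starRingEnd ℂ (Complex.exp ζ)) * dbar F (z + Complex.exp ζ) := by
      intro ζ
      rw [dbar, ← norm_I_mul_clm_sub]
      simp [hg', mul_comm]
    have hcont : Continuous fun ζ => Complex.I • g' ζ 1 - g' ζ Complex.I := by
      simp only [hD, dbar]
      fun_prop
    have hI := Complex.integral_boundary_rect_of_continuousOn_of_hasFDerivAt_real g g'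
      (a : ℂ) (b + 2 * Real.pi * Complex.I)
      (fun ζ _ => (hgd ζ).continuousAt.continuousWithinAt) (fun ζ _ => hgd ζ)
      (hcont.continuousOn.integrableOn_compact
        (IsCompact.reProdIm isCompact_uIcc isCompact_uIcc))
    have e1 : (∫ x : ℝ in (a:ℂ).re..(b + 2 * Real.pi * Complex.I : ℂ).re, g (x + (a:ℂ).im * Complex.I))
        = ∫ x : ℝ in (a:ℂ).re..(b + 2 * Real.pi * Complex.I : ℂ).re,
          g (x + (b + 2 * Real.pi * Complex.I : ℂ).im * Complex.I) := by
      apply intervalIntegral.integral_congr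
      intro x _
      simp [hg, Complex.exp_add]
    rw [e1, sub_self, zero_add] at hI
    have e2 : Complex.I • (∫ y : ℝ in (a:ℂ).im..(b + 2 * Real.pi * Complex.I : ℂ).im,
        g ((b + 2 * Real.pi * Complex.I : ℂ).re + y * Complex.I)) -
        Complex.I • (∫ y : ℝ in (a:ℂ).im..(b + 2 * Real.pi * Complex.I : ℂ).im,
        g ((a:ℂ).re + y * Complex.I)) = Complex.I * (m b - m a) := by
      simp [hm, hg, mul_sub]
    rw [e2] at hI
    have hn : ‖m b - m a‖ = ‖∫ x : ℝ in a..b, ∫ y : ℝ in (0:ℝ)..(2 * Real.pi),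
        Complex.I • g' (x + y * Complex.I) 1 - g' (x + y * Complex.I) Complex.I‖ := by
      have := congrArg norm hI
      simpa using this
    rw [hn]
    have inner : ∀ x : ℝ, ‖∫ y : ℝ in (0:ℝ)..(2 * Real.pi),
        Complex.I • g' (x + y * Complex.I) 1 - g' (x + y * Complex.I) Complex.I‖ ≤
        Real.exp x * ε * (2 * Real.pi) := by
      intro x
      have := intervalIntegral.norm_integral_le_of_norm_le_const (a := 0) (b := 2 * Real.pi)
        (C := Real.exp x * ε) (f := fun y : ℝ =>
          Complex.I • g' (x + y * Complex.I) 1 - g' (x + y * Complex.I) Complex.I) ?_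
      · simpa [abs_of_pos hpi] using this
      · intro y _
        rw [hD, norm_mul]
        simp only [RCLike.norm_conj, Complex.norm_exp]
        have : (↑x + ↑y * Complex.I : ℂ).re = x := by simp
        rw [this]
        exact mul_le_mul_of_nonneg_left (hb _) (Real.exp_pos x).le
    have inner0 : ∀ x : ℝ, Real.log (2 * ρ) ≤ x → (∫ y : ℝ in (0:ℝ)..(2 * Real.pi),
        Complex.I • g' (x + y * Complex.I) 1 - g' (x + y * Complex.I) Complex.I) = 0 := by
      intro x hx
      apply intervalIntegral.integral_zero_ae
      refine Eventually.of_forall fun y _ => ?_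
      rw [hD, h0, mul_zero]
      have h1 : ‖Complex.exp (x + y * Complex.I)‖ = Real.exp x := by
        rw [Complex.norm_exp]; simp
      have h2 : 2 * ρ ≤ Real.exp x := by
        rw [← Real.log_le_iff_le_exp (by positivity)]; exact hx
      have h3 := norm_sub_le (z + Complex.exp (x + y * Complex.I)) z
      rw [add_sub_cancel_left, h1] at h3
      linarith
    have hcI : Continuous fun x : ℝ => ∫ y : ℝ in (0:ℝ)..(2 * Real.pi),
        Complex.I • g' (x + y * Complex.I) 1 - g' (x + y * Complex.I) Complex.I := by
      apply intervalIntegral.continuous_parametric_intervalIntegral_of_continuous'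
      exact hcont.comp (by fun_prop : Continuous fun p : ℝ × ℝ => (p.1 + p.2 * Complex.I : ℂ))
    rw [← intervalIntegral.integral_add_adjacent_intervals
      (hcI.intervalIntegrable a (Real.log (2 * ρ))) (hcI.intervalIntegrable _ b)]
    have z2 : (∫ x : ℝ in Real.log (2 * ρ)..b, ∫ y : ℝ in (0:ℝ)..(2 * Real.pi),
        Complex.I • g' (x + y * Complex.I) 1 - g' (x + y * Complex.I) Complex.I) = 0 := by
      apply intervalIntegral.integral_zero_ae
      refine Eventually.of_forall fun x hx => inner0 x ?_
      rw [uIoc_of_le hab] at hx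
      exact hx.1.le
    rw [z2, add_zero]
    refine (intervalIntegral.norm_integral_le_of_norm_le (g := fun x => Real.exp x * ε * (2 * Real.pi))
      ha (Eventually.of_forall fun x _ => inner x)
      (Continuous.intervalIntegrable (by fun_prop) _ _)).trans ?_
    have : (∫ x in a..Real.log (2 * ρ), Real.exp x * ε * (2 * Real.pi)) =
        (2 * ρ - Real.exp a) * ε * (2 * Real.pi) := by
      rw [intervalIntegral.integral_mul_const, intervalIntegral.integral_mul_const, integral_exp,
        Real.exp_log (by positivity)]
    rw [this]
    have := Real.exp_pos a
    nlinarith [mul_nonneg (mul_nonneg this.le hε) hpi.le]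
  -- limits
  have avg : ∀ (M : ℂ) (η x : ℝ), (∀ ζ, ‖ζ‖ = Real.exp x → ‖F (z + ζ) - M‖ ≤ η) →
      ‖m x - 2 * Real.pi * M‖ ≤ 2 * Real.pi * η := by
    intro M η x hx
    have e : m x - 2 * Real.pi * M = ∫ y in (0:ℝ)..(2 * Real.pi),
        (F (z + Complex.exp (x + y * Complex.I)) - M) := by
      rw [intervalIntegral.integral_sub _ (by simp)]
      · simp [hm]
      · exact Continuous.intervalIntegrable (hFd.continuous.comp (by fun_prop)) _ _
    rw [e]
    have := intervalIntegral.norm_integral_le_of_norm_le_const (a := 0) (b := 2 * Real.pi)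
        (C := η) (f := fun y : ℝ => F (z + Complex.exp (x + y * Complex.I)) - M)
        (fun y _ => hx _ (by rw [Complex.norm_exp]; simp))
    simpa [abs_of_pos hpi, mul_comm] using this
  refine le_of_forall_pos_le_add fun η hη => ?_
  have hη2 : 0 < η / 2 := by positivity
  obtain ⟨δ, hδ, hδF⟩ := Metric.continuousAt_iff.1 (hFd.continuous.continuousAt (x := z)) _ hη2
  have hLe := hL.eventually (Metric.closedBall_mem_nhds L hη2)
  rw [← Metric.cobounded_eq_cocompact, ← comap_norm_atTop, eventually_comap] at hLe
  obtain ⟨R, hR⟩ := eventually_atTop.1 hLe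
  set a := min (Real.log (2 * ρ)) (Real.log (δ / 2))
  set b := max (Real.log (2 * ρ)) (R + ρ)
  have ka := avg (F z) (η / 2) a (by
    intro ζ hζ
    have h1 : Real.exp a ≤ δ / 2 := by
      rw [← Real.le_log_iff_exp_le (by positivity)]; exact min_le_right _ _
    have := hδF (x := z + ζ) (by simp [hζ]; linarith)
    rw [dist_eq_norm] at this; exact this.le)
  have kb := avg L (η / 2) b (by
    intro ζ hζ
    have h1 : R + ρ ≤ Real.exp b := (le_max_right _ _).trans ((Real.add_one_le_exp b).trans' (by linarith))
    have h3 := norm_sub_le (z + ζ) z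
    rw [add_sub_cancel_left, hζ] at h3
    have := hR ‖z + ζ‖ (by linarith) _ rfl
    rwa [dist_eq_norm] at this)
  have kk := key a b (min_le_left _ _) (le_max_left _ _)
  have tot : ‖2 * Real.pi * (F z - L)‖ ≤ 2 * Real.pi * (η / 2) + 4 * Real.pi * ρ * ε +
      2 * Real.pi * (η / 2) := by
    have : (2 * Real.pi * (F z - L) : ℂ) = -(m a - 2 * Real.pi * F z) + -(m b - m a) +
      (m b - 2 * Real.pi * L) := by ring
    rw [this]
    refine (norm_add₃_le).trans ?_
    rw [norm_neg, norm_neg]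
    gcongr
  rw [norm_mul] at tot
  have n2 : ‖(2 * Real.pi : ℂ)‖ = 2 * Real.pi := by
    simp [abs_of_pos hpi]
  rw [n2] at tot
  have : 2 * Real.pi * ‖F z - L‖ ≤ 2 * Real.pi * (2 * ρ * ε + η) := by linarith
  exact le_of_mul_le_mul_left this (by positivity)

lemma dbar_eq_zero_of_differentiableAt {R : ℂ → ℂ} {z : ℂ} (h : DifferentiableAt ℂ R z) :
    dbar R z = 0 := by
  rw [dbar, (h.hasFDerivAt.restrictScalars ℝ).fderiv]
  simp

lemma contDiffAt_smul_of_tsupport {χ : ℂ → ℝ} (hχ : ContDiff ℝ 1 χ) {R : ℂ → ℂ} {U : Set ℂ}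
    (hU : IsOpen U) (hs : tsupport χ ⊆ U) (hR : DifferentiableOn ℂ R U) :
    ContDiff ℝ 1 fun z => χ z • R z := by
  refine contDiff_iff_contDiffAt.2 fun z => ?_
  by_cases hz : z ∈ tsupport χ
  · have h1 : ContDiffAt ℂ 1 R z :=
      (hR.contDiffOn hU).contDiffAt (hU.mem_nhds (hs hz))
    exact hχ.contDiffAt.smul (h1.restrict_scalars ℝ)
  · have : (fun z => χ z • R z) =ᶠ[nhds z] fun _ => 0 := by
      filter_upwards [notMem_tsupport_iff_eventuallyEq.1 hz] with x hx
      simp [hx]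
    exact contDiffAt_const.congr_of_eventuallyEq this

lemma dbar_smul_of_tsupport {χ : ℂ → ℝ} (hχ : ContDiff ℝ 1 χ) {R : ℂ → ℂ} {U : Set ℂ}
    (hU : IsOpen U) (hs : tsupport χ ⊆ U) (hR : DifferentiableOn ℂ R U) (z : ℂ) :
    dbar (fun z => χ z • R z) z = dbar (fun z => (χ z : ℂ)) z * R z := by
  have hχd : DifferentiableAt ℝ χ z := hχ.differentiable (by norm_num) z
  have h3 : fderiv ℝ (fun z => (χ z : ℂ)) z = Complex.ofRealCLM.comp (fderiv ℝ χ z) := by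
    exact (Complex.ofRealCLM.hasFDerivAt.comp z hχd.hasFDerivAt).fderiv
  by_cases hz : z ∈ tsupport χ
  · have h1 : DifferentiableAt ℂ R z := hR.differentiableAt (hU.mem_nhds (hs hz))
    have h2 := dbar_eq_zero_of_differentiableAt h1
    have hRr : DifferentiableAt ℝ R z := h1.restrictScalars ℝ
    rw [dbar] at h2
    have h4 := (hχd.hasFDerivAt.smul hRr.hasFDerivAt).fderiv
    rw [dbar, dbar, h3]
    erw [h4]
    simp
    linear_combination (χ z : ℂ) * h2
  · have e0 := notMem_tsupport_iff_eventuallyEq.1 hz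
    have : (fun z => χ z • R z) =ᶠ[nhds z] fun _ => 0 := by
      filter_upwards [e0] with x hx
      simp [hx]
    have h2 : (fun z => (χ z : ℂ)) =ᶠ[nhds z] fun _ => 0 := by
      filter_upwards [e0] with x hx
      simp [hx]
    rw [dbar, dbar, this.fderiv_eq, h2.fderiv_eq]
    simp

/-- Stability of the additive Cousin problem for a finite open cover of the plane with a single
unbounded member. -/
theorem exists_cousin_bound {κ : Type} [Fintype κ] [DecidableEq κ] (U : κ → Set ℂ) (o : κ) {ρ : ℝ}
    (hρ : 0 < ρ) (hU : ∀ i, IsOpen (U i)) (hcov : ∀ z, ∃ i, z ∈ U i)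
    (hbd : ∀ i, i ≠ o → U i ⊆ Metric.ball 0 ρ) :
    ∃ (K : κ → Set ℂ) (C : ℝ), 0 ≤ C ∧ (∀ i, IsClosed (K i)) ∧ (∀ i, K i ⊆ U i) ∧
      (∀ z, ∃ i, z ∈ K i) ∧
      ∀ (R : κ → ℂ → ℂ) (L : ℂ) (ε : ℝ), 0 ≤ ε → (∀ i, DifferentiableOn ℂ (R i) (U i)) →
        Tendsto (R o) (cocompact ℂ) (nhds L) →
        (∀ i j, i ≠ j → ∀ z ∈ K i ∩ K j, ‖R i z - R j z‖ ≤ ε) →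
        ∀ i, ∀ z ∈ K i, ‖z‖ ≤ ρ → ‖R i z - L‖ ≤ C * ε := by
  obtain ⟨f, hf⟩ := SmoothPartitionOfUnity.exists_isSubordinate (modelWithCornersSelf ℝ ℂ)
    (s := univ) isClosed_univ U hU (fun z _ => by simpa using hcov z)
  have hfs : ∀ i, ContDiff ℝ 1 (f i) := fun i =>
    ((f i).contMDiff.contDiff).of_le (by exact_mod_cast le_top)
  have hsum : ∀ z, ∑ i, f i z = 1 := fun z => by
    rw [← finsum_eq_sum_of_fintype]; exact f.sum_eq_one (mem_univ z)
  have hcd : ∀ i, Continuous (dbar fun z => (f i z : ℂ)) := by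
    intro i
    have h1 : ContDiff ℝ 1 fun z => (f i z : ℂ) := Complex.ofRealCLM.contDiff.comp (hfs i)
    have := h1.continuous_fderiv (by norm_num)
    unfold dbar
    fun_prop
  have hd0 : ∀ i z, z ∉ tsupport (f i) → dbar (fun z => (f i z : ℂ)) z = 0 := by
    intro i z hz
    have h2 : (fun z => (f i z : ℂ)) =ᶠ[nhds z] fun _ => 0 := by
      filter_upwards [notMem_tsupport_iff_eventuallyEq.1 hz] with x hx
      simp [hx]
    rw [dbar, h2.fderiv_eq]; simp
  have hdadd : ∀ (z : ℂ) (g : κ → ℂ → ℂ), (∀ i, DifferentiableAt ℝ (g i) z) →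
      dbar (fun z => ∑ i, g i z) z = ∑ i, dbar (g i) z := by
    intro z g hg
    unfold dbar
    rw [fderiv_fun_sum (fun i _ => hg i)]
    simp [Finset.mul_sum]
  have hds : ∀ z, ∑ i, dbar (fun z => (f i z : ℂ)) z = 0 := by
    intro z
    rw [← hdadd z (fun i z => (f i z : ℂ))]
    · have : (fun z => ∑ i, (f i z : ℂ)) = fun _ => 1 := by
        funext z; rw [← Complex.ofReal_sum, hsum]; simp
      rw [this]; simp [dbar]
    · intro i
      exact (Complex.ofRealCLM.contDiff.comp (hfs i)).differentiable (by norm_num) z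
  have hB : ∃ B : ℝ, 0 ≤ B ∧ ∀ i, ∀ z ∈ Metric.closedBall (0:ℂ) ρ,
      ‖dbar (fun z => (f i z : ℂ)) z‖ ≤ B := by
    have : ∀ i, ∃ B : ℝ, ∀ z ∈ Metric.closedBall (0:ℂ) ρ, ‖dbar (fun z => (f i z : ℂ)) z‖ ≤ B :=
      fun i => (isCompact_closedBall 0 ρ).exists_bound_of_continuousOn (hcd i).continuousOn
    choose B hB using this
    exact ⟨∑ i, |B i|, Finset.sum_nonneg fun _ _ => abs_nonneg _, fun i z hz =>
      (hB i z hz).trans ((le_abs_self _).trans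
        (Finset.single_le_sum (f := fun i => |B i|) (fun _ _ => abs_nonneg _) (Finset.mem_univ i)))⟩
  obtain ⟨B, hB0, hB⟩ := hB
  have hout : ∀ z, ρ ≤ ‖z‖ → ∀ i, i ≠ o → z ∉ tsupport (f i) := by
    intro z hz i hi hzi
    have := hbd i hi (hf i hzi)
    rw [mem_ball_zero_iff] at this
    linarith
  refine ⟨fun i => tsupport (f i), 2 * ρ * (Fintype.card κ * B) + Fintype.card κ, by positivity,
    fun i => isClosed_tsupport _, hf,
    ?_, ?_⟩
  · intro z
    by_contra! h
    have : ∑ i, f i z = 0 := Finset.sum_eq_zero fun i _ => image_eq_zero_of_notMem_tsupport (h i)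
    rw [hsum] at this; exact one_ne_zero this
  intro R L ε hε hR hL hov i z hzi hz
  set F : ℂ → ℂ := fun z => ∑ i, f i z • R i z with hFdef
  have hFi : ∀ i, ContDiff ℝ 1 fun z => f i z • R i z := fun i =>
    contDiffAt_smul_of_tsupport (hfs i) (hU i) (hf i) (hR i)
  have hF : ContDiff ℝ 1 F := ContDiff.sum fun i _ => hFi i
  have hdF : ∀ z k, dbar F z = ∑ i, dbar (fun z => (f i z : ℂ)) z * (R i z - R k z) := by
    intro z k
    simp only [mul_sub, Finset.sum_sub_distrib]
    rw [← Finset.sum_mul, hds, zero_mul, sub_zero, hFdef, hdadd z (fun i z => f i z • R i z)]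
    · exact Finset.sum_congr rfl fun i _ => dbar_smul_of_tsupport (hfs i) (hU i) (hf i) (hR i) z
    · exact fun i => (hFi i).differentiable (by norm_num) z
  have hdF0 : ∀ z, ρ ≤ ‖z‖ → dbar F z = 0 := by
    intro z hz
    rw [hdF z o]
    refine Finset.sum_eq_zero fun i _ => ?_
    by_cases hi : i = o
    · simp [hi]
    · rw [hd0 i z (hout z hz i hi), zero_mul]
  have hex : ∀ z, ∃ k, z ∈ tsupport (f k) := by
    intro z
    by_contra! h
    have : ∑ i, f i z = 0 := Finset.sum_eq_zero fun i _ => image_eq_zero_of_notMem_tsupport (h i)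
    rw [hsum] at this; exact one_ne_zero this
  have hdFb : ∀ z, ‖dbar F z‖ ≤ Fintype.card κ * B * ε := by
    intro z
    by_cases hz : ρ ≤ ‖z‖
    · rw [hdF0 z hz, norm_zero]; positivity
    obtain ⟨k, hk⟩ := hex z
    rw [hdF z k]
    refine (norm_sum_le _ _).trans ?_
    have : ∀ i ∈ Finset.univ, ‖dbar (fun z => (f i z : ℂ)) z * (R i z - R k z)‖ ≤ B * ε := by
      intro i _
      by_cases hi : i = k
      · simp [hi]; positivity
      by_cases hzi : z ∈ tsupport (f i)
      · rw [norm_mul]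
        exact mul_le_mul (hB i z (by simpa using (not_le.1 hz).le)) (hov i k hi z ⟨hzi, hk⟩)
          (norm_nonneg _) hB0
      · rw [hd0 i z hzi, zero_mul, norm_zero]; positivity
    refine (Finset.sum_le_sum this).trans ?_
    simp [mul_assoc]
  have hFL : Tendsto F (cocompact ℂ) (nhds L) := by
    refine hL.congr' ?_
    have : (Metric.closedBall (0:ℂ) ρ)ᶜ ∈ cocompact ℂ := (isCompact_closedBall _ _).compl_mem_cocompact
    filter_upwards [this] with z hz
    have hz : ρ ≤ ‖z‖ := by
      simp at hz; exact hz.le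
    have h1 : ∀ i, i ≠ o → f i z = 0 := fun i hi =>
      image_eq_zero_of_notMem_tsupport (hout z hz i hi)
    have h2 := hsum z
    rw [Finset.sum_eq_single o (fun i _ hi => h1 i hi) (by simp)] at h2
    rw [hFdef]
    simp only
    rw [Finset.sum_eq_single o (fun i _ hi => by simp [h1 i hi]) (by simp), h2, one_smul]
  have main := norm_sub_le_of_dbar_le hρ (by positivity) hF hdFb hdF0 hFL hz
  have hRF : ‖R i z - F z‖ ≤ Fintype.card κ * ε := by
    have : R i z - F z = ∑ j, f j z • (R i z - R j z) := by
      simp only [smul_sub, Finset.sum_sub_distrib]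
      rw [← Finset.sum_smul, hsum, one_smul]
    rw [this]
    refine (norm_sum_le _ _).trans ?_
    have : ∀ j ∈ Finset.univ, ‖f j z • (R i z - R j z)‖ ≤ ε := by
      intro j _
      by_cases hj : i = j
      · simp [hj, hε]
      by_cases hzj : z ∈ tsupport (f j)
      · rw [norm_smul]
        have h1 : ‖f j z‖ ≤ 1 := by
          rw [Real.norm_of_nonneg (f.nonneg j z)]
          exact f.le_one j z
        calc _ ≤ 1 * ε := mul_le_mul h1 (hov i j hj z ⟨hzi, hzj⟩) (norm_nonneg _) zero_le_one
          _ = ε := one_mul _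
      · rw [image_eq_zero_of_notMem_tsupport hzj]; simpa using hε
    refine (Finset.sum_le_sum this).trans ?_
    simp
  calc ‖R i z - L‖ = ‖(R i z - F z) + (F z - L)‖ := by ring_nf
    _ ≤ _ := norm_add_le _ _
    _ ≤ Fintype.card κ * ε + 2 * ρ * (Fintype.card κ * B * ε) := add_le_add hRF main
    _ = _ := by ring

lemma exists_eventually_bound_of_isBigO_nhds {K : Set ℂ} (hK : IsCompact K) {F : ℕ → ℂ → ℂ}
    {φ : ℕ → ℝ} (h : ∀ p ∈ K, (fun x : ℕ × ℂ => F x.1 x.2) =O[atTop ×ˢ nhds p] fun x => φ x.1) :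
    ∃ C : ℝ, 0 ≤ C ∧ ∀ᶠ n in atTop, ∀ z ∈ K, ‖F n z‖ ≤ C * ‖φ n‖ := by
  refine hK.induction_on (p := fun s => ∃ C : ℝ, 0 ≤ C ∧ ∀ᶠ n in atTop, ∀ z ∈ s,
    ‖F n z‖ ≤ C * ‖φ n‖) ⟨0, le_rfl, by simp⟩ ?_ ?_ ?_
  · rintro s t hst ⟨C, hC, h⟩
    exact ⟨C, hC, h.mono fun n hn z hz => hn z (hst hz)⟩
  · rintro s t ⟨C, hC, h⟩ ⟨D, hD, h'⟩
    refine ⟨C + D, by positivity, ?_⟩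
    filter_upwards [h, h'] with n hn hn' z hz
    have := norm_nonneg (φ n)
    rcases hz with hz | hz
    · nlinarith [hn z hz, mul_nonneg hD this]
    · nlinarith [hn' z hz, mul_nonneg hC this]
  · intro p hp
    obtain ⟨C, hC, hb⟩ := (h p hp).exists_nonneg
    have := hb.bound
    obtain ⟨s, hs, t, ht, hst⟩ := mem_prod_iff.1 this
    refine ⟨t, mem_nhdsWithin_of_mem_nhds ht, C, hC, ?_⟩
    filter_upwards [hs] with n hn z hz
    exact hst (show (n, z) ∈ s ×ˢ t from ⟨hn, hz⟩)

set_option maxHeartbeats 1000000 in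
/-- Second-order asymptotics for the off-diagonal entry of a small-norm Riemann–Hilbert problem
posed as a multiplicative Cousin problem. -/
theorem cousin_second_order {κ : Type} [Fintype κ] [DecidableEq κ] (U : κ → Set ℂ) (o : κ) {ρ : ℝ}
    (hρ : 0 < ρ) (hU : ∀ i, IsOpen (U i)) (hcov : ∀ z, ∃ i, z ∈ U i)
    (hbd : ∀ i, i ≠ o → U i ⊆ Metric.ball 0 ρ) (h0 : ∀ i, i ≠ o → (0:ℂ) ∉ U i)
    (R1 R2 s g : ℕ → κ → ℂ → ℂ) (X11 X12 X21 X22 : ℕ → κ → κ → ℂ → ℂ)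
    (hR1 : ∀ᶠ n in atTop, ∀ i, DifferentiableOn ℂ (R1 n i) (U i))
    (hR2 : ∀ᶠ n in atTop, ∀ i, DifferentiableOn ℂ (R2 n i) (U i))
    (hs : ∀ n i, DifferentiableOn ℂ (s n i) (U i))
    (hR1o : ∀ᶠ n in atTop, Tendsto (R1 n o) (cocompact ℂ) (nhds 1))
    (hR2o : ∀ᶠ n in atTop, Tendsto (R2 n o) (cocompact ℂ) (nhds 0))
    (hso : ∀ n, Tendsto (s n o) (cocompact ℂ) (nhds 0))
    (hX1 : ∀ᶠ n in atTop, ∀ i j, i ≠ j → ∀ z ∈ U i ∩ U j,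
      R1 n i z = R1 n j z * X11 n j i z + R2 n j z * X21 n j i z)
    (hX2 : ∀ᶠ n in atTop, ∀ i j, i ≠ j → ∀ z ∈ U i ∩ U j,
      R2 n i z = R1 n j z * X12 n j i z + R2 n j z * X22 n j i z)
    (hsg : ∀ n i j, i ≠ j → ∀ z ∈ U i ∩ U j, s n i z - s n j z = g n j z - g n i z)
    (h11 : ∀ i j, i ≠ j → ∀ p ∈ U i ∩ U j, (fun x : ℕ × ℂ => X11 x.1 j i x.2 - 1)
      =O[atTop ×ˢ nhds p] fun x => ((x.1 : ℝ))⁻¹)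
    (h22 : ∀ i j, i ≠ j → ∀ p ∈ U i ∩ U j, (fun x : ℕ × ℂ => X22 x.1 j i x.2 - 1)
      =O[atTop ×ˢ nhds p] fun x => ((x.1 : ℝ))⁻¹)
    (h21 : ∀ i j, i ≠ j → ∀ p ∈ U i ∩ U j, (fun x : ℕ × ℂ => X21 x.1 j i x.2)
      =O[atTop ×ˢ nhds p] fun x => ((x.1 : ℝ))⁻¹)
    (h12 : ∀ i j, i ≠ j → ∀ p ∈ U i ∩ U j,
      (fun x : ℕ × ℂ => X12 x.1 j i x.2 - (g x.1 j x.2 - g x.1 i x.2))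
      =O[atTop ×ˢ nhds p] fun x => ((x.1 : ℝ) ^ 2)⁻¹)
    (hg : ∀ i j, i ≠ j → ∀ p ∈ U i ∩ U j,
      (fun x : ℕ × ℂ => g x.1 i x.2) =O[atTop ×ˢ nhds p] fun x => ((x.1 : ℝ))⁻¹) :
    ∃ C : ℝ, ∀ᶠ n : ℕ in atTop, ‖R2 n o 0 - s n o 0‖ ≤ C / (n : ℝ) ^ 2 := by
  obtain ⟨K, C, hC, hKc, hKU, hKcov, hK⟩ := exists_cousin_bound U o hρ hU hcov hbd
  have hsub : ∀ i j, i ≠ j → K i ∩ K j ⊆ U i ∩ U j := fun i j _ =>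
    inter_subset_inter (hKU i) (hKU j)
  have hcpt : ∀ i j, i ≠ j → IsCompact (K i ∩ K j) := by
    intro i j hij
    refine (isCompact_closedBall (0:ℂ) ρ).of_isClosed_subset ((hKc i).inter (hKc j)) ?_
    by_cases hi : i = o
    · exact fun z hz => Metric.ball_subset_closedBall (hbd j (fun h => hij (hi.trans h.symm)) (hKU j hz.2))
    · exact fun z hz => Metric.ball_subset_closedBall (hbd i hi (hKU i hz.1))
  have hrad : ∀ i j, i ≠ j → ∀ z ∈ K i ∩ K j, ‖z‖ ≤ ρ := by
    intro i j hij z hz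
    by_cases hi : i = o
    · have := hbd j (fun h => hij (hi.trans h.symm)) (hKU j hz.2)
      rw [mem_ball_zero_iff] at this; exact this.le
    · have := hbd i hi (hKU i hz.1)
      rw [mem_ball_zero_iff] at this; exact this.le
  have h00 : (0:ℂ) ∈ K o := by
    obtain ⟨i, hi⟩ := hKcov 0
    by_cases hio : i = o
    · rwa [hio] at hi
    · exact absurd (hKU i hi) (h0 i hio)
  -- a uniform constant
  have unif : ∀ (F : ℕ → κ → κ → ℂ → ℂ) (φ : ℕ → ℝ),
      (∀ i j, i ≠ j → ∀ p ∈ U i ∩ U j, (fun x : ℕ × ℂ => F x.1 i j x.2) =O[atTop ×ˢ nhds p]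
        fun x => φ x.1) →
      ∃ A : ℝ, 0 ≤ A ∧ ∀ᶠ n in atTop, ∀ i j, i ≠ j → ∀ z ∈ K i ∩ K j, ‖F n i j z‖ ≤ A * ‖φ n‖ := by
    intro F φ hF
    have : ∀ q : κ × κ, ∃ A : ℝ, 0 ≤ A ∧ (q.1 ≠ q.2 → ∀ᶠ n in atTop, ∀ z ∈ K q.1 ∩ K q.2,
        ‖F n q.1 q.2 z‖ ≤ A * ‖φ n‖) := by
      intro q
      by_cases hq : q.1 = q.2
      · exact ⟨0, le_rfl, fun h => absurd hq h⟩
      · obtain ⟨A, hA, h⟩ := exists_eventually_bound_of_isBigO_nhds (hcpt q.1 q.2 hq)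
          (F := fun n => F n q.1 q.2) (fun p hp => hF q.1 q.2 hq p (hsub _ _ hq hp))
        exact ⟨A, hA, fun _ => h⟩
    choose A hA hA' using this
    refine ⟨∑ q, A q, Finset.sum_nonneg fun q _ => hA q, ?_⟩
    have : ∀ q : κ × κ, ∀ᶠ n in atTop, q.1 ≠ q.2 → ∀ z ∈ K q.1 ∩ K q.2,
        ‖F n q.1 q.2 z‖ ≤ A q * ‖φ n‖ := by
      intro q
      by_cases hq : q.1 = q.2
      · exact Eventually.of_forall fun n h => absurd hq h
      · exact (hA' q hq).mono fun n h _ => h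
    filter_upwards [eventually_all.2 this] with n hn i j hij z hz
    exact (hn (i, j) hij z hz).trans (mul_le_mul_of_nonneg_right
      (Finset.single_le_sum (f := A) (fun q _ => hA q) (Finset.mem_univ (i, j))) (norm_nonneg _))
  obtain ⟨A1, hA1, e1⟩ := unif (fun n i j z => X11 n j i z - 1) (fun n => ((n:ℝ))⁻¹) h11
  obtain ⟨A2, hA2, e2⟩ := unif (fun n i j z => X22 n j i z - 1) (fun n => ((n:ℝ))⁻¹) h22
  obtain ⟨A3, hA3, e3⟩ := unif (fun n i j z => X21 n j i z) (fun n => ((n:ℝ))⁻¹) h21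
  obtain ⟨A4, hA4, e4⟩ := unif (fun n i j z => X12 n j i z - (g n j z - g n i z))
    (fun n => ((n:ℝ) ^ 2)⁻¹) h12
  obtain ⟨A5, hA5, e5⟩ := unif (fun n i j z => g n i z) (fun n => ((n:ℝ))⁻¹) hg
  set A : ℝ := A1 + A2 + A3 + A4 + 2 * A5 with hAdef
  have hA : 0 ≤ A := by positivity
  obtain ⟨N, hN⟩ := exists_nat_gt (4 * (C + 1) * A)
  refine ⟨C * (4 * C * A * A + 4 * C * A * A + A4), ?_⟩
  filter_upwards [hR1, hR2, hR1o, hR2o, hX1, hX2, e1, e2, e3, e4, e5, eventually_ge_atTop N,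
    eventually_gt_atTop 0] with n hR1 hR2 hR1o hR2o hX1 hX2 e1 e2 e3 e4 e5 hnN hn0
  have hn : (0:ℝ) < n := by exact_mod_cast hn0
  have hn1 : (1:ℝ) ≤ n := by exact_mod_cast hn0
  set δ : ℝ := ((n:ℝ))⁻¹ with hδ
  have hδ0 : 0 < δ := by positivity
  have hδ1 : δ ≤ 1 := inv_le_one_of_one_le₀ hn1
  have nδ : ‖δ‖ = δ := Real.norm_of_nonneg hδ0.le
  have nδ2 : ‖((n:ℝ) ^ 2)⁻¹‖ = δ ^ 2 := by
    rw [Real.norm_of_nonneg (by positivity), hδ, inv_pow]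
  have hCAδ : (C + 1) * A * δ ≤ 1 / 4 := by
    have : (N:ℝ) ≤ n := by exact_mod_cast hnN
    rw [hδ, ← div_eq_mul_inv, div_le_iff₀ hn]; linarith
  have b11 : ∀ i j, i ≠ j → ∀ z ∈ K i ∩ K j, ‖X11 n j i z - 1‖ ≤ A * δ := fun i j hij z hz =>
    (e1 i j hij z hz).trans (by rw [nδ]; gcongr; linarith)
  have b22 : ∀ i j, i ≠ j → ∀ z ∈ K i ∩ K j, ‖X22 n j i z - 1‖ ≤ A * δ := fun i j hij z hz =>
    (e2 i j hij z hz).trans (by rw [nδ]; gcongr; linarith)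
  have b21 : ∀ i j, i ≠ j → ∀ z ∈ K i ∩ K j, ‖X21 n j i z‖ ≤ A * δ := fun i j hij z hz =>
    (e3 i j hij z hz).trans (by rw [nδ]; gcongr; linarith)
  have bg : ∀ i j, i ≠ j → ∀ z ∈ K i ∩ K j, ‖g n i z‖ ≤ A5 * δ := fun i j hij z hz =>
    (e5 i j hij z hz).trans (by rw [nδ])
  have b12' : ∀ i j, i ≠ j → ∀ z ∈ K i ∩ K j, ‖X12 n j i z - (g n j z - g n i z)‖ ≤ A4 * δ ^ 2 :=
    fun i j hij z hz => (e4 i j hij z hz).trans (by rw [nδ2])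
  have b12 : ∀ i j, i ≠ j → ∀ z ∈ K i ∩ K j, ‖X12 n j i z‖ ≤ A * δ := by
    intro i j hij z hz
    have : X12 n j i z = (X12 n j i z - (g n j z - g n i z)) + (g n j z + -g n i z) := by ring
    rw [this]
    refine (norm_add_le _ _).trans ((add_le_add (b12' i j hij z hz) (norm_add_le _ _)).trans ?_)
    rw [norm_neg]
    have h1 := bg i j hij z hz
    have h2 := bg j i hij.symm z hz.symm
    have h3 : δ ^ 2 ≤ δ := by nlinarith
    have : A4 * δ ^ 2 ≤ A4 * δ := by gcongr
    rw [hAdef]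
    nlinarith [mul_nonneg hA1 hδ0.le, mul_nonneg hA2 hδ0.le, mul_nonneg hA3 hδ0.le]
  -- the a priori bound
  set B : Set ℝ := {M | 0 ≤ M ∧ ∀ i j, i ≠ j → ∀ z ∈ K i ∩ K j, ‖R1 n i z‖ ≤ M ∧ ‖R2 n i z‖ ≤ M}
    with hB
  have diff : ∀ M ∈ B, ∀ i j, i ≠ j → ∀ z ∈ K i ∩ K j,
      ‖R1 n i z - R1 n j z‖ ≤ M * (2 * A * δ) ∧ ‖R2 n i z - R2 n j z‖ ≤ M * (2 * A * δ) := by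
    rintro M ⟨hM0, hM⟩ i j hij z hz
    obtain ⟨m1, m2⟩ := hM j i hij.symm z hz.symm
    constructor
    · have : R1 n i z - R1 n j z = R1 n j z * (X11 n j i z - 1) + R2 n j z * X21 n j i z := by
        rw [hX1 i j hij z (hsub i j hij hz)]; ring
      rw [this]
      refine (norm_add_le _ _).trans ?_
      rw [norm_mul, norm_mul]
      calc _ ≤ M * (A * δ) + M * (A * δ) := add_le_add
            (mul_le_mul m1 (b11 i j hij z hz) (norm_nonneg _) hM0)
            (mul_le_mul m2 (b21 i j hij z hz) (norm_nonneg _) hM0)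
        _ = _ := by ring
    · have : R2 n i z - R2 n j z = R1 n j z * X12 n j i z + R2 n j z * (X22 n j i z - 1) := by
        rw [hX2 i j hij z (hsub i j hij hz)]; ring
      rw [this]
      refine (norm_add_le _ _).trans ?_
      rw [norm_mul, norm_mul]
      calc _ ≤ M * (A * δ) + M * (A * δ) := add_le_add
            (mul_le_mul m1 (b12 i j hij z hz) (norm_nonneg _) hM0)
            (mul_le_mul m2 (b22 i j hij z hz) (norm_nonneg _) hM0)
        _ = _ := by ring
  have app : ∀ M ∈ B, ∀ i, ∀ z ∈ K i, ‖z‖ ≤ ρ → ‖R1 n i z - 1‖ ≤ C * (M * (2 * A * δ)) ∧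
      ‖R2 n i z - 0‖ ≤ C * (M * (2 * A * δ)) := by
    intro M hM i z hz hzρ
    have hMn : 0 ≤ M * (2 * A * δ) := mul_nonneg hM.1 (by positivity)
    exact ⟨hK (R1 n) 1 _ hMn hR1 hR1o (fun i j hij z hz => (diff M hM i j hij z hz).1) i z hz hzρ,
      hK (R2 n) 0 _ hMn hR2 hR2o (fun i j hij z hz => (diff M hM i j hij z hz).2) i z hz hzρ⟩
  have Bne : B.Nonempty := by
    have : ∀ q : κ × κ, ∃ M : ℝ, 0 ≤ M ∧ (q.1 ≠ q.2 → ∀ z ∈ K q.1 ∩ K q.2,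
        ‖R1 n q.1 z‖ ≤ M ∧ ‖R2 n q.1 z‖ ≤ M) := by
      intro q
      by_cases hq : q.1 = q.2
      · exact ⟨0, le_rfl, fun h => absurd hq h⟩
      obtain ⟨M1, h1⟩ := (hcpt q.1 q.2 hq).exists_bound_of_continuousOn (f := R1 n q.1)
        ((hR1 q.1).continuousOn.mono fun z hz => hKU _ hz.1)
      obtain ⟨M2, h2⟩ := (hcpt q.1 q.2 hq).exists_bound_of_continuousOn (f := R2 n q.1)
        ((hR2 q.1).continuousOn.mono fun z hz => hKU _ hz.1)
      exact ⟨|M1| + |M2|, by positivity, fun _ z hz =>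
        ⟨(h1 z hz).trans ((le_abs_self _).trans (by linarith [abs_nonneg M2])),
        (h2 z hz).trans ((le_abs_self _).trans (by linarith [abs_nonneg M1]))⟩⟩
    choose M hM0 hM using this
    refine ⟨∑ q, M q, Finset.sum_nonneg fun q _ => hM0 q, fun i j hij z hz => ?_⟩
    have := Finset.single_le_sum (f := M) (fun q _ => hM0 q) (Finset.mem_univ (i, j))
    exact ⟨((hM (i, j) hij z hz).1).trans this, ((hM (i, j) hij z hz).2).trans this⟩
  have Bbdd : BddBelow B := ⟨0, fun M hM => hM.1⟩
  have mB : sInf B ∈ B := ⟨le_csInf Bne fun M hM => hM.1, fun i j hij z hz =>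
    ⟨le_csInf Bne fun M hM => (hM.2 i j hij z hz).1, le_csInf Bne fun M hM => (hM.2 i j hij z hz).2⟩⟩
  have step : ∀ M ∈ B, 1 + M / 2 ∈ B := by
    intro M hM
    have hq : C * (M * (2 * A * δ)) ≤ M / 2 := by
      have : C * A * δ ≤ 1 / 4 := by nlinarith [mul_nonneg hA hδ0.le]
      nlinarith [hM.1]
    refine ⟨by linarith [hM.1], fun i j hij z hz => ?_⟩
    obtain ⟨h1, h2⟩ := app M hM i z hz.1 (hrad i j hij z hz)
    constructor
    · have := norm_add_le (R1 n i z - 1) 1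
      rw [sub_add_cancel, norm_one] at this
      linarith
    · rw [sub_zero] at h2; linarith
  have m2 : sInf B ≤ 2 := by
    have := csInf_le Bbdd (step _ mB)
    linarith
  have B2 : (2:ℝ) ∈ B := ⟨by norm_num, fun i j hij z hz =>
    ⟨(mB.2 i j hij z hz).1.trans m2, (mB.2 i j hij z hz).2.trans m2⟩⟩
  have app2 := app 2 B2
  have hsR : ∀ i j, i ≠ j → ∀ z ∈ K i ∩ K j,
      ‖(R2 n i z - s n i z) - (R2 n j z - s n j z)‖ ≤ (4 * C * A * A + 4 * C * A * A + A4) * δ ^ 2 := by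
    intro i j hij z hz
    have hsg := hsg n i j hij z (hsub i j hij hz)
    have : (R2 n i z - s n i z) - (R2 n j z - s n j z) =
        (R1 n j z - 1) * X12 n j i z + (R2 n j z - 0) * (X22 n j i z - 1) +
        (X12 n j i z - (g n j z - g n i z)) := by
      rw [hX2 i j hij z (hsub i j hij hz)]
      linear_combination -hsg
    rw [this]
    refine norm_add₃_le.trans ?_
    rw [norm_mul, norm_mul]
    obtain ⟨h1, h2⟩ := app2 j z hz.2 (hrad i j hij z hz)
    calc _ ≤ C * (2 * (2 * A * δ)) * (A * δ) + C * (2 * (2 * A * δ)) * (A * δ) + A4 * δ ^ 2 := by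
          refine add_le_add (add_le_add ?_ ?_) (b12' i j hij z hz)
          · exact mul_le_mul h1 (b12 i j hij z hz) (norm_nonneg _) (by positivity)
          · exact mul_le_mul h2 (b22 i j hij z hz) (norm_nonneg _) (by positivity)
      _ = _ := by ring
  have fin := hK (fun i z => R2 n i z - s n i z) 0 _ (by positivity)
    (fun i => (hR2 i).sub (hs n i)) (by simpa using hR2o.sub (hso n)) hsR o 0 h00
    (by simpa using hρ.le)
  simp only [sub_zero] at fin
  refine fin.trans ?_
  rw [div_eq_mul_inv, ← inv_pow, ← hδ, ← mul_assoc]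

/-- A parametric integral of dominated holomorphic functions is holomorphic. -/
lemma differentiableOn_integral_of_dominated {μ : Measure ℝ} {k : ℂ → ℝ → ℂ} {U : Set ℂ}
    (hU : IsOpen U) {bound : ℝ → ℝ}
    (hm : ∀ z ∈ U, AEStronglyMeasurable (k z) μ)
    (hb : ∀ᵐ t ∂μ, ∀ z ∈ U, ‖k z t‖ ≤ bound t)
    (hbi : Integrable bound μ)
    (hd : ∀ᵐ t ∂μ, DifferentiableOn ℂ (fun z => k z t) U) :
    DifferentiableOn ℂ (fun z => ∫ t, k z t ∂μ) U := by
  intro p hp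
  obtain ⟨r, hr, hrU⟩ := Metric.isOpen_iff.1 hU p hp
  have hr2 : 0 < r / 2 := by positivity
  have hsub : ∀ x ∈ Metric.ball p (r / 2), Metric.closedBall x (r / 4) ⊆ U := by
    intro x hx y hy
    apply hrU
    rw [Metric.mem_ball] at hx ⊢
    rw [Metric.mem_closedBall] at hy
    have := dist_triangle y x p
    linarith
  refine (DifferentiableAt.differentiableWithinAt ?_)
  have hmeas' : AEStronglyMeasurable (fun t => deriv (fun z => k z t) p) μ := by
    refine aestronglyMeasurable_of_tendsto_ae (u := atTop) (f := fun (n : ℕ) t =>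
      (((r / 2 / (n + 1) : ℝ) : ℂ))⁻¹ * (k (p + ((r / 2 / (n + 1) : ℝ) : ℂ)) t - k p t)) ?_ ?_
    · intro n
      refine ((hm _ (hrU ?_)).sub (hm p hp)).const_mul _
      rw [Metric.mem_ball, dist_eq_norm, add_sub_cancel_left, Complex.norm_real,
        Real.norm_of_nonneg (by positivity)]
      calc r / 2 / (n + 1) ≤ r / 2 := div_le_self hr2.le (by linarith [n.cast_nonneg (α := ℝ)])
        _ < r := by linarith
    · filter_upwards [hd] with t ht
      have h1 := (ht.differentiableAt (hU.mem_nhds hp)).hasDerivAt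
      rw [hasDerivAt_iff_tendsto_slope_zero] at h1
      have h2 : Tendsto (fun n : ℕ => ((r / 2 / (n + 1) : ℝ) : ℂ)) atTop (nhdsWithin 0 {0}ᶜ) := by
        rw [tendsto_nhdsWithin_iff]
        constructor
        · have : Tendsto (fun n : ℕ => (r / 2 / (n + 1) : ℝ)) atTop (nhds 0) := by
            have := (tendsto_one_div_add_atTop_nhds_zero_nat (𝕜 := ℝ)).const_mul (r / 2)
            rw [mul_zero] at this
            refine this.congr fun n => ?_
            rw [mul_one_div]
          exact (Complex.continuous_ofReal.tendsto' 0 0 Complex.ofReal_zero).comp this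
        · refine Eventually.of_forall fun n => ?_
          have : (0:ℝ) < r / 2 / (n + 1) := by positivity
          exact Complex.ofReal_ne_zero.2 this.ne'
      exact h1.comp h2
  have key := hasDerivAt_integral_of_dominated_loc_of_deriv_le (μ := μ) (𝕜 := ℂ) (F := k) (x₀ := p)
    (bound := fun t => bound t / (r / 4)) (s := Metric.ball p (r / 2))
    (F' := fun z t => deriv (fun z => k z t) z)
    (Metric.ball_mem_nhds p hr2) ?_ ?_ hmeas' ?_ (hbi.div_const _) ?_
  · exact key.2.differentiableAt
  · filter_upwards [hU.mem_nhds hp] with z hz using hm z hz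
  · exact hbi.mono' (hm p hp) (hb.mono fun t ht => ht p hp)
  · filter_upwards [hb, hd] with t ht htd x hx
    refine Complex.norm_deriv_le_of_forall_mem_sphere_norm_le (by positivity) ?_ ?_
    · refine DifferentiableOn.diffContOnCl ?_
      rw [closure_ball x (by positivity)]
      exact htd.mono (hsub x hx)
    · exact fun z hz => ht z (hsub x hx (Metric.sphere_subset_closedBall hz))
  · filter_upwards [hd] with t htd x hx
    exact (htd.differentiableAt (hU.mem_nhds (hsub x hx
      (Metric.mem_closedBall_self (by positivity))))).hasDerivAt

lemma ae_circleMap_ne (q : ℂ) : ∀ᵐ t : ℝ, circleMap 0 1 t ≠ q := by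
  have : (({q} : Set ℂ).Countable) := countable_singleton q
  have h1 := this.preimage_cexp
  have h2 : ((fun t : ℝ => (t * Complex.I : ℂ)) ⁻¹' (Complex.exp ⁻¹' {q})).Countable :=
    h1.preimage (fun a b hab => by simpa using hab)
  rw [ae_iff]
  convert h2.measure_zero volume using 2
  ext t; simp [circleMap]

/-- The Cauchy transform over the unit circle. -/
noncomputable def cauchyT (F : ℂ → ℂ) (z : ℂ) : ℂ :=
  (2 * Real.pi * Complex.I : ℂ)⁻¹ * ∮ s in C(0, 1), (s - z)⁻¹ * F s

lemma cauchyT_eq (F : ℂ → ℂ) (z : ℂ) : cauchyT F z = (2 * Real.pi * Complex.I : ℂ)⁻¹ *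
    ∫ t in Ioc 0 (2 * Real.pi), (circleMap 0 1 t * Complex.I) *
      ((circleMap 0 1 t - z)⁻¹ * F (circleMap 0 1 t)) := by
  rw [cauchyT, circleIntegral, intervalIntegral.integral_of_le (by positivity)]
  simp

lemma CircleIntegrable.integrable {F : ℂ → ℂ} (hF : CircleIntegrable F 0 1) :
    Integrable (fun t => F (circleMap 0 1 t)) (volume.restrict (Ioc 0 (2 * Real.pi))) := by
  have := hF
  rwa [CircleIntegrable, intervalIntegrable_iff_integrableOn_Ioc_of_le (by positivity)] at this

lemma norm_circleMap_one (t : ℝ) : ‖circleMap 0 1 t‖ = 1 := by simp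

lemma isOpen_offCircle : IsOpen {z : ℂ | ‖z‖ ≠ 1} :=
  isOpen_ne_fun continuous_norm continuous_const

lemma measurable_circleMap_sub_inv (z : ℂ) : Measurable fun t : ℝ => (circleMap 0 1 t - z)⁻¹ :=
  ((measurable_circleMap 0 1).sub_const z).inv

/-- Commuting multiplication by a locally holomorphic function past the Cauchy transform. -/
lemma exists_analyticAt_mul_cauchyT {F G g : ℂ → ℂ} {p : ℂ} (q : ℂ)
    (hF : CircleIntegrable F 0 1) (hG : CircleIntegrable G 0 1) (hg : AnalyticAt ℂ g p)
    (hFG : ∀ᶠ s in nhds p, ‖s‖ = 1 → s ≠ q → G s = g s * F s) :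
    ∃ e : ℂ → ℂ, AnalyticAt ℂ e p ∧ ∀ᶠ z in nhds p, ‖z‖ ≠ 1 → g z * cauchyT F z =
      cauchyT G z + e z := by
  classical
  obtain ⟨r0, hr0, hr⟩ := Metric.eventually_nhds_iff_ball.1 (hg.eventually_analyticAt.and hFG)
  -- radius for the inner ball
  set r := r0 / 2 with hrdef
  have hrpos : 0 < r := by positivity
  have hgd : DifferentiableOn ℂ g (Metric.ball p r0) := fun z hz =>
    (hr z hz).1.differentiableAt.differentiableWithinAt
  have hcball : Metric.closedBall p r ⊆ Metric.ball p r0 :=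
    Metric.closedBall_subset_ball (by rw [hrdef]; linarith)
  have hball : Metric.ball p r ⊆ Metric.ball p r0 := Metric.ball_subset_closedBall.trans hcball
  obtain ⟨M, hM⟩ := (isCompact_closedBall p r).exists_bound_of_continuousOn (f := deriv g)
    ((hgd.deriv Metric.isOpen_ball).continuousOn.mono hcball)
  obtain ⟨M', hM'⟩ := (isCompact_closedBall p r).exists_bound_of_continuousOn (f := g)
    (hgd.continuousOn.mono hcball)
  have hM0 : 0 ≤ M := (norm_nonneg _).trans (hM p (Metric.mem_closedBall_self hrpos.le))
  have hM0' : 0 ≤ M' := (norm_nonneg _).trans (hM' p (Metric.mem_closedBall_self hrpos.le))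
  have hlip : ∀ s ∈ Metric.ball p r, ∀ z ∈ Metric.ball p r, ‖dslope g s z‖ ≤ M := by
    intro s hs z hz
    by_cases hsz : z = s
    · rw [hsz, dslope_same]; exact hM s (Metric.ball_subset_closedBall hs)
    · rw [dslope_of_ne _ hsz, slope_def_module, norm_smul, norm_inv]
      have := (convex_ball p r).norm_image_sub_le_of_norm_deriv_le
        (fun x hx => hgd.differentiableAt (Metric.isOpen_ball.mem_nhds (hball hx)))
        (fun x hx => hM x (Metric.ball_subset_closedBall hx)) hs hz
      rw [inv_mul_le_iff₀ (norm_pos_iff.2 (sub_ne_zero.2 hsz)), mul_comm]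
      exact this
  set cm := circleMap 0 1
  set k : ℂ → ℝ → ℂ := fun z t => (cm t * Complex.I) * (if cm t ∈ Metric.ball p r then
    -(dslope g (cm t) z * F (cm t)) else (cm t - z)⁻¹ * (g z * F (cm t) - G (cm t))) with hk
  have hkeq : ∀ᵐ t : ℝ, ∀ z ∈ Metric.ball p r, cm t ≠ z →
      k z t = (cm t * Complex.I) * ((cm t - z)⁻¹ * (g z * F (cm t) - G (cm t))) := by
    filter_upwards [ae_circleMap_ne q] with t ht z hz hzt
    simp only [hk]
    split_ifs with h
    · congr 1
      rw [(hr (cm t) (hball h)).2 (norm_circleMap_one t) ht, dslope_of_ne _ hzt.symm,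
        slope_def_field, ← sub_mul, div_eq_mul_inv]
      have : (cm t - z)⁻¹ = -(z - cm t)⁻¹ := by rw [← inv_neg, neg_sub]
      rw [this]; ring
    · rfl
  have hFi := hF.integrable
  have hGi := hG.integrable
  have hd : DifferentiableOn ℂ (fun z => ∫ t in Ioc 0 (2 * Real.pi), k z t)
      (Metric.ball p (r / 2)) := by
    refine differentiableOn_integral_of_dominated Metric.isOpen_ball
      (bound := fun t => (M + M' * (r / 2)⁻¹) * ‖F (cm t)‖ + (r / 2)⁻¹ * ‖G (cm t)‖) ?_ ?_ ?_ ?_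
    · intro z hz
      have hz' : z ∈ Metric.ball p r := Metric.ball_subset_ball (by linarith) hz
      have : AEStronglyMeasurable (fun t =>
          (cm t * Complex.I) * ((cm t - z)⁻¹ * (g z * F (cm t) - G (cm t))))
          (volume.restrict (Ioc 0 (2 * Real.pi))) := by
        refine AEStronglyMeasurable.mul ?_ (AEStronglyMeasurable.mul ?_ ?_)
        · exact ((measurable_circleMap 0 1).mul_const _).aestronglyMeasurable
        · exact (measurable_circleMap_sub_inv z).aestronglyMeasurable
        · exact (hFi.aestronglyMeasurable.const_mul _).sub hGi.aestronglyMeasurable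
      refine this.congr (ae_restrict_of_ae ?_)
      filter_upwards [hkeq, ae_circleMap_ne z] with t ht htz
      exact (ht z hz' htz).symm
    · refine Eventually.of_forall fun t z hz => ?_
      have hz' : z ∈ Metric.ball p r := Metric.ball_subset_ball (by linarith) hz
      simp only [hk, norm_mul, Complex.norm_I, mul_one, norm_circleMap_one, cm, one_mul]
      split_ifs with h
      · rw [norm_neg, norm_mul]
        have h1 := mul_le_mul_of_nonneg_right (hlip _ h z hz') (norm_nonneg (F (circleMap 0 1 t)))
        have : 0 ≤ M' * (r / 2)⁻¹ * ‖F (circleMap 0 1 t)‖ := by positivity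
        have : 0 ≤ (r / 2)⁻¹ * ‖G (circleMap 0 1 t)‖ := by positivity
        nlinarith
      · rw [norm_mul, norm_inv]
        have h1 : r / 2 ≤ ‖circleMap 0 1 t - z‖ := by
          rw [Metric.mem_ball, not_lt, dist_eq_norm] at h
          rw [Metric.mem_ball, dist_eq_norm] at hz
          have := norm_sub_le_norm_sub_add_norm_sub (circleMap 0 1 t) z p
          linarith
        have h2 : ‖circleMap 0 1 t - z‖⁻¹ ≤ (r / 2)⁻¹ := inv_anti₀ (by positivity) h1
        have h3 : ‖g z * F (circleMap 0 1 t) - G (circleMap 0 1 t)‖ ≤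
            M' * ‖F (circleMap 0 1 t)‖ + ‖G (circleMap 0 1 t)‖ := by
          refine (norm_sub_le _ _).trans ?_
          rw [norm_mul]
          gcongr
          exact hM' z (Metric.ball_subset_closedBall hz')
        calc _ ≤ (r / 2)⁻¹ * (M' * ‖F (circleMap 0 1 t)‖ + ‖G (circleMap 0 1 t)‖) :=
              mul_le_mul h2 h3 (norm_nonneg _) (by positivity)
          _ ≤ _ := by
            have : 0 ≤ M * ‖F (circleMap 0 1 t)‖ := by positivity
            nlinarith
    · exact (hFi.norm.const_mul _).add (hGi.norm.const_mul _)
    · refine Eventually.of_forall fun t => ?_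
      simp only [hk]
      refine DifferentiableOn.const_mul ?_ _
      split_ifs with h
      · refine (DifferentiableOn.mul_const ?_ _).neg
        refine ((Complex.differentiableOn_dslope (Metric.isOpen_ball.mem_nhds h)).2
          (hgd.mono hball)).mono (Metric.ball_subset_ball (by linarith))
      · refine DifferentiableOn.mul ?_ ?_
        · refine DifferentiableOn.inv (by fun_prop) fun z hz hz0 => h ?_
          rw [sub_eq_zero.1 hz0]
          exact Metric.ball_subset_ball (by linarith) hz
        · exact ((hgd.mono (hball.trans' (Metric.ball_subset_ball (by linarith)))).mul_const _).sub_const _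
  refine ⟨fun z => (2 * Real.pi * Complex.I : ℂ)⁻¹ * ∫ t in Ioc 0 (2 * Real.pi), k z t, ?_, ?_⟩
  · exact analyticAt_const.mul (hd.analyticAt (Metric.ball_mem_nhds p (by positivity)))
  · filter_upwards [Metric.ball_mem_nhds p hrpos] with z hz hz1
    have e1 : ∫ t in Ioc 0 (2 * Real.pi), k z t = ∫ t in Ioc 0 (2 * Real.pi),
        (g z * ((cm t * Complex.I) * ((cm t - z)⁻¹ * F (cm t))) -
        (cm t * Complex.I) * ((cm t - z)⁻¹ * G (cm t))) := by
      refine integral_congr_ae (ae_restrict_of_ae ?_)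
      filter_upwards [hkeq] with t ht
      rw [ht z hz (fun h => hz1 (by rw [← h]; exact norm_circleMap_one t))]
      ring
    have int : ∀ H : ℂ → ℂ, CircleIntegrable H 0 1 → IntegrableOn
        (fun t => (cm t * Complex.I) * ((cm t - z)⁻¹ * H (cm t))) (Ioc 0 (2 * Real.pi)) := by
      intro H hH
      have h1 : CircleIntegrable (fun s => (s * Complex.I * (s - z)⁻¹) * H s) 0 1 := by
        refine hH.continuousOn_mul (ContinuousOn.mul (by fun_prop) (ContinuousOn.inv₀ (by fun_prop) ?_))
        intro s hs h0
        rw [sub_eq_zero] at h0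
        apply hz1
        rw [← h0]; simpa using hs
      have h2 := h1.integrable
      simp only [mul_assoc] at h2 ⊢
      exact h2
    rw [e1, integral_sub ((int F hF).const_mul _) (int G hG), integral_const_mul, cauchyT_eq,
      cauchyT_eq]
    ring

lemma CircleIntegrable.contMul {F g : ℂ → ℂ} (hF : CircleIntegrable F 0 1)
    (hg : ContinuousOn g (Metric.sphere 0 1)) : CircleIntegrable (fun s => g s * F s) 0 1 :=
  hF.continuousOn_mul (by simpa using hg)

lemma ne_zero_of_mem_sphere_one {s : ℂ} (hs : s ∈ Metric.sphere (0:ℂ) 1) : s ≠ 0 := by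
  rintro rfl; simp at hs

lemma continuousOn_zpow_sphere (m : ℤ) : ContinuousOn (fun s : ℂ => s ^ m) (Metric.sphere 0 1) :=
  fun s hs => (continuousAt_zpow₀ s m (Or.inl (ne_zero_of_mem_sphere_one hs))).continuousWithinAt

lemma CircleIntegrable.mul_zpow {F : ℂ → ℂ} (hF : CircleIntegrable F 0 1) (m : ℤ) :
    CircleIntegrable (fun s => F s * s ^ m) 0 1 := by
  simpa only [mul_comm] using hF.contMul (continuousOn_zpow_sphere m)

lemma CircleIntegrable.sub_inv_mul {F : ℂ → ℂ} (hF : CircleIntegrable F 0 1) {z : ℂ}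
    (hz : ‖z‖ ≠ 1) : CircleIntegrable (fun s => (s - z)⁻¹ * F s) 0 1 := by
  refine hF.contMul (ContinuousOn.inv₀ (by fun_prop) ?_)
  intro s hs h0
  apply hz
  rw [← sub_eq_zero.1 h0]; simpa using hs

/-- Fourier coefficient of a function on the unit circle. -/
noncomputable def mom (F : ℂ → ℂ) (j : ℤ) : ℂ :=
  (2 * Real.pi * Complex.I : ℂ)⁻¹ * ∮ s in C(0, 1), s ^ (-j - 1) * F s

lemma two_pi_I_ne : (2 * Real.pi * Complex.I : ℂ) ≠ 0 := by
  simp [Real.pi_ne_zero]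

lemma mom_congr {F G : ℂ → ℂ} (h : ∀ s, ‖s‖ = 1 → F s = G s) (j : ℤ) : mom F j = mom G j := by
  unfold mom
  congr 1
  refine circleIntegral.integral_congr zero_le_one fun s hs => ?_
  rw [h s (by simpa using hs)]

lemma cauchyT_congr {F G : ℂ → ℂ} (h : ∀ s, ‖s‖ = 1 → F s = G s) (z : ℂ) :
    cauchyT F z = cauchyT G z := by
  unfold cauchyT
  congr 1
  refine circleIntegral.integral_congr zero_le_one fun s hs => ?_
  rw [h s (by simpa using hs)]

lemma mom_mul_zpow (F : ℂ → ℂ) (j m : ℤ) : mom (fun s => F s * s ^ m) j = mom F (j - m) := by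
  unfold mom
  congr 1
  refine circleIntegral.integral_congr zero_le_one fun s hs => ?_
  have := ne_zero_of_mem_sphere_one hs
  simp only
  rw [mul_comm (F s), ← mul_assoc, ← zpow_add₀ this]
  congr 2; ring

lemma mom_zpow_mul (F : ℂ → ℂ) (j m : ℤ) : mom (fun s => s ^ m * F s) j = mom F (j - m) := by
  rw [← mom_mul_zpow]
  exact mom_congr (fun s _ => mul_comm _ _) j

lemma mom_add {F G : ℂ → ℂ} (hF : CircleIntegrable F 0 1) (hG : CircleIntegrable G 0 1) (j : ℤ) :
    mom (fun s => F s + G s) j = mom F j + mom G j := by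
  unfold mom
  rw [← mul_add, ← circleIntegral.integral_add]
  · simp only [mul_add]
  · exact hF.contMul (continuousOn_zpow_sphere _)
  · exact hG.contMul (continuousOn_zpow_sphere _)

lemma mom_const_mul (F : ℂ → ℂ) (a : ℂ) (j : ℤ) :
    mom (fun s => a * F s) j = a * mom F j := by
  unfold mom
  rw [mul_left_comm]
  congr 1
  rw [← circleIntegral.integral_const_mul]
  exact circleIntegral.integral_congr zero_le_one fun s _ => mul_left_comm _ _ _

lemma mom_sum {ι : Type*} (t : Finset ι) {F : ι → ℂ → ℂ}
    (hF : ∀ i ∈ t, CircleIntegrable (F i) 0 1) (j : ℤ) :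
    mom (fun s => ∑ i ∈ t, F i s) j = ∑ i ∈ t, mom (F i) j := by
  unfold mom
  rw [← Finset.mul_sum, ← circleIntegral.integral_fun_sum]
  · simp only [Finset.mul_sum]
  · exact fun i hi => (hF i hi).contMul (continuousOn_zpow_sphere _)

lemma cauchyT_const_mul (F : ℂ → ℂ) (a z : ℂ) :
    cauchyT (fun s => a * F s) z = a * cauchyT F z := by
  unfold cauchyT
  rw [mul_left_comm]
  congr 1
  rw [← circleIntegral.integral_const_mul]
  exact circleIntegral.integral_congr zero_le_one fun s _ => mul_left_comm _ _ _

lemma analyticAt_cauchyT {F : ℂ → ℂ} (hF : CircleIntegrable F 0 1) {p : ℂ} (hp : ‖p‖ ≠ 1) :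
    AnalyticAt ℂ (cauchyT F) p := by
  have hoff := isOpen_offCircle.mem_nhds hp
  obtain ⟨e, he, h⟩ := exists_analyticAt_mul_cauchyT (F := F) (G := fun _ => 0) (g := fun _ => 1)
    (p := p) 0 hF (circleIntegrable_const 0 0 1) analyticAt_const (by
      filter_upwards [hoff] with s hs h using absurd h hs)
  refine he.congr ?_
  filter_upwards [h, hoff] with z hz hz1
  have := hz hz1
  rw [one_mul] at this
  rw [this]
  simp [cauchyT, circleIntegral]

lemma inv_sub_eq_geom {s z : ℂ} (hs : s ≠ 0) (hsz : s - z ≠ 0) (N : ℕ) :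
    (s - z)⁻¹ = ∑ k ∈ Finset.range N, z ^ k * s ^ (-(k : ℤ) - 1) +
      z ^ N * (s ^ (-(N : ℤ)) * (s - z)⁻¹) := by
  induction N with
  | zero => simp
  | succ n ih =>
    rw [Finset.sum_range_succ]
    conv_lhs => rw [ih]
    have h1 : s ^ (-((n + 1 : ℕ) : ℤ)) = s ^ (-(n : ℤ)) * s⁻¹ := by
      rw [← zpow_neg_one, ← zpow_add₀ hs]; congr 1; push_cast; ring
    have h2 : s ^ (-(n : ℤ) - 1) = s ^ (-(n : ℤ)) * s⁻¹ := by
      rw [← zpow_neg_one, ← zpow_add₀ hs]; congr 1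
    rw [h1, h2]
    field_simp
    ring

/-- Finite expansion of the Cauchy transform. -/
lemma cauchyT_eq_sum_add {F : ℂ → ℂ} (hF : CircleIntegrable F 0 1) {z : ℂ} (hz : ‖z‖ ≠ 1)
    (N : ℕ) : cauchyT F z = ∑ k ∈ Finset.range N, z ^ k * mom F k +
      z ^ N * cauchyT (fun s => F s * s ^ (-(N : ℤ))) z := by
  have h1 : ∮ s in C(0, 1), (s - z)⁻¹ * F s = ∮ s in C(0, 1),
      (∑ k ∈ Finset.range N, z ^ k * (s ^ (-(k : ℤ) - 1) * F s) +
        z ^ N * ((s - z)⁻¹ * (F s * s ^ (-(N : ℤ))))) := by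
    refine circleIntegral.integral_congr zero_le_one fun s hs => ?_
    conv_lhs => rw [inv_sub_eq_geom (ne_zero_of_mem_sphere_one hs) (z := z) (by
      intro h0; apply hz; rw [← sub_eq_zero.1 h0]; simpa using hs) N]
    rw [add_mul, Finset.sum_mul]
    congr 1
    · exact Finset.sum_congr rfl fun k _ => by ring
    · ring
  have hi : ∀ k : ℕ, CircleIntegrable (fun s => z ^ k * (s ^ (-(k : ℤ) - 1) * F s)) 0 1 :=
    fun k => (hF.contMul (continuousOn_zpow_sphere _)).contMul
      continuousOn_const
  rw [cauchyT, h1, circleIntegral.integral_add, circleIntegral.integral_fun_sum, mul_add,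
    Finset.mul_sum, circleIntegral.integral_const_mul, cauchyT]
  · congr 1
    · refine Finset.sum_congr rfl fun k _ => ?_
      rw [circleIntegral.integral_const_mul, mom]; ring
    · ring
  · exact fun k _ => hi k
  · exact CircleIntegrable.fun_sum _ fun k _ => hi k
  · exact ((hF.mul_zpow _).sub_inv_mul hz).contMul continuousOn_const

/-- Mean absolute value on the unit circle. -/
noncomputable def circleNorm (F : ℂ → ℂ) : ℝ :=
  (2 * Real.pi)⁻¹ * ∫ t in Ioc 0 (2 * Real.pi), ‖F (circleMap 0 1 t)‖

lemma circleNorm_mul_zpow (F : ℂ → ℂ) (m : ℤ) :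
    circleNorm (fun s => F s * s ^ m) = circleNorm F := by
  simp [circleNorm]

lemma norm_cauchyT_le {F : ℂ → ℂ} (hF : CircleIntegrable F 0 1) {z : ℂ} (hz : ‖z‖ ≠ 1) :
    ‖cauchyT F z‖ ≤ circleNorm F / |‖z‖ - 1| := by
  have hpos : 0 < |‖z‖ - 1| := abs_pos.2 (sub_ne_zero.2 hz)
  rw [cauchyT_eq, norm_mul, circleNorm]
  have h1 : ‖(2 * Real.pi * Complex.I : ℂ)⁻¹‖ = (2 * Real.pi)⁻¹ := by
    simp [abs_of_pos Real.pi_pos]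
  rw [h1, mul_div_assoc]
  refine mul_le_mul_of_nonneg_left ?_ (by positivity)
  rw [← integral_div]
  refine norm_integral_le_of_norm_le (hF.integrable.norm.div_const _) ?_
  refine Eventually.of_forall fun t => ?_
  rw [norm_mul, norm_mul, norm_mul, norm_circleMap_one, Complex.norm_I, norm_inv, one_mul,
    one_mul, div_eq_inv_mul]
  refine mul_le_mul_of_nonneg_right (inv_anti₀ hpos ?_) (norm_nonneg _)
  have := abs_norm_sub_norm_le (circleMap 0 1 t) z
  rw [norm_circleMap_one] at this
  rwa [abs_sub_comm]

lemma tendsto_cauchyT_cocompact {F : ℂ → ℂ} (hF : CircleIntegrable F 0 1) :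
    Tendsto (cauchyT F) (cocompact ℂ) (nhds 0) := by
  have h1 : Tendsto (fun z : ℂ => circleNorm F / (‖z‖ - 1)) (cocompact ℂ) (nhds 0) :=
    Tendsto.const_div_atTop (tendsto_atTop_add_const_right _ (-1) tendsto_norm_cocompact_atTop) _
  refine squeeze_zero_norm' ?_ h1
  filter_upwards [tendsto_norm_cocompact_atTop.eventually_gt_atTop 1] with z hz
  have := norm_cauchyT_le hF hz.ne'
  rwa [abs_of_pos (by linarith)] at this

lemma norm_mom_le {F : ℂ → ℂ} (hF : CircleIntegrable F 0 1) (k : ℤ) :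
    ‖mom F k‖ ≤ circleNorm F := by
  rw [mom, circleIntegral, intervalIntegral.integral_of_le (by positivity), norm_mul, circleNorm]
  have h1 : ‖(2 * Real.pi * Complex.I : ℂ)⁻¹‖ = (2 * Real.pi)⁻¹ := by
    simp [abs_of_pos Real.pi_pos]
  rw [h1]
  refine mul_le_mul_of_nonneg_left ?_ (by positivity)
  refine norm_integral_le_of_norm_le hF.integrable.norm (Eventually.of_forall fun t => ?_)
  simp

lemma hasSum_cauchyT_of_lt {F : ℂ → ℂ} (hF : CircleIntegrable F 0 1) {z : ℂ} (hz : ‖z‖ < 1) :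
    HasSum (fun k : ℕ => z ^ k * mom F k) (cauchyT F z) := by
  have hbd := fun k : ℕ => norm_mom_le hF k
  have hs : Summable (fun k : ℕ => z ^ k * mom F k) := by
    refine Summable.of_norm_bounded ((summable_geometric_of_lt_one (norm_nonneg z) hz).mul_right
      (circleNorm F)) fun k => ?_
    rw [norm_mul, norm_pow]
    exact mul_le_mul_of_nonneg_left (hbd k) (by positivity)
  refine (hs.hasSum_iff_tendsto_nat).2 ?_
  have h2 : ∀ N : ℕ, ∑ k ∈ Finset.range N, z ^ k * mom F k =
      cauchyT F z - z ^ N * cauchyT (fun s => F s * s ^ (-(N : ℤ))) z := by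
    intro N; rw [cauchyT_eq_sum_add hF hz.ne N]; ring
  simp only [h2]
  have h3 : Tendsto (fun N : ℕ => z ^ N * cauchyT (fun s => F s * s ^ (-(N : ℤ))) z) atTop
      (nhds 0) := by
    refine squeeze_zero_norm (a := fun N => ‖z‖ ^ N * (circleNorm F / |‖z‖ - 1|)) (fun N => ?_) ?_
    · rw [norm_mul, norm_pow]
      refine mul_le_mul_of_nonneg_left ?_ (by positivity)
      have := norm_cauchyT_le (hF.mul_zpow (-(N:ℤ))) hz.ne
      rwa [circleNorm_mul_zpow] at this
    · simpa using (tendsto_pow_atTop_nhds_zero_of_lt_one (norm_nonneg z) hz).mul_const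
        (circleNorm F / |‖z‖ - 1|)
  simpa using h3.const_sub (cauchyT F z)

lemma hasSum_cauchyT_of_gt {F : ℂ → ℂ} (hF : CircleIntegrable F 0 1) {z : ℂ} (hz : 1 < ‖z‖) :
    HasSum (fun k : ℕ => z⁻¹ ^ (k + 1) * mom F (-(k + 1 : ℤ))) (-cauchyT F z) := by
  have hz0 : z ≠ 0 := by rintro rfl; simp at hz; linarith
  have hzi : ‖z⁻¹‖ < 1 := by rw [norm_inv]; exact inv_lt_one_of_one_lt₀ hz
  have hbd : ∀ k : ℤ, ‖mom F k‖ ≤ circleNorm F := norm_mom_le hF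
  have hs : Summable (fun k : ℕ => z⁻¹ ^ (k + 1) * mom F (-(k + 1 : ℤ))) := by
    refine Summable.of_norm_bounded (((summable_geometric_of_lt_one (norm_nonneg z⁻¹) hzi).mul_left
      ‖z⁻¹‖).mul_right (circleNorm F)) fun k => ?_
    rw [norm_mul, norm_pow, pow_succ']
    exact mul_le_mul_of_nonneg_left (hbd _) (by positivity)
  refine (hs.hasSum_iff_tendsto_nat).2 ?_
  have h2 : ∀ N : ℕ, ∑ k ∈ Finset.range N, z⁻¹ ^ (k + 1) * mom F (-(k + 1 : ℤ)) =
      z⁻¹ ^ N * cauchyT (fun s => F s * s ^ (N : ℤ)) z - cauchyT F z := by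
    intro N
    have h3 := cauchyT_eq_sum_add (hF.mul_zpow N) hz.ne' N
    have h4 : cauchyT (fun s => F s * s ^ (N : ℤ) * s ^ (-(N : ℤ))) z = cauchyT F z := by
      refine cauchyT_congr (fun s hs => ?_) z
      have : s ≠ 0 := ne_zero_of_mem_sphere_one (by simpa using hs)
      rw [mul_assoc, ← zpow_add₀ this]; simp
    rw [h4] at h3
    simp only [mom_mul_zpow] at h3
    rw [h3, mul_add, ← mul_assoc, ← mul_pow, inv_mul_cancel₀ hz0, one_pow, one_mul,
      add_sub_cancel_right, Finset.mul_sum, ← Finset.sum_range_reflect]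
    refine Finset.sum_congr rfl fun k hk => ?_
    have hk' := Finset.mem_range.1 hk
    obtain ⟨m, rfl⟩ : ∃ m, N = k + m + 1 := ⟨N - k - 1, by omega⟩
    have e1 : k + m + 1 - 1 - k = m := by omega
    rw [e1, ← mul_assoc]
    congr 1
    · rw [show k + m + 1 = (m + 1) + k by ring, pow_add _ (m + 1) k, mul_assoc, ← mul_pow,
        inv_mul_cancel₀ hz0, one_pow, mul_one]
    · congr 1; push_cast; ring
  simp only [h2]
  have h3 : Tendsto (fun N : ℕ => z⁻¹ ^ N * cauchyT (fun s => F s * s ^ (N : ℤ)) z) atTop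
      (nhds 0) := by
    refine squeeze_zero_norm (a := fun N => ‖z⁻¹‖ ^ N * (circleNorm F / |‖z‖ - 1|)) (fun N => ?_) ?_
    · rw [norm_mul, norm_pow]
      refine mul_le_mul_of_nonneg_left ?_ (by positivity)
      have := norm_cauchyT_le (hF.mul_zpow N) hz.ne'
      rwa [circleNorm_mul_zpow] at this
    · simpa using (tendsto_pow_atTop_nhds_zero_of_lt_one (norm_nonneg z⁻¹) hzi).mul_const
        (circleNorm F / |‖z‖ - 1|)
  simpa using h3.sub_const (cauchyT F z)

/-- If `g F = g' F'` on the circle near `p`, then the corresponding multiples of the Cauchy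
transforms differ by a function analytic at `p`. -/
lemma exists_analyticAt_mul_cauchyT_sub {F F' g g' : ℂ → ℂ} {p : ℂ} (q : ℂ)
    (hF : CircleIntegrable F 0 1) (hF' : CircleIntegrable F' 0 1) (hg : AnalyticAt ℂ g p)
    (hg' : AnalyticAt ℂ g' p)
    (h : ∀ᶠ s in nhds p, ‖s‖ = 1 → s ≠ q → g s * F s = g' s * F' s) :
    ∃ e : ℂ → ℂ, AnalyticAt ℂ e p ∧ ∀ᶠ z in nhds p, ‖z‖ ≠ 1 → g z * cauchyT F z =
      g' z * cauchyT F' z + e z := by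
  classical
  obtain ⟨r, hr, hr'⟩ := Metric.eventually_nhds_iff_ball.1 hg.eventually_analyticAt
  have hcont : ContinuousOn g (Metric.closedBall p (r / 2)) := fun z hz =>
    (hr' z (Metric.closedBall_subset_ball (by linarith) hz)).continuousAt.continuousWithinAt
  obtain ⟨M, hM⟩ := (isCompact_closedBall p (r / 2)).exists_bound_of_continuousOn hcont
  set G : ℂ → ℂ := (Metric.closedBall p (r / 2)).indicator (fun s => g s * F s) with hGdef
  have hG : CircleIntegrable G 0 1 := by
    have hmeas : Measurable ((Metric.closedBall p (r / 2)).indicator g) :=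
      hcont.measurable_piecewise continuousOn_const Metric.isClosed_closedBall.measurableSet
    have h1 : Integrable (fun t => (Metric.closedBall p (r / 2)).indicator g (circleMap 0 1 t) *
        F (circleMap 0 1 t)) (volume.restrict (Ioc 0 (2 * Real.pi))) := by
      refine hF.integrable.bdd_mul (c := |M|)
        (hmeas.comp (measurable_circleMap 0 1)).aestronglyMeasurable
        (Eventually.of_forall fun t => ?_)
      by_cases hm : circleMap 0 1 t ∈ Metric.closedBall p (r / 2)
      · rw [indicator_of_mem hm]; exact (hM _ hm).trans (le_abs_self M)
      · rw [indicator_of_notMem hm, norm_zero]; exact abs_nonneg _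
    rw [CircleIntegrable, intervalIntegrable_iff_integrableOn_Ioc_of_le (by positivity)]
    refine h1.congr (Eventually.of_forall fun t => ?_)
    simp only [hGdef, indicator]
    split_ifs <;> simp
  have hball : Metric.closedBall p (r / 2) ∈ nhds p := Metric.closedBall_mem_nhds p (by linarith)
  obtain ⟨e1, he1, h1⟩ := exists_analyticAt_mul_cauchyT (G := G) q hF hG hg (by
    filter_upwards [hball] with s hs _ _
    rw [hGdef, indicator_of_mem hs])
  obtain ⟨e2, he2, h2⟩ := exists_analyticAt_mul_cauchyT (G := G) q hF' hG hg' (by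
    filter_upwards [hball, h] with s hs hs' a b
    rw [hGdef, indicator_of_mem hs, hs' a b])
  refine ⟨fun z => e1 z - e2 z, he1.sub he2, ?_⟩
  filter_upwards [h1, h2] with z hz1 hz2 hz
  rw [hz1 hz, hz2 hz]; ring

lemma dense_offCircle : Dense {z : ℂ | ‖z‖ ≠ 1} := by
  intro z
  by_cases hz : ‖z‖ = 1
  · refine mem_closure_of_tendsto (f := fun t : ℝ => (t : ℂ) * z) (b := nhdsWithin 1 (Ioi 1)) ?_ ?_
    · have : Tendsto (fun t : ℝ => (t : ℂ) * z) (nhds 1) (nhds z) := by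
        have : ContinuousAt (fun t : ℝ => (t : ℂ) * z) 1 := by fun_prop
        simpa [ContinuousAt] using this
      exact this.mono_left nhdsWithin_le_nhds
    · filter_upwards [self_mem_nhdsWithin] with t ht
      have : (1:ℝ) < t := ht
      simp only [norm_mul, hz, mul_one, Complex.norm_real, Real.norm_eq_abs]
      rw [abs_of_pos (by linarith)]; linarith
  · exact subset_closure hz

instance nhdsWithin_offCircle_neBot (p : ℂ) : (nhdsWithin p {z : ℂ | ‖z‖ ≠ 1}).NeBot :=
  mem_closure_iff_nhdsWithin_neBot.1 (dense_offCircle p)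

lemma eq_of_eventually_offCircle {A B : ℂ → ℂ} {p : ℂ} (hA : ContinuousAt A p)
    (hB : ContinuousAt B p) (h : ∀ᶠ z in nhds p, ‖z‖ ≠ 1 → A z = B z) : A p = B p := by
  refine tendsto_nhds_unique (f := A) (l := nhdsWithin p {z : ℂ | ‖z‖ ≠ 1})
    (hA.mono_left nhdsWithin_le_nhds) ?_
  refine (hB.mono_left nhdsWithin_le_nhds).congr' ?_
  rw [EventuallyEq, eventually_nhdsWithin_iff]
  exact h.mono fun z hz hz1 => (hz hz1).symm

/-- Extension by limits across the unit circle. -/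
noncomputable def extOff (W : ℂ → ℂ) (z : ℂ) : ℂ := by
  classical exact if ‖z‖ ≠ 1 then W z else limUnder (nhdsWithin z {z : ℂ | ‖z‖ ≠ 1}) W

lemma extOff_of_ne (W : ℂ → ℂ) {z : ℂ} (hz : ‖z‖ ≠ 1) : extOff W z = W z := by
  simp [extOff, hz]

lemma extOff_eventuallyEq {W e : ℂ → ℂ} {p : ℂ} (he : AnalyticAt ℂ e p)
    (h : ∀ᶠ z in nhds p, ‖z‖ ≠ 1 → W z = e z) : extOff W =ᶠ[nhds p] e := by
  filter_upwards [he.eventually_analyticAt, h, h.eventually_nhds] with z hz hWz hW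
  by_cases hz1 : ‖z‖ = 1
  · simp only [extOff, hz1, ne_eq, not_true, if_false]
    refine Tendsto.limUnder_eq ?_
    refine (hz.continuousAt.mono_left nhdsWithin_le_nhds).congr' ?_
    rw [EventuallyEq, eventually_nhdsWithin_iff]
    exact hW.mono fun y hy hy1 => (hy hy1).symm
  · rw [extOff_of_ne _ hz1, hWz hz1]

lemma analyticAt_extOff {W e : ℂ → ℂ} {p : ℂ} (he : AnalyticAt ℂ e p)
    (h : ∀ᶠ z in nhds p, ‖z‖ ≠ 1 → W z = e z) : AnalyticAt ℂ (extOff W) p :=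
  he.congr (extOff_eventuallyEq he h).symm

/-- A row `(y₁, y₂)` with `y₂ - y₁ T` analytic at `p`. -/
def RowAt (T : ℂ → ℂ) (y1 y2 : ℂ → ℂ) (p : ℂ) : Prop :=
  AnalyticAt ℂ y1 p ∧ ∃ e : ℂ → ℂ, AnalyticAt ℂ e p ∧ ∀ᶠ z in nhds p, ‖z‖ ≠ 1 →
    y2 z = y1 z * T z + e z

lemma RowAt.analyticAt_wronskian {T y1 y2 x1 x2 : ℂ → ℂ} {p : ℂ} (hy : RowAt T y1 y2 p)
    (hx : RowAt T x1 x2 p) : AnalyticAt ℂ (extOff fun z => y1 z * x2 z - y2 z * x1 z) p := by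
  obtain ⟨h1, e, he, h2⟩ := hy
  obtain ⟨h3, f, hf, h4⟩ := hx
  refine analyticAt_extOff (e := fun z => y1 z * f z - e z * x1 z)
    ((h1.mul hf).sub (he.mul h3)) ?_
  filter_upwards [h2, h4] with z hz2 hz4 hz
  rw [hz2 hz, hz4 hz]; ring

/-- Distance-to-circle weight. -/
noncomputable def wt (z : ℂ) : ℝ := 1 + |‖z‖ - 1|⁻¹

lemma one_le_wt (z : ℂ) : 1 ≤ wt z := by
  unfold wt; linarith [inv_nonneg.2 (abs_nonneg (‖z‖ - 1))]

/-- Locally uniform order bounds near `p` off the unit circle, up to polynomial blow-up. -/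
def WO (p : ℂ) (φ : ℕ → ℝ) (F : ℕ → ℂ → ℂ) : Prop :=
  ∃ m : ℕ, (fun x : ℕ × ℂ => F x.1 x.2) =O[atTop ×ˢ nhdsWithin p {z : ℂ | ‖z‖ ≠ 1}]
    fun x => φ x.1 * wt x.2 ^ m

lemma wt_pow_isBigO (φ : ℕ → ℝ) (l : Filter (ℕ × ℂ)) {m k : ℕ} (h : m ≤ k) :
    (fun x : ℕ × ℂ => φ x.1 * wt x.2 ^ m) =O[l] fun x => φ x.1 * wt x.2 ^ k := by
  refine Asymptotics.IsBigO.of_bound 1 (Eventually.of_forall fun x => ?_)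
  have h0 := one_le_wt x.2
  rw [norm_mul, norm_mul, one_mul]
  refine mul_le_mul_of_nonneg_left ?_ (norm_nonneg _)
  rw [Real.norm_of_nonneg (by positivity), Real.norm_of_nonneg (by positivity)]
  exact pow_le_pow_right₀ h0 h

lemma WO.add {p : ℂ} {φ : ℕ → ℝ} {F G : ℕ → ℂ → ℂ} (hF : WO p φ F) (hG : WO p φ G) :
    WO p φ fun n z => F n z + G n z := by
  obtain ⟨m, hm⟩ := hF
  obtain ⟨k, hk⟩ := hG
  exact ⟨max m k, (hm.trans (wt_pow_isBigO _ _ (le_max_left _ _))).add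
    (hk.trans (wt_pow_isBigO _ _ (le_max_right _ _)))⟩

lemma WO.mul {p : ℂ} {φ ψ : ℕ → ℝ} {F G : ℕ → ℂ → ℂ} (hF : WO p φ F) (hG : WO p ψ G) :
    WO p (fun n => φ n * ψ n) fun n z => F n z * G n z := by
  obtain ⟨m, hm⟩ := hF
  obtain ⟨k, hk⟩ := hG
  refine ⟨m + k, (hm.mul hk).congr_right fun x => ?_⟩
  ring

lemma WO.neg {p : ℂ} {φ : ℕ → ℝ} {F : ℕ → ℂ → ℂ} (hF : WO p φ F) :
    WO p φ fun n z => -F n z := by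
  obtain ⟨m, hm⟩ := hF
  exact ⟨m, hm.neg_left⟩

lemma WO.sub {p : ℂ} {φ : ℕ → ℝ} {F G : ℕ → ℂ → ℂ} (hF : WO p φ F) (hG : WO p φ G) :
    WO p φ fun n z => F n z - G n z := by
  simpa only [sub_eq_add_neg] using hF.add hG.neg

lemma WO.mono {p : ℂ} {φ ψ : ℕ → ℝ} {F : ℕ → ℂ → ℂ} (hF : WO p φ F) (h : φ =O[atTop] ψ) :
    WO p ψ F := by
  obtain ⟨m, hm⟩ := hF
  exact ⟨m, hm.trans ((h.comp_tendsto tendsto_fst).mul (Asymptotics.isBigO_refl _ _))⟩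

lemma WO.congr {p : ℂ} {φ : ℕ → ℝ} {F G : ℕ → ℂ → ℂ} (hF : WO p φ F)
    (h : ∀ᶠ x : ℕ × ℂ in atTop ×ˢ nhds p, ‖x.2‖ ≠ 1 → F x.1 x.2 = G x.1 x.2) : WO p φ G := by
  obtain ⟨m, hm⟩ := hF
  refine ⟨m, hm.congr' ?_ EventuallyEq.rfl⟩
  have h1 : atTop ×ˢ nhdsWithin p {z : ℂ | ‖z‖ ≠ 1} ≤ (atTop : Filter ℕ) ×ˢ nhds p :=
    prod_mono_right _ nhdsWithin_le_nhds
  filter_upwards [h.filter_mono h1, tendsto_snd.eventually (self_mem_nhdsWithin)] with x hx hx1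
  exact hx hx1

lemma WO.of_isBigO {p : ℂ} {φ : ℕ → ℝ} {F : ℕ → ℂ → ℂ}
    (hF : (fun x : ℕ × ℂ => F x.1 x.2) =O[atTop ×ˢ nhds p] fun x => φ x.1) : WO p φ F := by
  refine ⟨0, ?_⟩
  simp only [pow_zero, mul_one]
  exact hF.mono (prod_mono_right _ nhdsWithin_le_nhds)

lemma WO.of_continuousAt {p : ℂ} {g : ℂ → ℂ} (hg : ContinuousAt g p) :
    WO p (fun _ => 1) fun _ => g := by
  refine WO.of_isBigO ?_
  have h1 : g =O[nhds p] fun _ => (1:ℝ) := hg.isBigO_one ℝ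
  exact h1.comp_tendsto tendsto_snd

lemma isBigO_of_WO_of_norm_ne {p : ℂ} (hp : ‖p‖ ≠ 1) {φ : ℕ → ℝ} {F : ℕ → ℂ → ℂ} (h : WO p φ F) :
    (fun x : ℕ × ℂ => F x.1 x.2) =O[atTop ×ˢ nhds p] fun x => φ x.1 := by
  obtain ⟨m, hm⟩ := h
  rw [isOpen_offCircle.nhdsWithin_eq hp] at hm
  have hc : ContinuousAt (fun z => wt z ^ m) p := by
    unfold wt
    refine ContinuousAt.pow (continuousAt_const.add (ContinuousAt.inv₀ ?_ ?_)) m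
    · fun_prop
    · exact (abs_pos.2 (sub_ne_zero.2 hp)).ne'
  have h1 : (fun z => wt z ^ m) =O[nhds p] fun _ => (1:ℝ) := hc.isBigO_one ℝ
  have h2 : (fun x : ℕ × ℂ => wt x.2 ^ m) =O[atTop ×ˢ nhds p] fun _ => (1:ℝ) :=
    h1.comp_tendsto tendsto_snd
  refine hm.trans ?_
  simpa using (Asymptotics.isBigO_refl (fun x : ℕ × ℂ => φ x.1) _).mul h2

/-- Removal of polynomial blow-up at the circle by the maximum principle. -/
lemma isBigO_of_WO {p : ℂ} (hp : ‖p‖ = 1) {φ : ℕ → ℝ} {F : ℕ → ℂ → ℂ} (h : WO p φ F)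
    {V : Set ℂ} (hV : V ∈ nhds p) (hF : ∀ᶠ n in atTop, DifferentiableOn ℂ (F n) V) :
    (fun x : ℕ × ℂ => F x.1 x.2) =O[atTop ×ˢ nhds p] fun x => φ x.1 := by
  obtain ⟨m0, hm0⟩ := h
  have hm := hm0.trans (wt_pow_isBigO φ _ (Nat.le_succ m0))
  set m := m0.succ with hmdef
  obtain ⟨K, hK, hb⟩ := hm.exists_pos
  rw [Asymptotics.IsBigOWith, eventually_prod_iff] at hb
  obtain ⟨pa, ha, pb, hpb, hab⟩ := hb
  rw [eventually_nhdsWithin_iff] at hpb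
  obtain ⟨r0, hr0, hr0'⟩ := Metric.eventually_nhds_iff_ball.1 (hpb.and hV)
  set r := min (r0 / 2) (1 / 2) with hr
  have hrpos : 0 < r := by rw [hr]; positivity
  have hr1 : r ≤ 1 / 2 := min_le_right _ _
  have hrr0 : r < r0 := (min_le_left _ _).trans_lt (by linarith)
  have hp0 : p ≠ 0 := by rintro rfl; simp at hp
  set Q : ℂ → ℂ := fun z => ((z - p) / p) ^ 2 + (r : ℂ) ^ 2 * ((z - p) / p) + (r : ℂ) ^ 2 with hQ
  have hQs : ∀ z ∈ Metric.sphere p r, ‖Q z‖ ≤ 3 * |‖z‖ - 1| := by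
    intro z hz
    set ω := (z - p) / p with hω
    have hωr : ‖ω‖ = r := by rw [hω, norm_div, hp, div_one, ← dist_eq_norm]; exact hz
    have hzω : z = p * (1 + ω) := by rw [hω]; field_simp; ring
    have hcc : ω * (starRingEnd ℂ) ω = (r : ℂ) ^ 2 := by
      rw [Complex.mul_conj, Complex.normSq_eq_norm_sq, hωr]; push_cast; rfl
    have hnz : ‖z‖ ^ 2 = 1 + 2 * ω.re + r ^ 2 := by
      rw [hzω, norm_mul, hp, one_mul, ← Complex.normSq_eq_norm_sq, Complex.normSq_add,
        Complex.normSq_eq_norm_sq ω, hωr]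
      simp; ring
    have hQe : Q z = ω * ((2 * ω.re + r ^ 2 : ℝ) : ℂ) := by
      have hre : (2 * (ω.re : ℂ)) = ω + (starRingEnd ℂ) ω := by
        rw [Complex.add_conj]; push_cast; ring
      simp only [hQ, ← hω]
      push_cast
      rw [hre, ← hcc]; ring
    have h2 : (2 * ω.re + r ^ 2 : ℝ) = (‖z‖ + 1) * (‖z‖ - 1) := by linear_combination -hnz
    rw [hQe, norm_mul, hωr, h2, Complex.norm_real, Real.norm_eq_abs, abs_mul]
    have h3 : ‖z‖ ≤ 2 := by
      rw [hzω, norm_mul, hp, one_mul]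
      refine (norm_add_le _ _).trans ?_
      rw [hωr, norm_one]; linarith
    rw [abs_of_nonneg (by positivity : 0 ≤ ‖z‖ + 1), ← mul_assoc]
    refine mul_le_mul_of_nonneg_right ?_ (abs_nonneg _)
    nlinarith [norm_nonneg z]
  have hQb : ∀ z ∈ Metric.ball p (r / 2), r ^ 2 / 4 ≤ ‖Q z‖ := by
    intro z hz
    set ω := (z - p) / p with hω
    have hωr : ‖ω‖ ≤ r / 2 := by
      rw [hω, norm_div, hp, div_one, ← dist_eq_norm]; exact (Metric.mem_ball.1 hz).le
    have h1 : ‖ω ^ 2 + (r : ℂ) ^ 2 * ω‖ ≤ (r / 2) ^ 2 + r ^ 2 * (r / 2) := by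
      refine (norm_add_le _ _).trans ?_
      rw [norm_mul, norm_pow, norm_pow, Complex.norm_real, Real.norm_of_nonneg hrpos.le]
      gcongr
    have h2 : ‖(r : ℂ) ^ 2‖ = r ^ 2 := by
      rw [norm_pow, Complex.norm_real, Real.norm_of_nonneg hrpos.le]
    have h3 := norm_sub_le (Q z) (ω ^ 2 + (r : ℂ) ^ 2 * ω)
    have h4 : Q z - (ω ^ 2 + (r : ℂ) ^ 2 * ω) = (r : ℂ) ^ 2 := by simp only [hQ, ← hω]; ring
    rw [h4, h2] at h3
    nlinarith [sq_nonneg r]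
  refine Asymptotics.IsBigO.of_bound (((3 * 2) ^ m * K) * ((r ^ 2 / 4) ^ m)⁻¹) ?_
  rw [eventually_prod_iff]
  refine ⟨_, ha.and hF, _, Metric.ball_mem_nhds p (by positivity : 0 < r / 2), ?_⟩
  rintro n ⟨hna, hnF⟩ z hz
  have hsub : Metric.closedBall p r ⊆ Metric.ball p r0 := Metric.closedBall_subset_ball hrr0
  have hmax : ‖Q z ^ m * F n z‖ ≤ (3 * 2) ^ m * K * ‖φ n‖ := by
    refine Complex.norm_le_of_forall_mem_frontier_norm_le (U := Metric.ball p r)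
      (f := fun z => Q z ^ m * F n z) Metric.isBounded_ball ?_ ?_ ?_
    · refine DifferentiableOn.diffContOnCl ?_
      rw [closure_ball p hrpos.ne']
      refine DifferentiableOn.mul (by fun_prop) (hnF.mono fun y hy => ?_)
      exact (hr0' y (hsub hy)).2
    · intro y hy
      rw [frontier_ball p hrpos.ne'] at hy
      rw [norm_mul, norm_pow]
      by_cases hy1 : ‖y‖ = 1
      · have : ‖Q y‖ = 0 := le_antisymm (by simpa [hy1] using hQs y hy) (norm_nonneg _)
        rw [this, hmdef, zero_pow (Nat.succ_ne_zero _), zero_mul]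
        positivity
      · have hd : 0 < |‖y‖ - 1| := abs_pos.2 (sub_ne_zero.2 hy1)
        have h1 := hab hna ((hr0' y (hsub (Metric.sphere_subset_closedBall hy))).1 hy1)
        simp only at h1
        rw [norm_mul, Real.norm_of_nonneg (pow_nonneg (zero_le_one.trans (one_le_wt y)) _)] at h1
        have hd1 : |‖y‖ - 1| ≤ 1 := by
          have := abs_norm_sub_norm_le y p
          rw [hp] at this
          have h5 : ‖y - p‖ = r := by rw [← dist_eq_norm]; exact hy
          linarith
        have h6 : ‖Q y‖ * wt y ≤ 3 * 2 := by
          calc ‖Q y‖ * wt y ≤ 3 * |‖y‖ - 1| * wt y :=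
                mul_le_mul_of_nonneg_right (hQs y hy) (zero_le_one.trans (one_le_wt y))
            _ = 3 * (|‖y‖ - 1| + 1) := by unfold wt; field_simp
            _ ≤ 3 * 2 := by linarith
        calc ‖Q y‖ ^ m * ‖F n y‖ ≤ ‖Q y‖ ^ m * (K * (‖φ n‖ * wt y ^ m)) := by gcongr
          _ = (‖Q y‖ * wt y) ^ m * K * ‖φ n‖ := by rw [mul_pow]; ring
          _ ≤ (3 * 2) ^ m * K * ‖φ n‖ := by
            have := zero_le_one.trans (one_le_wt y)
            gcongr
    · rw [closure_ball p hrpos.ne']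
      exact Metric.closedBall_subset_closedBall (by linarith) (Metric.ball_subset_closedBall hz)
  rw [norm_mul, norm_pow] at hmax
  have h7 : (r ^ 2 / 4) ^ m * ‖F n z‖ ≤ (3 * 2) ^ m * K * ‖φ n‖ :=
    (mul_le_mul_of_nonneg_right (pow_le_pow_left₀ (by positivity) (hQb z hz) m)
      (norm_nonneg _)).trans hmax
  have h8 : 0 < (r ^ 2 / 4) ^ m := by positivity
  calc ‖F n z‖ = ((r ^ 2 / 4) ^ m)⁻¹ * ((r ^ 2 / 4) ^ m * ‖F n z‖) := by field_simp
    _ ≤ ((r ^ 2 / 4) ^ m)⁻¹ * ((3 * 2) ^ m * K * ‖φ n‖) := by gcongr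
    _ = _ := by ring

lemma inv_sq_isBigO_inv : (fun n : ℕ => (n : ℝ)⁻¹ * (n : ℝ)⁻¹) =O[atTop] fun n : ℕ => (n : ℝ)⁻¹ := by
  refine Asymptotics.IsBigO.of_bound 1 ?_
  filter_upwards [eventually_ge_atTop 1] with n hn
  have h1 : (1:ℝ) ≤ n := by exact_mod_cast hn
  rw [norm_mul, one_mul]
  refine mul_le_of_le_one_left (norm_nonneg _) ?_
  rw [norm_inv, Real.norm_of_nonneg (by positivity)]
  exact inv_le_one_of_one_le₀ h1

lemma inv_isBigO_one : (fun n : ℕ => (n : ℝ)⁻¹) =O[atTop] fun _ : ℕ => (1 : ℝ) :=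
  tendsto_inv_atTop_nhds_zero_nat.isBigO_one ℝ

/-- Entries of a quotient of two matrices close to the identity. -/
lemma WO_quotient {p : ℂ} {a11 a12 a21 a22 b11 b12 b21 b22 g k : ℕ → ℂ → ℂ}
    (ha11 : WO p (fun n => (n : ℝ)⁻¹) fun n z => a11 n z - 1)
    (ha22 : WO p (fun n => (n : ℝ)⁻¹) fun n z => a22 n z - 1)
    (ha21 : WO p (fun n => (n : ℝ)⁻¹) a21)
    (ha12 : WO p (fun n => (n : ℝ)⁻¹ * (n : ℝ)⁻¹) fun n z => a12 n z - g n z)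
    (hg : WO p (fun n => (n : ℝ)⁻¹) g)
    (hb11 : WO p (fun n => (n : ℝ)⁻¹) fun n z => b11 n z - 1)
    (hb22 : WO p (fun n => (n : ℝ)⁻¹) fun n z => b22 n z - 1)
    (hb21 : WO p (fun n => (n : ℝ)⁻¹) b21)
    (hb12 : WO p (fun n => (n : ℝ)⁻¹ * (n : ℝ)⁻¹) fun n z => b12 n z - k n z)
    (hk : WO p (fun n => (n : ℝ)⁻¹) k) :
    WO p (fun n => (n : ℝ)⁻¹) (fun n z => a11 n z * b22 n z - a12 n z * b21 n z - 1) ∧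
    WO p (fun n => (n : ℝ)⁻¹) (fun n z => -(a21 n z * b12 n z) + a22 n z * b11 n z - 1) ∧
    WO p (fun n => (n : ℝ)⁻¹) (fun n z => a21 n z * b22 n z - a22 n z * b21 n z) ∧
    WO p (fun n => (n : ℝ)⁻¹ * (n : ℝ)⁻¹)
      (fun n z => -(a11 n z * b12 n z) + a12 n z * b11 n z - (g n z - k n z)) := by
  have one : WO p (fun _ => 1) fun _ _ => (1 : ℂ) := WO.of_continuousAt continuousAt_const
  have a12' : WO p (fun n => (n : ℝ)⁻¹) a12 := by
    simpa using (ha12.mono inv_sq_isBigO_inv).add hg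
  have b12' : WO p (fun n => (n : ℝ)⁻¹) b12 := by
    simpa using (hb12.mono inv_sq_isBigO_inv).add hk
  have a22' : WO p (fun _ => 1) a22 := by
    simpa using (ha22.mono inv_isBigO_one).add one
  have b22' : WO p (fun _ => 1) b22 := by
    simpa using (hb22.mono inv_isBigO_one).add one
  have b11' : WO p (fun _ => 1) b11 := by
    simpa using (hb11.mono inv_isBigO_one).add one
  refine ⟨?_, ?_, ?_, ?_⟩
  · have h1 : WO p (fun n => (n : ℝ)⁻¹) fun n z => (a11 n z - 1) * b22 n z := by
      simpa using ha11.mul b22'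
    have := (h1.add hb22).sub ((a12'.mul hb21).mono inv_sq_isBigO_inv)
    convert this using 3; ring
  · have h1 : WO p (fun n => (n : ℝ)⁻¹) fun n z => (a22 n z - 1) * b11 n z := by
      simpa using ha22.mul b11'
    have := (h1.add hb11).sub ((ha21.mul b12').mono inv_sq_isBigO_inv)
    convert this using 3; ring
  · have h1 : WO p (fun n => (n : ℝ)⁻¹) fun n z => a21 n z * b22 n z := by
      simpa using ha21.mul b22'
    have h2 : WO p (fun n => (n : ℝ)⁻¹) fun n z => a22 n z * b21 n z := by
      simpa using a22'.mul hb21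
    exact h1.sub h2
  · have := (((ha11.mul b12').neg).sub hb12).add ((a12'.mul hb11).add ha12)
    convert this using 3; ring

/-- Riemann-Hilbert comparison: a row problem `y` compared with local models `M i`. -/
theorem rh_comparison {κ : Type} [Fintype κ] [DecidableEq κ] (U : κ → Set ℂ) (o : κ)
    {ρ : ℝ} (hρ : 0 < ρ) (hU : ∀ i, IsOpen (U i)) (hcov : ∀ z, ∃ i, z ∈ U i)
    (hbd : ∀ i ≠ o, U i ⊆ Metric.ball 0 ρ) (h0 : ∀ i ≠ o, (0 : ℂ) ∉ U i)
    (T : ℕ → ℂ → ℂ) (y1 y2 : ℕ → ℂ → ℂ) (hy : ∀ᶠ n in atTop, ∀ p, RowAt (T n) (y1 n) (y2 n) p)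
    (M11 M12 M21 M22 : ℕ → κ → ℂ → ℂ)
    (hM1 : ∀ᶠ n in atTop, ∀ i, ∀ p ∈ U i, RowAt (T n) (M11 n i) (M12 n i) p)
    (hM2 : ∀ᶠ n in atTop, ∀ i, ∀ p ∈ U i, RowAt (T n) (M21 n i) (M22 n i) p)
    (hdet : ∀ᶠ n in atTop, ∀ i, ∀ z ∈ U i, ‖z‖ ≠ 1 →
      M11 n i z * M22 n i z - M12 n i z * M21 n i z = 1)
    (N11 N12 N21 N22 : ℕ → ℂ → ℂ)
    (hN : ∀ n z, ‖z‖ ≠ 1 → N11 n z * N22 n z - N12 n z * N21 n z = 1)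
    (hR1o : ∀ᶠ n in atTop, Tendsto (fun z => y1 n z * M22 n o z - y2 n z * M21 n o z)
      (cocompact ℂ) (nhds 1))
    (hR2o : ∀ᶠ n in atTop, Tendsto (fun z => -(y1 n z * M12 n o z) + y2 n z * M11 n o z)
      (cocompact ℂ) (nhds 0))
    (s g : ℕ → κ → ℂ → ℂ) (hs : ∀ n i, DifferentiableOn ℂ (s n i) (U i))
    (hso : ∀ n, Tendsto (s n o) (cocompact ℂ) (nhds 0))
    (hsg : ∀ n i j, i ≠ j → ∀ z ∈ U i ∩ U j, s n i z - s n j z = g n j z - g n i z)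
    (hgd : ∀ n i j, i ≠ j → DifferentiableOn ℂ (g n i) (U i ∩ U j))
    (hg : ∀ i j, i ≠ j → ∀ p ∈ U i ∩ U j,
      (fun x : ℕ × ℂ => g x.1 i x.2) =O[atTop ×ˢ nhds p] fun x => (x.1 : ℝ)⁻¹)
    (h11 : ∀ i j, i ≠ j → ∀ p ∈ U i ∩ U j, WO p (fun n => (n : ℝ)⁻¹)
      fun n z => M11 n i z * N11 n z + M12 n i z * N21 n z - 1)
    (h22 : ∀ i j, i ≠ j → ∀ p ∈ U i ∩ U j, WO p (fun n => (n : ℝ)⁻¹)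
      fun n z => M21 n i z * N12 n z + M22 n i z * N22 n z - 1)
    (h21 : ∀ i j, i ≠ j → ∀ p ∈ U i ∩ U j, WO p (fun n => (n : ℝ)⁻¹)
      fun n z => M21 n i z * N11 n z + M22 n i z * N21 n z)
    (h12 : ∀ i j, i ≠ j → ∀ p ∈ U i ∩ U j, WO p (fun n => (n : ℝ)⁻¹ * (n : ℝ)⁻¹)
      fun n z => M11 n i z * N12 n z + M12 n i z * N22 n z - g n i z) :
    ∃ C, ∀ᶠ n : ℕ in atTop,
      ‖(-(y1 n 0 * M12 n o 0) + y2 n 0 * M11 n o 0) - s n o 0‖ ≤ C / (n : ℝ) ^ 2 := by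
  set R1 : ℕ → κ → ℂ → ℂ := fun n i => extOff fun z => y1 n z * M22 n i z - y2 n z * M21 n i z
    with hR1
  set R2 : ℕ → κ → ℂ → ℂ := fun n i => extOff fun z => -(y1 n z * M12 n i z - y2 n z * M11 n i z)
    with hR2
  set X11 : ℕ → κ → κ → ℂ → ℂ := fun n j i => extOff fun z =>
    M11 n j z * M22 n i z - M12 n j z * M21 n i z with hX11
  set X12 : ℕ → κ → κ → ℂ → ℂ := fun n j i => extOff fun z =>
    -(M11 n j z * M12 n i z - M12 n j z * M11 n i z) with hX12
  set X21 : ℕ → κ → κ → ℂ → ℂ := fun n j i => extOff fun z =>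
    M21 n j z * M22 n i z - M22 n j z * M21 n i z with hX21
  set X22 : ℕ → κ → κ → ℂ → ℂ := fun n j i => extOff fun z =>
    -(M21 n j z * M12 n i z - M22 n j z * M11 n i z) with hX22
  have hneg : ∀ (W : ℂ → ℂ) (p : ℂ), AnalyticAt ℂ (extOff W) p →
      AnalyticAt ℂ (extOff fun z => -W z) p := by
    intro W p hW
    refine analyticAt_extOff (e := fun z => -extOff W z) hW.neg ?_
    exact Eventually.of_forall fun z hz => by rw [extOff_of_ne _ hz]
  have aR1 : ∀ᶠ n in atTop, ∀ i, ∀ p ∈ U i, AnalyticAt ℂ (R1 n i) p := by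
    filter_upwards [hy, hM2] with n h1 h2 i p hp using (h1 p).analyticAt_wronskian (h2 i p hp)
  have aR2 : ∀ᶠ n in atTop, ∀ i, ∀ p ∈ U i, AnalyticAt ℂ (R2 n i) p := by
    filter_upwards [hy, hM1] with n h1 h2 i p hp
    exact hneg _ p ((h1 p).analyticAt_wronskian (h2 i p hp))
  have aX11 : ∀ᶠ n in atTop, ∀ i j, ∀ p ∈ U i ∩ U j, AnalyticAt ℂ (X11 n j i) p := by
    filter_upwards [hM1, hM2] with n h1 h2 i j p hp using
      (h1 j p hp.2).analyticAt_wronskian (h2 i p hp.1)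
  have aX12 : ∀ᶠ n in atTop, ∀ i j, ∀ p ∈ U i ∩ U j, AnalyticAt ℂ (X12 n j i) p := by
    filter_upwards [hM1] with n h1 i j p hp using
      hneg _ p ((h1 j p hp.2).analyticAt_wronskian (h1 i p hp.1))
  have aX21 : ∀ᶠ n in atTop, ∀ i j, ∀ p ∈ U i ∩ U j, AnalyticAt ℂ (X21 n j i) p := by
    filter_upwards [hM2] with n h2 i j p hp using
      (h2 j p hp.2).analyticAt_wronskian (h2 i p hp.1)
  have aX22 : ∀ᶠ n in atTop, ∀ i j, ∀ p ∈ U i ∩ U j, AnalyticAt ℂ (X22 n j i) p := by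
    filter_upwards [hM1, hM2] with n h1 h2 i j p hp using
      hneg _ p ((h2 j p hp.2).analyticAt_wronskian (h1 i p hp.1))
  have cc : ∀ {A : ℂ → ℂ} {p : ℂ}, AnalyticAt ℂ A p → ContinuousAt A p := fun h => h.continuousAt
  have hoo : ∀ᶠ z in cocompact ℂ, ‖z‖ ≠ 1 := by
    filter_upwards [tendsto_norm_cocompact_atTop.eventually_gt_atTop 1] with z hz using ne_of_gt hz
  -- unweighted estimates
  have unweight : ∀ {i j : κ} {p : ℂ}, i ≠ j → p ∈ U i ∩ U j → ∀ {φ : ℕ → ℝ} {F W : ℕ → ℂ → ℂ},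
      (∀ᶠ n in atTop, ∀ q ∈ U i ∩ U j, AnalyticAt ℂ (F n) q) → WO p φ W →
      (∀ᶠ n in atTop, ∀ z ∈ U i ∩ U j, ‖z‖ ≠ 1 → W n z = F n z) →
      (fun x : ℕ × ℂ => F x.1 x.2) =O[atTop ×ˢ nhds p] fun x => φ x.1 := by
    intro i j p hij hp φ F W hF hW hWF
    have hV : U i ∩ U j ∈ nhds p := ((hU i).inter (hU j)).mem_nhds hp
    have hWO : WO p φ F := hW.congr (by
      filter_upwards [hWF.prod_mk hV] with x hx h1 using hx.1 _ hx.2 h1)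
    by_cases hp1 : ‖p‖ = 1
    · refine isBigO_of_WO hp1 hWO hV ?_
      filter_upwards [hF] with n hn q hq using (hn q hq).differentiableAt.differentiableWithinAt
    · exact isBigO_of_WO_of_norm_ne hp1 hWO
  have quot := fun (i j : κ) (hij : i ≠ j) (p : ℂ) (hp : p ∈ U i ∩ U j) =>
    WO_quotient (h11 j i hij.symm p hp.symm) (h22 j i hij.symm p hp.symm)
      (h21 j i hij.symm p hp.symm) (h12 j i hij.symm p hp.symm)
      (WO.of_isBigO (hg j i hij.symm p hp.symm))
      (h11 i j hij p hp) (h22 i j hij p hp) (h21 i j hij p hp) (h12 i j hij p hp)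
      (WO.of_isBigO (hg i j hij p hp))
  have main := cousin_second_order U o hρ hU hcov hbd h0 R1 R2 s g X11 X12 X21 X22
    ?_ ?_ hs ?_ ?_ hso ?_ ?_ hsg ?_ ?_ ?_ ?_ hg
  · obtain ⟨C, hC⟩ := main
    refine ⟨C, hC.mono fun n hn => ?_⟩
    have : R2 n o 0 = -(y1 n 0 * M12 n o 0) + y2 n 0 * M11 n o 0 := by
      simp only [hR2]; rw [extOff_of_ne _ (by simp)]; ring
    rwa [this] at hn
  · filter_upwards [aR1] with n hn i p hp using (hn i p hp).differentiableAt.differentiableWithinAt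
  · filter_upwards [aR2] with n hn i p hp using (hn i p hp).differentiableAt.differentiableWithinAt
  · filter_upwards [hR1o] with n hn
    refine hn.congr' ?_
    filter_upwards [hoo] with z hz
    simp only [hR1]; rw [extOff_of_ne _ hz]
  · filter_upwards [hR2o] with n hn
    refine hn.congr' ?_
    filter_upwards [hoo] with z hz
    simp only [hR2]; rw [extOff_of_ne _ hz]; ring
  · filter_upwards [aR1, aR2, aX11, aX21, hdet] with n h1 h2 h3 h4 h5 i j _ p hp
    refine eq_of_eventually_offCircle (A := R1 n i)
      (B := fun z => R1 n j z * X11 n j i z + R2 n j z * X21 n j i z) (h1 i p hp.1).continuousAt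
      (((h1 j p hp.2).mul (h3 i j p hp)).add ((h2 j p hp.2).mul (h4 i j p hp))).continuousAt ?_
    filter_upwards [(hU j).mem_nhds hp.2] with z hz hz1
    have := h5 j z hz hz1
    simp only [hR1, hR2, hX11, hX21]
    simp only [extOff_of_ne _ hz1]
    linear_combination (-(y1 n z * M22 n i z - y2 n z * M21 n i z)) * this
  · filter_upwards [aR1, aR2, aX12, aX22, hdet] with n h1 h2 h3 h4 h5 i j _ p hp
    refine eq_of_eventually_offCircle (A := R2 n i)
      (B := fun z => R1 n j z * X12 n j i z + R2 n j z * X22 n j i z) (h2 i p hp.1).continuousAt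
      (((h1 j p hp.2).mul (h3 i j p hp)).add ((h2 j p hp.2).mul (h4 i j p hp))).continuousAt ?_
    filter_upwards [(hU j).mem_nhds hp.2] with z hz hz1
    have := h5 j z hz hz1
    simp only [hR1, hR2, hX12, hX22]
    simp only [extOff_of_ne _ hz1]
    linear_combination (y1 n z * M12 n i z - y2 n z * M11 n i z) * this
  · intro i j hij p hp
    refine unweight (F := fun n z => X11 n j i z - 1) hij hp ?_ (quot i j hij p hp).1 ?_
    · filter_upwards [aX11] with n hn q hq using (hn i j q hq).sub analyticAt_const
    · refine Eventually.of_forall fun n z _ hz => ?_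
      simp only [hX11]; rw [extOff_of_ne _ hz]
      linear_combination (M11 n j z * M22 n i z - M12 n j z * M21 n i z) * hN n z hz
  · intro i j hij p hp
    refine unweight (F := fun n z => X22 n j i z - 1) hij hp ?_ (quot i j hij p hp).2.1 ?_
    · filter_upwards [aX22] with n hn q hq using (hn i j q hq).sub analyticAt_const
    · refine Eventually.of_forall fun n z _ hz => ?_
      simp only [hX22]; rw [extOff_of_ne _ hz]
      linear_combination (-(M21 n j z * M12 n i z - M22 n j z * M11 n i z)) * hN n z hz
  · intro i j hij p hp
    refine unweight (F := fun n z => X21 n j i z) hij hp ?_ (quot i j hij p hp).2.2.1 ?_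
    · filter_upwards [aX21] with n hn q hq using hn i j q hq
    · refine Eventually.of_forall fun n z _ hz => ?_
      simp only [hX21]; rw [extOff_of_ne _ hz]
      linear_combination (M21 n j z * M22 n i z - M22 n j z * M21 n i z) * hN n z hz
  · intro i j hij p hp
    have := unweight (F := fun n z => X12 n j i z - (g n j z - g n i z)) hij hp ?_
      (quot i j hij p hp).2.2.2 ?_
    · refine this.congr_right fun x => ?_
      rw [pow_two, mul_inv]
    · filter_upwards [aX12] with n hn q hq
      refine (hn i j q hq).sub (AnalyticAt.sub ?_ ?_)
      · exact (hgd n j i hij.symm).analyticAt (((hU j).inter (hU i)).mem_nhds hq.symm)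
      · exact (hgd n i j hij).analyticAt (((hU i).inter (hU j)).mem_nhds hq)
    · refine Eventually.of_forall fun n z _ hz => ?_
      simp only [hX12]; rw [extOff_of_ne _ hz]
      linear_combination (-(M11 n j z * M12 n i z - M12 n j z * M11 n i z)) * hN n z hz

/-- The rising factorial `x (x + 1) ⋯ (x + k - 1)`. -/
noncomputable def poch (x : ℂ) (k : ℕ) : ℂ := ∏ i ∈ Finset.range k, (x + i)

@[simp] lemma poch_zero (x : ℂ) : poch x 0 = 1 := by simp [poch]

lemma poch_succ (x : ℂ) (k : ℕ) : poch x (k + 1) = poch x k * (x + k) := by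
  simp [poch, Finset.prod_range_succ]

lemma poch_succ_left (x : ℂ) (k : ℕ) : poch x (k + 1) = x * poch (x + 1) k := by
  rw [poch, Finset.prod_range_succ', mul_comm, poch]
  push_cast
  rw [add_zero]
  congr 1
  exact Finset.prod_congr rfl fun i _ => by ring

lemma poch_ne_zero {x : ℂ} (hx : 0 < x.re) (k : ℕ) : poch x k ≠ 0 := by
  refine Finset.prod_ne_zero_iff.2 fun i _ h => ?_
  have := congrArg Complex.re h
  simp at this
  have : (0:ℝ) ≤ i := Nat.cast_nonneg i
  linarith

lemma poch_one (k : ℕ) : poch 1 k = k.factorial := by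
  induction k with
  | zero => simp
  | succ k ih => rw [poch_succ, ih, Nat.factorial_succ]; push_cast; ring

lemma poch_eq_eval (x : ℂ) (k : ℕ) : poch x k = (ascPochhammer ℂ k).eval x := by
  induction k with
  | zero => simp
  | succ k ih => rw [poch_succ, ih, ascPochhammer_succ_eval]

lemma ring_choose_eq_poch (x : ℂ) (k : ℕ) :
    Ring.choose (x + k - 1) k = poch x k / k.factorial := by
  rw [Ring.choose_eq_smul, Polynomial.descPochhammer_smeval_eq_ascPochhammer,
    Polynomial.ascPochhammer_smeval_cast, Polynomial.ascPochhammer_smeval_eq_eval,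
    poch_eq_eval, smul_eq_mul, div_eq_inv_mul]
  congr 2
  ring

lemma hasSum_poch (x : ℂ) {z : ℂ} (hz : ‖z‖ < 1) :
    HasSum (fun k : ℕ => z ^ k * (poch x k / k.factorial)) ((1 - z) ^ (-x)) := by
  have h := (Complex.one_div_one_sub_cpow_hasFPowerSeriesOnBall_zero x).hasSum
    (y := z) (by simpa [← ofReal_norm] using hz)
  simp only [FormalMultilinearSeries.ofScalars_apply_eq, ring_choose_eq_poch, smul_eq_mul,
    zero_add] at h
  rw [Complex.cpow_neg, ← one_div]
  simpa only [mul_comm] using h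

lemma prod_one_add_div_le (M k : ℕ) :
    ∏ i ∈ Finset.range k, (1 + (M : ℝ) / (i + 1)) ≤ ((k : ℝ) + 1) ^ M := by
  induction k with
  | zero => simp
  | succ k ih =>
    rw [Finset.prod_range_succ]
    have h1 : (1 + (M : ℝ) / (k + 1)) ≤ (1 + 1 / ((k:ℝ) + 1)) ^ M := by
      have := one_add_mul_le_pow (a := 1 / ((k:ℝ) + 1)) (by
        have : (0:ℝ) ≤ 1 / ((k:ℝ) + 1) := by positivity
        linarith) M
      calc _ = 1 + (M:ℝ) * (1 / ((k:ℝ) + 1)) := by ring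
        _ ≤ _ := this
    calc _ ≤ ((k : ℝ) + 1) ^ M * (1 + 1 / ((k:ℝ) + 1)) ^ M := by gcongr
      _ = _ := by
        rw [← mul_pow]; push_cast; congr 1; field_simp

lemma norm_poch_div_factorial_le (x : ℂ) :
    ∃ M : ℕ, ∀ k : ℕ, ‖poch x k / k.factorial‖ ≤ ((k : ℝ) + 1) ^ M := by
  obtain ⟨M, hM⟩ := exists_nat_ge ‖x - 1‖
  refine ⟨M, fun k => le_trans ?_ (prod_one_add_div_le M k)⟩
  rw [← poch_one, poch, poch, ← Finset.prod_div_distrib, norm_prod]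
  refine Finset.prod_le_prod (fun _ _ => norm_nonneg _) fun i _ => ?_
  have h0 : (1 + (i:ℂ)) ≠ 0 := by
    intro h
    have := congrArg Complex.re h
    simp at this
    have : (0:ℝ) ≤ i := Nat.cast_nonneg i
    linarith
  have e : (x + i) / (1 + i) = 1 + (x - 1) / (1 + i) := by field_simp; ring
  have e2 : ‖(1 + (i:ℂ))‖ = i + 1 := by
    have := Complex.norm_natCast (i + 1); push_cast at this; rw [add_comm, this]
  rw [e]
  refine (norm_add_le _ _).trans ?_
  rw [norm_one, norm_div, e2]
  gcongr

lemma half_le_norm_add {y : ℂ} (hy : -(1 / 2) < y.re) {t : ℝ} (ht : 1 ≤ t) :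
    t / 2 ≤ ‖(t : ℂ) + y‖ := by
  have := Complex.re_le_norm ((t:ℂ) + y)
  simp at this
  linarith

lemma norm_div_add_le {y : ℂ} (hy : -(1 / 2) < y.re) (d : ℂ) {t : ℝ} (ht : 1 ≤ t) :
    ‖d / ((t : ℂ) + y)‖ ≤ 2 * ‖d‖ / t := by
  have h := half_le_norm_add hy ht
  rw [norm_div, div_le_div_iff₀ (by linarith) (by linarith)]
  nlinarith [norm_nonneg d]

lemma norm_prod_sub_one_le {f : ℕ → ℂ} {k : ℕ} {B n : ℝ} (hB : 0 ≤ B) (hn : 0 < n)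
    (hk : (k : ℝ) ≤ n) (hf : ∀ i < k, ‖f i‖ ≤ B / n) :
    ‖∏ i ∈ Finset.range k, (1 + f i) - 1‖ ≤ B * Real.exp B * (k / n) := by
  have h1 := Finset.norm_prod_one_add_sub_one_le (Finset.range k) f
  have h2 : ∑ i ∈ Finset.range k, ‖f i‖ ≤ B * (k / n) := by
    calc _ ≤ ∑ i ∈ Finset.range k, B / n :=
          Finset.sum_le_sum fun i hi => hf i (Finset.mem_range.1 hi)
      _ = _ := by simp; ring
  have h3 : B * (k / n) ≤ B := by
    have : (k:ℝ) / n ≤ 1 := (div_le_one hn).2 hk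
    nlinarith
  set t := B * (k / n) with ht
  have ht0 : 0 ≤ t := by positivity
  have h4 : Real.exp t - 1 ≤ t * Real.exp t := by
    have h5 := Real.add_one_le_exp (-t)
    have h6 : Real.exp (-t) * Real.exp t = 1 := by rw [← Real.exp_add]; simp
    nlinarith [Real.exp_pos t]
  have h5 : Real.exp t ≤ Real.exp B := Real.exp_le_exp.2 h3
  calc _ ≤ Real.exp t - 1 := by
        refine h1.trans ?_
        have := Real.exp_le_exp.2 h2
        linarith
    _ ≤ t * Real.exp t := h4
    _ ≤ t * Real.exp B := by gcongr
    _ = _ := by rw [ht]; ring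

lemma ascending_ratio_bound (d : ℂ) {y : ℂ} (hy : -(1 / 2) < y.re) :
    ∃ C : ℝ, 0 ≤ C ∧ ∃ M : ℕ, ∀ n k : ℕ,
      ‖∏ i ∈ Finset.range k, (1 + d / (((n + 1 + i : ℕ) : ℂ) + y)) - 1‖
        ≤ C * ((k : ℝ) + 1) ^ M / (n + 1) := by
  obtain ⟨M, hM⟩ := exists_nat_ge (2 * ‖d‖)
  refine ⟨M * Real.exp M + 2, by positivity, M + 1, fun n k => ?_⟩
  have hf : ∀ i : ℕ, ‖d / (((n + 1 + i : ℕ) : ℂ) + y)‖ ≤ M / (n + 1 + i) := fun i => by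
    have := norm_div_add_le hy d (t := ((n + 1 + i : ℕ) : ℝ)) (by
      have : 1 ≤ n + 1 + i := by omega
      exact_mod_cast this)
    push_cast at this ⊢
    refine this.trans ?_
    gcongr
  have hk1 : (1:ℝ) ≤ (k + 1 : ℝ) ^ M := one_le_pow₀ (by have : (0:ℝ) ≤ k := k.cast_nonneg; linarith)
  have hk0 : (0:ℝ) ≤ k := k.cast_nonneg
  rcases le_total k (n + 1) with h | h
  · have := norm_prod_sub_one_le (f := fun i => d / (((n + 1 + i : ℕ) : ℂ) + y)) (k := k)
      (B := M) (n := n + 1) (by positivity) (by positivity) (by exact_mod_cast h) (fun i _ => by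
        refine (hf i).trans (div_le_div_of_nonneg_left (by positivity) (by positivity) ?_)
        linarith [(i.cast_nonneg : (0:ℝ) ≤ i)])
    refine this.trans ?_
    rw [← mul_div_assoc]
    gcongr
    · linarith
    · calc (k:ℝ) ≤ 1 * (k + 1) := by linarith
        _ ≤ _ := by rw [pow_succ]; gcongr
  · have h1 : ‖∏ i ∈ Finset.range k, (1 + d / (((n + 1 + i : ℕ) : ℂ) + y))‖ ≤ ((k:ℝ) + 1) ^ M := by
      refine le_trans ?_ (prod_one_add_div_le M k)
      rw [norm_prod]
      refine Finset.prod_le_prod (fun _ _ => norm_nonneg _) fun i _ => ?_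
      refine (norm_add_le _ _).trans ?_
      rw [norm_one]
      gcongr
      refine (hf i).trans (div_le_div_of_nonneg_left (by positivity) (by positivity) ?_)
      linarith [(n.cast_nonneg : (0:ℝ) ≤ n)]
    have h2 : (n:ℝ) + 1 ≤ k + 1 := by
      have : n + 1 ≤ k + 1 := by omega
      exact_mod_cast this
    rw [le_div_iff₀ (by positivity)]
    have h3 := norm_sub_le (∏ i ∈ Finset.range k, (1 + d / (((n + 1 + i : ℕ) : ℂ) + y))) 1
    rw [norm_one] at h3
    calc _ ≤ (2 * ((k:ℝ) + 1) ^ M) * (k + 1) := by gcongr; linarith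
      _ = 2 * ((k:ℝ) + 1) ^ (M + 1) := by ring
      _ ≤ _ := by
        gcongr
        have : 0 ≤ M * Real.exp M := by positivity
        linarith

lemma descending_ratio_bound (d : ℂ) {y : ℂ} (hy : -(1 / 2) < y.re) :
    ∃ C : ℝ, 0 ≤ C ∧ ∃ M : ℕ, ∀ n k : ℕ, k ≤ n →
      ‖∏ i ∈ Finset.range k, (1 + d / (((n - i : ℕ) : ℂ) + y)) - 1‖
        ≤ C * ((k : ℝ) + 1) ^ M / (n + 1) := by
  obtain ⟨M, hM⟩ := exists_nat_ge (2 * ‖d‖)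
  refine ⟨3 * M * Real.exp (3 * M) + 2 * 2 ^ (M + 1), by positivity, M + 1, fun n k hkn => ?_⟩
  have hf : ∀ i < k, ‖d / (((n - i : ℕ) : ℂ) + y)‖ ≤ M / ((n - i : ℕ) : ℝ) := fun i hi => by
    have := norm_div_add_le hy d (t := ((n - i : ℕ) : ℝ)) (by
      have : 1 ≤ n - i := by omega
      exact_mod_cast this)
    rw [Complex.ofReal_natCast] at this
    refine this.trans ?_
    gcongr
  have hk0 : (0:ℝ) ≤ k := k.cast_nonneg
  have hk1 : (1:ℝ) ≤ (k + 1 : ℝ) ^ M := one_le_pow₀ (by linarith)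
  rcases le_total (2 * k) (n + 1) with h | h
  · have h2 : 2 * (k:ℝ) ≤ n + 1 := by exact_mod_cast h
    have := norm_prod_sub_one_le (f := fun i => d / (((n - i : ℕ) : ℂ) + y)) (k := k)
      (B := 3 * M) (n := n + 1) (by positivity) (by positivity) (by linarith) (fun i hi => by
        refine (hf i hi).trans ?_
        have h3 : (1:ℝ) ≤ ((n - i : ℕ) : ℝ) := by
          have : 1 ≤ n - i := by omega
          exact_mod_cast this
        have h4 : (n:ℝ) + 1 ≤ 3 * ((n - i : ℕ) : ℝ) := by
          have : n + 1 ≤ 3 * (n - i) := by omega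
          exact_mod_cast this
        rw [div_le_div_iff₀ (by linarith) (by positivity)]
        nlinarith [(M.cast_nonneg : (0:ℝ) ≤ M)])
    refine this.trans ?_
    rw [← mul_div_assoc]
    gcongr
    · have : (0:ℝ) ≤ 2 * 2 ^ (M + 1) := by positivity
      linarith
    · calc (k:ℝ) ≤ 1 * (k + 1) := by linarith
        _ ≤ _ := by rw [pow_succ]; gcongr
  · have h2 : (n:ℝ) + 1 ≤ 2 * (k + 1) := by
      have : n + 1 ≤ 2 * (k + 1) := by omega
      exact_mod_cast this
    have h1 : ‖∏ i ∈ Finset.range k, (1 + d / (((n - i : ℕ) : ℂ) + y))‖ ≤ ((n:ℝ) + 1) ^ M := by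
      refine le_trans ?_ (prod_one_add_div_le M n)
      rw [norm_prod]
      calc _ ≤ ∏ i ∈ Finset.range k, (1 + (M:ℝ) / ((n - i : ℕ) : ℝ)) := by
            refine Finset.prod_le_prod (fun _ _ => norm_nonneg _) fun i hi => ?_
            refine (norm_add_le _ _).trans ?_
            rw [norm_one]
            gcongr
            exact hf i (Finset.mem_range.1 hi)
        _ ≤ ∏ i ∈ Finset.range n, (1 + (M:ℝ) / ((n - i : ℕ) : ℝ)) := by
            rw [← Finset.prod_sdiff (Finset.range_mono hkn)]
            refine le_mul_of_one_le_left (by positivity) ?_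
            refine Finset.one_le_prod fun i _ => ?_
            have : (0:ℝ) ≤ (M:ℝ) / ((n - i : ℕ) : ℝ) := by positivity
            linarith
        _ = _ := by
            rw [← Finset.prod_range_reflect]
            refine Finset.prod_congr rfl fun i hi => ?_
            have : n - (n - 1 - i) = i + 1 := by have := Finset.mem_range.1 hi; omega
            rw [this]; push_cast; rfl
    rw [le_div_iff₀ (by positivity)]
    have h3 := norm_sub_le (∏ i ∈ Finset.range k, (1 + d / (((n - i : ℕ) : ℂ) + y))) 1
    rw [norm_one] at h3
    have h4 : (1:ℝ) ≤ (n + 1 : ℝ) ^ M := one_le_pow₀ (by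
      have : (0:ℝ) ≤ n := n.cast_nonneg
      linarith)
    calc _ ≤ (2 * ((n:ℝ) + 1) ^ M) * (n + 1) := by gcongr; linarith
      _ = 2 * ((n:ℝ) + 1) ^ (M + 1) := by ring
      _ ≤ 2 * (2 * ((k:ℝ) + 1)) ^ (M + 1) := by gcongr
      _ = 2 * 2 ^ (M + 1) * ((k:ℝ) + 1) ^ (M + 1) := by rw [mul_pow]; ring
      _ ≤ _ := by
        gcongr
        have : 0 ≤ 3 * M * Real.exp (3 * M) := by positivity
        linarith

/-- Comparison of two power series whose coefficients differ polynomially. -/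
lemma norm_hasSum_sub_le {u v : ℕ → ℂ} {ε : ℝ} {M : ℕ} (hε : 0 ≤ ε)
    (h : ∀ k, ‖u k - v k‖ ≤ ε * ((k : ℝ) + 1) ^ M) {z U V : ℂ} (hz : ‖z‖ < 1)
    (hU : HasSum (fun k => z ^ k * u k) U) (hV : HasSum (fun k => z ^ k * v k) V) :
    ‖U - V‖ ≤ ε * M.factorial * ((1 - ‖z‖)⁻¹) ^ (M + 1) := by
  have hs := hasSum_choose_mul_geometric_of_norm_lt_one' M (r := ‖z‖) (by simpa using hz)
  have hs' := hs.mul_left (ε * M.factorial)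
  have hd := hU.sub hV
  rw [← hd.tsum_eq]
  have hb : ∀ k, ‖z ^ k * u k - z ^ k * v k‖ ≤
      ε * M.factorial * (((k + M).choose M : ℝ) * ‖z‖ ^ k) := fun k => by
    rw [← mul_sub, norm_mul, norm_pow]
    have h1 : ((k:ℝ) + 1) ^ M ≤ M.factorial * ((k + M).choose M : ℝ) := by
      have h2 := Nat.pow_succ_le_ascFactorial (k + 1) M
      have h3 := Nat.ascFactorial_eq_factorial_mul_choose k M
      have h4 : (k + 1) ^ M ≤ M.factorial * (k + M).choose M := h3 ▸ h2
      exact_mod_cast h4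
    calc _ ≤ ‖z‖ ^ k * (ε * ((k : ℝ) + 1) ^ M) := by gcongr; exact h k
      _ ≤ ‖z‖ ^ k * (ε * (M.factorial * ((k + M).choose M : ℝ))) := by gcongr
      _ = _ := by ring
  refine (tsum_of_norm_bounded hs' hb).trans ?_
  rw [Ring.inverse_eq_inv']

/-- The model weight `(1 - s) ^ a (1 - 1 / s) ^ b` on the unit circle. -/
noncomputable def fhWeight (a b s : ℂ) : ℂ := (1 - s) ^ a * (1 - s⁻¹) ^ b

lemma norm_cpow_le_mul {z : ℂ} (hz : z ≠ 0) (a : ℂ) :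
    ‖z ^ a‖ ≤ Real.exp (Real.pi * |a.im|) * ‖z‖ ^ a.re := by
  rw [Complex.norm_cpow_of_ne_zero hz, div_eq_mul_inv, mul_comm, ← Real.exp_neg]
  gcongr
  calc _ ≤ |(-(z.arg * a.im))| := le_abs_self _
    _ = |z.arg| * |a.im| := by rw [abs_neg, abs_mul]
    _ ≤ _ := by gcongr; exact Complex.abs_arg_le_pi z

lemma norm_one_sub_inv_of_norm_eq_one {s : ℂ} (hs : ‖s‖ = 1) : ‖1 - s⁻¹‖ = ‖1 - s‖ := by
  have h0 : s ≠ 0 := by rintro rfl; simp at hs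
  have : 1 - s⁻¹ = -(s⁻¹ * (1 - s)) := by field_simp; ring
  rw [this, norm_neg, norm_mul, norm_inv, hs]; simp

lemma norm_fhWeight_le (a b : ℂ) : ∃ C : ℝ, 0 ≤ C ∧ ∀ s : ℂ, ‖s‖ = 1 → s ≠ 1 →
    ‖fhWeight a b s‖ ≤ C * ‖1 - s‖ ^ (a + b).re := by
  refine ⟨Real.exp (Real.pi * |a.im|) * Real.exp (Real.pi * |b.im|), by positivity,
    fun s hs h1 => ?_⟩
  have h2 : 1 - s ≠ 0 := sub_ne_zero.2 h1.symm
  have h3 : 1 - s⁻¹ ≠ 0 := by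
    rw [← norm_ne_zero_iff, norm_one_sub_inv_of_norm_eq_one hs]; exact norm_ne_zero_iff.2 h2
  rw [fhWeight, norm_mul, Complex.add_re, Real.rpow_add (norm_pos_iff.2 h2)]
  calc _ ≤ (Real.exp (Real.pi * |a.im|) * ‖1 - s‖ ^ a.re) *
        (Real.exp (Real.pi * |b.im|) * ‖1 - s⁻¹‖ ^ b.re) := by
          gcongr
          · exact norm_cpow_le_mul h2 a
          · exact norm_cpow_le_mul h3 b
    _ = _ := by rw [norm_one_sub_inv_of_norm_eq_one hs]; ring

lemma norm_one_sub_circleMap (t : ℝ) : ‖1 - circleMap 0 1 t‖ = 2 * |Real.sin (t / 2)| := by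
  have h : ‖1 - circleMap 0 1 t‖ ^ 2 = (2 * |Real.sin (t / 2)|) ^ 2 := by
    rw [← Complex.normSq_eq_norm_sq, mul_pow, sq_abs, Complex.normSq_apply]
    simp only [circleMap, Complex.ofReal_one, one_mul, zero_add, Complex.sub_re, Complex.one_re,
      Complex.exp_ofReal_mul_I_re, Complex.sub_im, Complex.one_im, Complex.exp_ofReal_mul_I_im]
    have h1 := Real.cos_sq_add_sin_sq t
    have h2 : Real.cos t = 1 - 2 * Real.sin (t / 2) ^ 2 := by
      have := Real.cos_two_mul (t / 2)
      have h3 := Real.cos_sq_add_sin_sq (t / 2)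
      rw [show 2 * (t / 2) = t by ring] at this
      linarith
    nlinarith
  exact (pow_left_inj₀ (norm_nonneg _) (by positivity) two_ne_zero).1 h

lemma circleMap_mem_slitPlane {t : ℝ} (ht : t ∈ Ioo 0 (2 * Real.pi)) :
    circleMap 0 1 t ≠ 1 := by
  intro h
  have h1 := norm_one_sub_circleMap t
  rw [h] at h1
  have := Real.sin_pos_of_pos_of_lt_pi (x := t / 2) (by linarith [ht.1]) (by linarith [ht.2])
  rw [abs_of_pos this] at h1
  simp at h1
  linarith

lemma one_sub_mem_slitPlane {s : ℂ} (hs : ‖s‖ ≤ 1) (h1 : s ≠ 1) : 1 - s ∈ Complex.slitPlane := by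
  rw [Complex.mem_slitPlane_iff]
  by_cases h : s.re < 1
  · left; simp [h]
  · right
    intro him
    apply h1
    have him' : s.im = 0 := by simpa using him
    have := Complex.re_le_norm s
    exact Complex.ext (by simp; linarith) (by simpa using him')

lemma norm_one_sub_circleMap_ge {t : ℝ} (ht : t ∈ Ioo 0 (2 * Real.pi)) :
    2 / Real.pi * min t (2 * Real.pi - t) ≤ ‖1 - circleMap 0 1 t‖ := by
  have hpi := Real.pi_pos
  have h0 := Real.sin_pos_of_pos_of_lt_pi (x := t / 2) (by linarith [ht.1]) (by linarith [ht.2])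
  rw [norm_one_sub_circleMap, abs_of_pos h0]
  rcases le_total t Real.pi with h | h
  · have := Real.mul_le_sin (x := t / 2) (by linarith [ht.1]) (by linarith)
    calc _ ≤ 2 / Real.pi * t := by gcongr; exact min_le_left _ _
      _ = 2 * (2 / Real.pi * (t / 2)) := by ring
      _ ≤ _ := by gcongr
  · have := Real.mul_le_sin (x := Real.pi - t / 2) (by linarith [ht.2]) (by linarith)
    rw [Real.sin_pi_sub] at this
    calc _ ≤ 2 / Real.pi * (2 * Real.pi - t) := by gcongr; exact min_le_right _ _
      _ = 2 * (2 / Real.pi * (Real.pi - t / 2)) := by ring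
      _ ≤ _ := by gcongr

lemma intervalIntegrable_norm_one_sub_rpow {p : ℝ} (hp : -1 < p) :
    IntervalIntegrable (fun t : ℝ => ‖1 - circleMap 0 1 t‖ ^ p) volume 0 (2 * Real.pi) := by
  have hpi := Real.pi_pos
  set q := min p 0 with hq
  have hq1 : -1 < q := lt_min hp (by norm_num)
  have hq0 : q ≤ 0 := min_le_right _ _
  have hqp : q ≤ p := min_le_left _ _
  have i1 := intervalIntegral.intervalIntegrable_rpow' (a := 0) (b := 2 * Real.pi) hq1
  have i2 := (intervalIntegral.intervalIntegrable_rpow' (a := 2 * Real.pi) (b := 0) hq1).comp_sub_left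
    (2 * Real.pi)
  simp only [sub_self, sub_zero] at i2
  have i3 := (i1.add i2).const_mul (2 ^ (p - q) * (2 / Real.pi) ^ q)
  rw [intervalIntegrable_iff_integrableOn_Ioo_of_le (by positivity)] at i3 ⊢
  refine Integrable.mono' i3 ?_ ?_
  · refine (ContinuousOn.rpow_const (by fun_prop) fun t ht => ?_).aestronglyMeasurable
      measurableSet_Ioo
    left
    exact norm_ne_zero_iff.2 (sub_ne_zero.2 (circleMap_mem_slitPlane ht).symm)
  · refine (ae_restrict_iff' measurableSet_Ioo).2 (Eventually.of_forall fun t ht => ?_)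
    have hr := norm_one_sub_circleMap_ge ht
    have hr2 : ‖1 - circleMap 0 1 t‖ ≤ 2 := by
      rw [norm_one_sub_circleMap]; linarith [Real.abs_sin_le_one (t / 2)]
    have hm : 0 < min t (2 * Real.pi - t) := lt_min ht.1 (by linarith [ht.2])
    have hm' : 0 < 2 / Real.pi * min t (2 * Real.pi - t) := by positivity
    have hr0 := hm'.trans_le hr
    rw [Real.norm_of_nonneg (by positivity)]
    have e1 : ‖1 - circleMap 0 1 t‖ ^ p =
        ‖1 - circleMap 0 1 t‖ ^ (p - q) * ‖1 - circleMap 0 1 t‖ ^ q := by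
      rw [← Real.rpow_add hr0]; congr 1; ring
    have e2 : ‖1 - circleMap 0 1 t‖ ^ q ≤ (2 / Real.pi) ^ q * (min t (2 * Real.pi - t)) ^ q := by
      rw [← Real.mul_rpow (by positivity) hm.le]
      exact Real.rpow_le_rpow_of_nonpos hm' hr hq0
    have e3 : (min t (2 * Real.pi - t)) ^ q ≤ t ^ q + (2 * Real.pi - t) ^ q := by
      have h1 : 0 ≤ t ^ q := Real.rpow_nonneg ht.1.le _
      have h2 : 0 ≤ (2 * Real.pi - t) ^ q := Real.rpow_nonneg (by linarith [ht.2]) _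
      rcases min_choice t (2 * Real.pi - t) with h | h <;> rw [h] <;> linarith
    rw [e1]
    calc _ ≤ (2:ℝ) ^ (p - q) * ((2 / Real.pi) ^ q * (t ^ q + (2 * Real.pi - t) ^ q)) := by
          gcongr
          exact e2.trans (by gcongr)
      _ = _ := by ring

lemma continuousAt_fhWeight (a b : ℂ) {s : ℂ} (hs : ‖s‖ = 1) (h1 : s ≠ 1) :
    ContinuousAt (fhWeight a b) s := by
  have h0 : s ≠ 0 := by rintro rfl; simp at hs
  refine ContinuousAt.mul ?_ ?_
  · exact ContinuousAt.cpow (by fun_prop) continuousAt_const (one_sub_mem_slitPlane hs.le h1)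
  · refine ContinuousAt.cpow (continuousAt_const.sub (continuousAt_inv₀ h0)) continuousAt_const
      (one_sub_mem_slitPlane (by simp [hs]) ?_)
    simpa using h1

lemma circleIntegrable_fhWeight {a b : ℂ} (hab : -1 < (a + b).re) :
    CircleIntegrable (fhWeight a b) 0 1 := by
  obtain ⟨C, hC, h⟩ := norm_fhWeight_le a b
  have i := (intervalIntegrable_norm_one_sub_rpow hab).const_mul C
  rw [CircleIntegrable]
  rw [intervalIntegrable_iff_integrableOn_Ioo_of_le (by positivity)] at i ⊢
  refine Integrable.mono' i ?_ ?_
  · refine ContinuousOn.aestronglyMeasurable (fun t ht => ?_) measurableSet_Ioo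
    exact ((continuousAt_fhWeight a b (norm_circleMap_one t) (circleMap_mem_slitPlane ht)).comp
      (continuous_circleMap 0 1).continuousAt).continuousWithinAt
  · exact (ae_restrict_iff' measurableSet_Ioo).2 (Eventually.of_forall fun t ht =>
      h _ (norm_circleMap_one t) (circleMap_mem_slitPlane ht))

lemma continuousOn_fhWeight_circleMap {a b : ℂ} (ha : a ≠ 0) (hab : 0 < (a + b).re) :
    ContinuousOn (fun t : ℝ => fhWeight a b (circleMap 0 1 t)) (Icc 0 (2 * Real.pi)) := by
  obtain ⟨C, hC, h⟩ := norm_fhWeight_le a b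
  have key : ∀ s : ℂ, ‖s‖ = 1 → ‖fhWeight a b s‖ ≤ C * ‖1 - s‖ ^ (a + b).re := fun s hs => by
    by_cases h1 : s = 1
    · subst h1
      simp [fhWeight, Complex.zero_cpow ha]
      positivity
    · exact h s hs h1
  intro t ht
  by_cases h1 : circleMap 0 1 t = 1
  · have hv : fhWeight a b (circleMap 0 1 t) = 0 := by
      rw [h1]; simp [fhWeight, Complex.zero_cpow ha]
    rw [ContinuousWithinAt, hv]
    refine squeeze_zero_norm (fun u => key _ (norm_circleMap_one u)) ?_
    have hc : Continuous fun u : ℝ => C * ‖1 - circleMap 0 1 u‖ ^ (a + b).re := by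
      refine continuous_const.mul ((by fun_prop : Continuous fun u : ℝ =>
        ‖1 - circleMap 0 1 u‖).rpow_const fun u => Or.inr hab.le)
    have := (hc.continuousWithinAt (s := Icc 0 (2 * Real.pi)) (x := t)).tendsto
    simpa only [h1, sub_self, norm_zero, Real.zero_rpow hab.ne', mul_zero] using this
  · exact ((continuousAt_fhWeight a b (norm_circleMap_one t) h1).comp
      (continuous_circleMap 0 1).continuousAt).continuousWithinAt

lemma mom_eq_integral (F : ℂ → ℂ) (j : ℤ) : mom F j =
    (2 * Real.pi : ℂ)⁻¹ * ∫ t in (0:ℝ)..2 * Real.pi,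
      F (circleMap 0 1 t) * circleMap 0 1 t ^ (-j) := by
  have h : ∀ t : ℝ, deriv (circleMap 0 1) t •
      (circleMap 0 1 t ^ (-j - 1) * F (circleMap 0 1 t)) =
      Complex.I * (F (circleMap 0 1 t) * circleMap 0 1 t ^ (-j)) := fun t => by
    have h0 : circleMap 0 1 t ≠ 0 := circleMap_ne_center one_ne_zero
    rw [deriv_circleMap, zpow_sub_one₀ h0, smul_eq_mul]
    field_simp
  rw [mom, circleIntegral]
  simp only [h]
  rw [intervalIntegral.integral_const_mul]
  have := Complex.I_ne_zero
  field_simp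

lemma mom_fhWeight_recurrence {a b : ℂ} (ha : a + 1 ≠ 0) (hab : -1 < (a + b).re) (j : ℤ) :
    (b + j) * mom (fhWeight a b) j = (j - (a + 1)) * mom (fhWeight a b) (j - 1) := by
  have hF := circleIntegrable_fhWeight hab
  set G : ℝ → ℂ := fun t => fhWeight (a + 1) b (circleMap 0 1 t) * circleMap 0 1 t ^ (-j) with hG
  set G' : ℝ → ℂ := fun t => Complex.I * ((j - (a + 1)) *
    (fhWeight a b (circleMap 0 1 t) * circleMap 0 1 t ^ (-(j - 1))) - (b + j) *
    (fhWeight a b (circleMap 0 1 t) * circleMap 0 1 t ^ (-j))) with hG'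
  have hi : ∀ m : ℤ, IntervalIntegrable
      (fun t => fhWeight a b (circleMap 0 1 t) * circleMap 0 1 t ^ m) volume 0 (2 * Real.pi) :=
    fun m => CircleIntegrable.mul_zpow hF m
  have hInt : IntervalIntegrable G' volume 0 (2 * Real.pi) :=
    (((hi _).const_mul _).sub ((hi _).const_mul _)).const_mul _
  have hcont : ContinuousOn G (Icc 0 (2 * Real.pi)) := by
    refine (continuousOn_fhWeight_circleMap ha (by simp at hab ⊢; linarith)).mul ?_
    intro t _
    exact (((continuousAt_zpow₀ _ _ (Or.inl (circleMap_ne_center one_ne_zero))).comp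
      (continuous_circleMap 0 1).continuousAt)).continuousWithinAt
  have hder : ∀ t ∈ Ioo 0 (2 * Real.pi), HasDerivAt G (G' t) t := by
    intro t ht
    have h1 := circleMap_mem_slitPlane ht
    have hs := norm_circleMap_one t
    have hd := hasDerivAt_circleMap 0 1 t
    set s := circleMap 0 1 t with hs_def
    have h0 : s ≠ 0 := circleMap_ne_center one_ne_zero
    have hs1 : 1 - s ≠ 0 := sub_ne_zero.2 h1.symm
    have hs2 : 1 - s⁻¹ ≠ 0 := by
      rw [← norm_ne_zero_iff, norm_one_sub_inv_of_norm_eq_one hs]; exact norm_ne_zero_iff.2 hs1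
    have d1 : HasDerivAt (fun s : ℂ => (1 - s) ^ (a + 1)) ((a + 1) * (1 - s) ^ (a + 1 - 1) * (-1)) s :=
      ((hasDerivAt_id s).const_sub 1).cpow_const (one_sub_mem_slitPlane hs.le h1)
    have d2 : HasDerivAt (fun s : ℂ => (1 - s⁻¹) ^ b)
        (b * (1 - s⁻¹) ^ (b - 1) * (-(-(s ^ 2)⁻¹))) s :=
      ((hasDerivAt_inv h0).const_sub 1).cpow_const
        (one_sub_mem_slitPlane (by simp [hs]) (by simpa using h1))
    have d3 := hasDerivAt_zpow (-j) s (Or.inl h0)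
    have hcomp := ((d1.mul d2).mul d3).comp t hd
    refine hcomp.congr_deriv ?_
    simp only [hG', fhWeight, ← hs_def, Pi.mul_apply]
    rw [show a + 1 - 1 = a by ring, Complex.cpow_add _ _ hs1, Complex.cpow_sub _ _ hs2,
      Complex.cpow_one, Complex.cpow_one, show (-(j - 1)) = -j + 1 by ring, zpow_add_one₀ h0,
      zpow_sub_one₀ h0]
    have hs3 : s - 1 ≠ 0 := sub_ne_zero.2 h1
    have e4 : 1 - s⁻¹ = (s - 1) / s := by field_simp
    generalize (1 - s⁻¹) ^ b = B
    rw [e4]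
    push_cast
    field_simp
    ring
  have h := intervalIntegral.integral_eq_sub_of_hasDerivAt_of_le (by positivity) hcont hder hInt
  have e0 : G 0 = 0 := by simp [hG, fhWeight, circleMap, Complex.zero_cpow ha]
  have e1 : G (2 * Real.pi) = 0 := by simp [hG, fhWeight, circleMap, Complex.zero_cpow ha]
  rw [e0, e1, sub_zero, hG'] at h
  rw [intervalIntegral.integral_const_mul, intervalIntegral.integral_sub ((hi _).const_mul _)
    ((hi _).const_mul _), intervalIntegral.integral_const_mul,
    intervalIntegral.integral_const_mul] at h
  have h2 := (mul_eq_zero.1 h).resolve_left Complex.I_ne_zero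
  rw [mom_eq_integral, mom_eq_integral]
  linear_combination -(2 * Real.pi : ℂ)⁻¹ * h2

/-- The Verblunsky coefficient of the model weight. -/
noncomputable def fhKappa (a b : ℂ) (n : ℕ) : ℂ := poch b n / poch (a + 1) n

/-- Coefficients of the orthogonal polynomials of the model weight. -/
noncomputable def fhCoeff (a b : ℂ) (n k : ℕ) : ℂ :=
  n.choose k * poch (a + 1) k * poch b (n - k) / poch (a + 1) n

/-- The monic orthogonal polynomials of the model weight. -/
noncomputable def fhPhi (a b : ℂ) (n : ℕ) (z : ℂ) : ℂ :=
  ∑ k ∈ Finset.range (n + 1), fhCoeff a b n k * z ^ k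

/-- The reversed dual polynomials of the model weight. -/
noncomputable def fhPsi (a b : ℂ) (n : ℕ) (z : ℂ) : ℂ :=
  ∑ k ∈ Finset.range (n + 1), fhCoeff b a n (n - k) * z ^ k

/-- The norms of the orthogonal polynomials of the model weight. -/
noncomputable def fhNorm (a b : ℂ) (n : ℕ) : ℂ := mom (fhWeight a b) 0 *
  ∏ i ∈ Finset.range n, ((i + 1) * (a + b + 1 + i) / ((a + 1 + i) * (b + 1 + i)))

/-- The moments of the orthogonality relations. -/
noncomputable def fhMom (a b : ℂ) (n : ℕ) (j : ℤ) : ℂ :=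
  mom (fun s => fhPhi a b n s * fhWeight a b s) j

lemma fhPsi_eq (a b : ℂ) (n : ℕ) {z : ℂ} (hz : z ≠ 0) :
    fhPsi a b n z = z ^ n * fhPhi b a n z⁻¹ := by
  rw [fhPsi, fhPhi, ← Finset.sum_range_reflect, Finset.mul_sum]
  refine Finset.sum_congr rfl fun k hk => ?_
  have hk' : k ≤ n := by have := Finset.mem_range.1 hk; omega
  have e : n + 1 - 1 - k = n - k := by omega
  rw [e, Nat.sub_sub_self hk']
  have : z ^ n = z ^ (n - k) * z ^ k := by rw [← pow_add]; congr 1; omega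
  rw [this, inv_pow]
  field_simp

lemma fhWeight_inv (a b s : ℂ) : fhWeight a b s⁻¹ = fhWeight b a s := by
  rw [fhWeight, fhWeight, inv_inv, mul_comm]

lemma mom_comp_inv (F : ℂ → ℂ) (j : ℤ) : mom (fun s => F s⁻¹) j = mom F (-j) := by
  rw [mom_eq_integral, mom_eq_integral]
  congr 1
  have h : ∀ t : ℝ, F (circleMap 0 1 t)⁻¹ * circleMap 0 1 t ^ (-j) =
      (fun u : ℝ => F (circleMap 0 1 u) * circleMap 0 1 u ^ j) (-t) := fun t => by
    have : circleMap 0 1 (-t) = (circleMap 0 1 t)⁻¹ := by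
      simp [circleMap, ← Complex.exp_neg]
    simp only [this, inv_zpow, zpow_neg]
  simp only [h]
  rw [intervalIntegral.integral_comp_neg
    (fun u : ℝ => F (circleMap 0 1 u) * circleMap 0 1 u ^ j)]
  have hp : Function.Periodic (fun u : ℝ => F (circleMap 0 1 u) * circleMap 0 1 u ^ j)
      (2 * Real.pi) := fun u => by
    simp only [periodic_circleMap 0 1 u]
  have := hp.intervalIntegral_add_eq (-(2 * Real.pi)) 0
  simpa only [neg_add_cancel, zero_add, neg_zero, neg_neg] using this

lemma differentiable_fhPhi (a b : ℂ) (n : ℕ) : Differentiable ℂ (fhPhi a b n) := by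
  unfold fhPhi; fun_prop

lemma differentiable_fhPsi (a b : ℂ) (n : ℕ) : Differentiable ℂ (fhPsi a b n) := by
  unfold fhPsi; fun_prop

lemma circleIntegrable_fhPhi_mul {a b : ℂ} (hab : -1 < (a + b).re) (n : ℕ) :
    CircleIntegrable (fun s => fhPhi a b n s * fhWeight a b s) 0 1 :=
  (circleIntegrable_fhWeight hab).contMul (differentiable_fhPhi a b n).continuous.continuousOn

lemma circleIntegrable_fhPsi_mul {a b : ℂ} (hab : -1 < (a + b).re) (n : ℕ) :
    CircleIntegrable (fun s => fhPsi a b n s * fhWeight a b s) 0 1 :=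
  (circleIntegrable_fhWeight hab).contMul (differentiable_fhPsi a b n).continuous.continuousOn

lemma mom_fhPsi (a b : ℂ) (n : ℕ) (j : ℤ) :
    mom (fun s => fhPsi a b n s * fhWeight a b s) j = fhMom b a n (n - j) := by
  have h : mom (fun s => fhPsi a b n s * fhWeight a b s) j =
      mom (fun s => (fun u => fhPhi b a n u * fhWeight b a u) s⁻¹ * s ^ (n : ℤ)) j := by
    refine mom_congr (fun s hs => ?_) j
    have h0 : s ≠ 0 := by rintro rfl; simp at hs
    simp only [fhPsi_eq a b n h0, fhWeight_inv, zpow_natCast]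
    ring
  rw [h, mom_mul_zpow, mom_comp_inv (fun u => fhPhi b a n u * fhWeight b a u), fhMom, neg_sub]

section
variable {a b : ℂ}

lemma fhCoeff_zero (a b : ℂ) (n : ℕ) : fhCoeff a b n 0 = fhKappa a b n := by
  simp [fhCoeff, fhKappa]

lemma fhCoeff_self (ha : -(1 / 2) < a.re) (n : ℕ) : fhCoeff a b n n = 1 := by
  have := poch_ne_zero (x := a + 1) (by simp; linarith) n
  simp [fhCoeff, this]

lemma fhCoeff_succ (ha : -(1 / 2) < a.re) (hb : -(1 / 2) < b.re) {n k : ℕ} (hk : k ≤ n) :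
    fhCoeff a b (n + 1) (k + 1) = fhCoeff a b n k +
      (if k < n then fhKappa a b (n + 1) * fhCoeff b a n (n - (k + 1)) else 0) := by
  have h1 := poch_ne_zero (x := a + 1) (by simp; linarith) n
  have h2 := poch_ne_zero (x := b + 1) (by simp; linarith) n
  have h3 := poch_ne_zero (x := a + 1) (by simp; linarith) (n + 1)
  have h4 : a + 1 + n ≠ 0 := fun h => h3 (by rw [poch_succ, h, mul_zero])
  rcases hk.lt_or_eq with h | rfl
  · rw [if_pos h]
    have e1 : n + 1 - (k + 1) = n - k := by omega
    have e2 : n - (n - (k + 1)) = k + 1 := by omega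
    have e3 : n - k = (n - (k + 1)) + 1 := by omega
    have e4 : n.choose (n - (k + 1)) = n.choose (k + 1) := Nat.choose_symm h
    rw [fhCoeff, fhCoeff, fhCoeff, fhKappa, e1, e2, e3, e4, poch_succ (a + 1) k,
      poch_succ (a + 1) n, poch_succ_left b, poch_succ_left a, poch_succ_left b]
    have c1 : ((n + 1).choose (k + 1) : ℂ) = n.choose k + n.choose (k + 1) := by
      exact_mod_cast Nat.choose_succ_succ n k
    have c2 : ((n + 1).choose (k + 1) : ℂ) * (k + 1) = (n + 1) * n.choose k := by
      exact_mod_cast (Nat.add_one_mul_choose_eq n k).symm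
    field_simp
    linear_combination poch (a + 1) k * b * poch (b + 1) (n - (k + 1)) * (c2 + a * c1)
  · simp only [lt_irrefl, if_false, add_zero]
    rw [fhCoeff_self ha, fhCoeff_self ha]

lemma fhPhi_succ (ha : -(1 / 2) < a.re) (hb : -(1 / 2) < b.re) (n : ℕ) (z : ℂ) :
    fhPhi a b (n + 1) z = z * fhPhi a b n z + fhKappa a b (n + 1) * fhPsi a b n z := by
  rw [fhPhi, Finset.sum_range_succ' _ (n + 1), fhPhi, fhPsi,
    Finset.sum_range_succ' (fun k => fhCoeff b a n (n - k) * z ^ k)]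
  have h1 : ∑ k ∈ Finset.range (n + 1), fhCoeff a b (n + 1) (k + 1) * z ^ (k + 1) =
      ∑ k ∈ Finset.range (n + 1), (z * (fhCoeff a b n k * z ^ k) +
        (if k < n then fhKappa a b (n + 1) * fhCoeff b a n (n - (k + 1)) * z ^ (k + 1) else 0)) := by
    refine Finset.sum_congr rfl fun k hk => ?_
    rw [fhCoeff_succ ha hb (by have := Finset.mem_range.1 hk; omega)]
    split_ifs <;> ring
  have h2 : ∑ k ∈ Finset.range (n + 1),
      (if k < n then fhKappa a b (n + 1) * fhCoeff b a n (n - (k + 1)) * z ^ (k + 1) else 0) =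
      ∑ k ∈ Finset.range n, fhKappa a b (n + 1) * (fhCoeff b a n (n - (k + 1)) * z ^ (k + 1)) := by
    rw [Finset.sum_range_succ, if_neg (lt_irrefl n), add_zero]
    refine Finset.sum_congr rfl fun k hk => ?_
    rw [if_pos (Finset.mem_range.1 hk)]; ring
  rw [h1, Finset.sum_add_distrib, h2, fhCoeff_zero, ← Finset.mul_sum, ← Finset.mul_sum,
    Nat.sub_zero, fhCoeff_self hb]
  ring

lemma fhMom_succ (ha : -(1 / 2) < a.re) (hb : -(1 / 2) < b.re) (n : ℕ) (j : ℤ) :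
    fhMom a b (n + 1) j = fhMom a b n (j - 1) + fhKappa a b (n + 1) * fhMom b a n (n - j) := by
  have hab : -1 < (a + b).re := by simp; linarith
  have h : ∀ s, fhPhi a b (n + 1) s * fhWeight a b s =
      s ^ (1 : ℤ) * (fhPhi a b n s * fhWeight a b s) +
      fhKappa a b (n + 1) * (fhPsi a b n s * fhWeight a b s) := fun s => by
    rw [fhPhi_succ ha hb, zpow_one]; ring
  rw [fhMom]
  simp only [h]
  rw [mom_add ((circleIntegrable_fhPhi_mul hab n).contMul (continuousOn_zpow_sphere 1))
    ((circleIntegrable_fhPsi_mul hab n).contMul continuousOn_const), mom_const_mul, mom_fhPsi,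
    mom_zpow_mul]
  rfl

lemma fhNorm_symm (a b : ℂ) (n : ℕ) : fhNorm a b n = fhNorm b a n := by
  have : mom (fhWeight a b) 0 = mom (fhWeight b a) 0 := by
    have := mom_comp_inv (fhWeight a b) 0
    simp only [fhWeight_inv, neg_zero] at this
    exact this.symm
  rw [fhNorm, fhNorm, this]
  congr 1
  exact Finset.prod_congr rfl fun i _ => by rw [add_comm a b, mul_comm (a + 1 + i : ℂ)]

lemma fhNorm_succ (a b : ℂ) (n : ℕ) : fhNorm a b (n + 1) =
    fhNorm a b n * ((n + 1) * (a + b + 1 + n) / ((a + 1 + n) * (b + 1 + n))) := by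
  rw [fhNorm, Finset.prod_range_succ, ← mul_assoc, fhNorm]

lemma add_nat_ne_zero {x : ℂ} (hx : 0 < x.re) (n : ℕ) : x + n ≠ 0 := fun h => by
  have := congrArg Complex.re h
  simp at this
  linarith [(n.cast_nonneg : (0:ℝ) ≤ n)]

lemma fhKappa_succ (ha : -(1 / 2) < a.re) (n : ℕ) :
    fhKappa a b (n + 1) * (a + 1 + n) = fhKappa a b n * (b + n) := by
  have h1 := add_nat_ne_zero (x := a + 1) (by simp; linarith) n
  have h2 := poch_ne_zero (x := a + 1) (by simp; linarith) n
  rw [fhKappa, fhKappa, poch_succ, poch_succ]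
  field_simp

lemma fhKappa_mul_fhKappa (ha : -(1 / 2) < a.re) (hb : -(1 / 2) < b.re) (n : ℕ) :
    fhKappa a b (n + 1) * fhKappa b a (n + 1) = a * b / ((a + 1 + n) * (b + 1 + n)) := by
  have h1 := add_nat_ne_zero (x := a + 1) (by simp; linarith) n
  have h2 := poch_ne_zero (x := a + 1) (by simp; linarith) n
  have h3 := add_nat_ne_zero (x := b + 1) (by simp; linarith) n
  have h4 := poch_ne_zero (x := b + 1) (by simp; linarith) n
  rw [fhKappa, fhKappa, poch_succ (a + 1), poch_succ (b + 1), poch_succ_left a, poch_succ_left b]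
  field_simp

lemma mom_fhWeight_nat (ha : -(1 / 2) < a.re) (hb : -(1 / 2) < b.re) (k : ℕ) :
    mom (fhWeight a b) k = mom (fhWeight a b) 0 * poch (-a) k / poch (b + 1) k := by
  induction k with
  | zero => simp
  | succ k ih =>
    have h := mom_fhWeight_recurrence (a := a) (b := b) (by
      simpa using add_nat_ne_zero (x := a + 1) (by simp; linarith) 0) (by simp; linarith) (k + 1)
    have h1 := add_nat_ne_zero (x := b + 1) (by simp; linarith) k
    have h2 := poch_ne_zero (x := b + 1) (by simp; linarith) k
    rw [add_sub_cancel_right, ih] at h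
    push_cast at h ⊢
    have h5 : b + (k + 1) ≠ 0 := by rwa [add_assoc, add_comm (1:ℂ)] at h1
    rw [poch_succ, poch_succ, ← mul_right_inj' h5, h]
    field_simp
    ring

theorem fhMom_eq (n : ℕ) : ∀ {a b : ℂ}, -(1 / 2) < a.re → -(1 / 2) < b.re →
    (∀ k : ℕ, fhMom a b n (n + k) = fhNorm a b n * poch (-a) k * poch (n + 1) k /
      (k.factorial * poch (n + b + 1) k)) ∧
    (∀ j : ℤ, 0 ≤ j → j < n → fhMom a b n j = 0) ∧
    (∀ k : ℕ, fhMom a b n (-1 - k) = -(fhKappa a b (n + 1) * fhNorm a b n * poch (1 - b) k *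
      poch (n + 1) k / (k.factorial * poch (n + a + 2) k))) := by
  induction n with
  | zero =>
    intro a b ha hb
    have e : ∀ (a b : ℂ) (j : ℤ), -(1 / 2) < a.re → fhMom a b 0 j = mom (fhWeight a b) j :=
      fun a b j h => by
        rw [fhMom]
        congr 1
        funext s
        simp [fhPhi, fhCoeff_self h]
    refine ⟨fun k => ?_, fun j h1 h2 => by exfalso; push_cast at h2; omega, fun k => ?_⟩
    · have h2 := poch_ne_zero (x := b + 1) (by simp; linarith) k
      have h3 : (k.factorial : ℂ) ≠ 0 := by exact_mod_cast k.factorial_ne_zero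
      rw [e _ _ _ ha]
      simp only [Nat.cast_zero, zero_add, poch_one, fhNorm, Finset.range_zero, Finset.prod_empty,
        mul_one]
      rw [mom_fhWeight_nat ha hb]
      field_simp
    · have h3 : (k.factorial : ℂ) ≠ 0 := by exact_mod_cast k.factorial_ne_zero
      have h4 := add_nat_ne_zero (x := a + 1) (by simp; linarith) 0
      have h5 := poch_ne_zero (x := a + 2) (by simp; linarith) k
      have h6 := mom_fhWeight_nat hb ha (k + 1)
      have h7 := mom_comp_inv (fhWeight a b) (k + 1)
      have h8 := fhNorm_symm a b 0
      simp only [fhNorm, Finset.range_zero, Finset.prod_empty, mul_one] at h8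
      simp only [fhWeight_inv] at h7
      rw [e _ _ _ ha, show (-1 - k : ℤ) = -(k + 1) by ring, ← h7, show ((k:ℤ) + 1) = (k + 1 : ℕ) by
        push_cast; ring, h6, ← h8]
      simp only [Nat.cast_zero, zero_add, poch_one, fhNorm, Finset.range_zero, Finset.prod_empty,
        mul_one, fhKappa, poch_succ_left, poch_zero]
      rw [show -b + 1 = 1 - b by ring, show a + 1 + 1 = a + 2 by ring]
      simp only [Nat.cast_zero, add_zero] at h4
      field_simp
  | succ n ih =>
    intro a b ha hb
    obtain ⟨i1, i2, i3⟩ := ih ha hb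
    obtain ⟨j1, j2, j3⟩ := ih hb ha
    have a1 := add_nat_ne_zero (x := a + 1) (by simp; linarith) n
    have b1 := add_nat_ne_zero (x := b + 1) (by simp; linarith) n
    have a2 := add_nat_ne_zero (x := a + 2) (by simp; linarith) n
    have n1 : (n:ℂ) + 1 ≠ 0 := by exact_mod_cast n.succ_ne_zero
    refine ⟨fun k => ?_, fun j h1 h2 => ?_, fun k => ?_⟩
    · rw [fhMom_succ ha hb, show ((n + 1 : ℕ) : ℤ) + k - 1 = n + k by push_cast; ring,
        show (n : ℤ) - (((n + 1 : ℕ) : ℤ) + k) = -1 - k by push_cast; ring, i1, j3,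
        fhNorm_succ, fhNorm_symm b a]
      have h3 : (k.factorial : ℂ) ≠ 0 := by exact_mod_cast k.factorial_ne_zero
      have h4 := poch_ne_zero (x := n + b + 1) (by simp; linarith [(n.cast_nonneg : (0:ℝ) ≤ n)]) k
      have h5 := poch_ne_zero (x := n + b + 2) (by simp; linarith [(n.cast_nonneg : (0:ℝ) ≤ n)]) k
      have p1 : poch (n + b + 1) k * (n + b + 1 + k) = (n + b + 1) * poch (n + b + 2) k := by
        rw [← poch_succ, poch_succ_left]; ring_nf
      have p2 : poch (n + 1) k * (n + 1 + k) = (n + 1) * poch (n + 2) k := by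
        rw [← poch_succ, poch_succ_left]; ring_nf
      have p3 : -a * poch (1 - a) k = poch (-a) k * (-a + k) := by
        rw [← poch_succ, poch_succ_left]; ring_nf
      have p4 := fhKappa_mul_fhKappa ha hb n
      have b1' : (n:ℂ) + b + 1 ≠ 0 := by convert b1 using 1; ring
      have a1' : (n:ℂ) + a + 1 ≠ 0 := by convert a1 using 1; ring
      have q1 : poch (n + 2) k = poch (n + 1) k * (n + 1 + k) / (n + 1) := by
        rw [p2]; field_simp
      have q2 : 1 / poch (n + b + 1) k = (n + b + 1 + k) / ((n + b + 1) * poch (n + b + 2) k) := by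
        rw [← p1, div_eq_div_iff h4]
        · ring
        · rw [p1]; exact mul_ne_zero b1' h5
      have q3 : fhKappa a b (n + 1) * fhKappa b a (n + 1) * poch (1 - a) k =
          -b * (poch (-a) k * (-a + k)) / ((n + a + 1) * (n + b + 1)) := by
        rw [p4, ← p3]
        field_simp
        ring
      push_cast
      rw [show (n:ℂ) + 1 + 1 = n + 2 by ring, show (n:ℂ) + 1 + b + 1 = n + b + 2 by ring, q1,
        show b + 1 + (n:ℂ) = n + b + 1 by ring, show a + 1 + (n:ℂ) = n + a + 1 by ring]
      have lhs : fhNorm a b n * poch (-a) k * poch (n + 1) k /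
            (k.factorial * poch (n + b + 1) k) + fhKappa a b (n + 1) *
            -(fhKappa b a (n + 1) * fhNorm a b n * poch (1 - a) k * poch (n + 1) k /
              (k.factorial * poch (n + b + 2) k)) =
          fhNorm a b n * poch (n + 1) k / k.factorial *
            (poch (-a) k * (1 / poch (n + b + 1) k) -
              (fhKappa a b (n + 1) * fhKappa b a (n + 1) * poch (1 - a) k) /
                poch (n + b + 2) k) := by
        field_simp
        ring
      rw [lhs, q2, q3]
      field_simp
      ring
    · rw [fhMom_succ ha hb]
      rcases h1.eq_or_lt with rfl | h1
      · have e1 := i3 0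
        have e2 := j1 0
        simp only [Nat.cast_zero, sub_zero, poch_zero, Nat.factorial_zero, Nat.cast_one, mul_one,
          div_one, add_zero] at e1 e2
        rw [zero_sub, e1, sub_zero, e2, fhNorm_symm b a]
        ring
      · rw [i2 _ (by omega) (by push_cast at h2; omega), j2 _ (by push_cast at h2; omega) (by omega)]
        ring
    · rw [fhMom_succ ha hb, show (-1 - (k:ℤ) - 1) = -1 - (k + 1 : ℕ) by push_cast; ring,
        show (n : ℤ) - (-1 - (k:ℤ)) = n + (k + 1 : ℕ) by push_cast; ring, i3, j1,
        fhNorm_succ, fhNorm_symm b a]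
      have h3 : (k.factorial : ℂ) ≠ 0 := by exact_mod_cast k.factorial_ne_zero
      have hk : (k:ℂ) + 1 ≠ 0 := by exact_mod_cast k.succ_ne_zero
      have h5 := poch_ne_zero (x := n + a + 3) (by simp; linarith [(n.cast_nonneg : (0:ℝ) ≤ n)]) k
      have h6 := poch_ne_zero (x := n + a + 1) (by simp; linarith [(n.cast_nonneg : (0:ℝ) ≤ n)]) (k + 1)
      have p1 : poch (n + a + 1) (k + 1) * (n + a + 2 + k) =
          (n + a + 1) * ((n + a + 2) * poch (n + a + 3) k) := by
        rw [show (n:ℂ) + a + 3 = n + a + 2 + 1 by ring, ← poch_succ_left, poch_succ_left, poch_succ]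
        ring_nf
      have p2 : poch (n + a + 2) (k + 1) = (n + a + 2) * poch (n + a + 3) k := by
        rw [poch_succ_left]; ring_nf
      have p3 : poch (n + 1) (k + 1) = (n + 1) * poch (n + 2) k := by
        rw [poch_succ_left]; ring_nf
      have p4 : poch (-b) (k + 1) = -b * poch (1 - b) k := by
        rw [poch_succ_left]; ring_nf
      have p5 : poch (1 - b) (k + 1) = poch (1 - b) k * (1 - b + k) := poch_succ _ _
      have a1' : (n:ℂ) + a + 1 ≠ 0 := by convert a1 using 1; ring
      have a2' : (n:ℂ) + a + 2 ≠ 0 := by convert a2 using 1; ring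
      have b1' : (n:ℂ) + b + 1 ≠ 0 := by convert b1 using 1; ring
      have q1 : 1 / poch (n + a + 1) (k + 1) = (n + a + 2 + k) /
          ((n + a + 1) * ((n + a + 2) * poch (n + a + 3) k)) := by
        rw [← p1, div_eq_div_iff h6]
        · ring
        · rw [p1]; exact mul_ne_zero a1' (mul_ne_zero a2' h5)
      have q2 : fhKappa a b (n + 1 + 1) = fhKappa a b (n + 1) * (n + b + 1) / (n + a + 2) := by
        have := fhKappa_succ (b := b) ha (n + 1)
        push_cast at this
        rw [eq_div_iff a2']
        linear_combination this
      push_cast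
      rw [q2, p5, p4, p3, p2, Nat.factorial_succ, show (n:ℂ) + 1 + 1 = n + 2 by ring,
        show (n:ℂ) + 1 + a + 2 = n + a + 3 by ring,
        show b + 1 + (n:ℂ) = n + b + 1 by ring, show a + 1 + (n:ℂ) = n + a + 1 by ring]
      push_cast
      have lhs : fhKappa a b (n + 1) * (fhNorm a b n * (-b * poch (1 - b) k) *
            ((n + 1) * poch (n + 2) k) / (((k:ℂ) + 1) * k.factorial * poch (n + a + 1) (k + 1))) =
          fhKappa a b (n + 1) * (fhNorm a b n * (-b * poch (1 - b) k) *
            ((n + 1) * poch (n + 2) k) / (((k:ℂ) + 1) * k.factorial)) *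
              (1 / poch (n + a + 1) (k + 1)) := by
        field_simp
      rw [lhs, q1]
      field_simp
      ring
end

/-- The second kind function of the model weight. -/
noncomputable def fhSnd (a b : ℂ) (n : ℕ) (z : ℂ) : ℂ :=
  cauchyT (fun s => fhPhi a b n s * fhWeight a b s * s ^ (-(n : ℤ))) z

lemma HasSum.of_eq {f g : ℕ → ℂ} {S : ℂ} (h : HasSum f S) (hfg : ∀ k, f k = g k) :
    HasSum g S :=
  (funext hfg : f = g) ▸ h

lemma norm_one_sub_cpow_le (x : ℂ) : ∃ C : ℝ, 0 ≤ C ∧ ∃ M : ℕ, ∀ w : ℂ, ‖w‖ < 1 →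
    ‖(1 - w) ^ (-x)‖ ≤ C * ((1 - ‖w‖)⁻¹) ^ M := by
  obtain ⟨M, hM⟩ := norm_poch_div_factorial_le x
  refine ⟨1 * M.factorial, by positivity, M + 1, fun w hw => ?_⟩
  have := norm_hasSum_sub_le (v := fun _ => 0) zero_le_one
    (fun k => by rw [sub_zero, one_mul]; exact hM k) hw (hasSum_poch x hw)
    (V := 0) (by simp [hasSum_zero])
  simpa using this

lemma ascending_series_bound (x : ℂ) {y : ℂ} (hy : -(1 / 2) < y.re) :
    ∃ C : ℝ, 0 ≤ C ∧ ∃ M : ℕ, ∀ (n : ℕ) (z U : ℂ), ‖z‖ < 1 →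
      HasSum (fun k : ℕ => z ^ k *
        (poch x k / k.factorial * (poch (n + 1) k / poch (n + 1 + y) k))) U →
      ‖U - (1 - z) ^ (-x)‖ ≤ C * ((1 - ‖z‖)⁻¹) ^ M / (n + 1) := by
  obtain ⟨C, hC, M, hM⟩ := ascending_ratio_bound (-y) hy
  obtain ⟨M', hM'⟩ := norm_poch_div_factorial_le x
  refine ⟨C * (M' + M).factorial, by positivity, M' + M + 1, fun n z U hz hU => ?_⟩
  have key : ∀ k : ℕ, poch (n + 1) k / poch (n + 1 + y) k =
      ∏ i ∈ Finset.range k, (1 + -y / (((n + 1 + i : ℕ) : ℂ) + y)) := fun k => by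
    rw [poch, poch, ← Finset.prod_div_distrib]
    refine Finset.prod_congr rfl fun i _ => ?_
    have h0 : (((n + 1 + i : ℕ) : ℂ) + y) ≠ 0 := fun h => by
      have := congrArg Complex.re h
      simp at this
      have h1 : (0 : ℝ) ≤ n := by positivity
      have h2 : (0 : ℝ) ≤ i := by positivity
      linarith
    have e : ((n : ℂ) + 1 + y + i) = (((n + 1 + i : ℕ) : ℂ) + y) := by push_cast; ring
    rw [e]
    field_simp
    push_cast
    ring
  have := norm_hasSum_sub_le (ε := C / (n + 1)) (M := M' + M) (by positivity) (fun k => ?_) hz hU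
    (hasSum_poch x hz)
  · exact this.trans (le_of_eq (by ring))
  · rw [key]
    have e : ∀ p q : ℂ, p * q - p = p * (q - 1) := fun p q => by ring
    rw [e, norm_mul, pow_add]
    calc _ ≤ ((k : ℝ) + 1) ^ M' * (C * ((k : ℝ) + 1) ^ M / (n + 1)) := by
          gcongr
          · exact hM' k
          · exact hM n k
      _ = _ := by ring

lemma circleIntegrable_fhSnd {a b : ℂ} (hab : -1 < (a + b).re) (n : ℕ) :
    CircleIntegrable (fun s => fhPhi a b n s * fhWeight a b s * s ^ (-(n : ℤ))) 0 1 :=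
  (circleIntegrable_fhPhi_mul hab n).mul_zpow _

section

variable {a b : ℂ}

lemma fhSnd_inside (ha : -(1 / 2) < a.re) (hb : -(1 / 2) < b.re) :
    ∃ C : ℝ, 0 ≤ C ∧ ∃ M : ℕ, ∀ (n : ℕ) (z : ℂ), ‖z‖ < 1 →
      ‖fhSnd a b n z - fhNorm a b n * (1 - z) ^ a‖ ≤
        ‖fhNorm a b n‖ * (C * ((1 - ‖z‖)⁻¹) ^ M / (n + 1)) := by
  obtain ⟨C, hC, M, h⟩ := ascending_series_bound (-a) hb
  refine ⟨C, hC, M, fun n z hz => ?_⟩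
  have hab : -1 < (a + b).re := by rw [Complex.add_re]; linarith
  have hs := hasSum_cauchyT_of_lt (circleIntegrable_fhSnd hab n) hz
  rw [← fhSnd] at hs
  have e : ∀ k : ℕ, mom (fun s => fhPhi a b n s * fhWeight a b s * s ^ (-(n : ℤ))) k =
      fhNorm a b n * (poch (-a) k / k.factorial * (poch (n + 1) k / poch (n + 1 + b) k)) := by
    intro k
    rw [mom_mul_zpow, show (k : ℤ) - -(n : ℤ) = n + k by ring]
    refine ((fhMom_eq n ha hb).1 k).trans ?_
    rw [show (n : ℂ) + b + 1 = n + 1 + b by ring]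
    ring
  by_cases h0 : fhNorm a b n = 0
  · have : fhSnd a b n z = 0 := by
      refine hs.unique ?_
      simp only [e, h0, zero_mul, mul_zero]
      exact hasSum_zero
    simp [h0, this]
  have hs' := hs.mul_left (fhNorm a b n)⁻¹
  have hs'' := h n z ((fhNorm a b n)⁻¹ * fhSnd a b n z) hz
    (hs'.of_eq fun k => by rw [e]; field_simp)
  rw [neg_neg] at hs''
  calc _ = ‖fhNorm a b n * ((fhNorm a b n)⁻¹ * fhSnd a b n z - (1 - z) ^ a)‖ := by
        congr 1; field_simp
    _ ≤ _ := by rw [norm_mul]; gcongr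

lemma cauchyT_fhPhi_mul (ha : -(1 / 2) < a.re) (hb : -(1 / 2) < b.re) (n : ℕ) {z : ℂ}
    (hz : ‖z‖ ≠ 1) :
    cauchyT (fun s => fhPhi a b n s * fhWeight a b s) z = z ^ n * fhSnd a b n z := by
  have hab : -1 < (a + b).re := by rw [Complex.add_re]; linarith
  rw [cauchyT_eq_sum_add (circleIntegrable_fhPhi_mul hab n) hz n, Finset.sum_eq_zero, zero_add,
    fhSnd]
  intro k hk
  have := (fhMom_eq n ha hb).2.1 k (by positivity) (by exact_mod_cast Finset.mem_range.1 hk)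
  rw [fhMom] at this
  rw [this, mul_zero]

lemma fhSnd_outside (ha : -(1 / 2) < a.re) (hb : -(1 / 2) < b.re) :
    ∃ C : ℝ, 0 ≤ C ∧ ∃ M : ℕ, ∀ (n : ℕ) (z : ℂ), 1 < ‖z‖ →
      ‖z ^ n * fhSnd a b n z - fhKappa a b (n + 1) * fhNorm a b n *
        (z⁻¹ * (1 - z⁻¹) ^ (b - 1))‖ ≤
        ‖fhKappa a b (n + 1)‖ * ‖fhNorm a b n‖ * (C * ((1 - ‖z⁻¹‖)⁻¹) ^ M / (n + 1)) := by
  have ha1 : -(1 / 2) < (a + 1).re := by simp; linarith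
  obtain ⟨C, hC, M, h⟩ := ascending_series_bound (1 - b) ha1
  refine ⟨C, hC, M, fun n z hz => ?_⟩
  have hzi : ‖z⁻¹‖ < 1 := by rw [norm_inv]; exact inv_lt_one_of_one_lt₀ hz
  have hz0 : z ≠ 0 := by rintro rfl; simp at hz; linarith
  have hab : -1 < (a + b).re := by rw [Complex.add_re]; linarith
  have hs := (hasSum_cauchyT_of_gt (circleIntegrable_fhPhi_mul hab n) hz).neg
  rw [neg_neg, cauchyT_fhPhi_mul ha hb n hz.ne'] at hs
  set q := fhKappa a b (n + 1) * fhNorm a b n with hq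
  have e : ∀ k : ℕ, -(z⁻¹ ^ (k + 1) *
      mom (fun s => fhPhi a b n s * fhWeight a b s) (-(k + 1 : ℤ))) =
      q * (z⁻¹ * (z⁻¹ ^ k *
        (poch (1 - b) k / k.factorial * (poch (n + 1) k / poch (n + 1 + (a + 1)) k)))) := by
    intro k
    have := (fhMom_eq n ha hb).2.2 k
    rw [fhMom, show (-1 - k : ℤ) = -(k + 1 : ℤ) by ring] at this
    rw [this, show (n : ℂ) + a + 2 = n + 1 + (a + 1) by ring, hq]
    ring
  simp only [e] at hs
  rw [← norm_mul, ← hq]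
  by_cases h0 : q = 0
  · have : z ^ n * fhSnd a b n z = 0 := by
      refine hs.unique ?_
      simp only [h0, zero_mul]
      exact hasSum_zero
    simp [h0, this]
  have hs' := (hs.mul_left q⁻¹).mul_left z
  have hs'' := h n z⁻¹ (z * (q⁻¹ * (z ^ n * fhSnd a b n z))) hzi
    (hs'.of_eq fun k => by field_simp)
  rw [neg_sub] at hs''
  calc _ = ‖q * z⁻¹ * (z * (q⁻¹ * (z ^ n * fhSnd a b n z)) - (1 - z⁻¹) ^ (b - 1))‖ := by
        congr 1; field_simp
    _ ≤ ‖q‖ * 1 * (C * ((1 - ‖z⁻¹‖)⁻¹) ^ M / (n + 1)) := by rw [norm_mul, norm_mul]; gcongr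
    _ = _ := by rw [mul_one]

lemma descending_poch (c : ℂ) (n : ℕ) : ∀ k : ℕ, k ≤ n →
    (∀ i < k, c + ((n - 1 - i : ℕ) : ℂ) ≠ 0) →
    (k.factorial * n.choose k : ℂ) * poch c (n - k) =
      poch c n * ∏ i ∈ Finset.range k, (((n - i : ℕ) : ℂ) / (c + ((n - 1 - i : ℕ) : ℂ))) := by
  intro k
  induction k with
  | zero => intro _ _; simp
  | succ k ih =>
    intro hk hc
    have h1 := ih (by omega) fun i hi => hc i (by omega)
    have h2 := hc k (by omega)
    obtain ⟨m, rfl⟩ : ∃ m, n = k + 1 + m := ⟨n - (k + 1), by omega⟩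
    have e1 : k + 1 + m - k = m + 1 := by omega
    have e2 : k + 1 + m - (k + 1) = m := by omega
    have e3 : k + 1 + m - 1 - k = m := by omega
    have h3 : ((k + 1 + m).choose (k + 1) * (k + 1) : ℂ) = (k + 1 + m).choose k * (m + 1) := by
      have := Nat.choose_succ_right_eq (k + 1 + m) k
      rw [e1] at this
      exact_mod_cast this
    rw [e3] at h2
    rw [e1, poch_succ] at h1
    rw [Finset.prod_range_succ, ← mul_assoc, ← h1, e1, e2, e3, Nat.factorial_succ]
    push_cast
    field_simp
    linear_combination k.factorial * poch c m * h3

lemma fhPhi_outside (ha : -(1 / 2) < a.re) (b : ℂ) :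
    ∃ C : ℝ, 0 ≤ C ∧ ∃ M : ℕ, ∀ (n : ℕ) (z : ℂ), 1 < ‖z‖ →
      ‖fhPhi a b n z * z⁻¹ ^ n - (1 - z⁻¹) ^ (-b)‖ ≤ C * ((1 - ‖z⁻¹‖)⁻¹) ^ M / (n + 1) := by
  obtain ⟨C, hC, M, hM⟩ := descending_ratio_bound (-a) ha
  obtain ⟨M', hM'⟩ := norm_poch_div_factorial_le b
  refine ⟨(C + 1) * (M' + M + 1).factorial, by positivity, M' + M + 1 + 1, fun n z hz => ?_⟩
  have hzi : ‖z⁻¹‖ < 1 := by rw [norm_inv]; exact inv_lt_one_of_one_lt₀ hz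
  have hz0 : z ≠ 0 := by rintro rfl; simp at hz; linarith
  have hS : HasSum (fun k : ℕ => z⁻¹ ^ k * (if k ≤ n then fhCoeff a b n (n - k) else 0))
      (fhPhi a b n z * z⁻¹ ^ n) := by
    have : fhPhi a b n z * z⁻¹ ^ n = ∑ k ∈ Finset.range (n + 1),
        z⁻¹ ^ k * (if k ≤ n then fhCoeff a b n (n - k) else 0) := by
      rw [fhPhi, ← Finset.sum_range_reflect, Finset.sum_mul]
      refine Finset.sum_congr rfl fun k hk => ?_
      have hk' : k ≤ n := by have := Finset.mem_range.1 hk; omega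
      rw [if_pos hk', show n + 1 - 1 - k = n - k by omega]
      have : z⁻¹ ^ n = z⁻¹ ^ k * z⁻¹ ^ (n - k) := by rw [← pow_add]; congr 1; omega
      rw [this, inv_pow z (n - k)]
      field_simp
    rw [this]
    refine hasSum_sum_of_ne_finset_zero fun k hk => ?_
    rw [if_neg (by simpa using hk), mul_zero]
  have hn : (0 : ℝ) < n + 1 := by positivity
  have := norm_hasSum_sub_le (ε := (C + 1) / (n + 1)) (M := M' + M + 1) (by positivity)
    (fun k => ?_) hzi hS (hasSum_poch b hzi)
  · exact this.trans (le_of_eq (by ring))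
  have hk1 : (1 : ℝ) ≤ (k : ℝ) + 1 := by have : (0 : ℝ) ≤ k := by positivity
                                         linarith
  split_ifs with hk
  · have h0 : ∀ i < k, (a + 1) + ((n - 1 - i : ℕ) : ℂ) ≠ 0 := fun i _ =>
      add_nat_ne_zero (by simp; linarith) _
    have h1 := descending_poch (a + 1) n k hk h0
    have h2 : fhCoeff a b n (n - k) = poch b k / k.factorial *
        ∏ i ∈ Finset.range k, (1 + -a / (((n - i : ℕ) : ℂ) + a)) := by
      have h3 : ∏ i ∈ Finset.range k, (1 + -a / (((n - i : ℕ) : ℂ) + a)) =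
          ∏ i ∈ Finset.range k, (((n - i : ℕ) : ℂ) / ((a + 1) + ((n - 1 - i : ℕ) : ℂ))) := by
        refine Finset.prod_congr rfl fun i hi => ?_
        have hi' := Finset.mem_range.1 hi
        have h4 := h0 i hi'
        have e : (a + 1) + ((n - 1 - i : ℕ) : ℂ) = ((n - i : ℕ) : ℂ) + a := by
          rw [show n - i = n - 1 - i + 1 by omega]; push_cast; ring
        rw [e] at h4 ⊢
        field_simp
        ring
      have h5 : poch (a + 1) n ≠ 0 := poch_ne_zero (by simp; linarith) n
      have h6 : (k.factorial : ℂ) ≠ 0 := by exact_mod_cast k.factorial_ne_zero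
      rw [h3, fhCoeff, Nat.sub_sub_self hk, Nat.choose_symm hk]
      field_simp
      linear_combination poch b k * h1
    have e : ∀ p q : ℂ, p * q - p = p * (q - 1) := fun p q => by ring
    rw [h2, e, norm_mul]
    calc _ ≤ ((k : ℝ) + 1) ^ M' * (C * ((k : ℝ) + 1) ^ M / (n + 1)) := by
          gcongr
          · exact hM' k
          · exact hM n k hk
      _ = C / (n + 1) * ((k : ℝ) + 1) ^ (M' + M) := by ring
      _ ≤ (C + 1) / (n + 1) * ((k : ℝ) + 1) ^ (M' + M + 1) := by
          refine mul_le_mul ?_ (pow_le_pow_right₀ hk1 (by omega)) (by positivity) (by positivity)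
          gcongr
          linarith
  · have hkn : (n : ℝ) + 1 ≤ k + 1 := by
      have : n ≤ k := by omega
      gcongr
    rw [zero_sub, norm_neg]
    calc _ ≤ ((k : ℝ) + 1) ^ M' * 1 := by rw [mul_one]; exact hM' k
      _ ≤ ((k : ℝ) + 1) ^ (M' + M) * ((C + 1) / (n + 1) * (k + 1)) := by
          gcongr
          · omega
          · rw [div_mul_eq_mul_div, le_div_iff₀ hn]
            nlinarith
      _ = _ := by ring

lemma fhPhi_inside (ha : -(1 / 2) < a.re) (hb : -(1 / 2) < b.re)
    (hκ : ∃ K : ℝ, ∀ n, ‖fhKappa a b n‖ ≤ K / (n + 1)) :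
    ∃ C : ℝ, 0 ≤ C ∧ ∃ M : ℕ, ∀ (n : ℕ) (z : ℂ), ‖z‖ < 1 →
      ‖fhPhi a b n z - fhKappa a b n * (1 - z) ^ (-(a + 1))‖ ≤
        C * ((1 - ‖z‖)⁻¹) ^ M / (n + 1) ^ 2 := by
  obtain ⟨K, hK⟩ := hκ
  obtain ⟨C, hC, M, hM⟩ := descending_ratio_bound (1 - b) hb
  obtain ⟨M', hM'⟩ := norm_poch_div_factorial_le (a + 1)
  have hK0 : 0 ≤ K := by have := (norm_nonneg _).trans (hK 0); simpa using this
  refine ⟨(2 * K * C + 1 + K) * (M' + M + 2).factorial, by positivity, M' + M + 2 + 1,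
    fun n z hz => ?_⟩
  have hS : HasSum (fun k : ℕ => z ^ k * (if k ≤ n then fhCoeff a b n k else 0))
      (fhPhi a b n z) := by
    have : fhPhi a b n z = ∑ k ∈ Finset.range (n + 1),
        z ^ k * (if k ≤ n then fhCoeff a b n k else 0) := by
      rw [fhPhi]
      refine Finset.sum_congr rfl fun k hk => ?_
      have hk' : k ≤ n := by have := Finset.mem_range.1 hk; omega
      rw [if_pos hk', mul_comm]
    rw [this]
    refine hasSum_sum_of_ne_finset_zero fun k hk => ?_
    rw [if_neg (by simpa using hk), mul_zero]
  have hV : HasSum (fun k : ℕ => z ^ k * (fhKappa a b n * (poch (a + 1) k / k.factorial)))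
      (fhKappa a b n * (1 - z) ^ (-(a + 1))) := by
    exact ((hasSum_poch (a + 1) hz).mul_left (fhKappa a b n)).of_eq fun k => by ring
  have hn : (0 : ℝ) < n + 1 := by positivity
  have := norm_hasSum_sub_le (ε := (2 * K * C + 1 + K) / (n + 1) ^ 2) (M := M' + M + 2)
    (by positivity) (fun k => ?_) hz hS hV
  · exact this.trans (le_of_eq (by ring))
  have hk1 : (1 : ℝ) ≤ (k : ℝ) + 1 := by have : (0 : ℝ) ≤ k := by positivity
                                         linarith
  rcases lt_or_ge k n with hk | hk
  · rw [if_pos hk.le]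
    have h0 : ∀ i < k, b + ((n - 1 - i : ℕ) : ℂ) ≠ 0 := fun i hi => by
      rw [show n - 1 - i = n - 2 - i + 1 by omega]
      push_cast
      rw [add_comm (_ : ℂ) 1, ← add_assoc]
      exact add_nat_ne_zero (by simp; linarith) _
    have h1 := descending_poch b n k hk.le h0
    have h2 : fhCoeff a b n k = fhKappa a b n * (poch (a + 1) k / k.factorial) *
        ∏ i ∈ Finset.range k, (1 + (1 - b) / (((n - 1 - i : ℕ) : ℂ) + b)) := by
      have h3 : ∏ i ∈ Finset.range k, (1 + (1 - b) / (((n - 1 - i : ℕ) : ℂ) + b)) =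
          ∏ i ∈ Finset.range k, (((n - i : ℕ) : ℂ) / (b + ((n - 1 - i : ℕ) : ℂ))) := by
        refine Finset.prod_congr rfl fun i hi => ?_
        have hi' := Finset.mem_range.1 hi
        have h4 := h0 i hi'
        rw [add_comm _ b, show n - i = n - 1 - i + 1 by omega]
        field_simp
        push_cast
        ring
      have h5 : poch (a + 1) n ≠ 0 := poch_ne_zero (by simp; linarith) n
      have h6 : (k.factorial : ℂ) ≠ 0 := by exact_mod_cast k.factorial_ne_zero
      rw [h3, fhCoeff, fhKappa]
      field_simp
      linear_combination poch (a + 1) k * h1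
    have e : ∀ p q : ℂ, p * q - p = p * (q - 1) := fun p q => by ring
    rw [h2, e, norm_mul, norm_mul]
    have hn1 : ((n - 1 : ℕ) : ℝ) + 1 = n := by
      have : n - 1 + 1 = n := by omega
      exact_mod_cast this
    have hn0 : (1 : ℝ) ≤ n := by exact_mod_cast (by omega : 1 ≤ n)
    have hd := hM (n - 1) k (by omega)
    rw [hn1] at hd
    calc _ ≤ (K / (n + 1)) * ((k : ℝ) + 1) ^ M' * (C * ((k : ℝ) + 1) ^ M / n) := by
          gcongr
          · exact hK n
          · exact hM' k
      _ ≤ (K / (n + 1)) * ((k : ℝ) + 1) ^ M' * (C * ((k : ℝ) + 1) ^ M / ((n + 1) / 2)) := by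
          gcongr
          linarith
      _ = 2 * K * C / (n + 1) ^ 2 * ((k : ℝ) + 1) ^ (M' + M) := by field_simp; ring
      _ ≤ (2 * K * C + 1 + K) / (n + 1) ^ 2 * ((k : ℝ) + 1) ^ (M' + M + 2) := by
          refine mul_le_mul ?_ (pow_le_pow_right₀ hk1 (by omega)) (by positivity) (by positivity)
          gcongr
          linarith
  · have hkn : (n : ℝ) + 1 ≤ k + 1 := by gcongr
    have h1 : ‖if k ≤ n then fhCoeff a b n k else 0‖ ≤ 1 := by
      split_ifs with h
      · rw [le_antisymm h hk, fhCoeff_self ha, norm_one]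
      · simp
    have h2 : K / (n + 1 : ℝ) ≤ K := div_le_self hK0 (by linarith [(by positivity : (0 : ℝ) ≤ n)])
    have h3 : (1 : ℝ) ≤ ((k : ℝ) + 1) ^ M' := one_le_pow₀ hk1
    calc _ ≤ 1 + K * ((k : ℝ) + 1) ^ M' := by
          refine (norm_sub_le _ _).trans (add_le_add h1 ?_)
          rw [norm_mul]
          gcongr
          · exact (hK n).trans h2
          · exact hM' k
      _ ≤ (2 * K * C + 1 + K) * ((k : ℝ) + 1) ^ M' := by
          have : 0 ≤ 2 * K * C * ((k : ℝ) + 1) ^ M' := by positivity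
          nlinarith
      _ ≤ (2 * K * C + 1 + K) * ((k : ℝ) + 1) ^ (M' + M) * 1 := by
          rw [mul_one]
          gcongr
          · omega
      _ ≤ (2 * K * C + 1 + K) * ((k : ℝ) + 1) ^ (M' + M) * (((k : ℝ) + 1) ^ 2 / (n + 1) ^ 2) := by
          gcongr
          rw [one_le_div (by positivity)]
          gcongr
      _ = _ := by ring

end

lemma exists_limit_of_ratio {x : ℕ → ℂ} {K : ℝ}
    (h : ∀ n : ℕ, ‖x (n + 1) - x n‖ ≤ K / (n + 1) ^ 2 * ‖x n‖) :
    ∃ L : ℂ, ∃ C : ℝ, ∀ n : ℕ, ‖x n - L‖ ≤ C / (n + 1) := by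
  have hK' : ∀ n : ℕ, ‖x (n + 1) - x n‖ ≤ |K| / (n + 1) ^ 2 * ‖x n‖ := fun n =>
    (h n).trans (by gcongr; exact le_abs_self K)
  set K' := |K|
  have hK : 0 ≤ K' := abs_nonneg K
  have tele : ∀ n : ℕ, 1 / ((n : ℝ) + 1) ^ 2 ≤ 2 * (1 / (n + 1) - 1 / (n + 2)) := fun n => by
    have hn : (0 : ℝ) ≤ n := by positivity
    rw [div_sub_div _ _ (by positivity) (by positivity), ← mul_div_assoc,
      div_le_div_iff₀ (by positivity) (by positivity)]
    nlinarith
  set B := ‖x 0‖ * Real.exp (2 * K') with hB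
  have hb : ∀ n : ℕ, ‖x n‖ ≤ ‖x 0‖ * Real.exp (2 * K' * (1 - 1 / (n + 1))) := by
    intro n
    induction n with
    | zero => simp
    | succ n ih =>
      have h1 : ‖x (n + 1)‖ ≤ (1 + K' / (n + 1) ^ 2) * ‖x n‖ := by
        have := norm_add_le (x (n + 1) - x n) (x n)
        rw [sub_add_cancel] at this
        linarith [hK' n]
      have h2 : 1 + K' / ((n : ℝ) + 1) ^ 2 ≤
          Real.exp (2 * K' * (1 / (n + 1) - 1 / (n + 2))) := by
        have := Real.add_one_le_exp (2 * K' * (1 / ((n : ℝ) + 1) - 1 / (n + 2)))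
        have h3 := mul_le_mul_of_nonneg_left (tele n) hK
        have h4 : K' / ((n : ℝ) + 1) ^ 2 = K' * (1 / (n + 1) ^ 2) := by ring
        linarith
      calc _ ≤ _ := h1
        _ ≤ Real.exp (2 * K' * (1 / (n + 1) - 1 / (n + 2))) *
            (‖x 0‖ * Real.exp (2 * K' * (1 - 1 / (n + 1)))) := by gcongr
        _ = ‖x 0‖ * (Real.exp (2 * K' * (1 / (n + 1) - 1 / (n + 2))) *
            Real.exp (2 * K' * (1 - 1 / (n + 1)))) := by ring
        _ = _ := by
          rw [← Real.exp_add]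
          congr 2
          push_cast
          rw [add_assoc, show (1 : ℝ) + 1 = 2 by norm_num]
          ring
  have hb' : ∀ n : ℕ, ‖x n‖ ≤ B := fun n => (hb n).trans (by
    have : 0 ≤ 1 / ((n : ℝ) + 1) := by positivity
    refine mul_le_mul_of_nonneg_left (Real.exp_le_exp.2 ?_) (norm_nonneg _)
    exact mul_le_of_le_one_right (by positivity) (by linarith))
  have hB0 : 0 ≤ B := by positivity
  have hstep : ∀ n : ℕ, ‖x (n + 1) - x n‖ ≤ 2 * B * K' * (1 / (n + 1) - 1 / (n + 2)) := fun n => by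
    calc _ ≤ K' / (n + 1) ^ 2 * ‖x n‖ := hK' n
      _ ≤ K' / (n + 1) ^ 2 * B := by gcongr; exact hb' n
      _ = K' * B * (1 / (n + 1) ^ 2) := by ring
      _ ≤ K' * B * (2 * (1 / (n + 1) - 1 / (n + 2))) := by gcongr; exact tele n
      _ = _ := by ring
  have hdiff : ∀ n k : ℕ, ‖x (n + k) - x n‖ ≤ 2 * B * K' * (1 / (n + 1) - 1 / (n + k + 1)) := by
    intro n k
    induction k with
    | zero => simp
    | succ k ih =>
      have := norm_add_le (x (n + k + 1) - x (n + k)) (x (n + k) - x n)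
      rw [sub_add_sub_cancel] at this
      have h3 := hstep (n + k)
      push_cast at h3 ⊢
      rw [← add_assoc n k 1]
      calc _ ≤ _ := this.trans (add_le_add h3 ih)
        _ = _ := by
          rw [show (n : ℝ) + (k + 1) + 1 = n + k + 2 by ring]
          ring
  have hdiff' : ∀ n k : ℕ, ‖x (n + k) - x n‖ ≤ 2 * B * K' / (n + 1) := fun n k =>
    (hdiff n k).trans (by
      have : 0 ≤ 1 / ((n : ℝ) + k + 1) := by positivity
      calc _ ≤ 2 * B * K' * (1 / (n + 1)) := by gcongr; linarith
        _ = _ := by ring)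
  have hC : CauchySeq x := by
    refine cauchySeq_of_le_tendsto_0' (fun n : ℕ => 2 * B * K' / (n + 1)) (fun n m hnm => ?_) ?_
    · obtain ⟨k, rfl⟩ := Nat.exists_eq_add_of_le hnm
      rw [dist_comm, dist_eq_norm]
      exact hdiff' n k
    · have := (tendsto_one_div_add_atTop_nhds_zero_nat (𝕜 := ℝ)).const_mul (2 * B * K')
      simpa only [mul_one_div, mul_zero] using this
  obtain ⟨L, hL⟩ := cauchySeq_tendsto_of_complete hC
  refine ⟨L, 2 * B * K', fun n => ?_⟩
  have h1 : Tendsto (fun k : ℕ => ‖x (n + k) - x n‖) atTop (nhds ‖L - x n‖) := by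
    refine ((hL.comp (tendsto_add_atTop_nat n)).sub_const _).norm.congr fun k => ?_
    simp [add_comm]
  rw [norm_sub_rev]
  exact le_of_tendsto h1 (Eventually.of_forall fun k => hdiff' n k)

lemma cauchyT_one_of_lt {z : ℂ} (hz : ‖z‖ < 1) : cauchyT (fun _ => 1) z = 1 := by
  rw [cauchyT]
  simp only [mul_one]
  rw [circleIntegral.integral_sub_inv_of_mem_ball (by simpa using hz),
    inv_mul_cancel₀ two_pi_I_ne]

lemma cauchyT_one_of_gt {z : ℂ} (hz : 1 < ‖z‖) : cauchyT (fun _ => 1) z = 0 := by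
  rw [cauchyT]
  have hne : ∀ w ∈ Metric.closedBall (0 : ℂ) 1, w - z ≠ 0 := fun w hw h => by
    rw [sub_eq_zero] at h
    subst h
    simp at hw
    linarith
  rw [Complex.circleIntegral_eq_zero_of_differentiable_on_off_countable zero_le_one
    Set.countable_empty, mul_zero]
  · simp only [mul_one]
    exact ContinuousOn.inv₀ (by fun_prop) hne
  · intro w hw
    have := hne w (Metric.ball_subset_closedBall hw.1)
    fun_prop (disch := assumption)

/-- A distance-to-circle weight invariant under inversion. -/
noncomputable def symWt (z : ℂ) : ℝ := (1 - min ‖z‖ ‖z⁻¹‖)⁻¹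

lemma symWt_inv (z : ℂ) : symWt z⁻¹ = symWt z := by rw [symWt, symWt, inv_inv, min_comm]

lemma symWt_of_lt {z : ℂ} (hz : ‖z‖ < 1) (h0 : z ≠ 0) : symWt z = (1 - ‖z‖)⁻¹ := by
  rw [symWt, min_eq_left]
  rw [norm_inv]
  have := norm_pos_iff.2 h0
  exact hz.le.trans ((one_le_inv₀ this).2 hz.le)

lemma symWt_of_gt {z : ℂ} (hz : 1 < ‖z‖) : symWt z = (1 - ‖z⁻¹‖)⁻¹ := by
  rw [symWt, min_eq_right]
  rw [norm_inv]
  exact (inv_le_one_of_one_le₀ hz.le).trans hz.le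

lemma symWt_le_wt {z : ℂ} (hz : ‖z‖ ≠ 1) (h0 : z ≠ 0) : symWt z ≤ wt z := by
  rcases lt_or_gt_of_ne hz with h | h
  · rw [symWt_of_lt h h0, wt, abs_sub_comm, abs_of_pos (by linarith)]
    linarith
  · rw [symWt_of_gt h, wt, abs_of_pos (by linarith), norm_inv]
    refine le_of_eq ?_
    have h1 : ‖z‖ ≠ 0 := by positivity
    have h2 : ‖z‖ - 1 ≠ 0 := by linarith
    field_simp
    ring

lemma one_le_symWt {z : ℂ} (hz : ‖z‖ ≠ 1) : 1 ≤ symWt z := by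
  by_cases h0 : z = 0
  · simp [h0, symWt]
  rcases lt_or_gt_of_ne hz with h | h
  · rw [symWt_of_lt h h0]
    exact (one_le_inv₀ (by linarith)).2 (by linarith [norm_nonneg z])
  · rw [symWt_of_gt h]
    have : ‖z⁻¹‖ < 1 := by rw [norm_inv]; exact inv_lt_one_of_one_lt₀ h
    exact (one_le_inv₀ (by linarith)).2 (by linarith [norm_nonneg z⁻¹])

section

variable {a b : ℂ}

lemma one_sub_mem_slitPlane_of_re_neg {z : ℂ} (hz : z.re < 0) : 1 - z ∈ Complex.slitPlane :=
  Or.inl (by rw [Complex.sub_re, Complex.one_re]; linarith)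

lemma one_sub_inv_mem_slitPlane_of_re_neg {z : ℂ} (hz : z.re < 0) :
    1 - z⁻¹ ∈ Complex.slitPlane := by
  refine one_sub_mem_slitPlane_of_re_neg ?_
  rw [Complex.inv_re]
  have : 0 < Complex.normSq z := Complex.normSq_pos.2 fun h => by simp [h] at hz
  exact div_neg_of_neg_of_pos hz this

lemma analyticAt_fhPlus (a : ℂ) {z : ℂ} (hz : 1 - z ∈ Complex.slitPlane) :
    AnalyticAt ℂ (fun z => (1 - z) ^ a) z := by
  exact (analyticAt_const.sub analyticAt_id).cpow analyticAt_const hz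

lemma analyticAt_fhMinus (b : ℂ) {z : ℂ} (h0 : z ≠ 0) (hz : 1 - z⁻¹ ∈ Complex.slitPlane) :
    AnalyticAt ℂ (fun z => (1 - z⁻¹) ^ b) z := by
  exact (analyticAt_const.sub (analyticAt_id.inv h0)).cpow analyticAt_const hz

/-- The function `z ↦ Y₁₂(z)`, continued through the unit circle from the inside. -/
lemma analyticAt_fhSnd_continuation (ha : -(1 / 2) < a.re) (hb : -(1 / 2) < b.re) (n : ℕ)
    {p : ℂ} (hp : p.re < 0) : AnalyticAt ℂ (extOff fun z => fhSnd a b n z + if ‖z‖ < 1 then 0 else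
      fhPhi a b n z * (1 - z) ^ a * (1 - z⁻¹) ^ b * z ^ (-(n : ℤ))) p := by
  have hab : -1 < (a + b).re := by rw [Complex.add_re]; linarith
  have hF := circleIntegrable_fhSnd hab n
  have hp0 : p ≠ 0 := by rintro rfl; simp at hp
  have hg : AnalyticAt ℂ (fun z => fhPhi a b n z * (1 - z) ^ a * (1 - z⁻¹) ^ b *
      z ^ (-(n : ℤ))) p := by
    refine ((((differentiable_fhPhi a b n).analyticAt p).mul
      (analyticAt_fhPlus a (one_sub_mem_slitPlane_of_re_neg hp))).mul
      (analyticAt_fhMinus b hp0 (one_sub_inv_mem_slitPlane_of_re_neg hp))).mul ?_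
    exact analyticAt_id.zpow hp0
  set g := fun z => fhPhi a b n z * (1 - z) ^ a * (1 - z⁻¹) ^ b * z ^ (-(n : ℤ))
  obtain ⟨e, he, h⟩ := exists_analyticAt_mul_cauchyT_sub (F' := fun _ => 1) (g := fun _ => 1)
    (g' := g) (p := p) 1 hF (circleIntegrable_const 1 0 1) analyticAt_const hg
    (Eventually.of_forall fun s _ _ => by simp only [g, fhWeight]; ring)
  refine analyticAt_extOff (e := fun z => e z + g z) (he.add hg) ?_
  filter_upwards [h] with z hz hz1
  have := hz hz1
  rw [one_mul] at this
  rcases lt_or_gt_of_ne hz1 with h1 | h1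
  · rw [if_pos h1, fhSnd, this, cauchyT_one_of_lt h1]; ring
  · rw [if_neg h1.not_gt, fhSnd, this, cauchyT_one_of_gt h1]; ring

lemma exists_limit_fhNorm (ha : -(1 / 2) < a.re) (hb : -(1 / 2) < b.re) :
    ∃ L : ℂ, ∃ C : ℝ, ∀ n : ℕ, ‖fhNorm a b n - L‖ ≤ C / (n + 1) := by
  refine exists_limit_of_ratio (K := 4 * ‖a * b‖) fun n => ?_
  have h1 : ∀ {x : ℂ}, -(1 / 2) < x.re → ((n : ℝ) + 1) / 2 ≤ ‖x + 1 + n‖ := fun {x} hx => by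
    have := half_le_norm_add hx (t := n + 1) (by linarith [(by positivity : (0 : ℝ) ≤ n)])
    refine this.trans (le_of_eq ?_)
    congr 1; push_cast; ring
  have hn : (0 : ℝ) < n + 1 := by positivity
  have ha0 : a + 1 + n ≠ 0 := norm_pos_iff.1 (lt_of_lt_of_le (by positivity) (h1 ha))
  have hb0 : b + 1 + n ≠ 0 := norm_pos_iff.1 (lt_of_lt_of_le (by positivity) (h1 hb))
  have e : fhNorm a b (n + 1) - fhNorm a b n =
      -(a * b) / ((a + 1 + n) * (b + 1 + n)) * fhNorm a b n := by
    rw [fhNorm_succ]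
    field_simp
    ring
  rw [e, norm_mul, norm_div, norm_neg]
  refine mul_le_mul_of_nonneg_right ?_ (norm_nonneg _)
  rw [norm_mul (a + 1 + n), div_le_div_iff₀ (by positivity) (by positivity)]
  have := mul_le_mul (h1 ha) (h1 hb) (by positivity) (norm_nonneg _)
  nlinarith [norm_nonneg (a * b)]

lemma norm_bounded_of_norm_sub_le {x : ℕ → ℂ} {L : ℂ} {C : ℝ}
    (h : ∀ n : ℕ, ‖x n - L‖ ≤ C / (n + 1)) : ∃ B : ℝ, 0 ≤ B ∧ ∀ n, ‖x n‖ ≤ B := by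
  have hC : 0 ≤ C := by have := (norm_nonneg _).trans (h 0); simpa using this
  refine ⟨‖L‖ + C, by positivity, fun n => ?_⟩
  have h1 := norm_add_le L (x n - L)
  rw [add_sub_cancel] at h1
  have h2 : C / ((n : ℝ) + 1) ≤ C := div_le_self hC (by linarith [(by positivity : (0 : ℝ) ≤ n)])
  linarith [h n]

lemma tendsto_of_norm_sub_le {x : ℕ → ℂ} {L : ℂ} {C : ℝ}
    (h : ∀ n : ℕ, ‖x n - L‖ ≤ C / (n + 1)) : Tendsto x atTop (nhds L) := by
  refine tendsto_iff_norm_sub_tendsto_zero.2 (squeeze_zero (fun _ => norm_nonneg _) h ?_)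
  have := (tendsto_one_div_add_atTop_nhds_zero_nat (𝕜 := ℝ)).const_mul C
  simpa only [mul_one_div, mul_zero] using this

lemma WO.of_bound {p : ℂ} {φ : ℕ → ℝ} (hφ : ∀ n, 0 ≤ φ n) {F : ℕ → ℂ → ℂ} {C : ℝ} {m : ℕ}
    (h : ∀ᶠ x : ℕ × ℂ in atTop ×ˢ nhds p, ‖x.2‖ ≠ 1 → ‖F x.1 x.2‖ ≤ C * (φ x.1 * wt x.2 ^ m)) :
    WO p φ F := by
  refine ⟨m, Asymptotics.IsBigO.of_bound C ?_⟩
  have h1 : atTop ×ˢ nhdsWithin p {z : ℂ | ‖z‖ ≠ 1} ≤ (atTop : Filter ℕ) ×ˢ nhds p :=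
    prod_mono_right _ nhdsWithin_le_nhds
  filter_upwards [h.filter_mono h1, tendsto_snd.eventually (self_mem_nhdsWithin)] with x hx hx1
  refine (hx hx1).trans_eq ?_
  have := one_le_wt x.2
  have := hφ x.1
  rw [Real.norm_of_nonneg (by positivity)]

theorem fhNorm_asymptotics (ha : -(1 / 2) < a.re) (hb : -(1 / 2) < b.re)
    (hκ : ∃ K : ℝ, ∀ n, ‖fhKappa a b n‖ ≤ K / (n + 1)) :
    ∃ C : ℝ, ∀ n : ℕ, ‖fhNorm a b n - 1‖ ≤ C / (n + 1) := by
  obtain ⟨L, C, hL⟩ := exists_limit_fhNorm ha hb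
  obtain ⟨B, hB0, hB⟩ := norm_bounded_of_norm_sub_le hL
  have hLt := tendsto_of_norm_sub_le hL
  obtain ⟨K, hK⟩ := hκ
  have hK0 : 0 ≤ K := by have := (norm_nonneg _).trans (hK 0); simpa using this
  suffices h1 : L = 1 from ⟨C, h1 ▸ hL⟩
  obtain ⟨C1, hC1, M1, hin⟩ := fhSnd_inside ha hb
  obtain ⟨C2, hC2, M2, hout⟩ := fhSnd_outside ha hb
  obtain ⟨C3, hC3, M3, hphi⟩ := fhPhi_outside ha b
  have hre : ((-1 : ℂ)).re < 0 := by simp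
  have hfp := (analyticAt_fhPlus a (one_sub_mem_slitPlane_of_re_neg hre)).continuousAt
  have hfm := (analyticAt_fhMinus b (by simp) (one_sub_inv_mem_slitPlane_of_re_neg hre)).continuousAt
  have hq : ContinuousAt (fun z : ℂ => z⁻¹ * (1 - z⁻¹) ^ (b - 1)) (-1) :=
    (continuousAt_inv₀ (by simp)).mul
      (analyticAt_fhMinus (b - 1) (by simp) (one_sub_inv_mem_slitPlane_of_re_neg hre)).continuousAt
  set W : ℕ → ℂ → ℂ := fun n z => fhSnd a b n z + if ‖z‖ < 1 then 0 else
      fhPhi a b n z * (1 - z) ^ a * (1 - z⁻¹) ^ b * z ^ (-(n : ℤ)) with hW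
  set D : ℕ → ℂ → ℂ := fun n z => extOff (W n) z - (1 - z) ^ a with hD
  have hDa : ∀ n (z : ℂ), z.re < 0 → AnalyticAt ℂ (D n) z := fun n z hz =>
    (analyticAt_fhSnd_continuation ha hb n hz).sub
      (analyticAt_fhPlus a (one_sub_mem_slitPlane_of_re_neg hz))
  obtain ⟨A, hA1, hS⟩ : ∃ A : ℝ, 1 ≤ A ∧ ∀ᶠ z : ℂ in nhds (-1), z.re < 0 ∧ ‖(1 - z) ^ a‖ ≤ A ∧
      ‖(1 - z⁻¹) ^ b‖ ≤ A ∧ ‖z⁻¹ * (1 - z⁻¹) ^ (b - 1)‖ ≤ A := by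
    refine ⟨max (max (‖(1 - (-1 : ℂ)) ^ a‖ + 1) (‖(1 - (-1 : ℂ)⁻¹) ^ b‖ + 1))
      (‖(-1 : ℂ)⁻¹ * (1 - (-1 : ℂ)⁻¹) ^ (b - 1)‖ + 1), ?_, ?_⟩
    · exact le_max_of_le_right (by linarith [norm_nonneg ((-1 : ℂ)⁻¹ * (1 - (-1 : ℂ)⁻¹) ^ (b - 1))])
    · filter_upwards [Complex.continuous_re.continuousAt.eventually (gt_mem_nhds hre),
        hfp.norm.eventually (gt_mem_nhds (lt_add_one _)),
        hfm.norm.eventually (gt_mem_nhds (lt_add_one _)),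
        hq.norm.eventually (gt_mem_nhds (lt_add_one _))] with z h0 h1 h2 h3
      exact ⟨h0, h1.le.trans ((le_max_left _ _).trans (le_max_left _ _)),
        h2.le.trans ((le_max_right _ _).trans (le_max_left _ _)), h3.le.trans (le_max_right _ _)⟩
  have hA0 : 0 ≤ A := by linarith
  set C' := B * C1 + (K * B * C2 + K * B * A + A * A * C3) with hC'
  have hwt : ∀ (z : ℂ) {i j : ℕ}, i ≤ j → wt z ^ i ≤ wt z ^ j := fun z i j hij =>
    pow_le_pow_right₀ (one_le_wt z) hij
  have hDin : ∀ (n : ℕ) (z : ℂ), z.re < 0 → ‖z‖ < 1 →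
      ‖D n z - (fhNorm a b n - 1) * (1 - z) ^ a‖ ≤ C' * wt z ^ (M1 + M2 + M3) / (n + 1) := by
    intro n z hzr hz
    have e : D n z - (fhNorm a b n - 1) * (1 - z) ^ a =
        fhSnd a b n z - fhNorm a b n * (1 - z) ^ a := by
      simp only [hD, hW]
      rw [extOff_of_ne _ hz.ne, if_pos hz]
      ring
    have hz0 : z ≠ 0 := by rintro rfl; simp at hzr
    have hw : (1 - ‖z‖)⁻¹ ≤ wt z := (symWt_of_lt hz hz0).symm.le.trans (symWt_le_wt hz.ne hz0)
    have hw0 : 0 ≤ (1 - ‖z‖)⁻¹ := inv_nonneg.2 (by linarith)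
    rw [e]
    calc _ ≤ _ := hin n z hz
      _ ≤ B * (C1 * wt z ^ M1 / (n + 1)) := by gcongr; exact hB n
      _ = B * C1 * wt z ^ M1 / (n + 1) := by ring
      _ ≤ _ := by
        have := one_le_wt z
        gcongr ?_ / _
        refine mul_le_mul ?_ (hwt z (by omega)) (by positivity) (by positivity)
        rw [hC']
        have : 0 ≤ K * B * C2 + K * B * A + A * A * C3 := by positivity
        linarith
  have hDout : ∀ (n : ℕ) (z : ℂ), z.re < 0 → ‖(1 - z) ^ a‖ ≤ A → ‖(1 - z⁻¹) ^ b‖ ≤ A →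
      ‖z⁻¹ * (1 - z⁻¹) ^ (b - 1)‖ ≤ A → 1 < ‖z‖ →
      ‖D n z‖ ≤ C' * wt z ^ (M1 + M2 + M3) / (n + 1) := by
    intro n z hzr h1 h2 h3 hz
    have hz0 : z ≠ 0 := by rintro rfl; simp at hzr
    have hw : (1 - ‖z⁻¹‖)⁻¹ ≤ wt z := (symWt_of_gt hz).symm.le.trans (symWt_le_wt hz.ne' hz0)
    have hzi : ‖z⁻¹‖ < 1 := by rw [norm_inv]; exact inv_lt_one_of_one_lt₀ hz
    have hw0 : 0 ≤ (1 - ‖z⁻¹‖)⁻¹ := inv_nonneg.2 (by linarith)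
    have hsl := one_sub_inv_mem_slitPlane_of_re_neg hzr
    have e : D n z = z⁻¹ ^ n * ((z ^ n * fhSnd a b n z - fhKappa a b (n + 1) * fhNorm a b n *
        (z⁻¹ * (1 - z⁻¹) ^ (b - 1))) + fhKappa a b (n + 1) * fhNorm a b n *
        (z⁻¹ * (1 - z⁻¹) ^ (b - 1))) + (1 - z) ^ a * ((1 - z⁻¹) ^ b *
          (fhPhi a b n z * z⁻¹ ^ n - (1 - z⁻¹) ^ (-b))) := by
      simp only [hD, hW]
      rw [extOff_of_ne _ hz.ne', if_neg hz.not_gt, Complex.cpow_neg, zpow_neg, zpow_natCast, inv_pow]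
      have h4 : (1 - z⁻¹) ^ b ≠ 0 := by
        rw [Complex.cpow_def_of_ne_zero (Complex.slitPlane_ne_zero hsl)]; exact Complex.exp_ne_zero _
      generalize (1 - z⁻¹) ^ b = q at h4 ⊢
      have h5 := pow_ne_zero n hz0
      field_simp
      ring
    have hK1 : ‖fhKappa a b (n + 1)‖ ≤ K / (n + 1) := (hK (n + 1)).trans (by
      push_cast; gcongr; linarith)
    have hn : (0 : ℝ) < n + 1 := by positivity
    have hK2 : K / ((n : ℝ) + 1) ≤ K := div_le_self hK0 (by linarith [(by positivity : (0 : ℝ) ≤ n)])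
    have hw1 := one_le_wt z
    rw [e]
    calc _ ≤ 1 * (K * B * (C2 * wt z ^ M2 / (n + 1)) + K / (n + 1) * B * A) +
          A * (A * (C3 * wt z ^ M3 / (n + 1))) := by
          refine (norm_add_le _ _).trans (add_le_add ?_ ?_)
          · rw [norm_mul, norm_pow]
            refine mul_le_mul (pow_le_one₀ (norm_nonneg _) hzi.le) ?_ (norm_nonneg _) zero_le_one
            refine (norm_add_le _ _).trans (add_le_add ?_ ?_)
            · refine (hout n z hz).trans ?_
              gcongr
              · exact hK1.trans hK2
              · exact hB n
            · rw [norm_mul, norm_mul]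
              gcongr
              exact hB n
          · rw [norm_mul, norm_mul]
            gcongr
            refine (hphi n z hz).trans ?_
            gcongr
      _ = (K * B * C2 * wt z ^ M2 + K * B * A * wt z ^ 0 + A * A * C3 * wt z ^ M3) / (n + 1) := by
          ring
      _ ≤ (K * B * C2 * wt z ^ (M1 + M2 + M3) + K * B * A * wt z ^ (M1 + M2 + M3) +
          A * A * C3 * wt z ^ (M1 + M2 + M3)) / (n + 1) := by
          gcongr ?_ / _
          refine add_le_add (add_le_add ?_ ?_) ?_ <;>
            exact mul_le_mul_of_nonneg_left (hwt z (by omega)) (by positivity)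
      _ ≤ _ := by
          gcongr ?_ / _
          rw [← add_mul, ← add_mul]
          gcongr
          rw [hC']
          have : 0 ≤ B * C1 := by positivity
          linarith
  have hC'0 : 0 ≤ C' := by positivity
  have hWO : WO (-1) (fun _ => 1) D := by
    refine WO.of_bound (C := C' + (B + 1) * A) (m := M1 + M2 + M3) (fun _ => zero_le_one) ?_
    filter_upwards [tendsto_snd.eventually hS] with x hx hx1
    obtain ⟨h0, h2, h3, h4⟩ := hx
    have hw1 := one_le_wt x.2
    have hw2 : 1 ≤ wt x.2 ^ (M1 + M2 + M3) := one_le_pow₀ hw1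
    have hn : C' * wt x.2 ^ (M1 + M2 + M3) / (x.1 + 1) ≤ C' * wt x.2 ^ (M1 + M2 + M3) :=
      div_le_self (by positivity) (by linarith [(by positivity : (0 : ℝ) ≤ x.1)])
    rw [one_mul]
    have hBA : 0 ≤ (B + 1) * A := by positivity
    rcases lt_or_gt_of_ne hx1 with h | h
    · have h5 := (hDin x.1 x.2 h0 h).trans hn
      have h6 := norm_add_le (D x.1 x.2 - (fhNorm a b x.1 - 1) * (1 - x.2) ^ a)
        ((fhNorm a b x.1 - 1) * (1 - x.2) ^ a)
      rw [sub_add_cancel] at h6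
      have h7 : ‖(fhNorm a b x.1 - 1) * (1 - x.2) ^ a‖ ≤ (B + 1) * A := by
        rw [norm_mul]
        gcongr
        refine (norm_sub_le _ _).trans ?_
        rw [norm_one]
        linarith [hB x.1]
      nlinarith
    · have h5 := (hDout x.1 x.2 h0 h2 h3 h4 h).trans hn
      nlinarith
  have hV : {z : ℂ | z.re < 0} ∈ nhds (-1 : ℂ) :=
    (isOpen_lt Complex.continuous_re continuous_const).mem_nhds hre
  have hO := isBigO_of_WO (by simp) hWO hV (Eventually.of_forall fun n z hz =>
    (hDa n z hz).differentiableAt.differentiableWithinAt)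
  obtain ⟨Q, hQ, hb1⟩ := hO.exists_pos
  rw [Asymptotics.IsBigOWith, eventually_prod_iff] at hb1
  obtain ⟨pa, hpa, pb, hpb, hab1⟩ := hb1
  obtain ⟨r, hr, hrb⟩ := Metric.eventually_nhds_iff_ball.1 (hpb.and hS)
  have hlip : ∀ᶠ n in atTop, ∀ z ∈ Metric.ball (-1 : ℂ) r,
      ‖D n z - D n (-1)‖ ≤ (2 * Q + 1) / r * ‖z - (-1)‖ := by
    filter_upwards [hpa] with n hn z hz
    have hball : ∀ y ∈ Metric.ball (-1 : ℂ) r, ‖D n y‖ ≤ Q := fun y hy => by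
      have := hab1 hn (hrb y hy).1
      simpa using this
    have := Complex.dist_le_div_mul_dist_of_mapsTo_ball (f := D n) (c := -1) (z := z) (R₁ := r)
      (R₂ := 2 * Q + 1) (fun y hy => (hDa n y (hrb y hy).2.1).differentiableAt.differentiableWithinAt)
      (fun y hy => by
        rw [mem_closedBall_iff_norm]
        have h1 := hball y hy
        have h2 := hball (-1) (Metric.mem_ball_self hr)
        have := norm_sub_le (D n y) (D n (-1))
        linarith) hz
    rwa [dist_eq_norm, dist_eq_norm] at this
  have hsm : ∀ δ : ℝ, 0 < δ → δ < r → δ < 1 →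
      ‖(L - 1) * (1 - ((-1 : ℂ) + δ)) ^ a‖ ≤ 2 * ((2 * Q + 1) / r) * δ := by
    intro δ hδ hδr hδ1
    have hzin : ‖(-1 : ℂ) + δ‖ < 1 := by
      rw [show (-1 : ℂ) + δ = ((-1 + δ : ℝ) : ℂ) by push_cast; ring, Complex.norm_real,
        Real.norm_eq_abs, abs_lt]
      constructor <;> linarith
    have hzout : 1 < ‖(-1 : ℂ) - δ‖ := by
      rw [show (-1 : ℂ) - δ = ((-1 - δ : ℝ) : ℂ) by push_cast; ring, Complex.norm_real,
        Real.norm_eq_abs, abs_of_neg (by linarith)]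
      linarith
    have hm1 : (-1 : ℂ) + δ ∈ Metric.ball (-1 : ℂ) r := by
      rw [mem_ball_iff_norm, add_sub_cancel_left, Complex.norm_real, Real.norm_of_nonneg hδ.le]
      exact hδr
    have hm2 : (-1 : ℂ) - δ ∈ Metric.ball (-1 : ℂ) r := by
      rw [mem_ball_iff_norm, sub_sub_cancel_left, norm_neg, Complex.norm_real,
        Real.norm_of_nonneg hδ.le]
      exact hδr
    have hz : ∀ q : ℝ, Tendsto (fun n : ℕ => q / ((n : ℝ) + 1)) atTop (nhds 0) := fun q => by
      have := (tendsto_one_div_add_atTop_nhds_zero_nat (𝕜 := ℝ)).const_mul q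
      simpa only [mul_one_div, mul_zero] using this
    have t1 : Tendsto (fun n => D n ((-1 : ℂ) + δ)) atTop
        (nhds ((L - 1) * (1 - ((-1 : ℂ) + δ)) ^ a)) := by
      have h1 : Tendsto (fun n => D n ((-1 : ℂ) + δ) -
          (fhNorm a b n - 1) * (1 - ((-1 : ℂ) + δ)) ^ a) atTop (nhds 0) :=
        squeeze_zero_norm (fun n => hDin n _ (hrb _ hm1).2.1 hzin) (hz _)
      have h2 := (hLt.sub_const 1).mul_const ((1 - ((-1 : ℂ) + δ)) ^ a)
      simpa using h1.add h2
    have t2 : Tendsto (fun n => D n ((-1 : ℂ) - δ)) atTop (nhds 0) := by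
      obtain ⟨-, h0, h1, h2, h3⟩ := hrb _ hm2
      exact squeeze_zero_norm (fun n => hDout n _ h0 h1 h2 h3 hzout) (hz _)
    have t3 := (t1.sub t2).norm
    rw [sub_zero] at t3
    refine le_of_tendsto t3 ?_
    filter_upwards [hlip] with n hn
    have h1 := hn _ hm1
    have h2 := hn _ hm2
    rw [show (-1 : ℂ) + δ - -1 = δ by ring, Complex.norm_real, Real.norm_of_nonneg hδ.le] at h1
    rw [show (-1 : ℂ) - δ - -1 = -δ by ring, norm_neg, Complex.norm_real,
      Real.norm_of_nonneg hδ.le] at h2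
    have := norm_sub_le (D n ((-1 : ℂ) + δ) - D n (-1)) (D n ((-1 : ℂ) - δ) - D n (-1))
    rw [sub_sub_sub_cancel_right] at this
    linarith
  have hlim : ‖(L - 1) * (1 - ((-1 : ℂ) + ((0 : ℝ) : ℂ))) ^ a‖ ≤ 2 * ((2 * Q + 1) / r) * 0 := by
    have c1 : ContinuousAt (fun δ : ℝ => ‖(L - 1) * (1 - ((-1 : ℂ) + δ)) ^ a‖) 0 := by
      have c2 : ContinuousAt (fun δ : ℝ => (-1 : ℂ) + δ) 0 := by fun_prop
      have c3 := ContinuousAt.comp (x := (0 : ℝ)) (f := fun δ : ℝ => (-1 : ℂ) + δ)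
        (g := fun z : ℂ => (1 - z) ^ a) (by simpa using hfp) c2
      exact (continuousAt_const.mul c3).norm
    have c4 : Tendsto (fun δ : ℝ => 2 * ((2 * Q + 1) / r) * δ) (nhdsWithin 0 (Ioi 0))
        (nhds (2 * ((2 * Q + 1) / r) * 0)) :=
      ((continuous_const.mul continuous_id).tendsto 0).mono_left nhdsWithin_le_nhds
    refine le_of_tendsto_of_tendsto (c1.tendsto.mono_left nhdsWithin_le_nhds) c4 ?_
    filter_upwards [Ioo_mem_nhdsGT (lt_min hr one_pos)] with δ hδ
    exact hsm δ hδ.1 (hδ.2.trans_le (min_le_left _ _)) (hδ.2.trans_le (min_le_right _ _))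
  rw [mul_zero, norm_le_zero_iff, mul_eq_zero] at hlim
  rcases hlim with h | h
  · exact sub_eq_zero.1 h
  · exfalso
    rw [Complex.cpow_def_of_ne_zero (by norm_num)] at h
    exact Complex.exp_ne_zero _ h

end

/-- Polynomial boundary growth together with decay of order `k` in the index. -/
def SymBound (S : Set ℂ) (k : ℕ) (F : ℕ → ℂ → ℂ) : Prop :=
  ∃ C : ℝ, 0 ≤ C ∧ ∃ M : ℕ, ∀ (n : ℕ), ∀ z ∈ S, z ≠ 0 → ‖z‖ ≠ 1 →
    ‖F n z‖ ≤ C * symWt z ^ M / ((n : ℝ) + 1) ^ k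

section SymBound

variable {S S' : Set ℂ} {k l : ℕ} {F G : ℕ → ℂ → ℂ}

lemma SymBound.add (hF : SymBound S k F) (hG : SymBound S k G) :
    SymBound S k (fun n z => F n z + G n z) := by
  obtain ⟨C, hC, M, h⟩ := hF
  obtain ⟨C', hC', M', h'⟩ := hG
  refine ⟨C + C', by positivity, M + M', fun n z hz h0 h1 => ?_⟩
  have hw := one_le_symWt h1
  refine (norm_add_le _ _).trans ((add_le_add (h n z hz h0 h1) (h' n z hz h0 h1)).trans ?_)
  rw [add_mul, add_div]
  refine add_le_add ?_ ?_ <;>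
  · gcongr ?_ / _
    exact mul_le_mul_of_nonneg_left (pow_le_pow_right₀ hw (by omega)) (by assumption)

lemma SymBound.mul (hF : SymBound S k F) (hG : SymBound S l G) :
    SymBound S (k + l) (fun n z => F n z * G n z) := by
  obtain ⟨C, hC, M, h⟩ := hF
  obtain ⟨C', hC', M', h'⟩ := hG
  refine ⟨C * C', by positivity, M + M', fun n z hz h0 h1 => ?_⟩
  have hw := one_le_symWt h1
  rw [norm_mul]
  refine (mul_le_mul (h n z hz h0 h1) (h' n z hz h0 h1) (norm_nonneg _)
    (by positivity)).trans (le_of_eq ?_)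
  rw [pow_add, pow_add]
  field_simp

lemma SymBound.congr (hF : SymBound S k F)
    (h : ∀ n, ∀ z ∈ S, z ≠ 0 → ‖z‖ ≠ 1 → G n z = F n z) : SymBound S k G := by
  obtain ⟨C, hC, M, hb⟩ := hF
  exact ⟨C, hC, M, fun n z hz h0 h1 => by rw [h n z hz h0 h1]; exact hb n z hz h0 h1⟩

lemma SymBound.union (hF : SymBound S k F) (hG : SymBound S' k F) : SymBound (S ∪ S') k F := by
  obtain ⟨C, hC, M, h⟩ := hF
  obtain ⟨C', hC', M', h'⟩ := hG
  refine ⟨C + C', by positivity, M + M', fun n z hz h0 h1 => ?_⟩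
  have hw := one_le_symWt h1
  rcases hz with hz | hz
  · refine (h n z hz h0 h1).trans ?_
    gcongr ?_ / _
    exact mul_le_mul (by linarith) (pow_le_pow_right₀ hw (by omega)) (by positivity)
      (by positivity)
  · refine (h' n z hz h0 h1).trans ?_
    gcongr ?_ / _
    exact mul_le_mul (by linarith) (pow_le_pow_right₀ hw (by omega)) (by positivity)
      (by positivity)

lemma SymBound.mono_order (hF : SymBound S k F) (h : l ≤ k) : SymBound S l F := by
  obtain ⟨C, hC, M, hb⟩ := hF
  refine ⟨C, hC, M, fun n z hz h0 h1 => (hb n z hz h0 h1).trans ?_⟩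
  have hw := one_le_symWt h1
  refine div_le_div_of_nonneg_left (by positivity) (by positivity) ?_
  exact pow_le_pow_right₀ (by linarith [(by positivity : (0 : ℝ) ≤ n)]) h

lemma SymBound.neg (hF : SymBound S k F) : SymBound S k (fun n z => -F n z) := by
  obtain ⟨C, hC, M, hb⟩ := hF
  exact ⟨C, hC, M, fun n z hz h0 h1 => by rw [norm_neg]; exact hb n z hz h0 h1⟩

lemma SymBound.of_const {x : ℕ → ℂ} {C : ℝ} (h : ∀ n, ‖x n‖ ≤ C / ((n : ℝ) + 1) ^ k) :
    SymBound S k (fun n _ => x n) := by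
  have hC : 0 ≤ C := by have := (norm_nonneg _).trans (h 0); simpa using this
  exact ⟨C, hC, 0, fun n z _ _ _ => by rw [pow_zero, mul_one]; exact h n⟩

lemma SymBound.of_lt {C : ℝ} (hC : 0 ≤ C) {M : ℕ}
    (h : ∀ (n : ℕ) (z : ℂ), ‖z‖ < 1 → ‖F n z‖ ≤ C * ((1 - ‖z‖)⁻¹) ^ M / ((n : ℝ) + 1) ^ k) :
    SymBound {z | ‖z‖ < 1} k F :=
  ⟨C, hC, M, fun n z hz h0 _ => by rw [symWt_of_lt hz h0]; exact h n z hz⟩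

lemma SymBound.of_gt {C : ℝ} (hC : 0 ≤ C) {M : ℕ}
    (h : ∀ (n : ℕ) (z : ℂ), 1 < ‖z‖ → ‖F n z‖ ≤ C * ((1 - ‖z⁻¹‖)⁻¹) ^ M / ((n : ℝ) + 1) ^ k) :
    SymBound {z | 1 < ‖z‖} k F :=
  ⟨C, hC, M, fun n z hz _ _ => by rw [symWt_of_gt hz]; exact h n z hz⟩

lemma SymBound.comp_inv {T : Set ℂ} (hF : SymBound S k F) (h : ∀ z ∈ T, z⁻¹ ∈ S) :
    SymBound T k (fun n z => F n z⁻¹) := by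
  obtain ⟨C, hC, M, hb⟩ := hF
  refine ⟨C, hC, M, fun n z hz h0 h1 => ?_⟩
  rw [← symWt_inv]
  exact hb n _ (h z hz) (inv_ne_zero h0) (by rw [norm_inv]; simpa using h1)

lemma SymBound.split (h1 : SymBound {z | ‖z‖ < 1} k F) (h2 : SymBound {z | 1 < ‖z‖} k F) :
    SymBound univ k F := by
  obtain ⟨C, hC, M, hb⟩ := h1.union h2
  exact ⟨C, hC, M, fun n z _ h0 h1 => hb n z (lt_or_gt_of_ne h1) h0 h1⟩

end SymBound

lemma symBound_one_sub_cpow (x : ℂ) : SymBound {z | ‖z‖ < 1} 0 (fun _ z => (1 - z) ^ x) := by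
  obtain ⟨C, hC, M, h⟩ := norm_one_sub_cpow_le (-x)
  refine SymBound.of_lt hC (M := M) fun n z hz => ?_
  have := h z hz
  rw [neg_neg] at this
  rwa [pow_zero, div_one]

lemma symBound_one_sub_inv_cpow (x : ℂ) :
    SymBound {z | 1 < ‖z‖} 0 (fun _ z => (1 - z⁻¹) ^ x) :=
  (symBound_one_sub_cpow x).comp_inv (F := fun _ z => (1 - z) ^ x) fun z hz => by
    simp only [mem_ofPred_eq] at hz ⊢
    rw [norm_inv]; exact inv_lt_one_of_one_lt₀ hz

section

variable {a b : ℂ}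

lemma fhKappa_succ_sub (ha : -(1 / 2) < a.re) {K : ℝ} (hκ : ∀ n, ‖fhKappa a b n‖ ≤ K / (n + 1))
    (n : ℕ) : ‖fhKappa a b (n + 1) - fhKappa a b n‖ ≤ 2 * K * ‖b - a - 1‖ / (n + 1) ^ 2 := by
  have h1 : (n + 1 : ℝ) / 2 ≤ ‖((n + 1 : ℝ) : ℂ) + a‖ :=
    half_le_norm_add ha (by linarith [(by positivity : (0 : ℝ) ≤ n)])
  have hn : (0 : ℝ) < n + 1 := by positivity
  have e0 : a + 1 + n = ((n + 1 : ℝ) : ℂ) + a := by push_cast; ring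
  have h2 : a + 1 + n ≠ 0 := by
    rw [e0, ← norm_pos_iff]; linarith
  have ha1 : 0 < (a + 1).re := by rw [Complex.add_re, Complex.one_re]; linarith
  have e : fhKappa a b (n + 1) - fhKappa a b n =
      fhKappa a b n * (b - a - 1) / (a + 1 + n) := by
    rw [eq_div_iff h2, sub_mul, fhKappa_succ (by linarith) n]
    ring
  rw [e, norm_div, norm_mul, e0]
  calc _ ≤ K / (n + 1) * ‖b - a - 1‖ / ((n + 1) / 2) := by
        have hK0 : 0 ≤ K / (n + 1) := (norm_nonneg _).trans (hκ n)
        exact div_le_div₀ (by positivity) (mul_le_mul_of_nonneg_right (hκ n) (norm_nonneg _))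
          (by positivity) h1
    _ = _ := by field_simp

/-- The diagonal entry of the first row of the model solution, normalised. -/
noncomputable def fhDiag (a b : ℂ) (n : ℕ) (z : ℂ) : ℂ :=
  if ‖z‖ < 1 then fhSnd a b n z * (1 - z) ^ (-a) else fhPhi a b n z * (1 - z⁻¹) ^ b * z⁻¹ ^ n

/-- The off-diagonal entry of the first row of the model solution, normalised. -/
noncomputable def fhOff (a b : ℂ) (n : ℕ) (z : ℂ) : ℂ :=
  if ‖z‖ < 1 then -(fhPhi a b n z * (1 - z) ^ a) else z ^ n * fhSnd a b n z * (1 - z⁻¹) ^ (-b)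

lemma one_sub_cpow_mul_neg {z : ℂ} (hz : ‖z‖ < 1) (x : ℂ) : (1 - z) ^ x * (1 - z) ^ (-x) = 1 := by
  have h : 1 - z ≠ 0 := sub_ne_zero.2 fun h => by rw [← h] at hz; simp at hz
  rw [← Complex.cpow_add _ _ h, add_neg_cancel, Complex.cpow_zero]

lemma symBound_fhDiag (ha : -(1 / 2) < a.re) (hb : -(1 / 2) < b.re)
    (hκ : ∃ K : ℝ, ∀ n, ‖fhKappa a b n‖ ≤ K / (n + 1)) :
    SymBound univ 1 (fun n z => fhDiag a b n z - 1) := by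
  obtain ⟨C, hC⟩ := fhNorm_asymptotics ha hb hκ
  obtain ⟨B, hB0, hB⟩ := norm_bounded_of_norm_sub_le hC
  refine SymBound.split ?_ ?_
  · obtain ⟨C1, hC1, M1, hin⟩ := fhSnd_inside ha hb
    have h1 : SymBound {z : ℂ | ‖z‖ < 1} 1
        (fun n z => fhSnd a b n z - fhNorm a b n * (1 - z) ^ a) := by
      refine SymBound.of_lt (C := B * C1) (by positivity) (M := M1) fun n z hz => ?_
      have : 0 ≤ (1 - ‖z‖)⁻¹ := inv_nonneg.2 (by linarith)
      refine (hin n z hz).trans ?_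
      calc _ ≤ B * (C1 * (1 - ‖z‖)⁻¹ ^ M1 / (n + 1)) := by gcongr; exact hB n
        _ = _ := by rw [pow_one]; ring
    have h2 : SymBound {z : ℂ | ‖z‖ < 1} 1 (fun n _ => fhNorm a b n - 1) :=
      SymBound.of_const (C := C) (by simpa using hC)
    refine ((h1.mul (symBound_one_sub_cpow (-a))).add h2).congr fun n z hz h0 _ => ?_
    simp only [mem_ofPred_eq] at hz
    have := one_sub_cpow_mul_neg hz a
    rw [fhDiag, if_pos hz]
    linear_combination fhNorm a b n * this
  · obtain ⟨C3, hC3, M3, hphi⟩ := fhPhi_outside ha b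
    have h1 : SymBound {z : ℂ | 1 < ‖z‖} 1
        (fun n z => fhPhi a b n z * z⁻¹ ^ n - (1 - z⁻¹) ^ (-b)) :=
      SymBound.of_gt hC3 (M := M3) fun n z hz => by simpa using hphi n z hz
    refine (h1.mul (symBound_one_sub_inv_cpow b)).congr fun n z hz h0 _ => ?_
    simp only [mem_ofPred_eq] at hz
    have hzi : ‖z⁻¹‖ < 1 := by rw [norm_inv]; exact inv_lt_one_of_one_lt₀ hz
    have := one_sub_cpow_mul_neg hzi b
    rw [fhDiag, if_neg hz.not_gt]
    linear_combination this

lemma symBound_fhOff (ha : -(1 / 2) < a.re) (hb : -(1 / 2) < b.re)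
    (hκ : ∃ K : ℝ, ∀ n, ‖fhKappa a b n‖ ≤ K / (n + 1)) :
    SymBound univ 2 (fun n z => fhOff a b n z - fhKappa a b n / (z - 1)) := by
  obtain ⟨C, hC⟩ := fhNorm_asymptotics ha hb hκ
  obtain ⟨B, hB0, hB⟩ := norm_bounded_of_norm_sub_le hC
  refine SymBound.split ?_ ?_
  · obtain ⟨C1, hC1, M1, hin⟩ := fhPhi_inside ha hb hκ
    have h1 : SymBound {z : ℂ | ‖z‖ < 1} 2
        (fun n z => fhPhi a b n z - fhKappa a b n * (1 - z) ^ (-(a + 1))) :=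
      SymBound.of_lt hC1 (M := M1) hin
    refine ((h1.mul (symBound_one_sub_cpow a)).neg).congr fun n z hz h0 _ => ?_
    simp only [mem_ofPred_eq] at hz
    have hne : 1 - z ≠ 0 := sub_ne_zero.2 fun h => by rw [← h] at hz; simp at hz
    have hne' : z - 1 ≠ 0 := by rw [← neg_sub]; exact neg_ne_zero.2 hne
    have e : (1 - z) ^ (-(a + 1)) * (1 - z) ^ a = (1 - z)⁻¹ := by
      rw [← Complex.cpow_add _ _ hne, show -(a + 1) + a = -1 by ring, Complex.cpow_neg_one]
    have e2 : fhKappa a b n / (z - 1) = -(fhKappa a b n * (1 - z)⁻¹) := by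
      field_simp
      ring
    rw [fhOff, if_pos hz, e2, ← e]
    ring
  · obtain ⟨K, hK⟩ := hκ
    have hK0 : 0 ≤ K := by have := (norm_nonneg _).trans (hK 0); simpa using this
    have hK1 : ∀ n : ℕ, ‖fhKappa a b (n + 1)‖ ≤ K / (n + 1) := fun n => (hK (n + 1)).trans (by
      push_cast; gcongr; linarith)
    obtain ⟨C2, hC2, M2, hout⟩ := fhSnd_outside ha hb
    have h1 : SymBound {z : ℂ | 1 < ‖z‖} 2 (fun n z => z ^ n * fhSnd a b n z -
        fhKappa a b (n + 1) * fhNorm a b n * (z⁻¹ * (1 - z⁻¹) ^ (b - 1))) := by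
      refine SymBound.of_gt (C := K * B * C2) (by positivity) (M := M2) fun n z hz => ?_
      have hzi : ‖z⁻¹‖ < 1 := by rw [norm_inv]; exact inv_lt_one_of_one_lt₀ hz
      have : 0 ≤ (1 - ‖z⁻¹‖)⁻¹ := inv_nonneg.2 (by linarith)
      refine (hout n z hz).trans ?_
      calc _ ≤ K / (n + 1) * B * (C2 * (1 - ‖z⁻¹‖)⁻¹ ^ M2 / (n + 1)) := by
            gcongr
            · exact hK1 n
            · exact hB n
        _ = _ := by field_simp
    have h2 : SymBound {z : ℂ | 1 < ‖z‖} 2 (fun n _ => fhKappa a b (n + 1) * (fhNorm a b n - 1)) :=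
      SymBound.mul (k := 1) (l := 1) (SymBound.of_const (C := K) (by simpa using hK1))
        (SymBound.of_const (C := C) (by simpa using hC))
    have h3 : SymBound {z : ℂ | 1 < ‖z‖} 2 (fun n _ => fhKappa a b (n + 1) - fhKappa a b n) :=
      SymBound.of_const (fhKappa_succ_sub ha hK)
    have h4 : SymBound {z : ℂ | 1 < ‖z‖} 0 (fun _ z => z⁻¹ * (1 - z⁻¹) ^ (-1 : ℂ)) := by
      refine SymBound.mul (k := 0) (l := 0) (SymBound.of_gt zero_le_one (M := 0) fun n z hz => ?_)
        (symBound_one_sub_inv_cpow (-1))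
      rw [norm_inv]
      simpa using (inv_lt_one_of_one_lt₀ hz).le
    refine ((h1.mul (symBound_one_sub_inv_cpow (-b))).add ((h2.add h3).mul h4)).congr
      fun n z hz h0 _ => ?_
    simp only [mem_ofPred_eq] at hz
    have hzi : ‖z⁻¹‖ < 1 := by rw [norm_inv]; exact inv_lt_one_of_one_lt₀ hz
    have hne : 1 - z⁻¹ ≠ 0 := sub_ne_zero.2 fun h => by rw [← h] at hzi; simp at hzi
    have hne' : z - 1 ≠ 0 := sub_ne_zero.2 fun h => by rw [h] at hz; simp at hz
    have e : (1 - z⁻¹) ^ (b - 1) * (1 - z⁻¹) ^ (-b) = (1 - z⁻¹)⁻¹ := by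
      rw [← Complex.cpow_add _ _ hne, show b - 1 + -b = -1 by ring, Complex.cpow_neg_one]
    have e2 : fhKappa a b n / (z - 1) = fhKappa a b n * z⁻¹ * (1 - z⁻¹)⁻¹ := by
      have : z - 1 = z * (1 - z⁻¹) := by rw [mul_sub, mul_one, mul_inv_cancel₀ h0]
      rw [this]
      field_simp
    rw [fhOff, if_neg hz.not_gt, e2, Complex.cpow_neg_one]
    linear_combination (fhKappa a b (n + 1) * fhNorm a b n * z⁻¹) * e

end

lemma cauchyT_comp_inv {Q : ℂ → ℂ} (hQ : CircleIntegrable Q 0 1)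
    (hQ' : CircleIntegrable (fun s => Q s⁻¹) 0 1) {z : ℂ} (hz : ‖z‖ ≠ 1) (h0 : z ≠ 0) :
    cauchyT (fun s => Q s⁻¹ * s ^ (-1 : ℤ)) z = -(z⁻¹ * cauchyT Q z⁻¹) := by
  have e : ∀ j : ℤ, mom (fun s => Q s⁻¹ * s ^ (-1 : ℤ)) j = mom Q (-(j + 1)) := fun j => by
    rw [mom_mul_zpow (fun s => Q s⁻¹), mom_comp_inv]
    congr 1
  have hi := hQ'.mul_zpow (-1)
  rcases lt_or_gt_of_ne hz with h | h
  · have hzi : 1 < ‖z⁻¹‖ := by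
      rw [norm_inv]; exact (one_lt_inv₀ (norm_pos_iff.2 h0)).2 h
    have h1 := hasSum_cauchyT_of_lt hi h
    have h2 := (hasSum_cauchyT_of_gt hQ hzi).mul_left z⁻¹
    have h3 := h1.unique (h2.of_eq fun k => ?_)
    · rw [h3]; ring
    · rw [e, inv_inv, pow_succ]
      field_simp
  · have hzi : ‖z⁻¹‖ < 1 := by rw [norm_inv]; exact inv_lt_one_of_one_lt₀ h
    have h1 := hasSum_cauchyT_of_gt hi h
    have h2 := (hasSum_cauchyT_of_lt hQ hzi).mul_left z⁻¹
    have h3 := h1.unique (h2.of_eq fun k => ?_)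
    · rw [← h3]; ring
    · rw [e, pow_succ, show -(-((k : ℤ) + 1) + 1) = k by ring]
      ring

lemma rowAt_cauchyT {F y : ℂ → ℂ} (hF : CircleIntegrable F 0 1) {p : ℂ} (hy : AnalyticAt ℂ y p)
    (hyF : CircleIntegrable (fun s => y s * F s) 0 1) :
    RowAt (cauchyT F) y (cauchyT fun s => y s * F s) p := by
  obtain ⟨e, he, h⟩ := exists_analyticAt_mul_cauchyT_sub (g := fun _ => 1) (g' := y) (p := p) 0
    hyF hF analyticAt_const hy (Eventually.of_forall fun s _ _ => by ring)
  exact ⟨hy, e, he, h.mono fun z hz h1 => by rw [← hz h1]; ring⟩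

/-- The first entry of the second row of the model solution at index `m + 1`. -/
noncomputable def fhPhiDual (a b : ℂ) (m : ℕ) (z : ℂ) : ℂ := -(fhNorm a b m)⁻¹ * fhPsi a b m z

/-- The second entry of the second row of the model solution at index `m + 1`. -/
noncomputable def fhSndDual (a b : ℂ) (m : ℕ) (z : ℂ) : ℂ :=
  cauchyT (fun s => fhPhiDual a b m s * (fhWeight a b s * s ^ (-((m + 1 : ℕ) : ℤ)))) z

section

variable {a b : ℂ}

lemma fhNorm_ne_zero (ha : -(1 / 2) < a.re) (hb : -(1 / 2) < b.re)
    (hκ : ∃ K : ℝ, ∀ n, ‖fhKappa a b n‖ ≤ K / (n + 1)) (n : ℕ) : fhNorm a b n ≠ 0 := by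
  intro h
  have h1 : ∀ k, fhNorm a b (n + k) = 0 := fun k => by
    induction k with
    | zero => exact h
    | succ k ih => rw [← add_assoc, fhNorm_succ, ih, zero_mul]
  obtain ⟨C, hC⟩ := fhNorm_asymptotics ha hb hκ
  have h2 := (tendsto_of_norm_sub_le hC).comp (tendsto_add_atTop_nat n)
  have h3 : (fhNorm a b ∘ fun k => k + n) = fun _ => 0 := by
    funext k; rw [Function.comp, add_comm, h1]
  rw [h3] at h2
  exact one_ne_zero (tendsto_nhds_unique h2 tendsto_const_nhds)

lemma exists_fhNorm_inv_bound (ha : -(1 / 2) < a.re) (hb : -(1 / 2) < b.re)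
    (hκ : ∃ K : ℝ, ∀ n, ‖fhKappa a b n‖ ≤ K / (n + 1)) :
    (∃ B : ℝ, ∀ n, ‖(fhNorm a b n)⁻¹‖ ≤ B) ∧
      ∃ C : ℝ, ∀ n : ℕ, ‖(fhNorm a b n)⁻¹ - 1‖ ≤ C / (n + 1) := by
  obtain ⟨C, hC⟩ := fhNorm_asymptotics ha hb hκ
  have h1 := (tendsto_of_norm_sub_le hC).inv₀ one_ne_zero
  obtain ⟨B, hB⟩ := (Metric.isBounded_range_of_tendsto _ h1).exists_norm_le
  have hB' : ∀ n, ‖(fhNorm a b n)⁻¹‖ ≤ B := fun n => hB _ ⟨n, rfl⟩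
  refine ⟨⟨B, hB'⟩, B * C, fun n => ?_⟩
  have h2 := fhNorm_ne_zero ha hb hκ n
  have e : (fhNorm a b n)⁻¹ - 1 = -((fhNorm a b n)⁻¹ * (fhNorm a b n - 1)) := by
    rw [mul_sub, inv_mul_cancel₀ h2]; ring
  rw [e, norm_neg, norm_mul, mul_div_assoc]
  exact mul_le_mul (hB' n) (hC n) (norm_nonneg _) ((norm_nonneg _).trans (hB' n))

lemma circleIntegrable_fhPhiDual (hab : -1 < (a + b).re) (m : ℕ) (k : ℤ) :
    CircleIntegrable (fun s => fhPhiDual a b m s * (fhWeight a b s * s ^ k)) 0 1 := by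
  refine CircleIntegrable.contMul ((circleIntegrable_fhWeight hab).mul_zpow k) ?_
  exact (continuous_const.mul (differentiable_fhPsi a b m).continuous).continuousOn

lemma fhSndDual_eq (ha : -(1 / 2) < a.re) (hb : -(1 / 2) < b.re) (m : ℕ) {z : ℂ} (hz : ‖z‖ ≠ 1)
    (h0 : z ≠ 0) :
    fhSndDual a b m z = (fhNorm a b m)⁻¹ * z⁻¹ ^ (m + 1) * fhSnd b a m z⁻¹ := by
  have hab : -1 < (a + b).re := by rw [Complex.add_re]; linarith
  have hba : -1 < (b + a).re := by rwa [add_comm]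
  have e : ∀ s ∈ Metric.sphere (0 : ℂ) 1,
      fhPhiDual a b m s * (fhWeight a b s * s ^ (-((m + 1 : ℕ) : ℤ))) =
        -(fhNorm a b m)⁻¹ * ((fun w => fhPhi b a m w * fhWeight b a w) s⁻¹ * s ^ (-1 : ℤ)) := by
    intro s hs
    have hs0 := ne_zero_of_mem_sphere_one hs
    simp only
    rw [fhPhiDual, fhPsi_eq a b m hs0, fhWeight_inv, zpow_neg, zpow_natCast, zpow_neg_one]
    field_simp
    ring
  have hQ' : CircleIntegrable (fun s : ℂ => (fun w => fhPhi b a m w * fhWeight b a w) s⁻¹) 0 1 := by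
    have h1 := (circleIntegrable_fhPsi_mul hab m).mul_zpow (-(m : ℤ))
    refine (circleIntegrable_congr fun s hs => ?_).1 h1
    rw [abs_one] at hs
    have hs0 := ne_zero_of_mem_sphere_one hs
    simp only
    rw [fhPsi_eq a b m hs0, fhWeight_inv, zpow_neg, zpow_natCast]
    field_simp
  rw [fhSndDual, cauchyT_congr fun s hs => e s (by simpa using hs), cauchyT_const_mul, cauchyT_comp_inv
    (circleIntegrable_fhPhi_mul hba m) hQ' hz h0, cauchyT_fhPhi_mul hb ha m (by
      rw [norm_inv]; simpa using hz)]
  ring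

lemma symBound_of_dual_diag (ha : -(1 / 2) < a.re) (hb : -(1 / 2) < b.re)
    (hκ : ∃ K : ℝ, ∀ n, ‖fhKappa a b n‖ ≤ K / (n + 1))
    (hκ' : ∃ K : ℝ, ∀ n, ‖fhKappa b a n‖ ≤ K / (n + 1)) :
    SymBound univ 1 (fun n z => (fhNorm a b n)⁻¹ * fhDiag b a n z⁻¹ - 1) := by
  obtain ⟨⟨B, hB⟩, C, hC⟩ := exists_fhNorm_inv_bound ha hb hκ
  have h1 := (symBound_fhDiag hb ha hκ').comp_inv (T := univ) fun _ _ => mem_univ _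
  have h2 : SymBound univ 0 (fun n _ => (fhNorm a b n)⁻¹) :=
    SymBound.of_const (C := B) (by simpa using hB)
  have h3 : SymBound univ 1 (fun n _ => (fhNorm a b n)⁻¹ - 1) :=
    SymBound.of_const (C := C) (by simpa using hC)
  exact ((h2.mul h1).mono_order (l := 1) (by omega)|>.add h3).congr fun n z _ _ _ => by ring

lemma symBound_of_dual_off (ha : -(1 / 2) < a.re) (hb : -(1 / 2) < b.re)
    (hκ : ∃ K : ℝ, ∀ n, ‖fhKappa a b n‖ ≤ K / (n + 1))
    (hκ' : ∃ K : ℝ, ∀ n, ‖fhKappa b a n‖ ≤ K / (n + 1)) :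
    SymBound univ 1 (fun n z => (fhNorm a b n)⁻¹ * fhOff b a n z⁻¹) := by
  obtain ⟨⟨B, hB⟩, -⟩ := exists_fhNorm_inv_bound ha hb hκ
  have h2 : SymBound univ 0 (fun n _ => (fhNorm a b n)⁻¹) :=
    SymBound.of_const (C := B) (by simpa using hB)
  have h1 := (symBound_fhOff hb ha hκ').mono_order (l := 1) (by omega)
  obtain ⟨K, hK⟩ := hκ'
  have h3 : SymBound univ 1 (fun n _ => fhKappa b a n) :=
    SymBound.of_const (C := K) (by simpa using hK)
  have h4 : SymBound univ 0 (fun _ z => (z - 1)⁻¹) := by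
    refine SymBound.split (SymBound.of_lt zero_le_one (M := 1) fun n z hz => ?_)
      (SymBound.of_gt zero_le_one (M := 1) fun n z hz => ?_)
    · rw [pow_zero, div_one, pow_one, one_mul, norm_inv]
      refine inv_anti₀ (by linarith) ?_
      have := norm_sub_norm_le (1 : ℂ) z
      rwa [norm_one, norm_sub_rev] at this
    · rw [pow_zero, div_one, pow_one, one_mul, norm_inv]
      have hz0 : z ≠ 0 := by rintro rfl; simp at hz; linarith
      have hzi : ‖z‖⁻¹ < 1 := inv_lt_one_of_one_lt₀ hz
      rw [norm_inv]
      refine inv_anti₀ (by linarith) ?_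
      have h5 := norm_sub_norm_le z 1
      rw [norm_one] at h5
      refine le_trans ?_ h5
      have : ‖z‖ * ‖z‖⁻¹ = 1 := mul_inv_cancel₀ (by positivity)
      nlinarith
  have h5 := h1.add (h3.mul h4)
  have h6 := h5.comp_inv (T := univ) fun _ _ => mem_univ _
  refine (h2.mul h6 |>.mono_order (l := 1) (by omega)).congr fun n z _ _ _ => by ring

theorem fhDet_eq_one (ha : -(1 / 2) < a.re) (hb : -(1 / 2) < b.re)
    (hκ : ∃ K : ℝ, ∀ n, ‖fhKappa a b n‖ ≤ K / (n + 1)) (m : ℕ) {z : ℂ} (hz : ‖z‖ ≠ 1) :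
    fhPhi a b (m + 1) z * fhSndDual a b m z - fhSnd a b (m + 1) z * fhPhiDual a b m z = 1 := by
  have hab : -1 < (a + b).re := by rw [Complex.add_re]; linarith
  have hba : -1 < (b + a).re := by rwa [add_comm]
  have hF := (circleIntegrable_fhWeight hab).mul_zpow (-((m + 1 : ℕ) : ℤ))
  set W : ℂ → ℂ := fun z =>
    fhPhi a b (m + 1) z * fhSndDual a b m z - fhSnd a b (m + 1) z * fhPhiDual a b m z with hW
  have hΨd : Differentiable ℂ (fhPhiDual a b m) := (differentiable_fhPsi a b m).const_mul _
  have hr1 : ∀ p, RowAt (cauchyT fun s => fhWeight a b s * s ^ (-((m + 1 : ℕ) : ℤ)))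
      (fhPhi a b (m + 1)) (fhSnd a b (m + 1)) p := fun p => by
    have h := rowAt_cauchyT hF (p := p) ((differentiable_fhPhi a b (m + 1)).analyticAt p) (by
      simpa only [mul_assoc] using circleIntegrable_fhSnd hab (m + 1))
    have e : fhSnd a b (m + 1) = cauchyT fun s => fhPhi a b (m + 1) s *
        (fhWeight a b s * s ^ (-((m + 1 : ℕ) : ℤ))) := by
      funext z; simp only [fhSnd, mul_assoc]
    rwa [e]
  have hr2 : ∀ p, RowAt (cauchyT fun s => fhWeight a b s * s ^ (-((m + 1 : ℕ) : ℤ)))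
      (fhPhiDual a b m) (fhSndDual a b m) p := fun p =>
    rowAt_cauchyT hF (hΨd.analyticAt p) (circleIntegrable_fhPhiDual hab m _)
  have hent : Differentiable ℂ (extOff W) := fun p =>
    ((hr1 p).analyticAt_wronskian (hr2 p)).differentiableAt
  have hinv : Tendsto (fun z : ℂ => z⁻¹) (cocompact ℂ) (nhds 0) := tendsto_inv₀_cobounded.mono_left
    (by rw [Metric.cobounded_eq_cocompact])
  have hlarge : ∀ᶠ z : ℂ in cocompact ℂ, 1 < ‖z‖ :=
    tendsto_norm_cocompact_atTop.eventually (eventually_gt_atTop 1)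
  have hlim : Tendsto (extOff W) (cocompact ℂ) (nhds 1) := by
    have t1 : Tendsto (fun z : ℂ => fhPsi b a (m + 1) z⁻¹) (cocompact ℂ) (nhds 1) := by
      have h := ((differentiable_fhPsi b a (m + 1)).continuous.tendsto 0).comp hinv
      have e : fhPsi b a (m + 1) 0 = 1 := by
        rw [fhPsi, Finset.sum_range_succ', Finset.sum_eq_zero fun k _ => by
          rw [pow_succ, mul_zero, mul_zero]]
        simp [fhCoeff_self ha]
      rw [e] at h
      exact h
    have t2 : Tendsto (fun z : ℂ => (fhNorm a b m)⁻¹ * fhSnd b a m z⁻¹) (cocompact ℂ) (nhds 1) := by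
      have hc : ContinuousAt (fhSnd b a m) 0 :=
        (analyticAt_cauchyT (circleIntegrable_fhSnd hba m) (by simp)).continuousAt
      have h := (hc.tendsto.comp hinv).const_mul (fhNorm a b m)⁻¹
      have e : fhSnd b a m 0 = fhNorm a b m := by
        have h1 := hasSum_cauchyT_of_lt (circleIntegrable_fhSnd hba m) (z := 0) (by simp)
        have h2 := h1.unique (hasSum_single 0 fun k hk => by rw [zero_pow hk, zero_mul])
        rw [fhSnd, h2, mom_mul_zpow]
        have h3 := (fhMom_eq m hb ha).1 0
        simp only [Nat.cast_zero, add_zero, poch_zero, Nat.factorial_zero, Nat.cast_one, mul_one,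
          div_one, fhMom] at h3
        rw [fhNorm_symm a b, ← h3]
        simp
      rw [e, inv_mul_cancel₀ (fhNorm_ne_zero ha hb hκ m)] at h
      exact h
    have t3 := tendsto_cauchyT_cocompact (circleIntegrable_fhPhi_mul hab (m + 1))
    have t4 : Tendsto (fun z : ℂ => (fhNorm a b m)⁻¹ * z⁻¹ * fhPhi b a m z⁻¹)
        (cocompact ℂ) (nhds 0) := by
      have h := (hinv.const_mul (fhNorm a b m)⁻¹).mul
        (((differentiable_fhPhi b a m).continuous.tendsto 0).comp hinv)
      simpa using h
    have t5 := (t1.mul t2).add (t3.mul t4)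
    rw [mul_one, zero_mul, add_zero] at t5
    refine t5.congr' ?_
    filter_upwards [hlarge] with z hz
    have hz0 : z ≠ 0 := by rintro rfl; simp at hz; linarith
    rw [extOff_of_ne _ hz.ne']
    simp only [hW]
    rw [fhSndDual_eq ha hb m hz.ne' hz0, cauchyT_fhPhi_mul ha hb _ hz.ne', fhPhiDual,
      fhPsi_eq a b m hz0, fhPsi_eq b a (m + 1) (inv_ne_zero hz0), inv_inv]
    field_simp
    ring
  have h := hent.apply_eq_of_tendsto_cocompact z hlim
  rwa [extOff_of_ne _ hz] at h

end

lemma exists_circleMap_div {x : ℂ} (hx : ‖x‖ = 1) :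
    ∃ φ : ℝ, ∀ t : ℝ, circleMap 0 1 t / x = circleMap 0 1 (t + φ) := by
  refine ⟨-x.arg, fun t => ?_⟩
  have h := Complex.norm_mul_exp_arg_mul_I x
  rw [hx, Complex.ofReal_one, one_mul] at h
  rw [circleMap_zero, circleMap_zero]
  conv_lhs => rw [← h]
  rw [Complex.ofReal_one, one_mul, one_mul, ← Complex.exp_sub]
  congr 1
  push_cast
  ring

lemma CircleIntegrable.comp_div {Q : ℂ → ℂ} (hQ : CircleIntegrable Q 0 1) {x : ℂ} (hx : ‖x‖ = 1) :
    CircleIntegrable (fun s => Q (s / x)) 0 1 := by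
  obtain ⟨φ, hφ⟩ := exists_circleMap_div hx
  have hp : Function.Periodic (fun u : ℝ => Q (circleMap 0 1 u)) (2 * Real.pi) := fun u => by
    simp only [periodic_circleMap 0 1 u]
  have h1 := hp.intervalIntegrable₀ (by positivity) hQ (0 + φ) (2 * Real.pi + φ)
  have h2 := h1.comp_add_right φ
  simp only [add_sub_cancel_right] at h2
  unfold CircleIntegrable
  simpa only [hφ] using h2

lemma cauchyT_comp_div (Q : ℂ → ℂ) {x : ℂ} (hx : ‖x‖ = 1) (z : ℂ) :
    cauchyT (fun s => Q (s / x)) z = cauchyT Q (z / x) := by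
  obtain ⟨φ, hφ⟩ := exists_circleMap_div hx
  have hx0 : x ≠ 0 := by rintro rfl; simp at hx
  rw [cauchyT_eq, cauchyT_eq, ← intervalIntegral.integral_of_le (by positivity),
    ← intervalIntegral.integral_of_le (by positivity)]
  congr 1
  set G : ℝ → ℂ := fun u => circleMap 0 1 u * Complex.I *
    ((circleMap 0 1 u - z / x)⁻¹ * Q (circleMap 0 1 u)) with hG
  have hp : Function.Periodic G (2 * Real.pi) := fun u => by
    simp only [hG, periodic_circleMap 0 1 u]
  have h : ∀ t : ℝ, circleMap 0 1 t * Complex.I *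
      ((circleMap 0 1 t - z)⁻¹ * Q (circleMap 0 1 t / x)) = G (t + φ) := fun t => by
    simp only [hG]
    rw [← hφ, ← sub_div, inv_div]
    field_simp
  simp only [h]
  rw [intervalIntegral.integral_comp_add_right G, zero_add, add_comm (2 * Real.pi),
    hp.intervalIntegral_add_eq φ 0, zero_add]

/-- Local factorisation of a weight and its Szegő factors at a Fisher–Hartwig singularity. -/
structure IsFHFactor (x a b : ℂ) (Ω : Set ℂ) (f fp fm u v : ℂ → ℂ) : Prop where
  norm_eq : ‖x‖ = 1
  mem : x ∈ Ω
  isOpen : IsOpen Ω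
  zero_notMem : (0 : ℂ) ∉ Ω
  re_a : -(1 / 2) < a.re
  re_b : -(1 / 2) < b.re
  kappa : ∃ K : ℝ, ∀ n, ‖fhKappa a b n‖ ≤ K / (n + 1)
  kappa' : ∃ K : ℝ, ∀ n, ‖fhKappa b a n‖ ≤ K / (n + 1)
  diff_u : DifferentiableOn ℂ u Ω
  diff_v : DifferentiableOn ℂ v Ω
  u_ne : ∀ z ∈ Ω, u z ≠ 0
  v_ne : ∀ z ∈ Ω, v z ≠ 0
  plus : ∀ z ∈ Ω, ‖z‖ < 1 → fp z = (1 - z / x) ^ a * u z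
  minus : ∀ z ∈ Ω, 1 < ‖z‖ → fm z = (1 - (z / x)⁻¹) ^ b * v z
  weight : ∀ s ∈ Ω, ‖s‖ = 1 → s ≠ x → f s = fhWeight a b (s / x) * (u s * v s)

namespace IsFHFactor

variable {x a b : ℂ} {Ω : Set ℂ} {f fp fm u v : ℂ → ℂ}

/-- Entries of the local parametrix. -/
noncomputable def m11 (x a b : ℂ) (v : ℂ → ℂ) (n : ℕ) (z : ℂ) : ℂ :=
  x ^ n * fhPhi a b n (z / x) / v z

/-- Entries of the local parametrix. -/
noncomputable def m12 (x a b : ℂ) (u : ℂ → ℂ) (n : ℕ) (z : ℂ) : ℂ := u z * fhSnd a b n (z / x)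

/-- Entries of the local parametrix. -/
noncomputable def m21 (x a b : ℂ) (u : ℂ → ℂ) (n : ℕ) (z : ℂ) : ℂ :=
  fhPhiDual a b (n - 1) (z / x) / u z

/-- Entries of the local parametrix. -/
noncomputable def m22 (x a b : ℂ) (v : ℂ → ℂ) (n : ℕ) (z : ℂ) : ℂ :=
  v z * (x⁻¹ ^ n * fhSndDual a b (n - 1) (z / x))

lemma ne_zero (h : IsFHFactor x a b Ω f fp fm u v) : x ≠ 0 := by
  rintro rfl; simpa using h.norm_eq

lemma re_add (h : IsFHFactor x a b Ω f fp fm u v) : -1 < (a + b).re := by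
  rw [Complex.add_re]; linarith [h.re_a, h.re_b]

lemma norm_div (h : IsFHFactor x a b Ω f fp fm u v) (z : ℂ) : ‖z / x‖ = ‖z‖ := by
  rw [_root_.norm_div, h.norm_eq, div_one]

lemma det (h : IsFHFactor x a b Ω f fp fm u v) {n : ℕ} (hn : n ≠ 0) {z : ℂ} (hz : z ∈ Ω)
    (hz1 : ‖z‖ ≠ 1) :
    m11 x a b v n z * m22 x a b v n z - m12 x a b u n z * m21 x a b u n z = 1 := by
  obtain ⟨m, rfl⟩ := Nat.exists_eq_succ_of_ne_zero hn
  have h1 := fhDet_eq_one h.re_a h.re_b h.kappa m (z := z / x) (by rwa [h.norm_div])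
  have h2 := h.u_ne z hz
  have h3 := h.v_ne z hz
  have h4 := h.ne_zero
  simp only [m11, m12, m21, m22, Nat.succ_eq_add_one, Nat.add_sub_cancel]
  rw [← h1, inv_pow]
  field_simp

lemma rowAt_one (h : IsFHFactor x a b Ω f fp fm u v) (hf : CircleIntegrable f 0 1) (n : ℕ) {p : ℂ}
    (hp : p ∈ Ω) : RowAt (cauchyT fun s => f s * s ^ (-(n : ℤ))) (m11 x a b v n)
      (m12 x a b u n) p := by
  have hu := h.diff_u.analyticAt (h.isOpen.mem_nhds hp)
  have hv := h.diff_v.analyticAt (h.isOpen.mem_nhds hp)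
  have h1 : AnalyticAt ℂ (m11 x a b v n) p := by
    refine AnalyticAt.div (analyticAt_const.mul ?_) hv (h.v_ne p hp)
    have : Differentiable ℂ fun z => fhPhi a b n (z / x) :=
      (differentiable_fhPhi a b n).comp (differentiable_id.div_const x)
    exact this.analyticAt p
  obtain ⟨e, he, h2⟩ := exists_analyticAt_mul_cauchyT_sub (p := p) x
    ((circleIntegrable_fhSnd h.re_add n).comp_div h.norm_eq) (hf.mul_zpow (-(n : ℤ))) hu h1 (by
      filter_upwards [h.isOpen.mem_nhds hp] with s hs hs1 hsx
      rw [h.weight s hs hs1 hsx, m11]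
      have := h.v_ne s hs
      have hx := h.ne_zero
      have hs0 : s ≠ 0 := fun h0 => by rw [h0] at hs1; simp at hs1
      rw [div_zpow, zpow_neg, zpow_neg, zpow_natCast, zpow_natCast]
      field_simp)
  refine ⟨h1, e, he, h2.mono fun z hz hz1 => ?_⟩
  rw [← hz hz1, cauchyT_comp_div (fun s => fhPhi a b n s * fhWeight a b s * s ^ (-(n : ℤ)))
    h.norm_eq]
  rfl

lemma rowAt_two (h : IsFHFactor x a b Ω f fp fm u v) (hf : CircleIntegrable f 0 1) {n : ℕ}
    (hn : n ≠ 0) {p : ℂ} (hp : p ∈ Ω) :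
    RowAt (cauchyT fun s => f s * s ^ (-(n : ℤ))) (m21 x a b u n) (m22 x a b v n) p := by
  obtain ⟨m, rfl⟩ := Nat.exists_eq_succ_of_ne_zero hn
  have hu := h.diff_u.analyticAt (h.isOpen.mem_nhds hp)
  have hv := h.diff_v.analyticAt (h.isOpen.mem_nhds hp)
  have h1 : AnalyticAt ℂ (m21 x a b u (m + 1)) p := by
    refine AnalyticAt.div ?_ hu (h.u_ne p hp)
    have : Differentiable ℂ fun z => fhPhiDual a b m (z / x) :=
      ((differentiable_fhPsi a b m).const_mul _).comp (differentiable_id.div_const x)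
    exact this.analyticAt p
  obtain ⟨e, he, h2⟩ := exists_analyticAt_mul_cauchyT_sub (p := p) x
    (g := fun z => v z * x⁻¹ ^ (m + 1))
    ((circleIntegrable_fhPhiDual h.re_add m (-((m + 1 : ℕ) : ℤ))).comp_div h.norm_eq)
    (hf.mul_zpow (-((m + 1 : ℕ) : ℤ))) (hv.mul analyticAt_const) h1 (by
      filter_upwards [h.isOpen.mem_nhds hp] with s hs hs1 hsx
      rw [h.weight s hs hs1 hsx, m21]
      have := h.u_ne s hs
      have hx := h.ne_zero
      have hs0 : s ≠ 0 := fun h0 => by rw [h0] at hs1; simp at hs1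
      rw [div_zpow, zpow_neg, zpow_neg, zpow_natCast, zpow_natCast, Nat.add_sub_cancel, inv_pow]
      field_simp)
  refine ⟨h1, e, he, h2.mono fun z hz hz1 => ?_⟩
  rw [Nat.succ_eq_add_one, ← hz hz1, cauchyT_comp_div (fun s => fhPhiDual a b m s *
    (fhWeight a b s * s ^ (-((m + 1 : ℕ) : ℤ)))) h.norm_eq, m22, Nat.add_sub_cancel, fhSndDual]
  ring

end IsFHFactor

/-- Entries of the global parametrix. -/
noncomputable def szegoN11 (fm : ℂ → ℂ) (n : ℕ) (z : ℂ) : ℂ :=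
  if ‖z‖ < 1 then 0 else fm z * z⁻¹ ^ n

/-- Entries of the global parametrix. -/
noncomputable def szegoN12 (fp : ℂ → ℂ) (z : ℂ) : ℂ := if ‖z‖ < 1 then -fp z else 0

/-- Entries of the global parametrix. -/
noncomputable def szegoN21 (fp : ℂ → ℂ) (z : ℂ) : ℂ := if ‖z‖ < 1 then (fp z)⁻¹ else 0

/-- Entries of the global parametrix. -/
noncomputable def szegoN22 (fm : ℂ → ℂ) (n : ℕ) (z : ℂ) : ℂ :=
  if ‖z‖ < 1 then 0 else z ^ n * (fm z)⁻¹

namespace IsFHFactor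

variable {x a b : ℂ} {Ω : Set ℂ} {f fp fm u v : ℂ → ℂ}

lemma cpow_ne {z : ℂ} (hz : ‖z‖ < 1) (a : ℂ) : (1 - z) ^ a ≠ 0 :=
  left_ne_zero_of_mul (one_sub_cpow_mul_neg hz a ▸ one_ne_zero)

lemma product_one (h : IsFHFactor x a b Ω f fp fm u v) (n : ℕ) {z : ℂ} (hz : z ∈ Ω)
    (hz1 : ‖z‖ ≠ 1) :
    m11 x a b v n z * szegoN11 fm n z + m12 x a b u n z * szegoN21 fp z = fhDiag a b n (z / x) ∧
    m11 x a b v n z * szegoN12 fp z + m12 x a b u n z * szegoN22 fm n z =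
      x ^ n * (u z / v z) * fhOff a b n (z / x) := by
  have hx := h.ne_zero
  have hu := h.u_ne z hz
  have hv := h.v_ne z hz
  have hz0 : z ≠ 0 := fun h0 => h.zero_notMem (h0 ▸ hz)
  have hnd := h.norm_div z
  simp only [m11, m12, szegoN11, szegoN12, szegoN21, szegoN22, fhDiag, fhOff, hnd]
  rcases lt_or_gt_of_ne hz1 with h1 | h1
  · have hw := cpow_ne (z := z / x) (by rwa [hnd]) a
    simp only [if_pos h1, h.plus z hz h1, Complex.cpow_neg]
    generalize (1 - z / x) ^ a = q at hw ⊢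
    constructor <;> field_simp <;> ring
  · have hw := cpow_ne (z := (z / x)⁻¹) (by
      rw [norm_inv, hnd]; exact inv_lt_one_of_one_lt₀ h1) b
    simp only [if_neg h1.not_gt, h.minus z hz h1, Complex.cpow_neg]
    generalize (1 - (z / x)⁻¹) ^ b = q at hw ⊢
    constructor
    · rw [inv_div, div_pow, inv_pow]
      field_simp
      ring
    · rw [div_pow]
      field_simp
      ring

lemma product_two (h : IsFHFactor x a b Ω f fp fm u v) {n : ℕ} (hn : n ≠ 0) {z : ℂ} (hz : z ∈ Ω)
    (hz1 : ‖z‖ ≠ 1) :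
    m21 x a b u n z * szegoN11 fm n z + m22 x a b v n z * szegoN21 fp z =
      x⁻¹ ^ n * (v z / u z * (z / x)⁻¹) *
        ((fhNorm a b (n - 1))⁻¹ * fhOff b a (n - 1) (z / x)⁻¹) ∧
    m21 x a b u n z * szegoN12 fp z + m22 x a b v n z * szegoN22 fm n z =
      (fhNorm a b (n - 1))⁻¹ * fhDiag b a (n - 1) (z / x)⁻¹ := by
  obtain ⟨m, rfl⟩ := Nat.exists_eq_succ_of_ne_zero hn
  rw [Nat.succ_eq_add_one]
  have hx := h.ne_zero
  have hu := h.u_ne z hz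
  have hv := h.v_ne z hz
  have hz0 : z ≠ 0 := fun h0 => h.zero_notMem (h0 ▸ hz)
  have hnd := h.norm_div z
  have hw0 : z / x ≠ 0 := div_ne_zero hz0 hx
  have hz' : z = x * (z / x) := by field_simp
  simp only [m21, m22, szegoN11, szegoN12, szegoN21, szegoN22, Nat.add_sub_cancel]
  rw [fhSndDual_eq h.re_a h.re_b m (by rwa [hnd]) hw0, fhPhiDual, fhPsi_eq a b m hw0]
  simp only [fhDiag, fhOff, norm_inv, hnd, inv_inv]
  rcases lt_or_gt_of_ne hz1 with h1 | h1
  · have hw := cpow_ne (z := z / x) (by rwa [hnd]) a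
    have h2 : ¬ ‖z‖⁻¹ < 1 := by
      rw [not_lt]
      exact (one_le_inv₀ (norm_pos_iff.2 hz0)).2 h1.le
    simp only [if_pos h1, if_neg h2, h.plus z hz h1, Complex.cpow_neg]
    generalize z / x = w at *
    generalize (1 - w) ^ a = q at hw ⊢
    generalize fhSnd b a m w⁻¹ = y
    generalize fhPhi b a m w⁻¹ = y'
    simp only [inv_pow, pow_succ]
    constructor <;> field_simp <;> ring
  · have hw := cpow_ne (z := (z / x)⁻¹) (by
      rw [norm_inv, hnd]; exact inv_lt_one_of_one_lt₀ h1) b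
    have h2 : ‖z‖⁻¹ < 1 := inv_lt_one_of_one_lt₀ h1
    simp only [if_neg h1.not_gt, if_pos h2, h.minus z hz h1, Complex.cpow_neg]
    generalize z / x = w at *
    generalize (1 - w⁻¹) ^ b = q at hw ⊢
    generalize fhSnd b a m w⁻¹ = y
    generalize fhPhi b a m w⁻¹ = y'
    simp only [inv_pow, pow_succ]
    subst hz'
    constructor <;> field_simp <;> ring

end IsFHFactor

lemma WO.of_symBound {F : ℕ → ℂ → ℂ} {k : ℕ} (h : SymBound univ k F) {x : ℂ} (hx : ‖x‖ = 1) {p : ℂ}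
    (hp : p ≠ 0) {σ : ℕ → ℕ} (hσ : ∀ n, n ≤ σ n + 1) :
    WO p (fun n => ((n : ℝ)⁻¹) ^ k) fun n z => F (σ n) (z / x) := by
  obtain ⟨C, hC, M, hM⟩ := h
  refine WO.of_bound (C := C) (m := M) (fun n => by positivity) ?_
  have h1 : ∀ᶠ y : ℕ × ℂ in atTop ×ˢ nhds p, y.2 ≠ 0 :=
    tendsto_snd.eventually (isOpen_ne.mem_nhds hp)
  have h2 : ∀ᶠ y : ℕ × ℂ in atTop ×ˢ nhds p, 1 ≤ y.1 :=
    tendsto_fst.eventually (eventually_ge_atTop 1)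
  filter_upwards [h1, h2] with y hy hn hy1
  have hx0 : x ≠ 0 := by rintro rfl; simp at hx
  have hnd : ‖y.2 / x‖ = ‖y.2‖ := by rw [norm_div, hx, div_one]
  have h3 := hM (σ y.1) (y.2 / x) (mem_univ _) (div_ne_zero hy hx0) (by rwa [hnd])
  have h4 : symWt (y.2 / x) ≤ wt y.2 := by
    have := symWt_le_wt (z := y.2 / x) (by rwa [hnd]) (div_ne_zero hy hx0)
    rwa [wt, hnd] at this
  have h5 : (1:ℝ) ≤ symWt (y.2 / x) := one_le_symWt (by rwa [hnd])
  refine h3.trans ?_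
  have h6 : (1:ℝ) ≤ y.1 := by exact_mod_cast hn
  have h7 : (y.1 : ℝ) ≤ (σ y.1 : ℝ) + 1 := by exact_mod_cast hσ y.1
  have h8 : ((σ y.1 : ℝ) + 1)⁻¹ ^ k ≤ ((y.1 : ℝ)⁻¹) ^ k := by gcongr
  have h9 : symWt (y.2 / x) ^ M ≤ wt y.2 ^ M := pow_le_pow_left₀ (by linarith) h4 _
  rw [div_eq_mul_inv, ← inv_pow, mul_assoc]
  refine mul_le_mul_of_nonneg_left ?_ hC
  rw [mul_comm]
  exact mul_le_mul h8 h9 (by positivity) (by positivity)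

section GlobalParametrix

variable (fp fm : ℂ → ℂ)

/-- Entries of the parametrix away from the singularities. -/
noncomputable def offM11 (n : ℕ) (z : ℂ) : ℂ := if ‖z‖ < 1 then 0 else z ^ n * (fm z)⁻¹

/-- Entries of the parametrix away from the singularities. -/
noncomputable def offM12 (z : ℂ) : ℂ := if ‖z‖ < 1 then fp z else 0

/-- Entries of the parametrix away from the singularities. -/
noncomputable def offM21 (z : ℂ) : ℂ := if ‖z‖ < 1 then -(fp z)⁻¹ else 0

/-- Entries of the parametrix away from the singularities. -/
noncomputable def offM22 (n : ℕ) (z : ℂ) : ℂ := if ‖z‖ < 1 then 0 else fm z * z⁻¹ ^ n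

variable {fp fm}

lemma rowAt_off {F : ℂ → ℂ} (hF : CircleIntegrable F 0 1) {p : ℂ} (hp : ‖p‖ ≠ 1)
    {q1 q2 r1 r2 : ℂ → ℂ} (h1 : ‖p‖ < 1 → AnalyticAt ℂ q1 p) (h2 : ‖p‖ < 1 → AnalyticAt ℂ q2 p)
    (h3 : 1 < ‖p‖ → AnalyticAt ℂ r1 p) (h4 : 1 < ‖p‖ → AnalyticAt ℂ r2 p) :
    RowAt (cauchyT F) (fun z => if ‖z‖ < 1 then q1 z else r1 z)
      (fun z => if ‖z‖ < 1 then q2 z else r2 z) p := by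
  have hT := analyticAt_cauchyT hF hp
  rcases lt_or_gt_of_ne hp with h | h
  · have hn : ∀ᶠ z in nhds p, ‖z‖ < 1 := continuous_norm.continuousAt.eventually_lt_const h
    refine ⟨(h1 h).congr (hn.mono fun z hz => by simp [hz]), fun z => q2 z - q1 z * cauchyT F z,
      (h2 h).sub ((h1 h).mul hT), hn.mono fun z hz _ => ?_⟩
    simp [hz]
  · have hn : ∀ᶠ z in nhds p, 1 < ‖z‖ := continuous_norm.continuousAt.eventually_const_lt h
    refine ⟨(h3 h).congr (hn.mono fun z hz => by simp [hz.not_gt]),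
      fun z => r2 z - r1 z * cauchyT F z, (h4 h).sub ((h3 h).mul hT), hn.mono fun z hz _ => ?_⟩
    simp [hz.not_gt]

variable {F : ℂ → ℂ} (hF : CircleIntegrable F 0 1) (hfp : DifferentiableOn ℂ fp {z | ‖z‖ < 1})
  (hfp0 : ∀ z, ‖z‖ < 1 → fp z ≠ 0) (hfm : DifferentiableOn ℂ fm {z | 1 < ‖z‖})
  (hfm0 : ∀ z, 1 < ‖z‖ → fm z ≠ 0)

include hF hfp hfm hfm0 in
lemma rowAt_off_one {p : ℂ} (hp : ‖p‖ ≠ 1) (n : ℕ) :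
    RowAt (cauchyT F) (offM11 fm n) (offM12 fp) p := by
  have ho : IsOpen {z : ℂ | 1 < ‖z‖} := isOpen_lt continuous_const continuous_norm
  have hi : IsOpen {z : ℂ | ‖z‖ < 1} := isOpen_lt continuous_norm continuous_const
  exact rowAt_off hF hp (fun _ => analyticAt_const)
    (fun h => hfp.analyticAt (hi.mem_nhds h))
    (fun h => (analyticAt_id.pow n).mul ((hfm.analyticAt (ho.mem_nhds h)).inv (hfm0 p h)))
    (fun _ => analyticAt_const)

include hF hfp hfp0 hfm in
lemma rowAt_off_two {p : ℂ} (hp : ‖p‖ ≠ 1) (n : ℕ) :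
    RowAt (cauchyT F) (offM21 fp) (offM22 fm n) p := by
  have ho : IsOpen {z : ℂ | 1 < ‖z‖} := isOpen_lt continuous_const continuous_norm
  have hi : IsOpen {z : ℂ | ‖z‖ < 1} := isOpen_lt continuous_norm continuous_const
  refine rowAt_off hF hp (fun h => ((hfp.analyticAt (hi.mem_nhds h)).inv (hfp0 p h)).neg)
    (fun _ => analyticAt_const) (fun _ => analyticAt_const)
    (fun h => (hfm.analyticAt (ho.mem_nhds h)).mul ((analyticAt_id.inv ?_).pow n))
  rintro h0
  simp only [id] at h0
  rw [h0] at h; simp at h; linarith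

end GlobalParametrix

lemma differentiableOn_const_div_sub {S : Set ℂ} (r : ℂ) {x : ℂ} (hx : x ∉ S) :
    DifferentiableOn ℂ (fun z => r / (z - x)) S :=
  (differentiableOn_const _).div (differentiableOn_id.sub_const x)
    fun z hz h => hx (by rwa [← sub_eq_zero.1 h])

/-- Second order asymptotics of the constant term of the monic orthogonal polynomials on the unit
circle with respect to a weight with finitely many Fisher–Hartwig singularities. -/
theorem fisherHartwig_asymptotics {ι : Type} [Fintype ι] [DecidableEq ι] {x a b : ι → ℂ}
    {Ω : ι → Set ℂ} {f fp fm : ℂ → ℂ} {u v : ι → ℂ → ℂ}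
    (hloc : ∀ j, IsFHFactor (x j) (a j) (b j) (Ω j) f fp fm (u j) (v j))
    {ρ : ℝ} (hρ : 0 < ρ) (hΩρ : ∀ j, Ω j ⊆ Metric.ball 0 ρ) (hxΩ : ∀ j k, j ≠ k → x j ∉ Ω k)
    (hcov : ∀ z : ℂ, ‖z‖ = 1 → ∃ j, z ∈ Ω j) (hf : CircleIntegrable f 0 1)
    (hfp : DifferentiableOn ℂ fp {z | ‖z‖ < 1}) (hfp0 : ∀ z, ‖z‖ < 1 → fp z ≠ 0)
    (hfm : DifferentiableOn ℂ fm {z | 1 < ‖z‖}) (hfm0 : ∀ z, 1 < ‖z‖ → fm z ≠ 0)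
    (hfm1 : Tendsto fm (cocompact ℂ) (nhds 1)) {Φ : ℕ → ℂ → ℂ} (hΦ : ∀ n, Differentiable ℂ (Φ n))
    (hΦ1 : ∀ n, Tendsto (fun z => Φ n z * z⁻¹ ^ n) (cocompact ℂ) (nhds 1))
    (hΦ0 : ∀ n, ∀ j < n, mom (fun s => Φ n s * f s) j = 0) :
    ∃ C, ∀ᶠ n : ℕ in atTop,
      ‖Φ n 0 * fp 0 - ∑ k, fhKappa (a k) (b k) n * x k ^ n * (u k (x k) / v k (x k))‖ ≤
        C / (n : ℝ) ^ 2 := by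
  classical
  set q : ι → ℂ → ℂ := fun j z => u j z / v j z with hq
  have hqd : ∀ j, DifferentiableOn ℂ (q j) (Ω j) := fun j =>
    (hloc j).diff_u.div (hloc j).diff_v (hloc j).v_ne
  set K : ℕ → ι → ℂ := fun n j => fhKappa (a j) (b j) n * x j ^ (n + 1) with hK
  set U : Option ι → Set ℂ := fun i => i.elim {z | ‖z‖ ≠ 1} Ω with hU
  set M11 : ℕ → Option ι → ℂ → ℂ := fun n i =>
    i.elim (offM11 fm n) fun j => IsFHFactor.m11 (x j) (a j) (b j) (v j) n with hM11
  set M12 : ℕ → Option ι → ℂ → ℂ := fun n i =>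
    i.elim (offM12 fp) fun j => IsFHFactor.m12 (x j) (a j) (b j) (u j) n with hM12
  set M21 : ℕ → Option ι → ℂ → ℂ := fun n i =>
    i.elim (offM21 fp) fun j => IsFHFactor.m21 (x j) (a j) (b j) (u j) n with hM21
  set M22 : ℕ → Option ι → ℂ → ℂ := fun n i =>
    i.elim (offM22 fm n) fun j => IsFHFactor.m22 (x j) (a j) (b j) (v j) n with hM22
  set g : ℕ → Option ι → ℂ → ℂ := fun n i =>
    i.elim (fun _ => 0) fun j z => K n j * q j z / (z - x j) with hg
  set s : ℕ → Option ι → ℂ → ℂ := fun n i =>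
    i.elim (fun z => ∑ k, K n k * q k (x k) / (z - x k)) fun j z =>
      ∑ k ∈ Finset.univ.erase j, K n k * q k (x k) / (z - x k) -
        K n j * dslope (q j) (x j) z with hs
  set T : ℕ → ℂ → ℂ := fun n => cauchyT fun s => f s * s ^ (-(n : ℤ)) with hT
  have hfn : ∀ n : ℕ, CircleIntegrable (fun s => f s * s ^ (-(n : ℤ))) 0 1 := fun n =>
    hf.mul_zpow _
  have hne : ∀ i j : Option ι, i ≠ j → ∀ k, i = some k → x k ∉ U j := by
    rintro i (_ | j) hij k rfl
    · simp [hU, (hloc k).norm_eq]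
    · exact hxΩ k j fun h => hij (by rw [h])
  have hUo : IsOpen {z : ℂ | ‖z‖ ≠ 1} := isOpen_offCircle
  have hκb : ∀ j, ∃ B : ℝ, ∀ n : ℕ, 1 ≤ n → ‖K n j‖ ≤ B * (n : ℝ)⁻¹ := fun j => by
    obtain ⟨B, hB⟩ := (hloc j).kappa
    refine ⟨|B|, fun n hn => ?_⟩
    have hn' : (1:ℝ) ≤ n := by exact_mod_cast hn
    rw [hK, norm_mul, norm_pow, (hloc j).norm_eq, one_pow, mul_one, ← div_eq_mul_inv]
    refine (hB n).trans ?_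
    refine (div_le_div_of_nonneg_right (le_abs_self B) (by positivity)).trans ?_
    gcongr
    linarith
  have hne0 : ∀ j, ∀ z ∈ Ω j, z ≠ 0 := fun j z hz h => (hloc j).zero_notMem (h ▸ hz)
  have hqb : ∀ (j : ι) (p : ℂ), p ∈ Ω j → p ≠ x j →
      ContinuousAt (fun z => q j z / (z - x j)) p := fun j p hp hpx =>
    ((hqd j).differentiableAt ((hloc j).isOpen.mem_nhds hp)).continuousAt.div
      (continuousAt_id.sub continuousAt_const) (sub_ne_zero.2 hpx)
  obtain ⟨C, hC⟩ := rh_comparison U none hρ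
    (by rintro (_ | j); exacts [hUo, (hloc j).isOpen])
    (fun z => by
      by_cases hz : ‖z‖ = 1
      · obtain ⟨j, hj⟩ := hcov z hz
        exact ⟨some j, hj⟩
      · exact ⟨none, hz⟩)
    (by rintro (_ | j) h; exacts [absurd rfl h, hΩρ j])
    (by rintro (_ | j) h; exacts [absurd rfl h, (hloc j).zero_notMem])
    T Φ (fun n => cauchyT fun s => Φ n s * (f s * s ^ (-(n : ℤ))))
    (Eventually.of_forall fun n p => rowAt_cauchyT (hfn n) ((hΦ n).analyticAt p)
      ((hfn n).contMul (hΦ n).continuous.continuousOn))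
    M11 M12 M21 M22
    (Eventually.of_forall fun n => by
      rintro (_ | j) p hp
      exacts [rowAt_off_one (hfn n) hfp hfm hfm0 hp n, (hloc j).rowAt_one hf n hp])
    ((eventually_ne_atTop 0).mono fun n hn => by
      rintro (_ | j) p hp
      exacts [rowAt_off_two (hfn n) hfp hfp0 hfm hp n, (hloc j).rowAt_two hf hn hp])
    ((eventually_ne_atTop 0).mono fun n hn => by
      rintro (_ | j) z hz hz1
      · simp only [hM11, hM12, hM21, hM22, Option.elim, offM11, offM12, offM21, offM22]
        rcases lt_or_gt_of_ne hz1 with h1 | h1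
        · simp [h1, hfp0 z h1]
        · have h2 : z ≠ 0 := by rintro rfl; simp at h1; linarith
          have := hfm0 z h1
          simp only [if_neg h1.not_gt, inv_pow]
          field_simp
          ring
      · exact (hloc j).det hn hz hz1)
    (szegoN11 fm) (fun _ => szegoN12 fp) (fun _ => szegoN21 fp) (szegoN22 fm)
    (fun n z hz1 => by
      simp only [szegoN11, szegoN12, szegoN21, szegoN22]
      rcases lt_or_gt_of_ne hz1 with h1 | h1
      · simp [h1, hfp0 z h1]
      · have h2 : z ≠ 0 := by rintro rfl; simp at h1; linarith
        have := hfm0 z h1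
        simp only [if_neg h1.not_gt, inv_pow]
        field_simp
        ring)
    (Eventually.of_forall fun n => by
      have h1 := (hΦ1 n).mul hfm1
      rw [one_mul] at h1
      refine h1.congr' ?_
      have h2 : ∀ᶠ z : ℂ in cocompact ℂ, 1 < ‖z‖ :=
        (tendsto_norm_cocompact_atTop (E := ℂ)).eventually_gt_atTop 1
      filter_upwards [h2] with z hz
      simp only [hM22, hM21, Option.elim, offM22, offM21, if_neg hz.not_gt]
      ring)
    (Eventually.of_forall fun n => by
      have hc : CircleIntegrable (fun s => Φ n s * f s) 0 1 :=
        hf.contMul (hΦ n).continuous.continuousOn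
      have h1 := (tendsto_cauchyT_cocompact hc).mul (hfm1.inv₀ one_ne_zero)
      rw [zero_mul] at h1
      refine h1.congr' ?_
      have h2 : ∀ᶠ z : ℂ in cocompact ℂ, 1 < ‖z‖ :=
        (tendsto_norm_cocompact_atTop (E := ℂ)).eventually_gt_atTop 1
      filter_upwards [h2] with z hz
      simp only [hM11, hM12, Option.elim, offM11, offM12, if_neg hz.not_gt]
      rw [cauchyT_eq_sum_add hc hz.ne' n, Finset.sum_eq_zero fun k hk => by
        rw [hΦ0 n k (Finset.mem_range.1 hk), mul_zero]]
      simp only [mul_assoc]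
      ring)
    s g
    (by
      rintro n (_ | j)
      · refine DifferentiableOn.fun_sum fun k _ => differentiableOn_const_div_sub _ ?_
        simp [hU, (hloc k).norm_eq]
      · refine DifferentiableOn.sub (DifferentiableOn.fun_sum fun k hk =>
          differentiableOn_const_div_sub _ (hxΩ k j (Finset.ne_of_mem_erase hk))) ?_
        exact ((Complex.differentiableOn_dslope ((hloc j).isOpen.mem_nhds (hloc j).mem)).2
          (hqd j)).const_mul _)
    (fun n => by
      have h1 : Tendsto (fun z : ℂ => ∑ k, K n k * q k (x k) / (z - x k)) (cocompact ℂ)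
          (nhds (∑ k : ι, K n k * q k (x k) * 0)) := by
        refine tendsto_finsetSum _ fun k _ => ?_
        simp only [div_eq_mul_inv]
        refine Tendsto.const_mul _ ?_
        have h2 := tendsto_inv₀_cobounded (α := ℂ)
        rw [Metric.cobounded_eq_cocompact] at h2
        refine h2.comp ?_
        simpa [sub_eq_add_neg] using (Homeomorph.addRight (-x k)).isClosedEmbedding.tendsto_cocompact
      simp only [mul_zero, Finset.sum_const_zero] at h1
      exact h1)
    (by
      have key : ∀ n (i j : Option ι), i ≠ j → ∀ z ∈ U i ∩ U j,
          s n i z + g n i z = ∑ k, K n k * q k (x k) / (z - x k) := by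
        rintro n (_ | i) j hij z hz
        · simp [hs, hg]
        · have hzx : z - x i ≠ 0 := sub_ne_zero.2 fun h => hne _ _ hij i rfl (h ▸ hz.2)
          simp only [hs, hg, Option.elim]
          rw [dslope_of_ne _ (sub_ne_zero.1 hzx), slope_def_field,
            ← Finset.add_sum_erase _ _ (Finset.mem_univ i)]
          field_simp
          ring
      intro n i j hij z hz
      have h1 := key n i j hij z hz
      have h2 := key n j i hij.symm z hz.symm
      linear_combination h1 - h2)
    (by
      rintro n (_ | i) j hij
      · exact differentiableOn_const _
      · refine DifferentiableOn.div (((hqd i).mono inter_subset_left).const_mul _)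
          (differentiableOn_id.sub_const _) fun z hz h => ?_
        exact hne _ _ hij i rfl (sub_eq_zero.1 h ▸ hz.2))
    (by
      rintro (_ | i) j hij p hp
      · simp only [hg, Option.elim]
        exact Asymptotics.isBigO_zero _ _
      · obtain ⟨B, hB⟩ := hκb i
        have h1 := (hqb i p hp.1 fun h => hne _ _ hij i rfl (h ▸ hp.2)).isBigO_one ℝ
        have h2 : (fun n => K n i) =O[atTop] fun n : ℕ => (n : ℝ)⁻¹ :=
          Asymptotics.IsBigO.of_bound B ((eventually_ge_atTop 1).mono fun n hn => by
            rw [Real.norm_of_nonneg (by positivity)]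
            exact hB n hn)
        refine ((h2.comp_tendsto tendsto_fst).mul (h1.comp_tendsto tendsto_snd)).congr ?_ ?_
        · intro y
          simp only [hg, Option.elim, Function.comp]
          ring
        · intro y
          simp)
    (by
      rintro (_ | i) j hij p hp
      · refine (WO.of_isBigO (F := fun _ _ => 0) (Asymptotics.isBigO_zero _ _)).congr
          (Eventually.of_forall fun y hy => ?_)
        simp only [hM11, hM12, Option.elim, offM11, offM12, szegoN11, szegoN21]
        rcases lt_or_gt_of_ne hy with h1 | h1
        · simp [h1, hfp0 _ h1]
        · have h2 : y.2 ≠ 0 := by intro h; rw [h] at h1; simp at h1; linarith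
          have := hfm0 _ h1
          simp only [if_neg h1.not_gt, inv_pow]
          field_simp
          ring
      · have h1 := WO.of_symBound (symBound_fhDiag (hloc i).re_a (hloc i).re_b (hloc i).kappa)
          (hloc i).norm_eq (hne0 i p hp.1) (σ := id) (fun n => by simp)
        simp only [pow_one] at h1
        refine h1.congr ?_
        filter_upwards [tendsto_snd.eventually ((hloc i).isOpen.mem_nhds hp.1)] with y hy hy1
        exact congrArg (· - 1) ((hloc i).product_one y.1 hy hy1).1.symm)
    (by
      rintro (_ | i) j hij p hp
      · refine (WO.of_isBigO (F := fun _ _ => 0) (Asymptotics.isBigO_zero _ _)).congr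
          (Eventually.of_forall fun y hy => ?_)
        simp only [hM21, hM22, Option.elim, offM21, offM22, szegoN12, szegoN22]
        rcases lt_or_gt_of_ne hy with h1 | h1
        · simp [h1, hfp0 _ h1]
        · have h2 : y.2 ≠ 0 := by intro h; rw [h] at h1; simp at h1; linarith
          have := hfm0 _ h1
          simp only [if_neg h1.not_gt, inv_pow]
          field_simp
          ring
      · have h1 := WO.of_symBound (symBound_of_dual_diag (hloc i).re_a (hloc i).re_b (hloc i).kappa
          (hloc i).kappa') (hloc i).norm_eq (hne0 i p hp.1) (σ := fun n => n - 1)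
          (fun n => by omega)
        simp only [pow_one] at h1
        refine h1.congr ?_
        filter_upwards [tendsto_snd.eventually ((hloc i).isOpen.mem_nhds hp.1),
          tendsto_fst.eventually (eventually_ne_atTop 0)] with y hy hn hy1
        exact congrArg (· - 1) ((hloc i).product_two hn hy hy1).2.symm)
    (by
      rintro (_ | i) j hij p hp
      · refine (WO.of_isBigO (F := fun _ _ => 0) (Asymptotics.isBigO_zero _ _)).congr
          (Eventually.of_forall fun y hy => ?_)
        simp only [hM21, hM22, Option.elim, offM21, offM22, szegoN11, szegoN21]
        by_cases h1 : ‖y.2‖ < 1 <;> simp [h1]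
      · have hi := hloc i
        have h1 := WO.of_symBound (symBound_of_dual_off hi.re_a hi.re_b hi.kappa
          hi.kappa') hi.norm_eq (hne0 i p hp.1) (σ := fun n => n - 1)
          (fun n => by omega)
        simp only [pow_one] at h1
        have h2 : ContinuousAt (fun z => v i z / u i z * (z / x i)⁻¹) p := by
          have hz0 := hne0 i p hp.1
          have := hi.ne_zero
          exact ((hi.diff_v.differentiableAt (hi.isOpen.mem_nhds hp.1)).continuousAt.div
            (hi.diff_u.differentiableAt (hi.isOpen.mem_nhds hp.1)).continuousAt
            (hi.u_ne p hp.1)).mul ((continuousAt_id.div_const _).inv₀ (div_ne_zero hz0 this))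
        have h3 : WO p (fun _ => 1) fun n _ => (x i)⁻¹ ^ n := WO.of_isBigO <|
          Asymptotics.IsBigO.of_bound 1 (Eventually.of_forall fun y => by
            simp [hi.norm_eq])
        refine (((h3.mul (WO.of_continuousAt h2)).mul h1).mono ?_).congr ?_
        · simpa using Asymptotics.isBigO_refl _ _
        filter_upwards [tendsto_snd.eventually (hi.isOpen.mem_nhds hp.1),
          tendsto_fst.eventually (eventually_ne_atTop 0)] with y hy hn hy1
        exact (hi.product_two hn hy hy1).1.symm)
    (by
      rintro (_ | i) j hij p hp
      · refine (WO.of_isBigO (F := fun _ _ => 0) (Asymptotics.isBigO_zero _ _)).congr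
          (Eventually.of_forall fun y hy => ?_)
        simp only [hM11, hM12, hg, Option.elim, offM11, offM12, szegoN12, szegoN22]
        by_cases h1 : ‖y.2‖ < 1 <;> simp [h1]
      · have hi := hloc i
        have h1 := WO.of_symBound (symBound_fhOff hi.re_a hi.re_b hi.kappa)
          hi.norm_eq (hne0 i p hp.1) (σ := id) (fun n => by simp)
        have h2 : ContinuousAt (q i) p :=
          ((hqd i).differentiableAt (hi.isOpen.mem_nhds hp.1)).continuousAt
        have h3 : WO p (fun _ => 1) fun n _ => x i ^ n := WO.of_isBigO <|
          Asymptotics.IsBigO.of_bound 1 (Eventually.of_forall fun y => by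
            simp [hi.norm_eq])
        refine (((h3.mul (WO.of_continuousAt h2)).mul h1).mono ?_).congr ?_
        · simpa [pow_two] using Asymptotics.isBigO_refl _ _
        have hpx : p ≠ x i := fun h => hne _ _ hij i rfl (h ▸ hp.2)
        filter_upwards [tendsto_snd.eventually (hi.isOpen.mem_nhds hp.1),
          tendsto_snd.eventually (isOpen_ne.mem_nhds hpx)] with y hy hyx hy1
        have h4 := (hi.product_one y.1 hy hy1).2
        have h5 : y.2 - x i ≠ 0 := sub_ne_zero.2 hyx
        have h6 := hi.ne_zero
        have h7 : y.2 / x i - 1 ≠ 0 := by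
          rw [div_sub_one h6]; exact div_ne_zero h5 h6
        simp only [hM11, hM12, hg, hK, Option.elim, id]
        rw [h4]
        have h8 : fhKappa (a i) (b i) y.1 / (y.2 / x i - 1) =
            fhKappa (a i) (b i) y.1 * x i / (y.2 - x i) := by
          field_simp
        rw [h8, pow_succ]
        simp only [hq]
        ring)
  refine ⟨C, hC.mono fun n hn => ?_⟩
  refine le_of_eq_of_le ?_ hn
  rw [← norm_neg]
  congr 1
  simp only [hM12, hM11, hs, Option.elim, offM12, offM11, norm_zero, zero_lt_one, if_true, mul_zero,
    add_zero, neg_sub, hK, hq]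
  have : ∀ k, fhKappa (a k) (b k) n * x k ^ (n + 1) * (u k (x k) / v k (x k)) / (0 - x k) =
      -(fhKappa (a k) (b k) n * x k ^ n * (u k (x k) / v k (x k))) := fun k => by
    have h6 := (hloc k).ne_zero
    rw [zero_sub, div_neg, pow_succ]
    field_simp
  simp only [this, Finset.sum_neg_distrib]
  ring

lemma isBigO_sq_of_hasDerivAt_zero {F : ℂ → ℂ} (hF : AnalyticAt ℂ F 0) (h0 : F 0 = 0)
    (h1 : HasDerivAt F 0 0) : F =O[nhds 0] fun z => z ^ 2 := by
  have aux : ∀ {G : ℂ → ℂ}, AnalyticAt ℂ G 0 → AnalyticAt ℂ (dslope G 0) 0 := fun ⟨p, hp⟩ =>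
    ⟨_, hp.has_fpower_series_dslope_fslope⟩
  have h2 := aux (aux hF)
  have h3 : ∀ z, F z = z ^ 2 * dslope (dslope F 0) 0 z := fun z => by
    have e1 := sub_smul_dslope F 0 z
    have e2 := sub_smul_dslope (dslope F 0) 0 z
    rw [dslope_same, h1.deriv] at e2
    simp only [sub_zero, smul_eq_mul, h0] at e1 e2
    rw [pow_two, mul_assoc, e2, e1]
  have h4 := h2.continuousAt.isBigO_one ℂ
  refine ((Asymptotics.isBigO_refl (fun z : ℂ => z ^ 2) (nhds 0)).mul h4).congr
    (fun z => (h3 z).symm) fun z => mul_one _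

lemma fhKappa_zero (a b : ℂ) : fhKappa a b 0 = 1 := by simp [fhKappa]

lemma norm_fhKappa_conj {a b : ℂ} (ha : -(1 / 2) < a.re) (hb : b = (starRingEnd ℂ) a) (n : ℕ) :
    ‖fhKappa a b n‖ * ‖a + n‖ = ‖a‖ := by
  induction n with
  | zero => simp [fhKappa_zero]
  | succ n ih =>
    have h := congrArg norm (fhKappa_succ (b := b) ha n)
    rw [norm_mul, norm_mul] at h
    have h2 : ‖b + n‖ = ‖a + n‖ := by
      rw [hb, ← RCLike.norm_conj (a + n)]
      simp
    rw [h2, ih] at h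
    rw [← h]
    push_cast
    ring_nf

lemma exists_fhKappa_bound {a b : ℂ} (ha : -(1 / 2) < a.re) (hb : b = (starRingEnd ℂ) a) :
    ∃ K : ℝ, ∀ n, ‖fhKappa a b n‖ ≤ K / (n + 1) := by
  refine ⟨1 + 4 * ‖a‖, fun n => ?_⟩
  rw [le_div_iff₀ (by positivity)]
  rcases Nat.eq_zero_or_pos n with rfl | hn
  · simp [fhKappa_zero]
  have hn' : (1:ℝ) ≤ n := by exact_mod_cast hn
  have h1 := half_le_norm_add ha hn'
  have h2 := norm_fhKappa_conj ha hb n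
  rw [add_comm] at h2
  rw [Complex.ofReal_natCast] at h1
  have h3 := norm_nonneg (fhKappa a b n)
  nlinarith [norm_nonneg a]

lemma fhKappa_self_mul {a : ℂ} (ha : -(1 / 2) < a.re) (n : ℕ) : fhKappa a a n * (a + n) = a := by
  induction n with
  | zero => simp [fhKappa_zero]
  | succ n ih =>
    have h := fhKappa_succ (b := a) ha n
    rw [ih] at h
    push_cast
    linear_combination h

lemma tendsto_natCast_div_succ_cpow (s : ℂ) :
    Tendsto (fun n : ℕ => (((n : ℝ) / (n + 1) : ℝ) : ℂ) ^ s) atTop (nhds 1) := by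
  have h1 : Tendsto (fun n : ℕ => (n : ℝ) / (n + 1)) atTop (nhds 1) :=
    tendsto_natCast_div_add_atTop 1
  have h2 : ContinuousAt (fun x : ℝ => ((x : ℂ)) ^ s) 1 := by
    refine ContinuousAt.cpow Complex.continuous_ofReal.continuousAt continuousAt_const ?_
    simp
  have h3 := h2.tendsto.comp h1
  simp only [Complex.ofReal_one, Complex.one_cpow] at h3
  exact h3

/-- The leading coefficient in `fhKappa_asymptotics`. -/
noncomputable def fhKappaLim (a : ℂ) : ℂ := a * Complex.Gamma a / Complex.Gamma (-a)

lemma tendsto_fhKappa_mul {a : ℂ} (ha0 : a ≠ 0) (hG : ∀ m : ℕ, -a ≠ -m) :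
    Tendsto (fun n : ℕ => (n : ℂ) ^ (1 + 2 * a) * fhKappa a (-a) (n + 1)) atTop
      (nhds (fhKappaLim a)) := by
  have h1 := (Complex.GammaSeq_tendsto_Gamma (a + 1)).div (Complex.GammaSeq_tendsto_Gamma (-a))
    (Complex.Gamma_ne_zero hG)
  rw [Complex.Gamma_add_one a ha0] at h1
  refine h1.congr' ?_
  filter_upwards [eventually_ne_atTop 0] with n hn
  have hn' : (n : ℂ) ≠ 0 := by exact_mod_cast hn
  have h2 : ((n.factorial : ℕ) : ℂ) ≠ 0 := by exact_mod_cast n.factorial_ne_zero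
  have h3 : (n : ℂ) ^ (a + 1) = (n : ℂ) ^ (1 + 2 * a) * (n : ℂ) ^ (-a) := by
    rw [← Complex.cpow_add _ _ hn']
    ring_nf
  have h4 : (n : ℂ) ^ (-a) ≠ 0 := by simp [hn']
  simp only [Pi.div_apply, Complex.GammaSeq, fhKappa, poch]
  rw [h3]
  generalize ∏ j ∈ Finset.range (n + 1), (a + 1 + (j : ℂ)) = s
  generalize ∏ j ∈ Finset.range (n + 1), (-a + (j : ℂ)) = t
  field_simp

lemma fhKappa_asymptotics {a : ℂ} (ha : a.re = 0) : ∃ C : ℝ, ∀ n : ℕ, 1 ≤ n →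
    ‖fhKappa a (-a) n - fhKappaLim a * (n : ℂ) ^ (-1 - 2 * a)‖ ≤ C / (n : ℝ) ^ 2 := by
  have hconj : -a = (starRingEnd ℂ) a := by
    apply Complex.ext <;> simp [ha]
  have ha' : -(1 / 2) < a.re := by rw [ha]; norm_num
  rcases eq_or_ne a 0 with rfl | ha0
  · refine ⟨0, fun n hn => ?_⟩
    have h := norm_fhKappa_conj ha' hconj n
    have hn' : (n : ℂ) ≠ 0 := by exact_mod_cast (by omega : n ≠ 0)
    simp only [zero_add, norm_zero, mul_eq_zero, norm_eq_zero, hn', or_false] at h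
    rw [h]
    simp [fhKappaLim]
  set x : ℕ → ℂ := fun n => fhKappa a (-a) (n + 1) * ((n + 1 : ℝ) : ℂ) ^ (1 + 2 * a) with hx
  set F : ℂ → ℂ := fun e => (1 - a * e) * (1 + e) ^ (1 + 2 * a) / (1 + (1 + a) * e) - 1 with hF
  have hF1 : AnalyticAt ℂ F 0 := by
    refine AnalyticAt.sub (AnalyticAt.div ?_ (by fun_prop) (by simp)) analyticAt_const
    refine AnalyticAt.mul (by fun_prop) (AnalyticAt.cpow (by fun_prop) analyticAt_const ?_)
    simp
  have hF2 : HasDerivAt F 0 0 := by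
    have h1 : HasDerivAt (fun e : ℂ => 1 - a * e) (-a) 0 := by
      simpa using ((hasDerivAt_id (0:ℂ)).const_mul a).const_sub 1
    have h2 : HasDerivAt (fun e : ℂ => (1 + e) ^ (1 + 2 * a)) (1 + 2 * a) 0 := by
      have := ((hasDerivAt_id (0:ℂ)).const_add 1).cpow_const (c := 1 + 2 * a) (by simp)
      simpa using this
    have h3 : HasDerivAt (fun e : ℂ => 1 + (1 + a) * e) (1 + a) 0 := by
      simpa using ((hasDerivAt_id (0:ℂ)).const_mul (1 + a)).const_add 1
    refine (((h1.mul h2).div h3 (by simp)).sub_const 1).congr_deriv ?_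
    simp
    ring
  have hO := (isBigO_sq_of_hasDerivAt_zero hF1 (by simp [hF]) hF2).comp_tendsto
    (tendsto_one_div_add_atTop_nhds_zero_nat (𝕜 := ℂ))
  obtain ⟨K, hK, hKb⟩ := Asymptotics.bound_of_isBigO_nat_atTop hO
  have hstep : ∀ n, x (n + 1) = x n * (1 + F (1 / ((n : ℂ) + 1))) := by
    intro n
    have hn1 : ((n : ℂ) + 1) ≠ 0 := by exact_mod_cast n.succ_ne_zero
    have h1 : a + 1 + ((n + 1 : ℕ) : ℂ) ≠ 0 :=
      add_nat_ne_zero (x := a + 1) (by simp [ha]) (n + 1)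
    have h2 := fhKappa_succ (b := -a) ha' (n + 1)
    have h3 : fhKappa a (-a) (n + 2) =
        fhKappa a (-a) (n + 1) * (-a + ((n + 1 : ℕ) : ℂ)) / (a + 1 + ((n + 1 : ℕ) : ℂ)) := by
      rw [eq_div_iff h1, h2]
    have h4 : ((((n + 1 : ℕ) : ℝ) + 1 : ℝ) : ℂ) ^ (1 + 2 * a) =
        ((n + 1 : ℝ) : ℂ) ^ (1 + 2 * a) * (1 + 1 / ((n : ℂ) + 1)) ^ (1 + 2 * a) := by
      have h5 := Complex.mul_cpow_ofReal_nonneg (a := (n + 1 : ℝ)) (b := 1 + 1 / ((n : ℝ) + 1))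
        (by positivity) (by positivity) (1 + 2 * a)
      push_cast at h5 ⊢
      rw [← h5]
      congr 1
      field_simp
    simp only [hx, hF]
    rw [h4, h3]
    generalize (1 + 1 / ((n : ℂ) + 1)) ^ (1 + 2 * a) = q
    generalize ((n + 1 : ℝ) : ℂ) ^ (1 + 2 * a) = r
    push_cast at h1 ⊢
    have h6 : 1 + (1 + a) * (1 / ((n : ℂ) + 1)) = (a + 1 + ((n : ℂ) + 1)) / ((n : ℂ) + 1) := by
      field_simp
      ring
    rw [h6, add_sub_cancel]
    generalize a + 1 + ((n : ℂ) + 1) = t at h1 ⊢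
    field_simp
    ring
  obtain ⟨L, C, hC⟩ := exists_limit_of_ratio (x := x) (K := K) fun n => by
    rw [hstep, mul_add, mul_one, add_sub_cancel_left, norm_mul, mul_comm]
    refine mul_le_mul_of_nonneg_right ?_ (norm_nonneg _)
    have hn1 : ((n : ℂ) + 1) ≠ 0 := by exact_mod_cast n.succ_ne_zero
    have h := hKb (x := n) (by simp [hn1])
    simp only [Function.comp, norm_pow, norm_div, norm_one] at h
    have h5 : ‖(n : ℂ) + 1‖ = n + 1 := by
      rw [← Nat.cast_succ, Complex.norm_natCast]; simp
    rw [h5] at h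
    refine h.trans (le_of_eq ?_)
    field_simp
  have hL : L = fhKappaLim a := by
    have h1 : Tendsto x atTop (nhds L) := by
      rw [tendsto_iff_norm_sub_tendsto_zero]
      have h2 : Tendsto (fun n : ℕ => C / ((n : ℝ) + 1)) atTop (nhds 0) := by
        have := (tendsto_one_div_add_atTop_nhds_zero_nat (𝕜 := ℝ)).const_mul C
        simpa [div_eq_mul_inv] using this
      exact squeeze_zero (fun _ => norm_nonneg _) hC h2
    have h2 := (tendsto_natCast_div_succ_cpow (1 + 2 * a)).mul h1
    rw [one_mul] at h2
    refine tendsto_nhds_unique (h2.congr fun n => ?_) (tendsto_fhKappa_mul ha0 fun m hm => ha0 ?_)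
    · have h5 := Complex.mul_cpow_ofReal_nonneg (a := (n : ℝ) / (n + 1)) (b := (n : ℝ) + 1)
        (by positivity) (by positivity) (1 + 2 * a)
      simp only [hx]
      rw [mul_comm (fhKappa _ _ _), ← mul_assoc, ← h5]
      congr 2
      push_cast
      have hn1 : ((n : ℂ) + 1) ≠ 0 := by exact_mod_cast n.succ_ne_zero
      field_simp
    · have hm' := neg_injective hm
      rw [hm', Complex.natCast_re] at ha
      rw [hm', ← Complex.ofReal_natCast, ha, Complex.ofReal_zero]
  refine ⟨C, fun n hn => ?_⟩
  obtain ⟨m, rfl⟩ := Nat.exists_eq_succ_of_ne_zero (by omega : n ≠ 0)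
  have h1 := hC m
  have hm : (0 : ℝ) < (m : ℝ) + 1 := by positivity
  have hm' : (((m : ℝ) + 1 : ℝ) : ℂ) ≠ 0 := by exact_mod_cast hm.ne'
  have h2 : fhKappa a (-a) (m + 1) - fhKappaLim a * ((m + 1 : ℕ) : ℂ) ^ (-1 - 2 * a) =
      (x m - L) * (((m : ℝ) + 1 : ℝ) : ℂ) ^ (-1 - 2 * a) := by
    simp only [hx]
    rw [sub_mul, mul_assoc, ← Complex.cpow_add _ _ hm', hL]
    ring_nf
    simp
  rw [Nat.succ_eq_add_one, h2, norm_mul, Complex.norm_cpow_eq_rpow_re_of_pos hm]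
  have h3 : (-1 - 2 * a).re = -1 := by simp [ha]
  rw [h3, Real.rpow_neg_one]
  push_cast
  calc _ ≤ C / ((m:ℝ) + 1) * ((m:ℝ) + 1)⁻¹ := by gcongr
    _ = _ := by field_simp

/-- A symmetric nonnegative integrable weight on the unit circle, positive off `±1`. -/
structure IsCircleWeight (f : ℂ → ℝ) : Prop where
  integrable : CircleIntegrable (fun s => (f s : ℂ)) 0 1
  symm : ∀ s : ℂ, ‖s‖ = 1 → f s⁻¹ = f s
  nonneg : ∀ s : ℂ, ‖s‖ = 1 → 0 ≤ f s
  pos : ∀ s : ℂ, ‖s‖ = 1 → s ≠ 1 → s ≠ -1 → 0 < f s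

/-- Moments of a polynomial against a weight on the circle. -/
noncomputable def polyMom (f : ℂ → ℝ) (p : ℝ[X]) (j : ℤ) : ℂ :=
  mom (fun s => aeval s p * (f s : ℂ)) j

lemma norm_circleMap_eq (t : ℝ) : ‖circleMap 0 1 t‖ = 1 := by simp

namespace IsCircleWeight

variable {f : ℂ → ℝ} (hf : IsCircleWeight f)
include hf

lemma integrable_aeval_mul (p : ℝ[X]) : CircleIntegrable (fun s => aeval s p * (f s : ℂ)) 0 1 :=
  hf.integrable.contMul (by fun_prop)

lemma polyMom_add (p q : ℝ[X]) (j : ℤ) : polyMom f (p + q) j = polyMom f p j + polyMom f q j := by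
  rw [polyMom, polyMom, polyMom, ← mom_add (hf.integrable_aeval_mul p) (hf.integrable_aeval_mul q)]
  simp only [map_add, add_mul]

omit hf in
lemma polyMom_C_mul (c : ℝ) (p : ℝ[X]) (j : ℤ) : polyMom f (C c * p) j = c * polyMom f p j := by
  rw [polyMom, polyMom, ← mom_const_mul]
  simp only [map_mul, aeval_C, mul_assoc]
  rfl

omit hf in
lemma polyMom_X_mul (p : ℝ[X]) (j : ℤ) : polyMom f (X * p) j = polyMom f p (j - 1) := by
  rw [polyMom, polyMom, ← mom_zpow_mul]
  simp only [map_mul, aeval_X, mul_assoc, zpow_one]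

omit hf in
lemma aeval_reflect {p : ℝ[X]} {m : ℕ} (hp : p.natDegree ≤ m) {s : ℂ} (hs : s ≠ 0) :
    aeval s (reflect m p) = s ^ m * aeval s⁻¹ p := by
  let _ : Invertible s⁻¹ := invertibleOfNonzero (inv_ne_zero hs)
  have h := eval₂_reflect_mul_pow (algebraMap ℝ ℂ) s⁻¹ m p hp
  rw [invOf_eq_inv, inv_inv] at h
  rw [aeval_def, aeval_def, ← h, mul_left_comm, ← mul_pow, mul_inv_cancel₀ hs, one_pow, mul_one]

lemma polyMom_reflect {p : ℝ[X]} {m : ℕ} (hp : p.natDegree ≤ m) (j : ℤ) :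
    polyMom f (reflect m p) j = polyMom f p (m - j) := by
  have h1 : polyMom f (reflect m p) j =
      mom (fun s => s ^ (m : ℤ) * (fun u => aeval u p * (f u : ℂ)) s⁻¹) j := by
    refine mom_congr (fun s hs => ?_) j
    have hs0 : s ≠ 0 := by rintro rfl; simp at hs
    simp only [aeval_reflect hp hs0, hf.symm s hs, zpow_natCast, mul_assoc]
  rw [h1, mom_zpow_mul, mom_comp_inv (fun u => aeval u p * (f u : ℂ)), neg_sub]
  rfl

lemma conj_polyMom (p : ℝ[X]) (j : ℤ) : (starRingEnd ℂ) (polyMom f p j) = polyMom f p j := by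
  have h1 : polyMom f p j = mom (fun s => (fun u => aeval u p * (f u : ℂ)) s⁻¹) (-j) := by
    rw [mom_comp_inv (fun u => aeval u p * (f u : ℂ)), neg_neg]; rfl
  conv_rhs => rw [h1]
  rw [polyMom, mom_eq_integral, mom_eq_integral, map_mul,
    intervalIntegral.integral_of_le (by positivity), ← integral_conj,
    ← intervalIntegral.integral_of_le (by positivity)]
  congr 1
  · simpa using Complex.conj_ofNat 2
  · refine intervalIntegral.integral_congr fun t _ => ?_
    have h2 : (circleMap 0 1 t)⁻¹ = (starRingEnd ℂ) (circleMap 0 1 t) := by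
      rw [Complex.inv_def, Complex.normSq_eq_norm_sq]; simp
    have h3 := hf.symm _ (norm_circleMap_eq t)
    simp only [map_mul, neg_neg, h3]
    rw [h2, aeval_conj, map_zpow₀, ← h2, inv_zpow', neg_neg]
    simp

lemma ofReal_re_polyMom (p : ℝ[X]) (j : ℤ) : ((polyMom f p j).re : ℂ) = polyMom f p j :=
  Complex.conj_eq_iff_re.1 (hf.conj_polyMom p j)

lemma eq_zero_of_polyMom {p : ℝ[X]} {m : ℕ} (hp : p.natDegree ≤ m)
    (h : ∀ j ≤ m, polyMom f p j = 0) : p = 0 := by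
  have h1 : mom (fun s => ∑ j ∈ Finset.range (m + 1),
      (p.coeff j : ℂ) * (aeval s p * (f s : ℂ) * s ^ (-(j : ℤ)))) 0 = 0 := by
    rw [mom_sum]
    · refine Finset.sum_eq_zero fun j hj => ?_
      rw [mom_const_mul, mom_mul_zpow, zero_sub, neg_neg]
      have := h j (by simpa [Nat.lt_succ_iff] using hj)
      rw [polyMom] at this
      rw [this, mul_zero]
    · intro j _
      exact ((hf.integrable_aeval_mul p).mul_zpow _).contMul continuousOn_const
  have h2 : mom (fun s => ((‖aeval s p‖ ^ 2 * f s : ℝ) : ℂ)) 0 = 0 := by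
    rw [← h1]
    refine mom_congr (fun s hs => ?_) 0
    have h3 : s⁻¹ = (starRingEnd ℂ) s := by
      rw [Complex.inv_def, Complex.normSq_eq_norm_sq]; simp [hs]
    have h4 : (starRingEnd ℂ) (aeval s p) =
        ∑ j ∈ Finset.range (m + 1), (p.coeff j : ℂ) * s ^ (-(j : ℤ)) := by
      rw [← aeval_conj, ← h3, aeval_eq_sum_range' (Nat.lt_succ_of_le hp)]
      refine Finset.sum_congr rfl fun j _ => ?_
      rw [zpow_neg, zpow_natCast, inv_pow]
      simp
    push_cast
    rw [← Complex.mul_conj', h4]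
    rw [Finset.mul_sum, Finset.sum_mul]
    refine Finset.sum_congr rfl fun j _ => ?_
    ring
  have h3 : ∫ t in Ioc 0 (2 * Real.pi),
      ‖aeval (circleMap 0 1 t) p‖ ^ 2 * f (circleMap 0 1 t) = 0 := by
    rw [mom_eq_integral] at h2
    simp only [neg_zero, zpow_zero, mul_one] at h2
    rw [intervalIntegral.integral_ofReal] at h2
    have : (2 * Real.pi : ℂ) ≠ 0 := by simp [Real.pi_ne_zero]
    rw [mul_eq_zero, or_iff_right (inv_ne_zero this)] at h2
    rw [← intervalIntegral.integral_of_le (by positivity)]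
    exact_mod_cast h2
  have hInt : IntegrableOn (fun t : ℝ =>
      ‖aeval (circleMap 0 1 t) p‖ ^ 2 * f (circleMap 0 1 t)) (Ioc 0 (2 * Real.pi)) := by
    have h5 : CircleIntegrable (fun s => ((‖aeval s p‖ ^ 2 : ℝ) : ℂ) * (f s : ℂ)) 0 1 :=
      hf.integrable.contMul (by fun_prop)
    have h6 := (intervalIntegrable_iff_integrableOn_Ioc_of_le (by positivity)).1 h5
    refine (h6.re).congr (Eventually.of_forall fun t => ?_)
    change (((‖aeval (circleMap 0 1 t) p‖ ^ 2 : ℝ) : ℂ) * (f (circleMap 0 1 t) : ℂ)).re = _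
    rw [← Complex.ofReal_mul]
    exact Complex.ofReal_re _
  rw [setIntegral_eq_zero_iff_of_nonneg_ae ?_ hInt] at h3
  swap
  · exact Eventually.of_forall fun t => mul_nonneg (by positivity)
      (hf.nonneg _ (norm_circleMap_eq t))
  have h4 : ∀ᵐ t ∂(volume.restrict (Ioo 0 Real.pi)), aeval (circleMap 0 1 t) p = 0 := by
    have h5 := ae_restrict_of_ae_restrict_of_subset (t := Ioc 0 (2 * Real.pi)) (s := Ioo 0 Real.pi)
      (fun t ht => ⟨ht.1, by linarith [ht.2, Real.pi_pos]⟩) h3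
    filter_upwards [h5, ae_restrict_mem measurableSet_Ioo] with t ht ht'
    have h6 : 0 < (circleMap 0 1 t).im := by
      have := Real.sin_pos_of_mem_Ioo ht'
      simpa [circleMap_zero, Complex.exp_ofReal_mul_I_im] using this
    have h7 := hf.pos _ (norm_circleMap_eq t) (fun h => by rw [h] at h6; simp at h6)
      (fun h => by rw [h] at h6; simp at h6)
    have h8 : ‖aeval (circleMap 0 1 t) p‖ ^ 2 * f (circleMap 0 1 t) = 0 := ht
    rw [mul_eq_zero, or_iff_left h7.ne'] at h8
    simpa using h8
  have h5 : {t ∈ Ioo 0 Real.pi | aeval (circleMap 0 1 t) p = 0}.Infinite := by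
    intro hfin
    have h6 := hfin.measure_zero volume
    rw [ae_restrict_iff' measurableSet_Ioo, ae_iff] at h4
    have h7 : Ioo 0 Real.pi ⊆ {t ∈ Ioo 0 Real.pi | aeval (circleMap 0 1 t) p = 0} ∪
        {t | ¬(t ∈ Ioo 0 Real.pi → aeval (circleMap 0 1 t) p = 0)} := fun t ht => by
      by_cases h : aeval (circleMap 0 1 t) p = 0
      · exact Or.inl ⟨ht, h⟩
      · exact Or.inr fun h' => h (h' ht)
    have h8 := (measure_mono (μ := volume) h7).trans (measure_union_le _ _)
    rw [h6, h4] at h8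
    simp [Real.pi_pos.not_ge] at h8
  have h6 : InjOn (circleMap 0 1) {t ∈ Ioo 0 Real.pi | aeval (circleMap 0 1 t) p = 0} := by
    intro t ht u hu htu
    have h7 := congrArg Complex.re htu
    simp only [circleMap_zero, Complex.ofReal_one, one_mul, Complex.exp_ofReal_mul_I_re] at h7
    exact Real.injOn_cos ⟨ht.1.1.le, ht.1.2.le⟩ ⟨hu.1.1.le, hu.1.2.le⟩ h7
  have h7 : p.map (algebraMap ℝ ℂ) = 0 := by
    refine eq_zero_of_infinite_isRoot _ ((h5.image h6).mono ?_)
    rintro _ ⟨t, ht, rfl⟩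
    have := ht.2
    rw [aeval_def, ← eval_map] at this
    exact this
  exact (Polynomial.map_eq_zero _).1 h7

end IsCircleWeight

/-- Monic orthogonal polynomials on the unit circle, by the Szegő recursion. -/
noncomputable def opuc (f : ℂ → ℝ) : ℕ → ℝ[X]
  | 0 => 1
  | m + 1 => X * opuc f m +
      C (-(polyMom f (X * opuc f m) 0).re / (polyMom f (opuc f m) m).re) * reflect m (opuc f m)

section opuc

variable {f : ℂ → ℝ}

lemma natDegree_reflect_le_of_le {p : ℝ[X]} {m : ℕ} (hp : p.natDegree ≤ m) :
    (reflect m p).natDegree ≤ m :=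
  natDegree_reflect_le.trans (max_le le_rfl hp)

lemma natDegree_opuc_le (f : ℂ → ℝ) (m : ℕ) : (opuc f m).natDegree ≤ m := by
  induction m with
  | zero => simp [opuc]
  | succ m ih =>
    refine natDegree_add_le_of_degree_le ?_ ?_
    · refine natDegree_mul_le.trans ?_
      rw [natDegree_X]
      omega
    · exact natDegree_mul_le.trans (by
        rw [natDegree_C]
        have := natDegree_reflect_le_of_le ih
        omega)

lemma coeff_reflect_of_le (p : ℝ[X]) {m i : ℕ} (h : i ≤ m) :
    (reflect m p).coeff i = p.coeff (m - i) := by rw [coeff_reflect, revAt_le h]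

lemma coeff_opuc_self (f : ℂ → ℝ) (m : ℕ) : (opuc f m).coeff m = 1 := by
  induction m with
  | zero => simp [opuc]
  | succ m ih =>
    rw [opuc, coeff_add, coeff_X_mul, ih, coeff_C_mul, coeff_eq_zero_of_natDegree_lt, mul_zero,
      add_zero]
    exact Nat.lt_succ_of_le (natDegree_reflect_le_of_le (natDegree_opuc_le f m))

lemma coeff_zero_opuc_succ (f : ℂ → ℝ) (m : ℕ) : (opuc f (m + 1)).coeff 0 =
    -(polyMom f (X * opuc f m) 0).re / (polyMom f (opuc f m) m).re := by
  rw [opuc, coeff_add, coeff_C_mul, coeff_reflect_of_le _ (Nat.zero_le m), Nat.sub_zero,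
    coeff_opuc_self, coeff_X_mul_zero, zero_add, mul_one]

lemma opuc_succ (f : ℂ → ℝ) (m : ℕ) : opuc f (m + 1) =
    X * opuc f m + C ((opuc f (m + 1)).coeff 0) * reflect m (opuc f m) := by
  rw [coeff_zero_opuc_succ, opuc]

lemma coeff_opuc_succ_succ (f : ℂ → ℝ) (m : ℕ) : (opuc f (m + 2)).coeff (m + 1) =
    (opuc f (m + 1)).coeff m + (opuc f (m + 2)).coeff 0 * (opuc f (m + 1)).coeff 0 := by
  rw [opuc_succ f (m + 1), coeff_add, coeff_X_mul, coeff_C_mul, coeff_reflect_of_le _ le_rfl,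
    Nat.sub_self, ← opuc_succ]

lemma tendsto_opuc (f : ℂ → ℝ) (m : ℕ) :
    Tendsto (fun z : ℂ => aeval z (opuc f m) * z⁻¹ ^ m) (cocompact ℂ) (nhds 1) := by
  have h1 : Tendsto (fun z : ℂ => aeval z⁻¹ (reflect m (opuc f m))) (cocompact ℂ) (nhds 1) := by
    have h2 := tendsto_inv₀_cobounded (α := ℂ)
    rw [Metric.cobounded_eq_cocompact] at h2
    have h3 : Continuous fun z : ℂ => aeval z (reflect m (opuc f m)) := by fun_prop
    have h4 := (h3.tendsto 0).comp h2
    have h5 : aeval (0 : ℂ) (reflect m (opuc f m)) = 1 := by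
      rw [← coeff_zero_eq_aeval_zero', coeff_reflect_of_le _ (Nat.zero_le m), Nat.sub_zero,
        coeff_opuc_self, map_one]
    rw [h5] at h4
    exact h4
  refine h1.congr' ?_
  have h2 : ∀ᶠ z : ℂ in cocompact ℂ, 1 < ‖z‖ :=
    (tendsto_norm_cocompact_atTop (E := ℂ)).eventually_gt_atTop 1
  filter_upwards [h2] with z hz
  have hz0 : z ≠ 0 := by rintro rfl; simp at hz; linarith
  rw [IsCircleWeight.aeval_reflect (natDegree_opuc_le f m) (inv_ne_zero hz0), inv_inv, mul_comm]

variable (hf : IsCircleWeight f)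
include hf

lemma polyMom_opuc (m : ℕ) : ∀ j < m, polyMom f (opuc f m) j = 0 := by
  induction m with
  | zero => simp
  | succ m ih =>
    have hne : polyMom f (opuc f m) m ≠ 0 := fun h => by
      have h1 := hf.eq_zero_of_polyMom (natDegree_opuc_le f m) fun j hj => by
        rcases hj.lt_or_eq with h2 | rfl
        exacts [ih j h2, h]
      have h2 := coeff_opuc_self f m
      rw [h1] at h2
      simp at h2
    intro j hj
    rw [opuc, hf.polyMom_add, IsCircleWeight.polyMom_C_mul,
      hf.polyMom_reflect (natDegree_opuc_le f m)]
    rcases j with _ | j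
    · push_cast
      rw [sub_zero, hf.ofReal_re_polyMom, hf.ofReal_re_polyMom]
      field_simp
      ring
    · rw [IsCircleWeight.polyMom_X_mul]
      have h1 : ((j + 1 : ℕ) : ℤ) - 1 = j := by push_cast; ring
      have h2 : (m : ℤ) - ((j + 1 : ℕ) : ℤ) = ((m - (j + 1) : ℕ) : ℤ) := by
        rw [Nat.cast_sub (by omega)]
      rw [h1, h2, ih j (by omega), ih (m - (j + 1)) (by omega), mul_zero, add_zero]

/-- A monic polynomial of degree `2 n`, with constant coefficient one and orthogonal to
`s, …, s ^ (2 n - 1)`, is determined by the orthogonal polynomial of degree `2 n - 1`. -/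
lemma eq_add_reflect_opuc {S : ℝ[X]} {n : ℕ} (hS : S.natDegree ≤ 2 * n + 2)
    (hS1 : S.coeff (2 * n + 2) = 1) (hS0 : S.coeff 0 = 1)
    (h : ∀ j : ℕ, j < 2 * n + 1 → polyMom f S (j + 1 : ℕ) = 0) :
    S = X * opuc f (2 * n + 1) + reflect (2 * n + 1) (opuc f (2 * n + 1)) := by
  set Φ := opuc f (2 * n + 1) with hΦ
  have hd : Φ.natDegree ≤ 2 * n + 1 := natDegree_opuc_le f (2 * n + 1)
  have hd' := natDegree_reflect_le_of_le hd
  set D := S - (X * Φ + reflect (2 * n + 1) Φ) with hD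
  have hD0 : D.coeff 0 = 0 := by
    rw [hD, coeff_sub, hS0, coeff_add, coeff_X_mul_zero, coeff_reflect_of_le _ (Nat.zero_le _),
      Nat.sub_zero, hΦ, coeff_opuc_self]
    ring
  have hE : D = X * D.divX := by
    conv_lhs => rw [← divX_mul_X_add D, hD0, map_zero, add_zero, mul_comm]
  have hEd : D.divX.natDegree ≤ 2 * n := by
    rw [natDegree_le_iff_coeff_eq_zero]
    intro N hN
    rw [coeff_divX, hD, coeff_sub, coeff_add, coeff_X_mul]
    rcases (Nat.lt_iff_add_one_le.1 hN).eq_or_lt with h1 | h1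
    · rw [← h1, hS1, hΦ, coeff_opuc_self, coeff_eq_zero_of_natDegree_lt (n := 2 * n + 1 + 1)]
      · ring
      · exact Nat.lt_succ_of_le hd'
    · rw [coeff_eq_zero_of_natDegree_lt (by omega), coeff_eq_zero_of_natDegree_lt (n := N)
        (by omega), coeff_eq_zero_of_natDegree_lt (n := N + 1)]
      · ring
      · omega
  have h0 : D.divX = 0 := by
    refine hf.eq_zero_of_polyMom hEd fun j hj => ?_
    have h1 : polyMom f D ((j + 1 : ℕ)) = 0 := by
      have h2 : D = S + C (-1) * (X * Φ + reflect (2 * n + 1) Φ) := by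
        rw [hD, map_neg, map_one]; ring
      rw [h2, hf.polyMom_add, IsCircleWeight.polyMom_C_mul, hf.polyMom_add,
        IsCircleWeight.polyMom_X_mul, hf.polyMom_reflect hd, h j (by omega)]
      have h3 : ((j + 1 : ℕ) : ℤ) - 1 = j := by push_cast; ring
      have h4 : ((2 * n + 1 : ℕ) : ℤ) - ((j + 1 : ℕ) : ℤ) = ((2 * n + 1 - (j + 1) : ℕ) : ℤ) := by
        rw [Nat.cast_sub (by omega)]
      rw [h3, h4, polyMom_opuc hf _ j (by omega), polyMom_opuc hf _ _ (by omega)]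
      ring
    rw [hE, IsCircleWeight.polyMom_X_mul] at h1
    simpa using h1
  rw [h0, mul_zero] at hE
  exact sub_eq_zero.1 hE

end opuc

lemma image_cos_Ioo : Real.cos '' Ioo 0 Real.pi = Ioo (-1) 1 := by
  apply Subset.antisymm
  · rintro _ ⟨t, ht, rfl⟩
    constructor
    · rw [← Real.cos_pi]
      exact Real.cos_lt_cos_of_nonneg_of_le_pi ht.1.le le_rfl ht.2
    · rw [← Real.cos_zero]
      exact Real.cos_lt_cos_of_nonneg_of_le_pi le_rfl ht.2.le ht.1
  · intro x hx
    refine ⟨Real.arccos x, ⟨Real.arccos_pos.2 hx.2, ?_⟩, Real.cos_arccos hx.1.le hx.2.le⟩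
    refine lt_of_le_of_ne (Real.arccos_le_pi x) fun h => ?_
    rw [Real.arccos_eq_pi] at h
    linarith [hx.1]

lemma injOn_cos_Ioo : InjOn Real.cos (Ioo 0 Real.pi) :=
  Real.injOn_cos.mono Ioo_subset_Icc_self

lemma integral_comp_cos_mul_abs_sin_half (G : ℝ → ℝ) :
    ∫ t in (0:ℝ)..Real.pi, G (Real.cos t) * |Real.sin t| = ∫ x in (-1:ℝ)..1, G x := by
  rw [intervalIntegral.integral_of_le Real.pi_pos.le, intervalIntegral.integral_of_le (by norm_num),
    integral_Ioc_eq_integral_Ioo, integral_Ioc_eq_integral_Ioo, ← image_cos_Ioo,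
    integral_image_eq_integral_abs_deriv_smul measurableSet_Ioo
      (fun t _ => (Real.hasDerivAt_cos t).hasDerivWithinAt) injOn_cos_Ioo]
  simp only [abs_neg, smul_eq_mul, mul_comm]

lemma intervalIntegrable_comp_cos_half {G : ℝ → ℝ} (hG : IntervalIntegrable G volume (-1) 1) :
    IntervalIntegrable (fun t => G (Real.cos t) * |Real.sin t|) volume 0 Real.pi := by
  rw [intervalIntegrable_iff_integrableOn_Ioo_of_le (by norm_num), ← image_cos_Ioo,
    integrableOn_image_iff_integrableOn_abs_deriv_smul measurableSet_Ioo
      (fun t _ => (Real.hasDerivAt_cos t).hasDerivWithinAt) injOn_cos_Ioo] at hG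
  rw [intervalIntegrable_iff_integrableOn_Ioo_of_le Real.pi_pos.le]
  simpa only [abs_neg, smul_eq_mul, mul_comm] using hG

lemma comp_cos_two_pi_sub (G : ℝ → ℝ) (t : ℝ) :
    G (Real.cos (2 * Real.pi - t)) * |Real.sin (2 * Real.pi - t)| =
      G (Real.cos t) * |Real.sin t| := by
  rw [Real.cos_two_pi_sub, Real.sin_two_pi_sub, abs_neg]

lemma intervalIntegrable_comp_cos_half' {G : ℝ → ℝ} (hG : IntervalIntegrable G volume (-1) 1) :
    IntervalIntegrable (fun t => G (Real.cos t) * |Real.sin t|) volume Real.pi (2 * Real.pi) := by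
  have h := (intervalIntegrable_comp_cos_half hG).comp_sub_left (2 * Real.pi)
  simp only [comp_cos_two_pi_sub, sub_zero] at h
  rw [show 2 * Real.pi - Real.pi = Real.pi by ring] at h
  exact h.symm

lemma intervalIntegrable_comp_cos {G : ℝ → ℝ} (hG : IntervalIntegrable G volume (-1) 1) :
    IntervalIntegrable (fun t => G (Real.cos t) * |Real.sin t|) volume 0 (2 * Real.pi) :=
  (intervalIntegrable_comp_cos_half hG).trans (intervalIntegrable_comp_cos_half' hG)

lemma integral_comp_cos_mul_abs_sin {G : ℝ → ℝ} (hG : IntervalIntegrable G volume (-1) 1) :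
    ∫ t in (0:ℝ)..(2 * Real.pi), G (Real.cos t) * |Real.sin t| = 2 * ∫ x in (-1:ℝ)..1, G x := by
  rw [← intervalIntegral.integral_add_adjacent_intervals (intervalIntegrable_comp_cos_half hG)
    (intervalIntegrable_comp_cos_half' hG)]
  have h := intervalIntegral.integral_comp_sub_left (a := 0) (b := Real.pi)
    (fun t => G (Real.cos t) * |Real.sin t|) (2 * Real.pi)
  simp only [comp_cos_two_pi_sub, sub_zero] at h
  rw [show 2 * Real.pi - Real.pi = Real.pi by ring] at h
  rw [← h, integral_comp_cos_mul_abs_sin_half]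
  ring

/-- The weight on the unit circle induced by a weight on `[-1,1]`. -/
noncomputable def szegoWeight (w : ℝ → ℝ) (s : ℂ) : ℝ := w s.re * |s.im|

lemma szegoWeight_circleMap (w : ℝ → ℝ) (t : ℝ) :
    szegoWeight w (circleMap 0 1 t) = w (Real.cos t) * |Real.sin t| := by
  simp [szegoWeight, circleMap, Complex.exp_ofReal_mul_I_re, Complex.exp_ofReal_mul_I_im]

lemma re_mem_Ioo_of_norm_eq_one {s : ℂ} (hs : ‖s‖ = 1) (h1 : s ≠ 1) (h2 : s ≠ -1) :
    s.re ∈ Ioo (-1) 1 ∧ s.im ≠ 0 := by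
  have h : s.re ^ 2 + s.im ^ 2 = 1 := by
    have := Complex.sq_norm s
    rw [hs, Complex.normSq_apply] at this
    linarith
  have him : s.im ≠ 0 := fun h0 => by
    rw [h0] at h
    have h3 : (s.re - 1) * (s.re + 1) = 0 := by linarith
    rcases mul_eq_zero.1 h3 with h4 | h4
    · exact h1 (Complex.ext (by simp; linarith) (by simpa using h0))
    · exact h2 (Complex.ext (by simp; linarith) (by simpa using h0))
  have : 0 < s.im ^ 2 := by positivity
  exact ⟨⟨by nlinarith, by nlinarith⟩, him⟩

lemma isCircleWeight_szegoWeight {w : ℝ → ℝ} (hw : IntervalIntegrable w volume (-1) 1)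
    (hw0 : ∀ x ∈ Icc (-1 : ℝ) 1, 0 ≤ w x) (hw1 : ∀ x ∈ Ioo (-1 : ℝ) 1, 0 < w x) :
    IsCircleWeight (szegoWeight w) where
  integrable := by
    have h0 := intervalIntegrable_comp_cos hw
    have h : IntervalIntegrable (fun t => ((w (Real.cos t) * |Real.sin t| : ℝ) : ℂ)) volume 0
      (2 * Real.pi) := ⟨h0.1.ofReal, h0.2.ofReal⟩
    rw [CircleIntegrable]
    simpa only [szegoWeight_circleMap] using h
  symm s hs := by
    have h2 : s⁻¹ = (starRingEnd ℂ) s := by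
      rw [Complex.inv_def, Complex.normSq_eq_norm_sq]; simp [hs]
    simp [h2, szegoWeight]
  nonneg s hs := by
    have := Complex.abs_re_le_norm s
    rw [hs, abs_le] at this
    exact mul_nonneg (hw0 _ ⟨this.1, this.2⟩) (abs_nonneg _)
  pos s hs h1 h2 := by
    obtain ⟨h3, h4⟩ := re_mem_Ioo_of_norm_eq_one hs h1 h2
    exact mul_pos (hw1 _ h3) (abs_pos.2 h4)

/-- The polynomial `2 ^ n * z ^ n * Pₙ ((z + 1/z) / 2)`. -/
noncomputable def joukowskyPoly (a b : ℕ → ℝ) : ℕ → ℝ[X]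
  | 0 => 1
  | 1 => X ^ 2 + 1 - C (2 * b 0) * X
  | n + 2 => (X ^ 2 + 1 - C (2 * b (n + 1)) * X) * joukowskyPoly a b (n + 1) -
      C (4 * a (n + 1) ^ 2) * X ^ 2 * joukowskyPoly a b n

section joukowskyPoly

variable (a b : ℕ → ℝ)

lemma joukowskyPoly_coeffs (n : ℕ) : (joukowskyPoly a b n).natDegree ≤ 2 * n ∧
    (joukowskyPoly a b n).coeff (2 * n) = 1 ∧ (joukowskyPoly a b n).coeff 0 = 1 := by
  induction n using Nat.twoStepInduction with
  | zero => simp [joukowskyPoly]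
  | one =>
    refine ⟨?_, ?_, ?_⟩
    · rw [joukowskyPoly]; compute_degree
    · rw [joukowskyPoly]; simp [coeff_one]
    · rw [joukowskyPoly]; simp
  | more n ih1 ih2 =>
    obtain ⟨d1, l1, z1⟩ := ih1
    obtain ⟨d2, l2, z2⟩ := ih2
    have e : joukowskyPoly a b (n + 2) = X ^ 2 * joukowskyPoly a b (n + 1) +
        joukowskyPoly a b (n + 1) - C (2 * b (n + 1)) * (X * joukowskyPoly a b (n + 1)) -
        C (4 * a (n + 1) ^ 2) * (X ^ 2 * joukowskyPoly a b n) := by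
      rw [joukowskyPoly]; ring
    generalize joukowskyPoly a b n = p at *
    generalize joukowskyPoly a b (n + 1) = q at *
    refine ⟨?_, ?_, ?_⟩
    · rw [e, natDegree_le_iff_coeff_eq_zero]
      intro N hN
      obtain ⟨k, rfl⟩ : ∃ k, N = k + 2 := ⟨N - 2, by omega⟩
      rw [coeff_sub, coeff_sub, coeff_add, coeff_C_mul, coeff_C_mul, coeff_X_pow_mul,
        coeff_X_pow_mul, show k + 2 = (k + 1) + 1 from rfl, coeff_X_mul,
        coeff_eq_zero_of_natDegree_lt (p := q) (by omega),
        coeff_eq_zero_of_natDegree_lt (p := q) (by omega),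
        coeff_eq_zero_of_natDegree_lt (p := q) (by omega),
        coeff_eq_zero_of_natDegree_lt (p := p) (by omega)]
      ring
    · rw [e, show 2 * (n + 2) = (2 * n + 2) + 2 by ring, coeff_sub, coeff_sub, coeff_add,
        coeff_C_mul, coeff_C_mul, coeff_X_pow_mul, coeff_X_pow_mul,
        show 2 * n + 2 + 2 = (2 * n + 2 + 1) + 1 from rfl, coeff_X_mul,
        show 2 * n + 2 = 2 * (n + 1) by ring, l2,
        coeff_eq_zero_of_natDegree_lt (p := q) (by omega),
        coeff_eq_zero_of_natDegree_lt (p := q) (by omega),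
        coeff_eq_zero_of_natDegree_lt (p := p) (by omega)]
      ring
    · rw [e]
      simp [z2]

lemma joukowskyPoly_coeff_one (n : ℕ) : (joukowskyPoly a b (n + 1)).coeff 1 =
    (joukowskyPoly a b n).coeff 1 - 2 * b n := by
  rcases n with _ | n
  · rw [joukowskyPoly, joukowskyPoly]; simp [coeff_one]
  · have e : joukowskyPoly a b (n + 2) = X ^ 2 * joukowskyPoly a b (n + 1) +
        joukowskyPoly a b (n + 1) - C (2 * b (n + 1)) * (X * joukowskyPoly a b (n + 1)) -
        C (4 * a (n + 1) ^ 2) * (X ^ 2 * joukowskyPoly a b n) := by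
      rw [joukowskyPoly]; ring
    rw [e, coeff_sub, coeff_sub, coeff_add, coeff_C_mul, coeff_C_mul, coeff_X_pow_mul',
      coeff_X_pow_mul', coeff_X_mul (n := 0),
      (joukowskyPoly_coeffs a b (n + 1)).2.2]
    simp

variable {a b}

lemma aeval_joukowskyPoly {P : ℕ → ℝ[X]} (hP0 : P 0 = 1) (hrec0 : P 1 = (X - C (b 0)) * P 0)
    (hrec : ∀ n ≥ 1, P (n + 1) = (X - C (b n)) * P n - C (a n ^ 2) * P (n - 1))
    {s : ℂ} (hs : s ≠ 0) (n : ℕ) :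
    aeval s (joukowskyPoly a b n) = 2 ^ n * s ^ n * aeval ((s + s⁻¹) / 2) (P n) := by
  induction n using Nat.twoStepInduction with
  | zero => simp [joukowskyPoly, hP0]
  | one =>
    rw [hrec0, hP0, joukowskyPoly]
    simp
    field_simp
  | more n ih1 ih2 =>
    rw [hrec (n + 1) (by omega), joukowskyPoly]
    simp only [map_sub, map_mul, map_add, map_pow, aeval_X, aeval_C, map_one, ih1, ih2,
      Nat.add_sub_cancel]
    generalize aeval ((s + s⁻¹) / 2) (P (n + 1)) = p
    generalize aeval ((s + s⁻¹) / 2) (P n) = q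
    simp
    field_simp
    ring

end joukowskyPoly

lemma IsCircleWeight.re_polyMom {f : ℂ → ℝ} (hf : IsCircleWeight f) (p : ℝ[X]) (j : ℤ) :
    (polyMom f p j).re = (2 * Real.pi)⁻¹ * ∫ t in (0:ℝ)..(2 * Real.pi),
      (aeval (circleMap 0 1 t) p * circleMap 0 1 t ^ (-j)).re * f (circleMap 0 1 t) := by
  have h0 := (hf.integrable_aeval_mul p).mul_zpow (-j)
  rw [CircleIntegrable] at h0
  have h1 := Complex.reCLM.intervalIntegral_comp_comm h0
  rw [polyMom, mom_eq_integral]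
  have h2 : ((2 : ℂ) * Real.pi)⁻¹ = ((2 * Real.pi)⁻¹ : ℝ) := by push_cast; rfl
  rw [h2, Complex.re_ofReal_mul]
  congr 1
  refine Eq.trans h1.symm ?_
  refine intervalIntegral.integral_congr fun t _ => ?_
  simp only [Complex.reCLM_apply]
  rw [mul_right_comm, Complex.re_mul_ofReal]

/-- Orthogonality on the interval transfers to the circle. -/
lemma polyMom_joukowskyPoly {w : ℝ → ℝ} (hw : IntervalIntegrable w volume (-1) 1)
    (hf : IsCircleWeight (szegoWeight w)) {P : ℕ → ℝ[X]} {a b : ℕ → ℝ}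
    (hP0 : P 0 = 1) (hrec0 : P 1 = (X - C (b 0)) * P 0)
    (hrec : ∀ n ≥ 1, P (n + 1) = (X - C (b n)) * P n - C (a n ^ 2) * P (n - 1)) {n : ℕ}
    (horth : ∀ k < n, ∫ x in (-1:ℝ)..1, (P n).eval x * x ^ k * w x = 0) {j : ℕ}
    (hj0 : 0 < j) (hj : j < 2 * n) : polyMom (szegoWeight w) (joukowskyPoly a b n) j = 0 := by
  set T := Chebyshev.T ℝ ((n : ℤ) - j) with hT
  have hTd : T.natDegree < n := by
    rw [hT, Chebyshev.natDegree_T]; omega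
  have hcont : ∀ p : ℝ[X], IntervalIntegrable (fun x => p.eval x * w x) volume (-1) 1 :=
    fun p => hw.continuousOn_mul p.continuous.continuousOn
  have h0 : ∫ x in (-1:ℝ)..1, (2 ^ n * P n * T).eval x * w x = 0 := by
    have h1 : ∀ x : ℝ, (2 ^ n * P n * T).eval x * w x =
        ∑ k ∈ Finset.range n, 2 ^ n * T.coeff k * ((P n).eval x * x ^ k * w x) := fun x => by
      rw [eval_mul, eval_eq_sum_range' hTd, Finset.mul_sum, Finset.sum_mul]
      refine Finset.sum_congr rfl fun k _ => ?_
      simp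
      ring
    simp only [h1]
    rw [intervalIntegral.integral_finsetSum]
    · refine Finset.sum_eq_zero fun k hk => ?_
      rw [intervalIntegral.integral_const_mul, horth k (Finset.mem_range.1 hk), mul_zero]
    · intro k _
      refine IntervalIntegrable.const_mul ?_ _
      have := hcont (P n * X ^ k)
      simpa using this
  have h2 : (polyMom (szegoWeight w) (joukowskyPoly a b n) j).re = 0 := by
    rw [hf.re_polyMom]
    have h3 := integral_comp_cos_mul_abs_sin (hcont (2 ^ n * P n * T))
    rw [h0, mul_zero] at h3
    rw [mul_eq_zero]
    right
    refine Eq.trans ?_ h3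
    apply intervalIntegral.integral_congr
    intro t _
    have hz : circleMap 0 1 t ≠ 0 := by simp
    have hre : (circleMap 0 1 t + (circleMap 0 1 t)⁻¹) / 2 = (Real.cos t : ℂ) := by
      rw [Complex.ofReal_cos, Complex.cos]
      simp [circleMap, ← Complex.exp_neg]
    have hP : aeval ((Real.cos t : ℝ) : ℂ) (P n) = (((P n).eval (Real.cos t) : ℝ) : ℂ) := by
      rw [show ((Real.cos t : ℝ) : ℂ) = algebraMap ℝ ℂ (Real.cos t) from rfl,
        aeval_algebraMap_apply]
      rfl
    have hTt : (circleMap 0 1 t ^ ((n : ℤ) - j)).re = T.eval (Real.cos t) := by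
      rw [hT, Chebyshev.T_real_cos, circleMap]
      simp only [zero_add, Complex.ofReal_one, one_mul]
      rw [← Complex.exp_int_mul, show (((n : ℤ) - j : ℤ) : ℂ) * (t * Complex.I) =
        (((((n : ℤ) - j : ℤ) : ℝ) * t : ℝ) : ℂ) * Complex.I by push_cast; ring,
        Complex.exp_ofReal_mul_I_re]
    simp only [szegoWeight_circleMap, aeval_joukowskyPoly hP0 hrec0 hrec hz, hre, hP, eval_mul,
      ← hTt]
    rw [show (2 ^ n * circleMap 0 1 t ^ n * (((P n).eval (Real.cos t) : ℝ) : ℂ) *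
      circleMap 0 1 t ^ (-(j : ℤ))) = ((2 ^ n * (P n).eval (Real.cos t) : ℝ) : ℂ) *
      circleMap 0 1 t ^ ((n : ℤ) - j) by
        rw [sub_eq_add_neg, zpow_add₀ hz, zpow_natCast]; push_cast; ring, Complex.re_ofReal_mul]
    simp
    ring
  rw [← hf.ofReal_re_polyMom, h2, Complex.ofReal_zero]

/-- Geronimus relations: the diagonal recurrence coefficients in terms of the constant
coefficients of the orthogonal polynomials on the circle. -/
lemma recurrence_coeff_eq {w : ℝ → ℝ} (hw : IntervalIntegrable w volume (-1) 1)
    (hf : IsCircleWeight (szegoWeight w)) {P : ℕ → ℝ[X]} {a b : ℕ → ℝ}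
    (hP0 : P 0 = 1) (hrec0 : P 1 = (X - C (b 0)) * P 0)
    (hrec : ∀ n ≥ 1, P (n + 1) = (X - C (b n)) * P n - C (a n ^ 2) * P (n - 1))
    (horth : ∀ n, ∀ k < n, ∫ x in (-1:ℝ)..1, (P n).eval x * x ^ k * w x = 0)
    {φ : ℕ → ℝ} (hφ : ∀ n, φ n = (opuc (szegoWeight w) n).coeff 0) (n : ℕ) :
    b (n + 1) = (φ (2 * n + 1) - φ (2 * n + 3)) / 2 -
      φ (2 * n + 2) * (φ (2 * n + 1) + φ (2 * n + 3)) / 2 := by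
  have h1 : ∀ m, (joukowskyPoly a b (m + 1)).coeff 1 =
      φ (2 * m + 1) + (opuc (szegoWeight w) (2 * m + 1)).coeff (2 * m) := fun m => by
    obtain ⟨hd, hl, hz⟩ := joukowskyPoly_coeffs a b (m + 1)
    rw [eq_add_reflect_opuc hf (n := m) hd hl hz fun j hj =>
      polyMom_joukowskyPoly hw hf hP0 hrec0 hrec (horth (m + 1)) (by omega) (by omega),
      coeff_add, coeff_X_mul (n := 0), coeff_reflect_of_le _ (by omega), hφ]
    rfl
  have h2 := joukowskyPoly_coeff_one a b (n + 1)
  rw [h1, h1, show 2 * (n + 1) = 2 * n + 1 + 1 by ring,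
    coeff_opuc_succ_succ, coeff_opuc_succ_succ, ← hφ, ← hφ, ← hφ] at h2
  simp only [show 2 * n + 1 + 2 = 2 * n + 3 by ring,
    show 2 * n + 1 + 1 = 2 * n + 2 by ring] at h2
  linarith

lemma AnalyticAt.exists_complex_extension {h : ℝ → ℝ} {x : ℝ} (hh : AnalyticAt ℝ h x) :
    ∃ r > 0, ∃ G : ℂ → ℂ, DifferentiableOn ℂ G (Metric.ball (x : ℂ) r) ∧
      ∀ t : ℝ, |t - x| < r → G t = h t := by
  obtain ⟨p, r0, hp⟩ := hh
  obtain ⟨ρ, hρ0, hρ⟩ := ENNReal.lt_iff_exists_nnreal_btwn.1 hp.r_pos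
  have hρ0' : (0 : ℝ) < ρ := by exact_mod_cast hρ0
  have hs := p.summable_norm_mul_pow (hρ.trans_le hp.r_le)
  refine ⟨ρ, hρ0', fun z => ∑' n, (p.coeff n : ℂ) * (z - x) ^ n, ?_, fun t ht => ?_⟩
  · refine Complex.differentiableOn_tsum_of_summable_norm hs (fun n => by fun_prop)
      Metric.isOpen_ball fun n z hz => ?_
    rw [norm_mul, norm_pow, Complex.norm_real, ← FormalMultilinearSeries.norm_apply_eq_norm_coef]
    rw [Metric.mem_ball, dist_eq_norm] at hz
    gcongr
  · have ht' : t ∈ Metric.eball x r0 := by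
      rw [Metric.mem_eball, edist_dist, Real.dist_eq]
      refine lt_trans ?_ hρ
      rw [← ENNReal.ofReal_coe_nnreal]
      exact (ENNReal.ofReal_lt_ofReal_iff hρ0').2 ht
    have h1 := hp.hasSum_sub ht'
    have h2 : HasSum (fun n => p.coeff n * (t - x) ^ n) (h t) := by
      have e : (fun n => p.coeff n * (t - x) ^ n) = fun n => p n fun _ => t - x := by
        funext n
        rw [FormalMultilinearSeries.apply_eq_pow_smul_coeff, smul_eq_mul, mul_comm]
      rw [e]
      exact h1
    have h3 := (Complex.hasSum_ofReal (L := SummationFilter.unconditional ℕ)).2 h2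
    push_cast at h3
    exact h3.tsum_eq

/-- Real analytic functions on a compact interval extend to a complex neighbourhood. -/
lemma AnalyticOnNhd.exists_complex_extension {h : ℝ → ℝ} {K : Set ℝ} (hh : AnalyticOnNhd ℝ h K) :
    ∃ U : Set ℂ, IsOpen U ∧ (∀ x ∈ K, (x : ℂ) ∈ U) ∧ ∃ G : ℂ → ℂ, DifferentiableOn ℂ G U ∧
      ∀ x ∈ K, G x = h x := by
  classical
  choose! r hr G hG hGh using fun x hx => (hh x hx).exists_complex_extension
  have key : ∀ x ∈ K, ∀ y ∈ K, ∀ z ∈ Metric.ball (x : ℂ) (r x) ∩ Metric.ball (y : ℂ) (r y),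
      G x z = G y z := by
    intro x hx y hy z hz
    have hre : ∀ (v : ℝ), z ∈ Metric.ball (v : ℂ) (r v) → |z.re - v| < r v := fun v hv => by
      rw [Metric.mem_ball, dist_eq_norm] at hv
      have := Complex.abs_re_le_norm (z - v)
      rw [Complex.sub_re, Complex.ofReal_re] at this
      exact this.trans_lt hv
    have hmem : (z.re : ℂ) ∈ Metric.ball (x : ℂ) (r x) ∩ Metric.ball (y : ℂ) (r y) := by
      constructor
      · rw [Metric.mem_ball, dist_eq_norm, ← Complex.ofReal_sub, Complex.norm_real]
        exact hre x hz.1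
      · rw [Metric.mem_ball, dist_eq_norm, ← Complex.ofReal_sub, Complex.norm_real]
        exact hre y hz.2
    refine ((hG x hx).mono inter_subset_left |>.analyticOnNhd
      (Metric.isOpen_ball.inter Metric.isOpen_ball)).eqOn_of_preconnected_of_frequently_eq
      ((hG y hy).mono inter_subset_right |>.analyticOnNhd
      (Metric.isOpen_ball.inter Metric.isOpen_ball))
      ((convex_ball _ _).inter (convex_ball _ _)).isPreconnected hmem ?_ hz
    have h1 : ∀ᶠ t : ℝ in nhds z.re, G x t = G y t := by
      have e1 : ∀ᶠ t : ℝ in nhds z.re, |t - x| < r x :=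
        (continuous_abs.comp (continuous_id.sub continuous_const)).continuousAt.eventually_lt
          continuousAt_const (hre x hz.1)
      have e2 : ∀ᶠ t : ℝ in nhds z.re, |t - y| < r y :=
        (continuous_abs.comp (continuous_id.sub continuous_const)).continuousAt.eventually_lt
          continuousAt_const (hre y hz.2)
      filter_upwards [e1, e2] with t h1 h2
      rw [hGh x hx t h1, hGh y hy t h2]
    have h2 : Tendsto (fun t : ℝ => (t : ℂ)) (nhdsWithin z.re {z.re}ᶜ)
        (nhdsWithin (z.re : ℂ) {(z.re : ℂ)}ᶜ) := by
      refine tendsto_nhdsWithin_of_tendsto_nhds_of_eventually_within _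
        (Complex.continuous_ofReal.continuousAt.tendsto.mono_left nhdsWithin_le_nhds) ?_
      filter_upwards [self_mem_nhdsWithin] with t ht
      simpa using ht
    exact h2.frequently (h1.filter_mono nhdsWithin_le_nhds).frequently
  let U : Set ℂ := ⋃ x ∈ K, Metric.ball (x : ℂ) (r x)
  have hU : ∀ z ∈ U, ∃ x ∈ K, z ∈ Metric.ball (x : ℂ) (r x) := fun z hz => by
    simpa only [U, mem_iUnion, exists_prop] using hz
  choose! q hqK hq using hU
  have hsub : ∀ x ∈ K, Metric.ball (x : ℂ) (r x) ⊆ U := fun x hx z hz =>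
    mem_biUnion hx hz
  have hKU : ∀ x ∈ K, (x : ℂ) ∈ U := fun x hx => hsub x hx (Metric.mem_ball_self (hr x hx))
  refine ⟨U, isOpen_biUnion fun x _ => Metric.isOpen_ball, hKU, fun z => G (q z) z, ?_, ?_⟩
  · intro z hz
    refine DifferentiableAt.differentiableWithinAt ?_
    have h1 := (hG (q z) (hqK z hz)).differentiableAt (Metric.isOpen_ball.mem_nhds (hq z hz))
    refine h1.congr_of_eventuallyEq ?_
    filter_upwards [Metric.isOpen_ball.mem_nhds (hq z hz)] with y hy
    have hyU := hsub _ (hqK z hz) hy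
    exact key _ (hqK y hyU) _ (hqK z hz) y ⟨hq y hyU, hy⟩
  · intro x hx
    change G (q x) x = h x
    rw [key _ (hqK x (hKU x hx)) _ hx x ⟨hq x (hKU x hx), Metric.mem_ball_self (hr x hx)⟩]
    exact hGh x hx x (by simpa using hr x hx)

lemma exists_annulus_subset {U : Set ℂ} (hU : IsOpen U) (h : Metric.sphere (0 : ℂ) 1 ⊆ U) :
    ∃ R > 1, ∀ z : ℂ, R⁻¹ < ‖z‖ → ‖z‖ < R → z ∈ U := by
  obtain ⟨δ, hδ, hsub⟩ := (isCompact_sphere (0 : ℂ) 1).exists_thickening_subset_open hU h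
  have hd : 0 < min δ 1 / 2 := by have := lt_min hδ one_pos; linarith
  have hdδ : min δ 1 / 2 < δ := by have := min_le_left δ 1; linarith
  generalize min δ 1 / 2 = d at hd hdδ
  refine ⟨1 + d, by linarith, fun z h1 h2 => hsub ?_⟩
  have hz : 0 < ‖z‖ := lt_trans (by positivity) h1
  have hz0 : z ≠ 0 := norm_pos_iff.1 hz
  have h3 : 1 - d < ‖z‖ := by
    refine lt_of_le_of_lt ?_ h1
    rw [← one_div, le_div_iff₀ (by linarith)]
    nlinarith
  refine Metric.mem_thickening_iff.2 ⟨z / ‖z‖, by simp [hz0], ?_⟩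
  have h4 : z - z / ‖z‖ = ((‖z‖ - 1 : ℝ) : ℂ) * (z / ‖z‖) := by
    have : (‖z‖ : ℂ) ≠ 0 := by exact_mod_cast hz.ne'
    push_cast
    field_simp
  rw [dist_eq_norm, h4, norm_mul, Complex.norm_real, Real.norm_eq_abs]
  simp only [norm_div, Complex.norm_real, norm_norm, div_self hz.ne', mul_one]
  rw [abs_lt]
  constructor <;> linarith

lemma circleIntegral_inv_radius {R : ℝ} (hR : 0 < R) (g : ℂ → ℂ) :
    ∮ s in C(0, R⁻¹), g s = ∮ s in C(0, R), (s ^ 2)⁻¹ * g s⁻¹ := by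
  have h := intervalIntegral.integral_comp_sub_left (a := 0) (b := 2 * Real.pi)
    (fun t => deriv (circleMap 0 R⁻¹) t • g (circleMap 0 R⁻¹ t)) (2 * Real.pi)
  simp only [sub_self, sub_zero] at h
  rw [circleIntegral, circleIntegral, ← h]
  refine intervalIntegral.integral_congr fun t _ => ?_
  have h1 : circleMap 0 R⁻¹ (2 * Real.pi - t) = (circleMap 0 R t)⁻¹ := by
    simp only [circleMap, zero_add, mul_inv, ← Complex.exp_neg]
    push_cast
    rw [show (2 * Real.pi - t : ℂ) * Complex.I = -(t * Complex.I) + 2 * Real.pi * Complex.I by ring,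
      Complex.exp_add, Complex.exp_two_pi_mul_I, mul_one]
  have h2 : circleMap 0 R t ≠ 0 := circleMap_ne_center hR.ne'
  simp only [deriv_circleMap, h1, smul_eq_mul]
  field_simp

/-- Laurent splitting of a function on an annulus that is invariant under inversion. -/
lemma exists_add_comp_inv {H : ℂ → ℂ} {R₀ : ℝ} (hR₀ : 1 < R₀)
    (hH : DifferentiableOn ℂ H {z | R₀⁻¹ < ‖z‖ ∧ ‖z‖ < R₀})
    (hsymm : ∀ z, R₀⁻¹ < ‖z‖ → ‖z‖ < R₀ → H z⁻¹ = H z) :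
    ∃ R > 1, ∃ (c : ℂ) (L : ℂ → ℂ), DifferentiableOn ℂ L (Metric.ball 0 R) ∧ L 0 = 0 ∧
      ∀ z : ℂ, ‖z‖ = 1 → H z = c + L z + L z⁻¹ := by
  obtain ⟨R, hR1, hRR⟩ := exists_between hR₀
  have hR0 : 0 < R := by linarith
  have hRi : R⁻¹ < 1 := inv_lt_one_of_one_lt₀ hR1
  have hRi' : R₀⁻¹ < R⁻¹ := (inv_lt_inv₀ (by linarith) hR0).2 hRR
  set A : Set ℂ := {z | R₀⁻¹ < ‖z‖ ∧ ‖z‖ < R₀} with hA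
  have hAo : IsOpen A := (isOpen_lt continuous_const continuous_norm).inter
    (isOpen_lt continuous_norm continuous_const)
  have hsphere : Metric.sphere (0 : ℂ) R ⊆ A := fun z hz => by
    rw [mem_sphere_zero_iff_norm] at hz
    exact ⟨by linarith, by linarith⟩
  have hsphere' : Metric.sphere (0 : ℂ) R⁻¹ ⊆ A := fun z hz => by
    rw [mem_sphere_zero_iff_norm] at hz
    exact ⟨by linarith, by linarith⟩
  have hHR : CircleIntegrable H 0 R :=
    (hH.continuousOn.mono hsphere).circleIntegrable hR0.le
  set l : ℂ → ℂ := fun w => (2 * Real.pi * Complex.I)⁻¹ * ∮ s in C(0, R), (s - w)⁻¹ * H s with hl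
  have hld : DifferentiableOn ℂ l (Metric.ball 0 R) := by
    obtain ⟨ρ, rfl⟩ : ∃ ρ : NNReal, R = ρ := ⟨⟨R, hR0.le⟩, rfl⟩
    have h1 := (hasFPowerSeriesOn_cauchy_integral hHR hR0).differentiableOn
    have h2 : Metric.ball (0 : ℂ) ρ = Metric.eball (0 : ℂ) ρ := by
      rw [Metric.eball_coe]
    rw [h2]
    exact h1
  refine ⟨R, hR1, l 0, fun w => l w - l 0, hld.sub_const _, sub_self _, fun z hz => ?_⟩
  have hz0 : z ≠ 0 := by rintro rfl; simp at hz
  have hzA : z ∈ A := ⟨by rw [hz]; linarith, by rw [hz]; linarith⟩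
  have hne : ∀ {r : ℝ}, r ≠ 1 → ∀ s ∈ Metric.sphere (0 : ℂ) r, ∀ {w : ℂ}, ‖w‖ = 1 → s - w ≠ 0 := by
    intro r hr s hs w hw h
    rw [mem_sphere_zero_iff_norm, sub_eq_zero.1 h, hw] at hs
    exact hr hs.symm
  have hInt : ∀ {r : ℝ}, 0 < r → r ≠ 1 → Metric.sphere (0 : ℂ) r ⊆ A → ∀ {w : ℂ}, ‖w‖ = 1 →
      CircleIntegrable (fun s => (s - w)⁻¹ * H s) 0 r := fun hr0 hr hsub w hw =>
    (((continuousOn_id.sub continuousOn_const).inv₀ fun s hs => hne hr s hs hw).mul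
      (hH.continuousOn.mono hsub)).circleIntegrable hr0.le
  have hint1 : ∀ {r : ℝ}, 0 < r → r ≠ 1 →
      CircleIntegrable (fun s => (s - z)⁻¹ * H z) 0 r := fun hr0 hr =>
    (((continuousOn_id.sub continuousOn_const).inv₀ fun s hs => hne hr s hs hz).mul
      continuousOn_const).circleIntegrable hr0.le
  have hds : ∀ {r : ℝ}, 0 < r → r ≠ 1 → Metric.sphere (0 : ℂ) r ⊆ A →
      ∮ s in C(0, r), dslope H z s = (∮ s in C(0, r), (s - z)⁻¹ * H s) -
        (∮ s in C(0, r), (s - z)⁻¹) * H z := by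
    intro r hr0 hr hsub
    have e : (∮ s in C(0, r), (s - z)⁻¹) * H z = ∮ s in C(0, r), (s - z)⁻¹ * H z := by
      rw [mul_comm, ← circleIntegral.integral_const_mul]
      simp only [mul_comm]
    rw [e, ← circleIntegral.integral_sub (hInt hr0 hr hsub hz) (hint1 hr0 hr)]
    refine circleIntegral.integral_congr hr0.le fun s hs => ?_
    have hsz : s ≠ z := fun h => hne hr s hs hz (sub_eq_zero.2 h)
    simp only [dslope_of_ne _ hsz, slope_def_field]
    rw [div_eq_inv_mul, mul_sub]
  have hD : DifferentiableOn ℂ (dslope H z) A :=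
    (Complex.differentiableOn_dslope (hAo.mem_nhds hzA)).2 hH
  have hsub : Metric.closedBall (0 : ℂ) R \ Metric.ball 0 R⁻¹ ⊆ A := fun s hs => by
    have h1 := mem_closedBall_zero_iff.1 hs.1
    have h2 : ¬ ‖s‖ < R⁻¹ := fun h => hs.2 (mem_ball_zero_iff.2 h)
    exact ⟨by linarith, by linarith⟩
  have h1 := Complex.circleIntegral_eq_of_differentiable_on_annulus_off_countable
    (inv_pos.2 hR0) (by linarith) countable_empty (hD.continuousOn.mono hsub) (fun s hs =>
      hD.differentiableAt (hAo.mem_nhds (hsub ⟨Metric.ball_subset_closedBall hs.1.1,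
        fun h => hs.1.2 (Metric.ball_subset_closedBall h)⟩)))
  have h2 : ∮ s in C(0, R), (s - z)⁻¹ = 2 * Real.pi * Complex.I :=
    circleIntegral.integral_sub_inv_of_mem_ball (by simpa [hz] using hR1)
  have h3 : ∮ s in C(0, R⁻¹), (s - z)⁻¹ = 0 := by
    have hd : ∀ s ∈ Metric.closedBall (0 : ℂ) R⁻¹, DifferentiableAt ℂ (fun s => (s - z)⁻¹) s :=
      fun s hs => by
        refine (differentiableAt_id.sub_const z).inv fun h => ?_
        rw [sub_eq_zero] at h
        have := mem_closedBall_zero_iff.1 hs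
        rw [show s = z from h, hz] at this
        linarith
    exact Complex.circleIntegral_eq_zero_of_differentiable_on_off_countable (inv_pos.2 hR0).le
      countable_empty (fun s hs => (hd s hs).continuousAt.continuousWithinAt) fun s hs =>
      hd s (Metric.ball_subset_closedBall hs.1)
  rw [hds hR0 hR1.ne' hsphere, hds (inv_pos.2 hR0) hRi.ne hsphere', h2, h3, zero_mul, sub_zero] at h1
  have hzi : ‖z⁻¹‖ = 1 := by rw [norm_inv, hz, inv_one]
  have hint0 : CircleIntegrable (fun s => (s - 0)⁻¹ * H s) 0 R := by
    refine (((continuousOn_id.sub continuousOn_const).inv₀ fun s hs h => ?_).mul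
      (hH.continuousOn.mono hsphere)).circleIntegrable hR0.le
    rw [mem_sphere_zero_iff_norm] at hs
    rw [show s = 0 by simpa using h, norm_zero] at hs
    exact hR0.ne hs
  have h4 : ∮ s in C(0, R⁻¹), (s - z)⁻¹ * H s =
      (∮ s in C(0, R), (s - 0)⁻¹ * H s) - ∮ s in C(0, R), (s - z⁻¹)⁻¹ * H s := by
    rw [circleIntegral_inv_radius hR0, ← circleIntegral.integral_sub hint0
      (hInt hR0 hR1.ne' hsphere hzi)]
    refine circleIntegral.integral_congr hR0.le fun s hs => ?_
    have hs0 : s ≠ 0 := by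
      rintro rfl
      rw [mem_sphere_zero_iff_norm, norm_zero] at hs
      exact hR0.ne hs
    have hsz := hne hR1.ne' s hs hzi
    have hsA := hsphere hs
    have hsz' : s⁻¹ - z ≠ 0 := fun h => hsz (by rw [← sub_eq_zero.1 h, inv_inv, sub_self])
    have hsz2 : s * z - 1 ≠ 0 := fun h => hsz' (by field_simp; linear_combination -h)
    simp only [hsymm s hsA.1 hsA.2]
    have e : (s ^ 2)⁻¹ * (s⁻¹ - z)⁻¹ = (s - 0)⁻¹ - (s - z⁻¹)⁻¹ := by
      have e1 : s⁻¹ - z = -(s * z - 1) / s := by field_simp; ring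
      have e2 : s - z⁻¹ = (s * z - 1) / z := by field_simp
      rw [e1, e2, sub_zero]
      field_simp
      ring
    rw [← mul_assoc, e, sub_mul]
  have hpi : (2 * Real.pi * Complex.I : ℂ) ≠ 0 := Complex.two_pi_I_ne_zero
  rw [h4] at h1
  have h5 : H z = (2 * Real.pi * Complex.I)⁻¹ * ((∮ s in C(0, R), (s - z)⁻¹ * H s) +
      (∮ s in C(0, R), (s - z⁻¹)⁻¹ * H s) - ∮ s in C(0, R), (s - 0)⁻¹ * H s) := by
    rw [eq_inv_mul_iff_mul_eq₀ hpi]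
    linear_combination -h1
  rw [h5]
  ring

lemma circleMap_two_pi_sub (t : ℝ) : circleMap 0 1 (2 * Real.pi - t) = (circleMap 0 1 t)⁻¹ := by
  simp only [circleMap, zero_add, Complex.ofReal_one, one_mul, ← Complex.exp_neg]
  push_cast
  rw [show (2 * Real.pi - t : ℂ) * Complex.I = -(t * Complex.I) + 2 * Real.pi * Complex.I by ring,
    Complex.exp_add, Complex.exp_two_pi_mul_I, mul_one]

lemma circleMap_re (t : ℝ) : (circleMap 0 1 t).re = Real.cos t := by
  simp [circleMap, Complex.exp_ofReal_mul_I_re]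

lemma circleMap_add_inv (t : ℝ) :
    circleMap 0 1 t + (circleMap 0 1 t)⁻¹ = 2 * (Real.cos t : ℂ) := by
  rw [Complex.ofReal_cos, Complex.cos]
  simp [circleMap, ← Complex.exp_neg]
  ring

lemma exists_szego_decomposition {h : ℝ → ℝ} (h_an : AnalyticOnNhd ℝ h (Icc (-1) 1))
    (h_pos : ∀ x ∈ Icc (-1 : ℝ) 1, 0 < h x) :
    ∃ R > 1, ∃ (c : ℂ) (L : ℂ → ℂ), DifferentiableOn ℂ L (Metric.ball 0 R) ∧ L 0 = 0 ∧
      ∀ s : ℂ, ‖s‖ = 1 → (Real.log (h s.re) : ℂ) = c + L s + L s⁻¹ := by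
  obtain ⟨U, hU, hKU, G, hG, hGh⟩ := h_an.exists_complex_extension
  set V := U ∩ G ⁻¹' Complex.slitPlane with hV
  have hVo : IsOpen V := hG.continuousOn.isOpen_inter_preimage hU Complex.isOpen_slitPlane
  set J : ℂ → ℂ := fun z => (z + z⁻¹) / 2 with hJ
  have hJd : DifferentiableOn ℂ J {0}ᶜ := fun z hz => by
    have : z ≠ 0 := hz
    refine DifferentiableAt.differentiableWithinAt ?_
    simp only [hJ]
    fun_prop (disch := assumption)
  have hWo : IsOpen ({0}ᶜ ∩ J ⁻¹' V) :=
    hJd.continuousOn.isOpen_inter_preimage isOpen_compl_singleton hVo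
  have hJre : ∀ s : ℂ, ‖s‖ = 1 → J s = (s.re : ℂ) := fun s hs => by
    have h2 : s⁻¹ = (starRingEnd ℂ) s := by
      rw [Complex.inv_def, Complex.normSq_eq_norm_sq]; simp [hs]
    simp only [hJ, h2, Complex.add_conj]
    push_cast
    ring
  have hre : ∀ s : ℂ, ‖s‖ = 1 → s.re ∈ Icc (-1 : ℝ) 1 := fun s hs => by
    have := Complex.abs_re_le_norm s
    rw [hs, abs_le] at this
    exact this
  have hsub : Metric.sphere (0 : ℂ) 1 ⊆ {0}ᶜ ∩ J ⁻¹' V := fun s hs => by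
    rw [mem_sphere_zero_iff_norm] at hs
    refine ⟨by rintro rfl; simp at hs, ?_⟩
    change J s ∈ V
    rw [hJre s hs]
    refine ⟨hKU _ (hre s hs), ?_⟩
    change G (s.re : ℂ) ∈ Complex.slitPlane
    rw [hGh _ (hre s hs)]
    exact Complex.ofReal_mem_slitPlane.2 (h_pos _ (hre s hs))
  obtain ⟨R₀, hR₀, hR⟩ := exists_annulus_subset hWo hsub
  obtain ⟨R, hR1, c, L, hL, hL0, hLs⟩ := exists_add_comp_inv
    (H := fun z => Complex.log (G (J z))) hR₀ (fun z hz => by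
      obtain ⟨h1, h2, h3⟩ := hR z hz.1 hz.2
      refine DifferentiableAt.differentiableWithinAt ?_
      exact ((hG.differentiableAt (hU.mem_nhds h2)).comp z
        (hJd.differentiableAt (isOpen_compl_singleton.mem_nhds h1))).clog h3)
    (fun z _ _ => by simp only [hJ, inv_inv, add_comm])
  refine ⟨R, hR1, c, L, hL, hL0, fun s hs => ?_⟩
  rw [← hLs s hs]
  simp only [hJre s hs, hGh _ (hre s hs)]
  rw [Complex.ofReal_log (h_pos _ (hre s hs)).le]

/-- Division of an odd function by `z + 1/z` up to a linear correction. -/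
lemma exists_factor_of_odd {L : ℂ → ℂ} {R : ℝ} (hR : 1 < R)
    (hL : DifferentiableOn ℂ L (Metric.ball 0 R)) :
    ∃ Q : ℂ → ℂ, DifferentiableOn ℂ Q (Metric.ball 0 R) ∧ ∀ z,
      L z - L (-z) = (z ^ 2 + 1) * Q z + (L Complex.I - L (-Complex.I)) / Complex.I * z := by
  set k := (L Complex.I - L (-Complex.I)) / Complex.I with hk
  set N : ℂ → ℂ := fun z => L z - L (-z) - k * z with hN
  have hI : k * Complex.I = L Complex.I - L (-Complex.I) := div_mul_cancel₀ _ Complex.I_ne_zero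
  have hN1 : N Complex.I = 0 := by simp only [hN, hI]; ring
  have hN2 : N (-Complex.I) = 0 := by
    simp only [hN, neg_neg]; linear_combination hI
  have hmem : Metric.ball (0 : ℂ) R ∈ nhds Complex.I :=
    Metric.isOpen_ball.mem_nhds (by simpa using hR)
  have hmem' : Metric.ball (0 : ℂ) R ∈ nhds (-Complex.I) :=
    Metric.isOpen_ball.mem_nhds (by simpa using hR)
  have hNd : DifferentiableOn ℂ N (Metric.ball 0 R) := by
    refine (hL.sub (hL.comp differentiableOn_id.neg fun z hz => ?_)).sub
      (differentiableOn_const k |>.mul differentiableOn_id)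
    simpa using hz
  refine ⟨dslope (dslope N Complex.I) (-Complex.I), (Complex.differentiableOn_dslope hmem').2
    ((Complex.differentiableOn_dslope hmem).2 hNd), fun z => ?_⟩
  have h1 := sub_smul_dslope N Complex.I z
  have h2 := sub_smul_dslope (dslope N Complex.I) (-Complex.I) z
  have h3 : dslope N Complex.I (-Complex.I) = 0 := by
    have hne : -Complex.I ≠ Complex.I := fun h => by
      have := congrArg Complex.im h
      norm_num at this
    rw [dslope_of_ne _ hne, slope_def_field, hN1, hN2]
    simp
  rw [h3, sub_zero, smul_eq_mul] at h2
  rw [hN1, sub_zero, smul_eq_mul, ← h2] at h1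
  simp only [hN] at h1 ⊢
  generalize dslope (dslope N Complex.I) (-Complex.I) z = q at *
  linear_combination -h1 - q * Complex.I_sq

lemma integral_circleMap_mul_eq_zero {Q : ℂ → ℂ} {R : ℝ} (hR : 1 < R)
    (hQ : DifferentiableOn ℂ Q (Metric.ball 0 R)) :
    ∫ t in (0:ℝ)..(2 * Real.pi), circleMap 0 1 t * Q (circleMap 0 1 t) = 0 := by
  have hd : ∀ s ∈ Metric.closedBall (0 : ℂ) 1, DifferentiableAt ℂ Q s := fun s hs =>
    hQ.differentiableAt (Metric.isOpen_ball.mem_nhds (Metric.closedBall_subset_ball hR hs))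
  have h := Complex.circleIntegral_eq_zero_of_differentiable_on_off_countable zero_le_one
    countable_empty (fun s hs => (hd s hs).continuousAt.continuousWithinAt) fun s hs =>
      hd s (Metric.ball_subset_closedBall hs.1)
  rw [circleIntegral] at h
  simp only [deriv_circleMap, smul_eq_mul, mul_comm _ Complex.I, mul_assoc] at h
  rw [intervalIntegral.integral_const_mul] at h
  exact (mul_eq_zero.1 h).resolve_left Complex.I_ne_zero

/-- The principal value of `log h(t) / (t √(1 - t²))` in terms of the exterior part of the
Fourier expansion of `log h(cos t)`. -/
lemma szego_odd {p : ℝ → ℝ} (hp : ContinuousOn p (Icc (-1) 1)) {R : ℝ} (hR : 1 < R) {c : ℂ}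
    {L : ℂ → ℂ} (hL : DifferentiableOn ℂ L (Metric.ball 0 R))
    (hpL : ∀ s : ℂ, ‖s‖ = 1 → (p s.re : ℂ) = c + L s + L s⁻¹) {H : ℝ}
    (hH : Tendsto (fun ε : ℝ => ∫ t in (Ioo (-1 : ℝ) 1 \ Ioo (0 - ε) (0 + ε)),
      p t / Real.sqrt (1 - t ^ 2) / (t - 0)) (nhdsWithin 0 (Ioi 0)) (nhds (2 * Real.pi * H))) :
    L Complex.I - L (-Complex.I) = 2 * Complex.I * H := by
  obtain ⟨Q, hQ, hLQ⟩ := exists_factor_of_odd hR hL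
  set k := (L Complex.I - L (-Complex.I)) / Complex.I with hk
  set σ : ℝ → ℂ := circleMap 0 1 with hσ
  have hσc : Continuous σ := continuous_circleMap 0 1
  have hσn : ∀ t, ‖σ t‖ = 1 := fun t => by simp [hσ]
  have hσ0 : ∀ t, σ t ≠ 0 := fun t => by rw [← norm_ne_zero_iff, hσn]; exact one_ne_zero
  have hσi : Continuous fun t => (σ t)⁻¹ := hσc.inv₀ hσ0
  have hmemb : ∀ z : ℂ, ‖z‖ = 1 → z ∈ Metric.ball (0 : ℂ) R := fun z hz => by simpa [hz] using hR
  set g₁ : ℝ → ℂ := fun t => σ t * Q (σ t) with hg₁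
  set g : ℝ → ℂ := fun t => g₁ t + g₁ (2 * Real.pi - t) + k with hg
  have hg₁c : Continuous g₁ := hσc.mul (hQ.continuousOn.comp_continuous hσc fun t =>
    hmemb _ (hσn t))
  have hg₁c' : Continuous fun t => g₁ (2 * Real.pi - t) := hg₁c.comp (by fun_prop)
  have hgc : Continuous g := (hg₁c.add hg₁c').add continuous_const
  have hgs : ∀ t, g (2 * Real.pi - t) = g t := fun t => by
    simp only [hg, sub_sub_cancel]; ring
  have hgint : ∫ t in (0:ℝ)..Real.pi, g t = Real.pi * k := by
    have h1 : ∫ t in (0:ℝ)..(2 * Real.pi), g₁ t = 0 := integral_circleMap_mul_eq_zero hR hQ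
    have h2 : ∫ t in (0:ℝ)..(2 * Real.pi), g₁ (2 * Real.pi - t) = 0 := by
      rw [intervalIntegral.integral_comp_sub_left]; simpa using h1
    have h3 : ∫ t in (0:ℝ)..(2 * Real.pi), g t = 2 * Real.pi * k := by
      simp only [hg]
      rw [intervalIntegral.integral_add (f := fun t => g₁ t + g₁ (2 * Real.pi - t))
          ((hg₁c.add hg₁c').intervalIntegrable _ _) intervalIntegrable_const,
        intervalIntegral.integral_add (hg₁c.intervalIntegrable _ _)
        (hg₁c'.intervalIntegrable _ _), h1, h2]
      simp
    have h4 : ∫ t in Real.pi..(2 * Real.pi), g t = ∫ t in (0:ℝ)..Real.pi, g t := by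
      have := intervalIntegral.integral_comp_sub_left (a := 0) (b := Real.pi) g (2 * Real.pi)
      simp only [hgs] at this
      rw [this]
      congr 1 <;> ring
    rw [← intervalIntegral.integral_add_adjacent_intervals (hgc.intervalIntegrable 0 Real.pi)
      (hgc.intervalIntegrable _ _), h4] at h3
    linear_combination h3 / 2
  have hodd : ∀ t : ℝ, (p (Real.cos t) : ℂ) - p (-Real.cos t) = 2 * Real.cos t * g t := fun t => by
    have h1 := hpL (σ t) (hσn t)
    have h2 := hpL (-σ t) (by rw [norm_neg, hσn])
    have h3 : (σ t).re = Real.cos t := circleMap_re t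
    have h4 : σ (2 * Real.pi - t) = (σ t)⁻¹ := circleMap_two_pi_sub t
    have h5 : σ t + (σ t)⁻¹ = 2 * (Real.cos t : ℂ) := circleMap_add_inv t
    rw [Complex.neg_re, h3, inv_neg] at h2
    rw [h3] at h1
    have h6 := hLQ (σ t)
    have h7 := hLQ (σ t)⁻¹
    have h8 := mul_inv_cancel₀ (hσ0 t)
    rw [h1, h2, ← h5]
    simp only [hg, hg₁, h4]
    linear_combination h6 + h7 - (Q (σ t) + Q (σ t)⁻¹) * h8
  set B : ℝ → Set ℝ := fun ε => Real.cos ⁻¹' (Ioo (0 - ε) (0 + ε))ᶜ with hB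
  have hBc : ∀ ε, IsClosed (B ε) := fun ε => isOpen_Ioo.isClosed_compl.preimage Real.continuous_cos
  have hB0 : ∀ ε, 0 < ε → ∀ t ∈ B ε, Real.cos t ≠ 0 := fun ε hε t ht h0 => by
    apply ht
    rw [h0]
    constructor <;> linarith
  set q : ℝ → ℝ → ℂ := fun ε => (B ε).indicator fun t => (p (Real.cos t) : ℂ) / Real.cos t with hq
  have hpc : Continuous fun t => (p (Real.cos t) : ℂ) :=
    Complex.continuous_ofReal.comp (hp.comp_continuous Real.continuous_cos fun t =>
      ⟨Real.neg_one_le_cos t, Real.cos_le_one t⟩)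
  have hqi : ∀ ε, 0 < ε → IntervalIntegrable (q ε) volume 0 Real.pi := fun ε hε => by
    rw [intervalIntegrable_iff_integrableOn_Icc_of_le Real.pi_pos.le]
    have hco : IsCompact (B ε ∩ Icc 0 Real.pi) := isCompact_Icc.inter_left (hBc ε)
    have : IntegrableOn (fun t => (p (Real.cos t) : ℂ) / Real.cos t) (B ε ∩ Icc 0 Real.pi) :=
      ContinuousOn.integrableOn_compact hco (hpc.continuousOn.div
        (Complex.continuous_ofReal.comp Real.continuous_cos).continuousOn fun t ht => by
          exact_mod_cast hB0 ε hε t ht.1)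
    rw [IntegrableOn, integrable_indicator_iff (hBc ε).measurableSet, IntegrableOn,
      Measure.restrict_restrict (hBc ε).measurableSet]
    exact this
  have hIq : ∀ ε, ((∫ t in (Ioo (-1 : ℝ) 1 \ Ioo (0 - ε) (0 + ε)),
      p t / Real.sqrt (1 - t ^ 2) / (t - 0) : ℝ) : ℂ) = ∫ t in (0:ℝ)..Real.pi, q ε t := fun ε => by
    rw [sdiff_eq, ← image_cos_Ioo, ← image_inter_preimage,
      integral_image_eq_integral_abs_deriv_smul (f' := fun t => -Real.sin t)
        (measurableSet_Ioo.inter (hBc ε).measurableSet)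
        (fun t _ => (Real.hasDerivAt_cos t).hasDerivWithinAt)
        (injOn_cos_Ioo.mono inter_subset_left), ← integral_complex_ofReal,
      intervalIntegral.integral_of_le Real.pi_pos.le, integral_Ioc_eq_integral_Ioo, hq,
      setIntegral_indicator (hBc ε).measurableSet]
    refine setIntegral_congr_fun (measurableSet_Ioo.inter (hBc ε).measurableSet) fun t ht => ?_
    have hs := Real.sin_pos_of_mem_Ioo ht.1
    have h1 : Real.sqrt (1 - Real.cos t ^ 2) = Real.sin t := by
      rw [← Real.sin_sq, Real.sqrt_sq hs.le]
    simp only [h1, abs_neg, abs_of_pos hs, smul_eq_mul, sub_zero]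
    rw [div_div, ← mul_div_assoc, mul_div_mul_left _ _ hs.ne']
    push_cast
    rfl
  have hsum : ∀ ε, 0 < ε → 2 * ∫ t in (0:ℝ)..Real.pi, q ε t =
      ∫ t in (0:ℝ)..Real.pi, (B ε).indicator (fun t => 2 * g t) t := fun ε hε => by
    have h1 : ∫ t in (0:ℝ)..Real.pi, q ε (Real.pi - t) = ∫ t in (0:ℝ)..Real.pi, q ε t := by
      rw [intervalIntegral.integral_comp_sub_left]; simp
    have h2 : IntervalIntegrable (fun t => q ε (Real.pi - t)) volume 0 Real.pi := by
      have := ((hqi ε hε).comp_sub_left Real.pi).symm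
      simpa using this
    rw [two_mul]
    nth_rewrite 2 [← h1]
    rw [← intervalIntegral.integral_add (hqi ε hε) h2]
    refine intervalIntegral.integral_congr fun t _ => ?_
    have hBt : Real.pi - t ∈ B ε ↔ t ∈ B ε := by
      simp only [hB, mem_preimage, Real.cos_pi_sub, mem_compl_iff, mem_Ioo, not_and_or, not_lt]
      constructor <;> (rintro (h | h) <;> [right; left] <;> linarith)
    by_cases ht : t ∈ B ε
    · have h0 : (Real.cos t : ℂ) ≠ 0 := by exact_mod_cast hB0 ε hε t ht
      simp only [hq, indicator_of_mem ht, indicator_of_mem (hBt.2 ht), Real.cos_pi_sub]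
      have := hodd t
      push_cast at this ⊢
      rw [div_neg, ← sub_eq_add_neg, ← sub_div, div_eq_iff (by exact_mod_cast h0), this]
      ring
    · simp only [hq, indicator_of_notMem ht, indicator_of_notMem (mt hBt.1 ht), add_zero]
  have hlim : Tendsto (fun ε : ℝ => ∫ t in (0:ℝ)..Real.pi, (B ε).indicator (fun t => 2 * g t) t)
      (nhdsWithin 0 (Ioi 0)) (nhds (∫ t in (0:ℝ)..Real.pi, 2 * g t)) := by
    have hgc2 : Continuous fun t => 2 * g t := continuous_const.mul hgc
    refine intervalIntegral.tendsto_integral_filter_of_dominated_convergence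
      (fun t => ‖2 * g t‖) (Eventually.of_forall fun ε =>
        (hgc2.aestronglyMeasurable.indicator (hBc ε).measurableSet))
      (Eventually.of_forall fun ε => Eventually.of_forall fun t _ => norm_indicator_le_norm_self _ _)
      (hgc2.norm.intervalIntegrable _ _) ?_
    filter_upwards [(countable_singleton (Real.pi / 2)).ae_notMem volume] with t ht htm
    rw [uIoc_of_le Real.pi_pos.le] at htm
    have h0 : 0 < |Real.cos t| := by
      rw [abs_pos]
      intro h0
      rw [← Real.cos_pi_div_two] at h0
      exact ht (Real.injOn_cos ⟨htm.1.le, htm.2⟩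
        ⟨by positivity, by linarith [Real.pi_pos]⟩ h0)
    refine tendsto_const_nhds.congr' ?_
    filter_upwards [mem_nhdsWithin_of_mem_nhds (Iio_mem_nhds h0)] with ε hε
    rw [indicator_of_mem]
    rintro ⟨h1, h2⟩
    rw [zero_sub] at h1
    rw [zero_add] at h2
    exact absurd hε (not_lt.2 (abs_le.2 ⟨h1.le, h2.le⟩))
  have hlim' : Tendsto (fun ε : ℝ => ∫ t in (0:ℝ)..Real.pi, (B ε).indicator (fun t => 2 * g t) t)
      (nhdsWithin 0 (Ioi 0)) (nhds (2 * ((2 * Real.pi * H : ℝ) : ℂ))) := by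
    refine (((Complex.continuous_ofReal.tendsto _).comp hH).const_mul 2).congr' ?_
    filter_upwards [self_mem_nhdsWithin] with ε hε
    rw [← hsum ε hε, ← hIq ε]
    rfl
  have hfin := tendsto_nhds_unique hlim hlim'
  rw [intervalIntegral.integral_const_mul, hgint] at hfin
  have hπ : (Real.pi : ℂ) ≠ 0 := by exact_mod_cast Real.pi_ne_zero
  have hkH : k = 2 * H := by
    push_cast at hfin
    refine mul_left_cancel₀ hπ ?_
    linear_combination hfin / 2
  rw [hk, div_eq_iff Complex.I_ne_zero] at hkH
  rw [hkH]
  ring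

lemma one_sub_mem_slitPlane_of_re_mul_pos {q y : ℂ} (hy : y.re ≤ 0) (hqy : 0 < (q * y).re) :
    1 - q ∈ Complex.slitPlane := by
  rw [Complex.mem_slitPlane_iff]
  by_contra! h
  obtain ⟨h1, h2⟩ := h
  simp only [Complex.sub_re, Complex.one_re, Complex.sub_im, Complex.one_im, zero_sub,
    neg_eq_zero] at h1 h2
  rw [Complex.mul_re, h2, zero_mul, sub_zero] at hqy
  nlinarith

lemma one_sub_inv_mem_slitPlane_of_re_mul_pos {q y : ℂ} (hy : y.re ≤ 0) (hqy : 0 < (q * y).re) :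
    1 - q⁻¹ ∈ Complex.slitPlane := by
  rw [Complex.mem_slitPlane_iff]
  by_contra! h
  obtain ⟨h1, h2⟩ := h
  have hq0 : q ≠ 0 := by rintro rfl; simp at hqy
  have hn : 0 < Complex.normSq q := Complex.normSq_pos.2 hq0
  simp only [Complex.sub_re, Complex.one_re, Complex.sub_im, Complex.one_im, zero_sub,
    Complex.inv_re, Complex.inv_im, neg_eq_zero, div_eq_zero_iff, hn.ne', or_false] at h1 h2
  rw [Complex.mul_re, h2, zero_mul, sub_zero] at hqy
  have h3 : 0 < q.re / Complex.normSq q := by linarith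
  rw [div_pos_iff_of_pos_right hn] at h3
  nlinarith

set_option maxHeartbeats 400000 in
/-- First-order asymptotics of the Verblunsky coefficients of a circle weight with finitely many
Fisher–Hartwig singularities. -/
theorem opuc_coeff_zero_asymptotics {ι : Type} [Fintype ι] [DecidableEq ι] {x a b : ι → ℂ}
    (hx : ∀ j, ‖x j‖ = 1) (hb : ∀ j, b j = (starRingEnd ℂ) (a j)) (ha : ∀ j, -(1 / 2) < (a j).re)
    (hsep : ∀ j k, j ≠ k → (x k / x j).re ≤ 0) (hcov : ∀ z : ℂ, ‖z‖ = 1 → ∃ j, 0 < (z / x j).re)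
    {R : ℝ} (hR : 1 < R) {L : ℂ → ℂ} (hL : DifferentiableOn ℂ L (Metric.ball 0 R)) (hL0 : L 0 = 0)
    {K : ℂ} (hK : K ≠ 0) {f : ℂ → ℝ} (hf : IsCircleWeight f)
    (hfs : ∀ s : ℂ, ‖s‖ = 1 → (∀ j, s ≠ x j) →
      (f s : ℂ) = K * Complex.exp (L s) * Complex.exp (L s⁻¹) *
        ∏ j, fhWeight (a j) (b j) (s / x j)) :
    ∃ C, ∀ᶠ n : ℕ in atTop, ‖((opuc f n).coeff 0 : ℂ) - ∑ k, fhKappa (a k) (b k) n * x k ^ n *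
      (Complex.exp (L (x k)) * (∏ j ∈ Finset.univ.erase k, (1 - x k / x j) ^ a j) /
        (Complex.exp (L (x k)⁻¹) * ∏ j ∈ Finset.univ.erase k, (1 - (x k / x j)⁻¹) ^ b j))‖ ≤
        C / (n : ℝ) ^ 2 := by
  have hx0 : ∀ j, x j ≠ 0 := fun j => by rw [← norm_ne_zero_iff, hx]; exact one_ne_zero
  have ha' : ∀ j, -(1 / 2) < (b j).re := fun j => by rw [hb, Complex.conj_re]; exact ha j
  set Ω : ι → Set ℂ := fun j => {z | R⁻¹ < ‖z‖ ∧ ‖z‖ < R ∧ 0 < (z / x j).re} with hΩ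
  have hR0 : 0 < R := by linarith
  have hz0 : ∀ {j z}, z ∈ Ω j → z ≠ 0 := fun {j z} hz => by
    rw [← norm_pos_iff]; exact (inv_pos.2 hR0).trans hz.1
  have hxm : ∀ j, x j ∈ Ω j := fun j => ⟨by rw [hx]; exact inv_lt_one_of_one_lt₀ hR,
    by rw [hx]; exact hR, by rw [div_self (hx0 j)]; norm_num⟩
  have hxn : ∀ j k, j ≠ k → x j ∉ Ω k := fun j k hjk h => by
    have := hsep k j hjk.symm
    linarith [h.2.2]
  have hs1 : ∀ {j k z}, k ≠ j → z ∈ Ω j → 1 - z / x k ∈ Complex.slitPlane := fun {j k z} hkj hz =>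
    one_sub_mem_slitPlane_of_re_mul_pos (hsep j k hkj.symm) (by
      rw [div_mul_div_cancel₀ (hx0 k)]; exact hz.2.2)
  have hs2 : ∀ {j k z}, k ≠ j → z ∈ Ω j → 1 - (z / x k)⁻¹ ∈ Complex.slitPlane :=
    fun {j k z} hkj hz => one_sub_inv_mem_slitPlane_of_re_mul_pos (hsep j k hkj.symm) (by
      rw [div_mul_div_cancel₀ (hx0 k)]; exact hz.2.2)
  have hpd : ∀ (k : ι) {z : ℂ}, 1 - z / x k ∈ Complex.slitPlane →
      DifferentiableAt ℂ (fun z => (1 - z / x k) ^ a k) z := fun k z hz =>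
    ((differentiableAt_id.div_const _).const_sub _).cpow_const (by simpa using hz)
  have hmd : ∀ (k : ι) {z : ℂ}, z ≠ 0 → 1 - (z / x k)⁻¹ ∈ Complex.slitPlane →
      DifferentiableAt ℂ (fun z => (1 - (z / x k)⁻¹) ^ b k) z := fun k z h0 hz => by
    have h1 : DifferentiableAt ℂ (fun z => (z / x k)⁻¹) z :=
      (differentiableAt_id.div_const (x k)).fun_inv (div_ne_zero h0 (hx0 k))
    exact (h1.const_sub 1).cpow_const hz
  have hLd : ∀ {z : ℂ}, ‖z‖ < R → DifferentiableAt ℂ L z := fun {z} hz =>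
    hL.differentiableAt (Metric.isOpen_ball.mem_nhds (by simpa using hz))
  have hLi : ∀ {z : ℂ}, z ≠ 0 → R⁻¹ < ‖z‖ → DifferentiableAt ℂ (fun z => L z⁻¹) z :=
    fun {z} h0 hz => by
      have : ‖z⁻¹‖ < R := by rw [norm_inv]; exact inv_lt_of_inv_lt₀ hR0 hz
      exact (hLd this).comp z (differentiableAt_inv h0)
  set u : ι → ℂ → ℂ := fun j z => K * Complex.exp (L z) *
    ∏ k ∈ Finset.univ.erase j, (1 - z / x k) ^ a k with hu
  set v : ι → ℂ → ℂ := fun j z => Complex.exp (L z⁻¹) *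
    ∏ k ∈ Finset.univ.erase j, (1 - (z / x k)⁻¹) ^ b k with hv
  set fp : ℂ → ℂ := fun z => K * Complex.exp (L z) * ∏ k, (1 - z / x k) ^ a k with hfp
  set fm : ℂ → ℂ := fun z => Complex.exp (L z⁻¹) * ∏ k, (1 - (z / x k)⁻¹) ^ b k with hfm
  have hcp : ∀ {z c : ℂ}, z ∈ Complex.slitPlane → z ^ c ≠ 0 := fun {z c} hz => by
    rw [Complex.cpow_def_of_ne_zero (Complex.slitPlane_ne_zero hz)]; exact Complex.exp_ne_zero _
  have hin : ∀ (k : ι) {z : ℂ}, ‖z‖ < 1 → 1 - z / x k ∈ Complex.slitPlane := fun k z hz => by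
    have : ‖z / x k‖ < 1 := by rwa [norm_div, hx, div_one]
    exact one_sub_mem_slitPlane this.le fun h => by rw [h, norm_one] at this; exact this.false
  have hout : ∀ (k : ι) {z : ℂ}, 1 < ‖z‖ → 1 - (z / x k)⁻¹ ∈ Complex.slitPlane := fun k z hz => by
    have : ‖(z / x k)⁻¹‖ < 1 := by
      rw [norm_inv, norm_div, hx, div_one]; exact inv_lt_one_of_one_lt₀ hz
    exact one_sub_mem_slitPlane this.le fun h => by rw [h, norm_one] at this; exact this.false
  have hloc : ∀ j, IsFHFactor (x j) (a j) (b j) (Ω j) (fun s => (f s : ℂ)) fp fm (u j) (v j) :=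
    fun j =>
    { norm_eq := hx j
      mem := hxm j
      isOpen := by
        refine (isOpen_lt continuous_const continuous_norm).inter
          ((isOpen_lt continuous_norm continuous_const).inter
          (isOpen_lt continuous_const (Complex.continuous_re.comp (continuous_id.div_const _))))
      zero_notMem := fun h => hz0 h rfl
      re_a := ha j
      re_b := ha' j
      kappa := exists_fhKappa_bound (ha j) (hb j)
      kappa' := exists_fhKappa_bound (ha' j) (by rw [hb, Complex.conj_conj])
      diff_u := fun z hz => by
        refine DifferentiableAt.differentiableWithinAt (((hLd hz.2.1).cexp.const_mul K).mul ?_)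
        exact DifferentiableAt.fun_finsetProd fun k hk => hpd k (hs1 (Finset.ne_of_mem_erase hk) hz)
      diff_v := fun z hz => by
        refine DifferentiableAt.differentiableWithinAt ((hLi (hz0 hz) hz.1).cexp.mul ?_)
        exact DifferentiableAt.fun_finsetProd fun k hk =>
          hmd k (hz0 hz) (hs2 (Finset.ne_of_mem_erase hk) hz)
      u_ne := fun z hz => mul_ne_zero (mul_ne_zero hK (Complex.exp_ne_zero _))
        (Finset.prod_ne_zero_iff.2 fun k hk => hcp (hs1 (Finset.ne_of_mem_erase hk) hz))
      v_ne := fun z hz => mul_ne_zero (Complex.exp_ne_zero _)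
        (Finset.prod_ne_zero_iff.2 fun k hk => hcp (hs2 (Finset.ne_of_mem_erase hk) hz))
      plus := fun z _ _ => by
        simp only [hfp, hu, ← Finset.mul_prod_erase Finset.univ _ (Finset.mem_univ j)]; ring
      minus := fun z _ _ => by
        simp only [hfm, hv, ← Finset.mul_prod_erase Finset.univ _ (Finset.mem_univ j)]; ring
      weight := fun s hs hs1 hsj => by
        rw [hfs s hs1 fun k => ?_]
        · simp only [hu, hv, fhWeight, Finset.prod_mul_distrib,
            ← Finset.mul_prod_erase Finset.univ _ (Finset.mem_univ j)]
          ring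
        · rcases eq_or_ne k j with rfl | hkj
          · exact hsj
          · rintro rfl
            exact hxn k j hkj hs }
  obtain ⟨C, hC⟩ := fisherHartwig_asymptotics hloc (ρ := R) hR0
    (fun j z hz => by simpa using hz.2.1) hxn
    (fun z hz => by
      obtain ⟨j, hj⟩ := hcov z hz
      exact ⟨j, by rw [hz]; exact inv_lt_one_of_one_lt₀ hR, by rw [hz]; exact hR, hj⟩)
    hf.integrable
    (fun z hz => by
      have hz : ‖z‖ < 1 := hz
      refine DifferentiableAt.differentiableWithinAt
        (((hLd (hz.trans hR)).cexp.const_mul K).mul ?_)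
      exact DifferentiableAt.fun_finsetProd fun k hk => hpd k (hin k hz))
    (fun z hz => mul_ne_zero (mul_ne_zero hK (Complex.exp_ne_zero _))
        (Finset.prod_ne_zero_iff.2 fun k hk => hcp (hin k hz)))
    (fun z hz => by
      have hz : 1 < ‖z‖ := hz
      have h0 : z ≠ 0 := by rw [← norm_pos_iff]; linarith
      refine DifferentiableAt.differentiableWithinAt
        ((hLi h0 ((inv_lt_one_of_one_lt₀ hR).trans hz)).cexp.mul ?_)
      exact DifferentiableAt.fun_finsetProd fun k hk => hmd k h0 (hout k hz))
    (fun z hz => mul_ne_zero (Complex.exp_ne_zero _)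
        (Finset.prod_ne_zero_iff.2 fun k hk => hcp (hout k hz)))
    (by
      set F : ℂ → ℂ := fun y => Complex.exp (L y) * ∏ k, (1 - y * x k) ^ b k with hF
      have hFc : ContinuousAt F 0 := by
        refine ((hLd (by simpa using hR0)).continuousAt.cexp).mul ?_
        refine tendsto_finsetProd _ fun k _ => ContinuousAt.cpow ?_ continuousAt_const ?_
        · fun_prop
        · simp
      have hF0 : F 0 = 1 := by simp [hF, hL0]
      have h2 := tendsto_inv₀_cobounded (α := ℂ)
      rw [Metric.cobounded_eq_cocompact] at h2
      have h3 := hFc.tendsto.comp h2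
      rw [hF0] at h3
      refine h3.congr fun z => ?_
      simp only [Function.comp, hF, hfm, div_eq_mul_inv, mul_inv, inv_inv])
    (Φ := fun n z => aeval z (opuc f n)) (fun n => Polynomial.differentiable_aeval _)
    (fun n => tendsto_opuc f n) (fun n j hj => polyMom_opuc hf n j hj)
  refine ⟨C / ‖K‖, hC.mono fun n hn => ?_⟩
  have hK' : 0 < ‖K‖ := norm_pos_iff.2 hK
  have hfp0 : fp 0 = K := by simp [hfp, hL0]
  rw [div_right_comm, le_div_iff₀ hK', ← norm_mul]
  refine le_trans (le_of_eq (congrArg _ ?_)) hn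
  rw [hfp0, sub_mul, Finset.sum_mul, ← coeff_zero_eq_aeval_zero']
  congr 1
  refine Finset.sum_congr rfl fun k _ => ?_
  simp only [hu, hv]
  ring

lemma fhWeight_conj (a : ℂ) {s : ℂ} (hs : ‖s‖ = 1) (h1 : s ≠ 1) :
    fhWeight a ((starRingEnd ℂ) a) s =
      (((‖1 - s‖ ^ a.re / Real.exp ((1 - s).arg * a.im)) ^ 2 : ℝ) : ℂ) := by
  have h2 : s⁻¹ = (starRingEnd ℂ) s := by
    rw [Complex.inv_def, Complex.normSq_eq_norm_sq]; simp [hs]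
  have h3 : 1 - s⁻¹ ∈ Complex.slitPlane := one_sub_mem_slitPlane (by rw [norm_inv, hs, inv_one])
    (by rwa [ne_eq, inv_eq_one])
  have h4 : (starRingEnd ℂ) (1 - s⁻¹) = 1 - s := by rw [h2]; simp
  rw [fhWeight, Complex.cpow_conj _ _ (Complex.mem_slitPlane_iff_arg.1 h3).1, h4, Complex.mul_conj,
    Complex.normSq_eq_norm_sq, Complex.norm_cpow_of_ne_zero (sub_ne_zero.2 h1.symm)]

lemma sq_norm_one_sub {s : ℂ} (hs : ‖s‖ = 1) : ‖1 - s‖ ^ 2 = 2 * (1 - s.re) := by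
  have h : s.re * s.re + s.im * s.im = 1 := by
    rw [← Complex.normSq_apply, Complex.normSq_eq_norm_sq, hs, one_pow]
  rw [← Complex.normSq_eq_norm_sq, Complex.normSq_apply]
  simp only [Complex.sub_re, Complex.one_re, Complex.sub_im, Complex.one_im]
  linear_combination h

lemma fhWeight_real (r : ℝ) {s : ℂ} (hs : ‖s‖ = 1) (h1 : s ≠ 1) :
    fhWeight r r s = (((2 * (1 - s.re)) ^ r : ℝ) : ℂ) := by
  have h := fhWeight_conj r hs h1
  rw [Complex.conj_ofReal] at h
  rw [h, Complex.ofReal_im, mul_zero, Real.exp_zero, div_one, Complex.ofReal_re,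
    ← sq_norm_one_sub hs, ← Real.rpow_natCast, ← Real.rpow_natCast, ← Real.rpow_mul (norm_nonneg _),
    ← Real.rpow_mul (norm_nonneg _), mul_comm]

lemma arg_one_sub_mul_I_sub {s : ℂ} (hs : ‖s‖ = 1) (h0 : s.re ≠ 0) :
    (1 - s * Complex.I).arg - (1 + s * Complex.I).arg =
      if 0 < s.re then -(Real.pi / 2) else Real.pi / 2 := by
  have h : s.re * s.re + s.im * s.im = 1 := by
    rw [← Complex.normSq_apply, Complex.normSq_eq_norm_sq, hs, one_pow]
  have h00 : 0 < s.re * s.re := mul_self_pos.2 h0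
  have hi : -1 < s.im ∧ s.im < 1 := abs_lt.1 (by rw [← sq_lt_one_iff_abs_lt_one]; nlinarith)
  set z := 1 - s * Complex.I with hz
  set y := (starRingEnd ℂ) (1 + s * Complex.I) with hy
  have hzr : 0 < z.re := by simp [hz]; linarith
  have hyr : 0 < y.re := by simp [hy]; linarith
  have hz0 : z ≠ 0 := by intro h; simp [h] at hzr
  have hy0 : y ≠ 0 := by intro h; simp [h] at hyr
  have hza := abs_lt.1 (Complex.abs_arg_lt_pi_div_two_iff.2 (Or.inl hzr))
  have hya := abs_lt.1 (Complex.abs_arg_lt_pi_div_two_iff.2 (Or.inl hyr))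
  have hyc : y.arg = -(1 + s * Complex.I).arg := by
    rw [hy, Complex.arg_conj, if_neg]
    intro h
    rw [hy, Complex.arg_conj, if_pos h] at hya
    linarith [Real.pi_pos]
  have hm : z * y = ((2 * s.re : ℝ) : ℂ) * -Complex.I := by
    apply Complex.ext
    · simp [hz, hy]; linarith
    · simp [hz, hy]; ring
  have hadd : (z * y).arg = z.arg + y.arg := Complex.arg_mul hz0 hy0 ⟨by linarith, by linarith⟩
  rw [hyc, ← sub_eq_add_neg] at hadd
  rw [← hadd, hm]
  split_ifs with hp
  · rw [Complex.arg_real_mul _ (by linarith), Complex.arg_neg_I]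
  · have hn : 0 < -(2 * s.re) := by
      rcases lt_or_gt_of_ne h0 with h | h <;> [linarith; exact absurd h hp]
    rw [show ((2 * s.re : ℝ) : ℂ) * -Complex.I = ((-(2 * s.re) : ℝ) : ℂ) * Complex.I by
      push_cast; ring, Complex.arg_real_mul _ hn, Complex.arg_I]

lemma fhWeight_jump (l : ℝ) {s : ℂ} (hs : ‖s‖ = 1) (h0 : s.re ≠ 0) :
    fhWeight (Complex.I * l) (-(Complex.I * l)) (s / Complex.I) *
      fhWeight (-(Complex.I * l)) (Complex.I * l) (s / -Complex.I) =
      ((if 0 < s.re then Real.exp (-(l * Real.pi)) else Real.exp (l * Real.pi) : ℝ) : ℂ) := by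
  have hc : (starRingEnd ℂ) (Complex.I * l) = -(Complex.I * l) := by simp
  have hc' : (starRingEnd ℂ) (-(Complex.I * l)) = Complex.I * l := by simp
  have h1 : s / Complex.I ≠ 1 := fun h => by
    rw [div_eq_one_iff_eq Complex.I_ne_zero] at h; simp [h] at h0
  have h2 : s / -Complex.I ≠ 1 := fun h => by
    rw [div_eq_one_iff_eq (neg_ne_zero.2 Complex.I_ne_zero)] at h; simp [h] at h0
  have w1 := fhWeight_conj (Complex.I * l) (s := s / Complex.I) (by simp [hs]) h1
  have w2 := fhWeight_conj (-(Complex.I * l)) (s := s / -Complex.I) (by simp [hs]) h2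
  rw [hc] at w1
  rw [hc'] at w2
  have e1 : 1 - s / Complex.I = 1 + s * Complex.I := by rw [Complex.div_I]; ring
  have e2 : 1 - s / -Complex.I = 1 - s * Complex.I := by rw [div_neg, Complex.div_I]; ring
  have h3 := arg_one_sub_mul_I_sub hs h0
  rw [w1, w2, e1, e2, ← Complex.ofReal_mul]
  congr 1
  simp only [Complex.neg_re, Complex.neg_im, Complex.mul_re, Complex.mul_im, Complex.I_re,
    Complex.I_im, Complex.ofReal_re, Complex.ofReal_im, zero_mul, mul_zero, sub_zero, neg_zero,
    Real.rpow_zero, one_mul, zero_add, one_div, ← Real.exp_neg, ← Real.exp_nat_mul,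
    ← Real.exp_add]
  rw [← apply_ite Real.exp (0 < s.re)]
  congr 1
  split_ifs at h3 ⊢ <;> push_cast <;> linear_combination 2 * l * h3

/-- Fisher–Hartwig factorization of the pullback of the modified Jacobi weight to the circle. -/
lemma szegoWeight_eq_prod {α β c : ℝ} (hc : 0 < c) {h w : ℝ → ℝ}
    (h_pos : ∀ x ∈ Icc (-1 : ℝ) 1, 0 < h x)
    (hw : ∀ x : ℝ, w x = h x * (1 - x) ^ α * (1 + x) ^ β * (if x < 0 then 1 else c ^ 2))
    {c₀ : ℂ} {L : ℂ → ℂ}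
    (hL : ∀ s : ℂ, ‖s‖ = 1 → (Real.log (h s.re) : ℂ) = c₀ + L s + L s⁻¹)
    {l : ℝ} (hl : l * Real.pi = -Real.log c) {s : ℂ} (hs : ‖s‖ = 1) (h1 : s ≠ 1) (h2 : s ≠ -1)
    (h3 : s ≠ Complex.I) (h4 : s ≠ -Complex.I) :
    (szegoWeight w s : ℂ) = Complex.exp c₀ * ((c * 2 ^ (-(α + β + 1)) : ℝ) : ℂ) *
      Complex.exp (L s) * Complex.exp (L s⁻¹) *
      (fhWeight ((α + 1 / 2 : ℝ) : ℂ) ((α + 1 / 2 : ℝ) : ℂ) (s / 1) *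
        fhWeight ((β + 1 / 2 : ℝ) : ℂ) ((β + 1 / 2 : ℝ) : ℂ) (s / -1) *
        (fhWeight (Complex.I * l) (-(Complex.I * l)) (s / Complex.I) *
          fhWeight (-(Complex.I * l)) (Complex.I * l) (s / -Complex.I))) := by
  have hq : s.re * s.re + s.im * s.im = 1 := by
    rw [← Complex.normSq_apply, Complex.normSq_eq_norm_sq, hs, one_pow]
  obtain ⟨hx, hi⟩ := re_mem_Ioo_of_norm_eq_one hs h1 h2
  have h0 : s.re ≠ 0 := fun h0 => by
    rw [h0, mul_zero, zero_add, mul_self_eq_one_iff] at hq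
    rcases hq with hq | hq
    · exact h3 (Complex.ext (by simp [h0]) (by simp [hq]))
    · exact h4 (Complex.ext (by simp [h0]) (by simp [hq]))
  rw [div_one, div_neg, div_one, fhWeight_real _ hs h1, fhWeight_real _ (by rwa [norm_neg])
    (by rwa [ne_eq, neg_eq_iff_eq_neg]), fhWeight_jump l hs h0, hl, neg_neg, Real.exp_log hc]
  have e1 : Complex.exp c₀ * Complex.exp (L s) * Complex.exp (L s⁻¹) = (h s.re : ℂ) := by
    rw [← Complex.exp_add, ← Complex.exp_add, ← hL s hs, ← Complex.ofReal_exp,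
      Real.exp_log (h_pos _ ⟨hx.1.le, hx.2.le⟩)]
  have hA : 0 < 1 - s.re := by linarith [hx.2]
  have hB : 0 < 1 + s.re := by linarith [hx.1]
  have e2 : |s.im| = (1 - s.re) ^ (1 / 2 : ℝ) * (1 + s.re) ^ (1 / 2 : ℝ) := by
    rw [← Real.mul_rpow hA.le hB.le, ← Real.sqrt_eq_rpow, ← Real.sqrt_sq_eq_abs]
    congr 1
    linear_combination hq
  have e3 : (2 * (1 - s.re)) ^ (α + 1 / 2) * (2 * (1 + s.re)) ^ (β + 1 / 2) =
      2 ^ (α + β + 1) * ((1 - s.re) ^ α * (1 + s.re) ^ β * |s.im|) := by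
    rw [Real.mul_rpow two_pos.le hA.le, Real.mul_rpow two_pos.le hB.le, Real.rpow_add hA,
      Real.rpow_add hB, e2, show α + β + 1 = (α + 1 / 2) + (β + 1 / 2) by ring,
      Real.rpow_add two_pos (α + 1 / 2) (β + 1 / 2)]
    ring
  have e4 : (2:ℝ) ^ (-(α + β + 1)) * 2 ^ (α + β + 1) = 1 := by
    rw [← Real.rpow_add two_pos, neg_add_cancel, Real.rpow_zero]
  have e5 : (if s.re < 0 then 1 else c ^ 2) = c * if 0 < s.re then c else Real.exp (-Real.log c) := by
    rcases lt_or_gt_of_ne h0 with h | h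
    · rw [if_pos h, if_neg h.not_gt, Real.exp_neg, Real.exp_log hc, mul_inv_cancel₀ hc.ne']
    · rw [if_neg h.not_gt, if_pos h, sq]
  rw [szegoWeight, hw, e5, Complex.neg_re, sub_neg_eq_add]
  set J := if 0 < s.re then c else Real.exp (-Real.log c)
  have e6 : h s.re * (1 - s.re) ^ α * (1 + s.re) ^ β * (c * J) * |s.im| =
      h s.re * (c * 2 ^ (-(α + β + 1))) * ((2 * (1 - s.re)) ^ (α + 1 / 2) *
        (2 * (1 + s.re)) ^ (β + 1 / 2) * J) := by
    rw [e3]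
    linear_combination (-(h s.re * (1 - s.re) ^ α * (1 + s.re) ^ β * (c * J) * |s.im|)) * e4
  rw [e6, Complex.ofReal_mul, Complex.ofReal_mul, ← e1, Complex.ofReal_mul (_ * _) J,
    Complex.ofReal_mul (_ ^ _) (_ ^ _)]
  ring

lemma intervalIntegrable_jacobiWeight {α β c : ℝ} (hα : -1 < α) (hβ : -1 < β) {h w : ℝ → ℝ}
    (h_cont : ContinuousOn h (Icc (-1) 1))
    (hw : ∀ x : ℝ, w x = h x * (1 - x) ^ α * (1 + x) ^ β * (if x < 0 then 1 else c ^ 2)) :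
    IntervalIntegrable w volume (-1) 1 := by
  have h1 : IntervalIntegrable w volume (-1) 0 := by
    have i1 : IntervalIntegrable (fun x : ℝ => (1 + x) ^ β) volume (-1) 0 := by
      have := (intervalIntegral.intervalIntegrable_rpow' (a := 0) (b := 1) hβ).comp_add_left 1
      simpa using this
    have i2 := i1.continuousOn_mul (g := fun x => h x * (1 - x) ^ α) (by
      rw [uIcc_of_le (by norm_num)]
      refine (h_cont.mono (Icc_subset_Icc_right zero_le_one)).mul fun x hx => ?_
      exact (ContinuousAt.rpow_const (by fun_prop)
        (Or.inl (by linarith [hx.2]))).continuousWithinAt)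
    refine i2.congr_uIoo fun x hx => ?_
    rw [uIoo_of_le (by norm_num)] at hx
    simp only
    rw [hw, if_pos hx.2, mul_one]
  have h2 : IntervalIntegrable w volume 0 1 := by
    have i1 : IntervalIntegrable (fun x : ℝ => (1 - x) ^ α) volume 0 1 := by
      have := ((intervalIntegral.intervalIntegrable_rpow' (a := 0) (b := 1) hα).comp_sub_left 1).symm
      simpa using this
    have i2 := i1.continuousOn_mul (g := fun x => h x * (1 + x) ^ β * c ^ 2) (by
      rw [uIcc_of_le (by norm_num)]
      refine ((h_cont.mono (Icc_subset_Icc_left (by norm_num))).mul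
        fun x hx => ?_).mul continuousOn_const
      exact (ContinuousAt.rpow_const (by fun_prop)
        (Or.inl (by linarith [hx.1]))).continuousWithinAt)
    refine i2.congr_uIoo fun x hx => ?_
    rw [uIoo_of_le (by norm_num)] at hx
    simp only
    rw [hw, if_neg (not_lt.2 hx.1.le)]
    ring
  exact h1.trans h2

lemma one_sub_I_cpow_div (r : ℝ) :
    (1 - Complex.I) ^ (r : ℂ) / (1 + Complex.I) ^ (r : ℂ) =
      Complex.exp (-(Real.pi / 2 * r * Complex.I)) := by
  have h1 := arg_one_sub_mul_I_sub (s := 1) (by simp) (by simp)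
  rw [one_mul, if_pos (by simp)] at h1
  have hn1 : (1 - Complex.I) ≠ 0 := fun h => by
    have := congrArg Complex.re h; simp at this
  have hn2 : (1 + Complex.I) ≠ 0 := fun h => by
    have := congrArg Complex.re h; simp at this
  have h2 : ‖1 - Complex.I‖ = ‖1 + Complex.I‖ := by
    rw [← Complex.norm_conj]; simp
  rw [Complex.cpow_def_of_ne_zero hn1, Complex.cpow_def_of_ne_zero hn2, ← Complex.exp_sub]
  congr 1
  rw [Complex.log, Complex.log, h2]
  have h3 : (((1 - Complex.I).arg : ℂ) - (1 + Complex.I).arg) = -(Real.pi / 2) := by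
    exact_mod_cast h1
  linear_combination r * Complex.I * h3

lemma exp_mul_two_cpow (r : ℂ) : (2 : ℂ) ^ r = Complex.exp (Real.log 2 * r) := by
  rw [Complex.cpow_def_of_ne_zero two_ne_zero, Complex.ofReal_log two_pos.le, Complex.ofReal_ofNat]

/-- First-order asymptotics of the Verblunsky coefficients of the modified Jacobi weight with a
jump at the origin. -/
lemma opuc_coeff_zero_szegoWeight {α β c : ℝ} (hα : -1 < α) (hβ : -1 < β) (hc : 0 < c)
    {h w : ℝ → ℝ} (h_an : AnalyticOnNhd ℝ h (Icc (-1) 1))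
    (h_pos : ∀ x ∈ Icc (-1 : ℝ) 1, 0 < h x)
    (hw : ∀ x : ℝ, w x = h x * (1 - x) ^ α * (1 + x) ^ β * (if x < 0 then 1 else c ^ 2))
    (hf : IsCircleWeight (szegoWeight w)) {H : ℝ}
    (hH : Tendsto (fun ε : ℝ => ∫ t in (Ioo (-1 : ℝ) 1 \ Ioo (0 - ε) (0 + ε)),
      Real.log (h t) / Real.sqrt (1 - t ^ 2) / (t - 0))
      (nhdsWithin 0 (Ioi 0)) (nhds (2 * Real.pi * H)))
    {l : ℝ} (hl : l * Real.pi = -Real.log c) {ψ : ℝ}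
    (hψ : ψ = 2 * H + Real.pi / 2 * (β - α) - 2 * l * Real.log 2) :
    ∃ (C₁ C₂ : ℂ) (C : ℝ), ∀ᶠ n : ℕ in atTop, ‖((opuc (szegoWeight w) n).coeff 0 : ℂ) -
      (fhKappa (α + 1 / 2 : ℝ) (α + 1 / 2 : ℝ) n * C₁ +
        fhKappa (β + 1 / 2 : ℝ) (β + 1 / 2 : ℝ) n * (-1) ^ n * C₂ +
        (fhKappa (Complex.I * l) (-(Complex.I * l)) n * Complex.I ^ n * Complex.exp (Complex.I * ψ)
        + fhKappa (-(Complex.I * l)) (Complex.I * l) n * (-Complex.I) ^ n *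
          Complex.exp (-(Complex.I * ψ))))‖ ≤ C / (n : ℝ) ^ 2 := by
  obtain ⟨R, hR, c₀, L, hL, hL0, hLs⟩ := exists_szego_decomposition h_an h_pos
  have hodd := szego_odd (p := fun x => Real.log (h x))
    (h_an.continuousOn.log fun x hx => (h_pos x hx).ne') hR hL hLs hH
  obtain ⟨r₁, hr₁⟩ : ∃ r, r = α + 1 / 2 := ⟨_, rfl⟩
  obtain ⟨r₂, hr₂⟩ : ∃ r, r = β + 1 / 2 := ⟨_, rfl⟩
  have hfs := fun {s : ℂ} => szegoWeight_eq_prod hc h_pos hw hLs hl (s := s)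
  rw [← hr₁, ← hr₂] at hfs ⊢
  obtain ⟨C, hC⟩ := opuc_coeff_zero_asymptotics (ι := Fin 4)
    (x := ![1, -1, Complex.I, -Complex.I])
    (a := ![(r₁ : ℂ), (r₂ : ℂ), Complex.I * l, -(Complex.I * l)])
    (b := ![(r₁ : ℂ), (r₂ : ℂ), -(Complex.I * l), Complex.I * l])
    (fun j => by fin_cases j <;> simp) (fun j => by fin_cases j <;> simp)
    (fun j => by fin_cases j <;> simp <;> linarith)
    (fun j k hjk => by fin_cases j <;> fin_cases k <;> simp [div_neg] at hjk ⊢)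
    (fun z hz => by
      have hq : z.re * z.re + z.im * z.im = 1 := by
        rw [← Complex.normSq_apply, Complex.normSq_eq_norm_sq, hz, one_pow]
      rcases lt_trichotomy z.re 0 with h | h | h
      · exact ⟨1, by simpa [div_neg] using h⟩
      · rcases lt_trichotomy z.im 0 with h' | h' | h'
        · exact ⟨3, by simpa [div_neg, Complex.div_I] using h'⟩
        · simp [h, h'] at hq
        · exact ⟨2, by simpa [Complex.div_I] using h'⟩
      · exact ⟨0, by simpa using h⟩)
    hR hL hL0 (K := Complex.exp c₀ * ((c * 2 ^ (-(α + β + 1)) : ℝ) : ℂ))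
    (mul_ne_zero (Complex.exp_ne_zero _) (by
      rw [ne_eq, Complex.ofReal_eq_zero]; positivity)) hf
    (fun s hs hne => by
      rw [hfs hs (by simpa using hne 0) (by simpa using hne 1)
        (by simpa using hne 2) (by simpa using hne 3)]
      simp only [Fin.prod_univ_four, Matrix.cons_val]
      ring)
  have e2 : Finset.univ.erase (2 : Fin 4) = {0, 1, 3} := by decide
  have e3 : Finset.univ.erase (3 : Fin 4) = {0, 1, 2} := by decide
  have n1 : (1 - Complex.I) ≠ 0 := fun h => by
    have := congrArg Complex.re h; simp at this
  have n2 : (1 + Complex.I) ≠ 0 := fun h => by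
    have := congrArg Complex.re h; simp at this
  have hcp : ∀ {z r : ℂ}, z ≠ 0 → z ^ r ≠ 0 := fun {z r} hz => by
    rw [Complex.cpow_def_of_ne_zero hz]; exact Complex.exp_ne_zero _
  have hψc : (ψ : ℂ) = 2 * H + Real.pi / 2 * (r₂ - r₁) - 2 * l * Real.log 2 := by
    rw [hψ, hr₁, hr₂]; push_cast; ring
  have hE : Complex.exp (Complex.I * ψ) = Complex.exp (L Complex.I - L (-Complex.I)) *
      ((1 - Complex.I) ^ (r₁ : ℂ) / (1 + Complex.I) ^ (r₁ : ℂ)) /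
      ((1 - Complex.I) ^ (r₂ : ℂ) / (1 + Complex.I) ^ (r₂ : ℂ)) *
      2 ^ (-(Complex.I * l)) / 2 ^ (Complex.I * l) := by
    rw [one_sub_I_cpow_div, one_sub_I_cpow_div, exp_mul_two_cpow, exp_mul_two_cpow, hodd,
      ← Complex.exp_add, ← Complex.exp_sub, ← Complex.exp_add, ← Complex.exp_sub, hψc]
    congr 1
    ring
  rw [Complex.exp_sub] at hE
  have hp1 := hcp n1 (r := (r₁ : ℂ))
  have hp2 := hcp n1 (r := (r₂ : ℂ))
  have hp3 := hcp n2 (r := (r₁ : ℂ))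
  have hp4 := hcp n2 (r := (r₂ : ℂ))
  have hp5 := hcp two_ne_zero (r := Complex.I * l)
  have hp6 := hcp two_ne_zero (r := -(Complex.I * l))
  have hp7 := Complex.exp_ne_zero (L Complex.I)
  have hp8 := Complex.exp_ne_zero (L (-Complex.I))
  set D : Fin 4 → ℂ := fun k => Complex.exp (L (![1, -1, Complex.I, -Complex.I] k)) *
    (∏ j ∈ Finset.univ.erase k,
      (1 - ![1, -1, Complex.I, -Complex.I] k / ![1, -1, Complex.I, -Complex.I] j) ^
        ![(r₁ : ℂ), (r₂ : ℂ), Complex.I * l, -(Complex.I * l)] j) /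
    (Complex.exp (L (![1, -1, Complex.I, -Complex.I] k)⁻¹) * ∏ j ∈ Finset.univ.erase k,
      (1 - (![1, -1, Complex.I, -Complex.I] k / ![1, -1, Complex.I, -Complex.I] j)⁻¹) ^
        ![(r₁ : ℂ), (r₂ : ℂ), -(Complex.I * l), Complex.I * l] j) with hD
  have hD2 : D 2 = Complex.exp (Complex.I * ψ) := by
    rw [hE]
    simp [hD, e2, Finset.prod_insert, Complex.div_I, div_neg, one_add_one_eq_two]
    simp only [← sub_eq_add_neg]
    field_simp
  have hD3 : D 3 = Complex.exp (-(Complex.I * ψ)) := by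
    rw [Complex.exp_neg, hE]
    simp [hD, e3, Finset.prod_insert, Complex.div_I, div_neg, one_add_one_eq_two]
    field_simp
  refine ⟨D 0, D 1, C, hC.mono fun n hn => le_trans (le_of_eq (congrArg _ ?_)) hn⟩
  rw [Fin.sum_univ_four]
  change _ = _ - (_ * _ * D 0 + _ * _ * D 1 + _ * _ * D 2 + _ * _ * D 3)
  rw [hD2, hD3]
  simp only [Matrix.cons_val, one_pow, mul_one]
  ring

lemma Gamma_div_Gamma_neg_of_arg {l γ : ℝ} (hl : l ≠ 0)
    (hγ : ∃ k : ℤ, (Complex.Gamma (-(Complex.I * l))).arg = γ + k * Real.pi) :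
    Complex.Gamma (Complex.I * l) / Complex.Gamma (-(Complex.I * l)) =
      Complex.exp (-(2 * γ * Complex.I)) := by
  obtain ⟨k, hk⟩ := hγ
  set Z := Complex.Gamma (-(Complex.I * l)) with hZ
  have hZ0 : Z ≠ 0 := Complex.Gamma_ne_zero fun m h => by
    have := congrArg Complex.im h
    simp [hl] at this
  have h1 : Complex.Gamma (Complex.I * l) = (starRingEnd ℂ) Z := by
    rw [hZ, ← Complex.Gamma_conj]
    simp
  have h2 := Complex.norm_mul_exp_arg_mul_I Z
  have h3 : (starRingEnd ℂ) Z = ‖Z‖ * Complex.exp (-(Z.arg * Complex.I)) := by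
    conv_lhs => rw [← h2]
    rw [map_mul, Complex.conj_ofReal, ← Complex.exp_conj]
    simp
  rw [h1, div_eq_iff hZ0, h3]
  conv_rhs => rw [← h2]
  rw [mul_left_comm, ← Complex.exp_add, hk]
  congr 1
  rw [Complex.exp_eq_exp_iff_exists_int]
  refine ⟨-k, ?_⟩
  push_cast
  ring

lemma natCast_cpow_neg_one_sub {n : ℕ} (hn : 1 ≤ n) (l : ℝ) :
    (n : ℂ) ^ (-1 - 2 * (Complex.I * l)) =
      Complex.exp (-(2 * l * Real.log n * Complex.I)) / n := by
  have hn0 : (n : ℂ) ≠ 0 := by exact_mod_cast (by omega : n ≠ 0)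
  rw [sub_eq_add_neg, Complex.cpow_add _ _ hn0, Complex.cpow_neg_one,
    Complex.cpow_def_of_ne_zero hn0, ← Complex.natCast_log, div_eq_mul_inv, mul_comm]
  congr 2
  ring

lemma fhKappa_pair_asymptotics {l γ : ℝ} (ψ : ℝ) (hX : l ≠ 0 → Complex.Gamma (Complex.I * l) /
      Complex.Gamma (-(Complex.I * l)) = Complex.exp (-(2 * γ * Complex.I))) :
    ∃ C : ℝ, ∀ m : ℕ, ‖fhKappa (Complex.I * l) (-(Complex.I * l)) (2 * m + 1) *
        Complex.I ^ (2 * m + 1) * Complex.exp (Complex.I * ψ) +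
      fhKappa (-(Complex.I * l)) (Complex.I * l) (2 * m + 1) * (-Complex.I) ^ (2 * m + 1) *
        Complex.exp (-(Complex.I * ψ)) -
      (-((-1) ^ m * (2 * l * (Real.cos (ψ - 2 * γ - 2 * l * Real.log (2 * m + 1)) /
        (2 * m + 1)))) : ℝ)‖ ≤ C / (2 * m + 1 : ℝ) ^ 2 := by
  set a : ℂ := Complex.I * l with ha
  obtain ⟨C₁, hC₁⟩ := fhKappa_asymptotics (a := a) (by simp [ha])
  obtain ⟨C₂, hC₂⟩ := fhKappa_asymptotics (a := -a) (by simp [ha])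
  have hL1 : fhKappaLim a = Complex.I * l * Complex.exp (-(2 * γ * Complex.I)) := by
    rcases eq_or_ne l 0 with h0 | h0
    · simp [fhKappaLim, ha, h0]
    · rw [fhKappaLim, mul_div_assoc, hX h0]
  have hL2 : fhKappaLim (-a) = -(Complex.I * l * Complex.exp (2 * γ * Complex.I)) := by
    rcases eq_or_ne l 0 with h0 | h0
    · simp [fhKappaLim, ha, h0]
    · rw [fhKappaLim, neg_neg, mul_div_assoc, ← inv_div (Complex.Gamma a), hX h0, ← Complex.exp_neg,
        neg_neg]
      ring
  refine ⟨C₁ + C₂, fun m => ?_⟩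
  have k1 := hC₁ (2 * m + 1) (by omega)
  have k2 := hC₂ (2 * m + 1) (by omega)
  rw [neg_neg] at k2
  have e1 := natCast_cpow_neg_one_sub (n := 2 * m + 1) (by omega) l
  have e2 := natCast_cpow_neg_one_sub (n := 2 * m + 1) (by omega) (-l)
  rw [show Complex.I * ((-l : ℝ) : ℂ) = -a by rw [ha]; push_cast; ring] at e2
  rw [← ha] at e1
  rw [e1, hL1] at k1
  rw [e2, hL2] at k2
  have hN : ((2 * m + 1 : ℕ) : ℝ) = 2 * m + 1 := by push_cast; ring
  have hNc : ((2 * m + 1 : ℕ) : ℂ) = 2 * m + 1 := by push_cast; ring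
  rw [hN, hNc] at k1 k2
  set g := Real.log (2 * m + 1) with hg
  have hI1 : Complex.I ^ (2 * m + 1) = (-1) ^ m * Complex.I := by
    rw [pow_succ, pow_mul, Complex.I_sq]
  have hI2 : (-Complex.I) ^ (2 * m + 1) = -((-1) ^ m * Complex.I) := by
    rw [Odd.neg_pow ⟨m, rfl⟩, hI1]
  set E1 := Complex.exp (Complex.I * ψ) with hE1
  set E2 := Complex.exp (-(Complex.I * ψ)) with hE2
  have n1 : ‖E1‖ = 1 := Complex.norm_exp_I_mul_ofReal ψ
  have n2 : ‖E2‖ = 1 := by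
    have := Complex.norm_exp_I_mul_ofReal (-ψ)
    rw [hE2, ← this]
    congr 2
    push_cast
    ring
  set ω := ψ - 2 * γ - 2 * l * g with hω
  have c1 : Complex.exp (-(2 * γ * Complex.I)) * Complex.exp (-(2 * l * g * Complex.I)) * E1 =
      Complex.exp (ω * Complex.I) := by
    rw [hE1, ← Complex.exp_add, ← Complex.exp_add, hω]
    congr 1
    push_cast
    ring
  have c2 : Complex.exp (2 * γ * Complex.I) * Complex.exp (-(2 * ((-l : ℝ) : ℂ) * g * Complex.I)) *
      E2 = Complex.exp (-ω * Complex.I) := by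
    rw [hE2, ← Complex.exp_add, ← Complex.exp_add, hω]
    congr 1
    push_cast
    ring
  have c3 : Complex.exp (ω * Complex.I) + Complex.exp (-ω * Complex.I) = 2 * (Real.cos ω : ℂ) := by
    rw [Complex.ofReal_cos, Complex.cos]; ring
  rw [add_div]
  set κ1 := fhKappa a (-a) (2 * m + 1)
  set κ2 := fhKappa (-a) a (2 * m + 1)
  set X1 := Complex.exp (-(2 * γ * Complex.I))
  set X2 := Complex.exp (2 * γ * Complex.I)
  set Y1 := Complex.exp (-(2 * l * g * Complex.I))
  set Y2 := Complex.exp (-(2 * ((-l : ℝ) : ℂ) * g * Complex.I))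
  have hm : ‖((-1 : ℂ) ^ m * Complex.I)‖ = 1 := by simp
  calc _ = ‖(κ1 - Complex.I * l * X1 * (Y1 / (2 * m + 1))) * ((-1) ^ m * Complex.I) * E1 +
        (κ2 - -(Complex.I * l * X2) * (Y2 / (2 * m + 1))) * -((-1) ^ m * Complex.I) * E2‖ := by
        congr 1
        rw [hI1, hI2]
        push_cast
        generalize (-1 : ℂ) ^ m = σ
        rw [← Complex.ofReal_cos]
        linear_combination (Complex.I ^ 2 * l * σ / (2 * m + 1)) * (c1 + c2 + c3) +
          (2 * σ * l * Real.cos ω / (2 * m + 1)) * Complex.I_sq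
    _ ≤ _ := by
        refine (norm_add_le _ _).trans (add_le_add ?_ ?_)
        · rw [norm_mul, norm_mul, hm, n1, mul_one, mul_one]; exact k1
        · rw [norm_mul, norm_mul, norm_neg, hm, n2, mul_one, mul_one]; exact k2

lemma abs_cos_log_div_sub_le (ω l : ℝ) {x : ℝ} (hx : 1 ≤ x) :
    |Real.cos (ω - 2 * l * Real.log (x + 1)) / (x + 1) - Real.cos (ω - 2 * l * Real.log x) / x| ≤
      (2 * |l| + 1) / x ^ 2 := by
  have hx0 : 0 < x := by linarith
  have hlog : |Real.log (x + 1) - Real.log x| ≤ 1 / x := by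
    rw [← Real.log_div (by positivity) hx0.ne', abs_of_nonneg (Real.log_nonneg (by
      rw [le_div_iff₀ hx0]; linarith))]
    refine (Real.log_le_sub_one_of_pos (by positivity)).trans (le_of_eq ?_)
    field_simp
    ring
  set A := ω - 2 * l * Real.log (x + 1) with hA
  set B := ω - 2 * l * Real.log x with hB
  have hcos : |Real.cos A - Real.cos B| ≤ 2 * |l| * (1 / x) := by
    have h1 : |Real.cos A - Real.cos B| ≤ |A - B| := Real.abs_cos_sub_cos_le A B
    have h2 : A - B = -(2 * l) * (Real.log (x + 1) - Real.log x) := by rw [hA, hB]; ring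
    rw [h2, abs_mul, abs_neg, abs_mul, abs_two] at h1
    exact h1.trans (mul_le_mul_of_nonneg_left hlog (by positivity))
  have e : Real.cos A / (x + 1) - Real.cos B / x =
      (Real.cos A - Real.cos B) / x - Real.cos A * (1 / (x * (x + 1))) := by
    field_simp
    ring
  rw [e]
  refine (abs_sub _ _).trans ?_
  rw [abs_div, abs_mul, abs_of_pos hx0, add_div]
  refine add_le_add ?_ ?_
  · rw [div_le_div_iff₀ hx0 (by positivity)]
    calc _ ≤ 2 * |l| * (1 / x) * x ^ 2 := by gcongr
      _ = _ := by field_simp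
  · rw [abs_of_pos (a := 1 / (x * (x + 1))) (by positivity)]
    calc _ ≤ 1 * (1 / (x * (x + 1))) := by gcongr; exact Real.abs_cos_le_one A
      _ ≤ _ := by rw [one_mul]; gcongr; nlinarith

lemma norm_fhKappa_self_sub_le {r : ℝ} (hr : -(1 / 2) < r) (m : ℕ) :
    ‖fhKappa (r : ℂ) r (2 * m + 1) - fhKappa (r : ℂ) r (2 * m + 3)‖ ≤
      4 * |r| / (m + 1 : ℝ) ^ 2 := by
  have h1 := fhKappa_self_mul (a := (r : ℂ)) (by simpa using hr) (2 * m + 1)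
  have h2 := fhKappa_self_mul (a := (r : ℂ)) (by simpa using hr) (2 * m + 3)
  have p1 : 0 < r + (2 * m + 1) := by have := m.cast_nonneg (α := ℝ); linarith
  have p2 : 0 < r + (2 * m + 3) := by linarith
  have q1 : (r : ℂ) + (2 * m + 1 : ℕ) ≠ 0 := by exact_mod_cast p1.ne'
  have q2 : (r : ℂ) + (2 * m + 3 : ℕ) ≠ 0 := by exact_mod_cast p2.ne'
  rw [← eq_div_iff q1] at h1
  rw [← eq_div_iff q2] at h2
  have e : fhKappa (r : ℂ) r (2 * m + 1) - fhKappa (r : ℂ) r (2 * m + 3) =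
      ((2 * r / ((r + (2 * m + 1)) * (r + (2 * m + 3))) : ℝ) : ℂ) := by
    rw [h1, h2]
    push_cast at q1 q2 ⊢
    field_simp
    ring
  rw [e, Complex.norm_real, Real.norm_eq_abs, abs_div, abs_mul, abs_two, abs_of_pos (mul_pos p1 p2),
    div_le_div_iff₀ (mul_pos p1 p2) (by positivity)]
  have := m.cast_nonneg (α := ℝ)
  nlinarith [abs_nonneg r, mul_nonneg (abs_nonneg r) (by nlinarith :
    0 ≤ 2 * ((r + (2 * m + 1)) * (r + (2 * m + 3))) - (m + 1 : ℝ) ^ 2)]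

lemma exists_abs_le_div_of_fhKappa_expansion {φ : ℕ → ℝ} {r₁ r₂ l ψ C : ℝ} {C₁ C₂ : ℂ}
    (hr₁ : -(1 / 2) < r₁) (hr₂ : -(1 / 2) < r₂)
    (hφ : ∀ᶠ n : ℕ in atTop, ‖(φ n : ℂ) - (fhKappa (r₁ : ℝ) (r₁ : ℝ) n * C₁ +
      fhKappa (r₂ : ℝ) (r₂ : ℝ) n * (-1) ^ n * C₂ +
      (fhKappa (Complex.I * l) (-(Complex.I * l)) n * Complex.I ^ n *
          Complex.exp (Complex.I * ψ) +
        fhKappa (-(Complex.I * l)) (Complex.I * l) n * (-Complex.I) ^ n *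
          Complex.exp (-(Complex.I * ψ))))‖ ≤ C / (n : ℝ) ^ 2) :
    ∃ K : ℝ, ∀ᶠ n : ℕ in atTop, |φ n| ≤ K / n := by
  obtain ⟨K₁, h₁⟩ := exists_fhKappa_bound (a := (r₁ : ℂ)) (b := r₁) (by simpa using hr₁) (by simp)
  obtain ⟨K₂, h₂⟩ := exists_fhKappa_bound (a := (r₂ : ℂ)) (b := r₂) (by simpa using hr₂) (by simp)
  obtain ⟨K₃, h₃⟩ := exists_fhKappa_bound (a := Complex.I * l) (b := -(Complex.I * l))
    (by simp) (by simp)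
  obtain ⟨K₄, h₄⟩ := exists_fhKappa_bound (a := -(Complex.I * l)) (b := Complex.I * l)
    (by simp) (by simp)
  have n1 : ‖Complex.exp (Complex.I * ψ)‖ = 1 := Complex.norm_exp_I_mul_ofReal ψ
  have n2 : ‖Complex.exp (-(Complex.I * ψ))‖ = 1 := by
    have := Complex.norm_exp_I_mul_ofReal (-ψ)
    rw [← this]
    congr 2
    push_cast
    ring
  refine ⟨|C| + (K₁ * ‖C₁‖ + K₂ * ‖C₂‖ + (K₃ + K₄)), ?_⟩
  filter_upwards [hφ, eventually_ge_atTop 1] with n hn hn1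
  have hn1' : (1 : ℝ) ≤ n := by exact_mod_cast hn1
  have hK : ∀ {K : ℝ} {κ : ℂ}, ‖κ‖ ≤ K / (n + 1) → ‖κ‖ ≤ K / n := fun {K κ} h => by
    refine h.trans ?_
    have : 0 ≤ K := by
      have := (norm_nonneg _).trans h
      by_contra! hneg
      exact absurd this (not_le.2 (div_neg_of_neg_of_pos hneg (by positivity)))
    gcongr
    linarith
  have b₁ := hK (h₁ n)
  have b₂ := hK (h₂ n)
  have b₃ := hK (h₃ n)
  have b₄ := hK (h₄ n)
  rw [← Real.norm_eq_abs, ← Complex.norm_real]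
  refine (norm_le_norm_sub_add _ _).trans ((add_le_add hn (norm_add₃_le.trans
    (add_le_add_right (norm_add_le _ _) _))).trans ?_)
  simp only [norm_mul, norm_pow, norm_neg, norm_one, Complex.norm_I, one_pow, mul_one, n1, n2]
  calc _ ≤ |C| / n + (K₁ / n * ‖C₁‖ + K₂ / n * ‖C₂‖ + (K₃ / n + K₄ / n)) := by
        gcongr
        · exact le_abs_self C
        · nlinarith
    _ = _ := by ring

lemma verblunsky_recurrence_asymptotics {φ : ℕ → ℝ} {r₁ r₂ l γ ψ C : ℝ} {C₁ C₂ : ℂ}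
    (hr₁ : -(1 / 2) < r₁) (hr₂ : -(1 / 2) < r₂)
    (hX : l ≠ 0 → Complex.Gamma (Complex.I * l) /
      Complex.Gamma (-(Complex.I * l)) = Complex.exp (-(2 * γ * Complex.I)))
    (hφ : ∀ᶠ n : ℕ in atTop, ‖(φ n : ℂ) - (fhKappa (r₁ : ℝ) (r₁ : ℝ) n * C₁ +
      fhKappa (r₂ : ℝ) (r₂ : ℝ) n * (-1) ^ n * C₂ +
      (fhKappa (Complex.I * l) (-(Complex.I * l)) n * Complex.I ^ n *
          Complex.exp (Complex.I * ψ) +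
        fhKappa (-(Complex.I * l)) (Complex.I * l) n * (-Complex.I) ^ n *
          Complex.exp (-(Complex.I * ψ))))‖ ≤ C / (n : ℝ) ^ 2) :
    ∃ K : ℝ, ∀ᶠ m : ℕ in atTop,
      |(φ (2 * m + 1) - φ (2 * m + 3)) / 2 - φ (2 * m + 2) * (φ (2 * m + 1) + φ (2 * m + 3)) / 2 -
        l / (m + 1) * ((-1) ^ (m + 1) *
          Real.cos (ψ - 2 * γ - 2 * l * Real.log (2 * (m + 1))))| ≤ K / (m + 1 : ℝ) ^ 2 := by
  obtain ⟨K, hK⟩ := exists_abs_le_div_of_fhKappa_expansion hr₁ hr₂ hφ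
  obtain ⟨C', hC'⟩ := fhKappa_pair_asymptotics ψ hX
  set ω := ψ - 2 * γ with hω
  set y : ℝ → ℝ := fun x => Real.cos (ω - 2 * l * Real.log x) / x with hy
  set κ₁ : ℕ → ℂ := fun n => fhKappa (r₁ : ℝ) (r₁ : ℝ) n with hκ₁
  set κ₂ : ℕ → ℂ := fun n => fhKappa (r₂ : ℝ) (r₂ : ℝ) n with hκ₂
  have hodd : ∀ᶠ m : ℕ in atTop, ‖(φ (2 * m + 1) : ℂ) - (κ₁ (2 * m + 1) * C₁ -
      κ₂ (2 * m + 1) * C₂ + (-((-1) ^ m * (2 * l * y (2 * m + 1))) : ℝ))‖ ≤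
      (|C| + |C'|) / (m + 1 : ℝ) ^ 2 := by
    have ht : Tendsto (fun m : ℕ => 2 * m + 1) atTop atTop :=
      tendsto_atTop_mono (fun m => by simp only [id]; omega) tendsto_id
    filter_upwards [ht.eventually hφ] with m hm
    have hm' := hC' m
    have hcast : ((2 * m + 1 : ℕ) : ℝ) = 2 * m + 1 := by push_cast; ring
    rw [hcast] at hm
    have hs : (-1 : ℂ) ^ (2 * m + 1) = -1 := Odd.neg_one_pow ⟨m, rfl⟩
    rw [hs] at hm
    have hle : ∀ D : ℝ, D / (2 * m + 1 : ℝ) ^ 2 ≤ |D| / (m + 1 : ℝ) ^ 2 := fun D => by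
      gcongr
      · exact le_abs_self D
      · have := m.cast_nonneg (α := ℝ); linarith
    rw [add_div]
    refine le_trans (le_of_eq_of_le (congrArg norm ?_) (norm_add_le _ _))
      (add_le_add (hm.trans (hle C)) (hm'.trans (hle C')))
    simp only [hy, hκ₁, hκ₂]
    ring
  have hodd' : ∀ᶠ m : ℕ in atTop, ‖(φ (2 * m + 3) : ℂ) - (κ₁ (2 * m + 3) * C₁ -
      κ₂ (2 * m + 3) * C₂ + ((-1) ^ m * (2 * l * y (2 * m + 3)) : ℝ))‖ ≤
      (|C| + |C'|) / (m + 1 : ℝ) ^ 2 := by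
    filter_upwards [(tendsto_add_atTop_nat 1).eventually hodd] with m hm
    have e : (2 * ((m + 1 : ℕ) : ℝ) + 1) = 2 * m + 3 := by push_cast; ring
    rw [e, show 2 * (m + 1) + 1 = 2 * m + 3 by ring, pow_succ] at hm
    refine le_of_eq_of_le (congrArg norm ?_) (hm.trans ?_)
    · push_cast; ring
    · push_cast
      gcongr
      linarith
  refine ⟨(|C| + |C'|) + (4 * |r₁| * ‖C₁‖ + 4 * |r₂| * ‖C₂‖) / 2 + |l| * (2 * (2 * |l| + 1)) +
    K ^ 2, ?_⟩
  have hshift : ∀ j : ℕ, ∀ᶠ m : ℕ in atTop, |φ (2 * m + 1 + j)| ≤ |K| / (m + 1) := fun j => by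
    have ht : Tendsto (fun m : ℕ => 2 * m + 1 + j) atTop atTop :=
      tendsto_atTop_mono (fun m => by simp only [id]; omega) tendsto_id
    filter_upwards [ht.eventually hK] with m hm
    refine hm.trans ?_
    push_cast
    have := m.cast_nonneg (α := ℝ)
    have := j.cast_nonneg (α := ℝ)
    exact div_le_div₀ (abs_nonneg K) (le_abs_self K) (by positivity) (by linarith)
  filter_upwards [hodd, hodd', hshift 0, hshift 1, hshift 2] with m o₁ o₃ s₀ s₁ s₂
  have d₁ : ‖κ₁ (2 * m + 1) - κ₁ (2 * m + 3)‖ ≤ _ := norm_fhKappa_self_sub_le hr₁ m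
  have d₂ : ‖κ₂ (2 * m + 1) - κ₂ (2 * m + 3)‖ ≤ _ := norm_fhKappa_self_sub_le hr₂ m
  have hm0 := m.cast_nonneg (α := ℝ)
  have y₁ : |y (2 * m + 2) - y (2 * m + 1)| ≤ (2 * |l| + 1) / (m + 1 : ℝ) ^ 2 := by
    have := abs_cos_log_div_sub_le ω l (x := 2 * m + 1) (by linarith)
    rw [show (2 * (m : ℝ) + 1 + 1) = 2 * m + 2 by ring] at this
    exact this.trans (div_le_div_of_nonneg_left (by positivity) (by positivity)
      (pow_le_pow_left₀ (by positivity) (by linarith) 2))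
  have y₂ : |y (2 * m + 3) - y (2 * m + 2)| ≤ (2 * |l| + 1) / (m + 1 : ℝ) ^ 2 := by
    have := abs_cos_log_div_sub_le ω l (x := 2 * m + 2) (by linarith)
    rw [show (2 * (m : ℝ) + 2 + 1) = 2 * m + 3 by ring] at this
    exact this.trans (div_le_div_of_nonneg_left (by positivity) (by positivity)
      (pow_le_pow_left₀ (by positivity) (by linarith) 2))
  have hT : l / (m + 1) * ((-1) ^ (m + 1) * Real.cos (ω - 2 * l * Real.log (2 * (m + 1)))) =
      -((-1) ^ m * (2 * l * y (2 * m + 2))) := by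
    simp only [hy]
    rw [show (2 * (m : ℝ) + 2) = 2 * (m + 1) by ring, pow_succ]
    field_simp
  rw [hT]
  have hq : |φ (2 * m + 2) * (φ (2 * m + 1) + φ (2 * m + 3)) / 2| ≤ K ^ 2 / (m + 1 : ℝ) ^ 2 := by
    rw [abs_div, abs_mul, abs_two, div_le_iff₀ two_pos]
    calc _ ≤ |K| / (m + 1) * (|K| / (m + 1) + |K| / (m + 1)) :=
          mul_le_mul s₁ ((abs_add_le _ _).trans (add_le_add s₀ s₂)) (abs_nonneg _) (by positivity)
      _ = |K| ^ 2 / (m + 1) ^ 2 * 2 := by rw [← div_pow]; ring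
      _ = _ := by rw [sq_abs]
  set Q := φ (2 * m + 2) * (φ (2 * m + 1) + φ (2 * m + 3)) / 2
  have hlin : |(φ (2 * m + 1) - φ (2 * m + 3)) / 2 - -((-1) ^ m * (2 * l * y (2 * m + 2)))| ≤
      ((|C| + |C'|) + (4 * |r₁| * ‖C₁‖ + 4 * |r₂| * ‖C₂‖) / 2 + |l| * (2 * (2 * |l| + 1))) /
        (m + 1 : ℝ) ^ 2 := by
    set ρ₁ := (φ (2 * m + 1) : ℂ) - (κ₁ (2 * m + 1) * C₁ -
      κ₂ (2 * m + 1) * C₂ + (-((-1) ^ m * (2 * l * y (2 * m + 1))) : ℝ)) with hρ₁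
    set ρ₃ := (φ (2 * m + 3) : ℂ) - (κ₁ (2 * m + 3) * C₁ -
      κ₂ (2 * m + 3) * C₂ + ((-1) ^ m * (2 * l * y (2 * m + 3)) : ℝ)) with hρ₃
    set z : ℝ := (-1) ^ m * l * ((y (2 * m + 2) - y (2 * m + 1)) - (y (2 * m + 3) - y (2 * m + 2)))
      with hz
    have hzle : ‖(z : ℂ)‖ ≤ |l| * (2 * ((2 * |l| + 1) / (m + 1 : ℝ) ^ 2)) := by
      rw [Complex.norm_real, Real.norm_eq_abs, hz, abs_mul, abs_mul, abs_pow, abs_neg, abs_one,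
        one_pow, one_mul, two_mul ((2 * |l| + 1) / _)]
      gcongr
      exact (abs_sub _ _).trans (add_le_add y₁ y₂)
    have e : (((φ (2 * m + 1) - φ (2 * m + 3)) / 2 - -((-1) ^ m * (2 * l * y (2 * m + 2))) : ℝ) : ℂ) =
        (ρ₁ - ρ₃) / 2 + ((κ₁ (2 * m + 1) - κ₁ (2 * m + 3)) * C₁ -
          (κ₂ (2 * m + 1) - κ₂ (2 * m + 3)) * C₂) / 2 + z := by
      rw [hρ₁, hρ₃, hz]
      push_cast
      ring
    rw [← Real.norm_eq_abs, ← Complex.norm_real, e]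
    refine norm_add₃_le.trans ?_
    rw [norm_div, norm_div, Complex.norm_two]
    have f₁ : ‖ρ₁ - ρ₃‖ ≤ _ := (norm_sub_le _ _).trans (add_le_add o₁ o₃)
    have f₂ : ‖(κ₁ (2 * m + 1) - κ₁ (2 * m + 3)) * C₁ - (κ₂ (2 * m + 1) - κ₂ (2 * m + 3)) * C₂‖ ≤
        4 * |r₁| / (m + 1 : ℝ) ^ 2 * ‖C₁‖ + 4 * |r₂| / (m + 1 : ℝ) ^ 2 * ‖C₂‖ := by
      refine (norm_sub_le _ _).trans ?_
      rw [norm_mul, norm_mul]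
      gcongr
    refine (add_le_add (add_le_add (div_le_div_of_nonneg_right f₁ two_pos.le)
      (div_le_div_of_nonneg_right f₂ two_pos.le)) hzle).trans (le_of_eq ?_)
    ring
  rw [sub_right_comm, add_div]
  exact (abs_sub _ _).trans (add_le_add hlin hq)

theorem stmt2
    (α β c : ℝ) (hα : -1 < α) (hβ : -1 < β) (hc : 0 < c)
    (h : ℝ → ℝ)
    (h_an : AnalyticOnNhd ℝ h (Icc (-1) 1))
    (h_pos : ∀ x ∈ Icc (-1 : ℝ) 1, 0 < h x)
    -- the weight w_c(x) = h(x)(1-x)^α(1+x)^β Ξ_c(x)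
    (w : ℝ → ℝ)
    (hw : ∀ x : ℝ, w x = h x * (1 - x) ^ α * (1 + x) ^ β * (if x < 0 then 1 else c ^ 2))
    -- the monic orthogonal polynomials with respect to w_c
    (P : ℕ → Polynomial ℝ)
    (hP_monic : ∀ n, (P n).Monic)
    (hP_deg : ∀ n, (P n).natDegree = n)
    (hP_orth : ∀ n, ∀ k < n, ∫ x in (-1 : ℝ)..1, (P n).eval x * x ^ k * w x = 0)
    -- the recurrence coefficients: P_{n+1}(z) = (z - bₙ)Pₙ(z) - aₙ²P_{n-1}(z), aₙ > 0
    (a b : ℕ → ℝ)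
    (ha_pos : ∀ n, 0 < a n)
    (hrec0 : P 1 = (Polynomial.X - Polynomial.C (b 0)) * P 0)
    (hrec : ∀ n : ℕ, 1 ≤ n →
      P (n + 1) = (Polynomial.X - Polynomial.C (b n)) * P n - Polynomial.C (a n ^ 2) * P (n - 1))
    -- ħ, defined by the principal value integral
    (hbar : ℝ → ℝ)
    (hhbar : ∀ x ∈ Ioo (-1 : ℝ) 1,
      Tendsto (fun ε : ℝ =>
          ∫ t in (Ioo (-1 : ℝ) 1 \ Ioo (x - ε) (x + ε)),
            Real.log (h t) / Real.sqrt (1 - t ^ 2) / (t - x))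
        (nhdsWithin 0 (Ioi 0)) (nhds (2 * Real.pi * hbar x / Real.sqrt (1 - x ^ 2))))
    -- γ = arg Γ(i·log(c)/π), the determination lying in (-π/2, π/2)
    (γ : ℝ)
    (hγ : c ≠ 1 → γ ∈ Ioo (-(Real.pi / 2)) (Real.pi / 2) ∧
      ∃ k : ℤ, Complex.arg (Complex.Gamma (Complex.I * ((Real.log c / Real.pi : ℝ) : ℂ))) =
        γ + k * Real.pi)
    -- the phase θₙ
    (θ : ℕ → ℝ)
    (hθ : ∀ n : ℕ, θ n =
      if c = 1 then
        2 * ((Real.log c / Real.pi) * Real.log (4 * n) + n * Real.pi / 2 +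
          (β - α) / 4 * Real.pi + hbar 0 + Real.pi / 2)
      else
        2 * ((Real.log c / Real.pi) * Real.log (4 * n) + n * Real.pi / 2 +
          (β - α) / 4 * Real.pi + hbar 0 - γ)) :
    -- bₙ = −(log c/(πn))·cos(θₙ) + O(1/n²)
    ∃ C : ℝ, ∃ N : ℕ, ∀ n : ℕ, N ≤ n →
      |b n - (-(Real.log c / (Real.pi * n)) * Real.cos (θ n))| ≤ C / (n : ℝ) ^ 2 := by
  have hw0 : ∀ x ∈ Icc (-1 : ℝ) 1, 0 ≤ w x := fun x hx => by
    rw [hw]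
    have h1 : 0 ≤ 1 - x := by linarith [hx.2]
    have h2 : 0 ≤ 1 + x := by linarith [hx.1]
    have h3 := (h_pos x hx).le
    split_ifs <;> positivity
  have hw1 : ∀ x ∈ Ioo (-1 : ℝ) 1, 0 < w x := fun x hx => by
    rw [hw]
    have h1 : 0 < 1 - x := by linarith [hx.2]
    have h2 : 0 < 1 + x := by linarith [hx.1]
    have h3 := h_pos x (Ioo_subset_Icc_self hx)
    split_ifs <;> positivity
  have hInt := intervalIntegrable_jacobiWeight hα hβ h_an.continuousOn hw
  have hf := isCircleWeight_szegoWeight hInt hw0 hw1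
  set l : ℝ := -Real.log c / Real.pi with hl
  have hH := hhbar 0 (by norm_num)
  rw [show (2 * Real.pi * hbar 0 / Real.sqrt (1 - 0 ^ 2)) = 2 * Real.pi * hbar 0 by simp] at hH
  obtain ⟨C₁, C₂, C, hC⟩ := opuc_coeff_zero_szegoWeight hα hβ hc h_an h_pos hw hf hH
    (l := l) (div_mul_cancel₀ _ Real.pi_ne_zero) rfl
  have hcl : l ≠ 0 → c ≠ 1 := fun h0 h1 => h0 (by simp [hl, h1])
  obtain ⟨K, hK⟩ := verblunsky_recurrence_asymptotics (l := l) (γ := γ) (r₁ := α + 1 / 2)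
    (r₂ := β + 1 / 2) (φ := fun n => (opuc (szegoWeight w) n).coeff 0) (by linarith) (by linarith)
    (fun h0 => Gamma_div_Gamma_neg_of_arg h0 (by
      obtain ⟨k, hk⟩ := (hγ (hcl h0)).2
      refine ⟨k, ?_⟩
      rw [← hk, hl]
      congr 2
      push_cast
      ring)) hC
  obtain ⟨N, hN⟩ := eventually_atTop.1 hK
  refine ⟨K, N + 1, fun n hn => ?_⟩
  obtain ⟨m, rfl⟩ : ∃ m, n = m + 1 := ⟨n - 1, by omega⟩
  have hP0 : P 0 = 1 := (hP_monic 0).natDegree_eq_zero.1 (hP_deg 0)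
  have hb := recurrence_coeff_eq hInt hf hP0 hrec0 hrec hP_orth
    (φ := fun n => (opuc (szegoWeight w) n).coeff 0) (fun _ => rfl) m
  have key := hN m (by omega)
  rw [← hb] at key
  push_cast
  refine le_of_eq_of_le (congrArg (fun t => |b (m + 1) - t|) ?_) key
  rcases eq_or_ne c 1 with h1 | h1
  · simp [hl, h1]
  rw [show -(Real.log c / (Real.pi * (m + 1 : ℝ))) = l / (m + 1) by rw [hl]; field_simp]
  congr 1
  have hlog : Real.log (4 * (m + 1 : ℝ)) = Real.log 2 + Real.log (2 * (m + 1)) := by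
    rw [← Real.log_mul two_ne_zero (by positivity)]
    ring_nf
  rw [hθ, if_neg h1, ← Real.cos_add_nat_mul_pi]
  push_cast
  rw [hlog, hl]
  congr 1
  ring
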